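/- Let R be a local hypersurface and M, N nonzero finitely generated R-modules such that N has rank and M ⊗_R N is reflexive. Then Tor_i^R(M,N) = 0 for all i ≥ 1, M is reflexive, and N is torsion-free. -/

import Mathlib

open RingTheory.Sequence CategoryTheory

universe u

noncomputable section

/-- Depth of a module: supremum of lengths of weakly regular sequences consisting of nonunits.
For a f.g. module over a noetherian local ring this is the usual depth, and the zero module
has depth `⊤`. -/
def rdepth (A : Type u) [CommRing A] (M : Type u) [AddCommGroup M] [Module A M] : ℕ∞ :=
  sSup {n : ℕ∞ | ∃ rs : List A, (rs.length : ℕ∞) = n ∧ (∀ r ∈ rs, r ∈ nonunits A) ∧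
    RingTheory.Sequence.IsWeaklyRegular M rs}

/-- Serre's condition `(S_n)`. -/
def SerreCond (R : Type u) [CommRing R] (M : Type u) [AddCommGroup M] [Module R M] (n : ℕ) :
    Prop :=
  ∀ (p : Ideal R) (hp : p.IsPrime), Nontrivial (LocalizedModule p.primeCompl M) →
    min (n : ℕ∞) (Order.height (⟨p, hp⟩ : PrimeSpectrum R)) ≤
      rdepth (Localization.AtPrime p) (LocalizedModule p.primeCompl M)

/-- `Tor_i^R(M, N)` as an object of `ModuleCat R`. -/
def TorModCat (R : Type u) [CommRing R] (i : ℕ) (M N : Type u) [AddCommGroup M] [Module R M]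
    [AddCommGroup N] [Module R N] : ModuleCat.{u} R :=
  ((Tor (ModuleCat.{u} R) i).obj (ModuleCat.of R M)).obj (ModuleCat.of R N)

/-- `Tor_i^R(M, N)` as a type (with its `R`-module structure given by instances below). -/
def TorM (R : Type u) [CommRing R] (i : ℕ) (M N : Type u) [AddCommGroup M] [Module R M]
    [AddCommGroup N] [Module R N] : Type u :=
  TorModCat R i M N

instance (R : Type u) [CommRing R] (i : ℕ) (M N : Type u) [AddCommGroup M] [Module R M]
    [AddCommGroup N] [Module R N] : AddCommGroup (TorM R i M N) :=
  inferInstanceAs (AddCommGroup (TorModCat R i M N))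

instance (R : Type u) [CommRing R] (i : ℕ) (M N : Type u) [AddCommGroup M] [Module R M]
    [AddCommGroup N] [Module R N] : Module R (TorM R i M N) :=
  inferInstanceAs (Module R (TorModCat R i M N))

/-- A regular local ring: noetherian local, whose maximal ideal is generated by a
(weakly) regular sequence. -/
def IsRegLocal (Q : Type u) [CommRing Q] : Prop :=
  IsNoetherianRing Q ∧ IsLocalRing Q ∧
    ∃ rs : List Q, RingTheory.Sequence.IsWeaklyRegular Q rs ∧ (∀ r ∈ rs, r ∈ nonunits Q) ∧
      Ideal.span {x | x ∈ rs} = Ideal.span (nonunits Q)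

/-- A (local) complete intersection: noetherian local ring whose completion is a regular
local ring modulo a regular sequence (of nonunits). -/
def IsCIRing (R : Type u) [CommRing R] : Prop :=
  IsNoetherianRing R ∧ IsLocalRing R ∧
    ∃ (Q : Type u) (_ : CommRing Q), IsRegLocal Q ∧
      ∃ rs : List Q, (∀ r ∈ rs, r ∈ nonunits Q) ∧ RingTheory.Sequence.IsWeaklyRegular Q rs ∧
        Nonempty ((Q ⧸ Ideal.span {x | x ∈ rs}) ≃+* AdicCompletion (Ideal.span (nonunits R)) R)

/-- A hypersurface: noetherian local ring whose completion is a regular local ring modulo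
a single non-zerodivisor in the maximal ideal. -/
def IsHypersurfaceRing (R : Type u) [CommRing R] : Prop :=
  IsNoetherianRing R ∧ IsLocalRing R ∧
    ∃ (Q : Type u) (_ : CommRing Q), IsRegLocal Q ∧
      ∃ f : Q, f ∈ nonunits Q ∧ f ∈ nonZeroDivisors Q ∧
        Nonempty ((Q ⧸ Ideal.span {f}) ≃+* AdicCompletion (Ideal.span (nonunits R)) R)

/-- Maximal Cohen-Macaulay module over a local ring: depth equals the Krull dimension. -/
def IsMCM (R : Type u) [CommRing R] (M : Type u) [AddCommGroup M] [Module R M] : Prop :=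
  (rdepth R M : WithBot ℕ∞) = ringKrullDim R

/-- Cohen-Macaulay local ring. -/
def IsCMLocalRing (A : Type u) [CommRing A] : Prop :=
  IsNoetherianRing A ∧ IsLocalRing A ∧ (rdepth A A : WithBot ℕ∞) = ringKrullDim A

/-- `M` has (constant) rank: free of the same rank at every minimal prime. -/
def HasRank (R : Type u) [CommRing R] (M : Type u) [AddCommGroup M] [Module R M] : Prop :=
  ∃ r : ℕ, ∀ (p : Ideal R) (hp : p.IsPrime), p ∈ minimalPrimes R →
    Nonempty ((LocalizedModule (@Ideal.primeCompl R _ p hp) M)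
      ≃ₗ[Localization (@Ideal.primeCompl R _ p hp)]
      (Fin r → Localization (@Ideal.primeCompl R _ p hp)))

/-- Projective dimension at most `n`. -/
def pdLE (R : Type u) [CommRing R] : ℕ → ∀ (M : Type u) [AddCommGroup M] [Module R M], Prop
  | 0, M, _, _ => Module.Projective R M
  | n+1, M, _, _ => ∃ (P : Type u) (_ : AddCommGroup P) (_ : Module R P),
      Module.Projective R P ∧ ∃ f : P →ₗ[R] M, Function.Surjective f ∧
        pdLE R n (LinearMap.ker f)

/-- Injective dimension at most `n`. -/
def idLE (R : Type u) [CommRing R] : ℕ → ∀ (M : Type u) [AddCommGroup M] [Module R M], Prop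
  | 0, M, _, _ => Module.Injective R M
  | n+1, M, _, _ => ∃ (I : Type u) (_ : AddCommGroup I) (_ : Module R I),
      Module.Injective R I ∧ ∃ f : M →ₗ[R] I, Function.Injective f ∧
        idLE R n (I ⧸ LinearMap.range f)

/-- Gorenstein local ring: noetherian local with finite self-injective dimension. -/
def IsGorensteinLocalRing (R : Type u) [CommRing R] : Prop :=
  IsNoetherianRing R ∧ IsLocalRing R ∧ ∃ n : ℕ, idLE R n R

/-- The map `M → R^ν` obtained from a free cover `ε : R^ν ↠ M^*` by dualizing and composing
with the biduality map; its cokernel is the pushforward `M₁`. -/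
def pushMap (R M : Type u) [CommRing R] [AddCommGroup M] [Module R M] {ν : ℕ}
    (ε : (Fin ν → R) →ₗ[R] Module.Dual R M) : M →ₗ[R] (Fin ν → R) where
  toFun m := fun i => ε (Pi.single i 1) m
  map_add' x y := by funext i; simp
  map_smul' r x := by funext i; simp

/-- Length of a module, as the Krull dimension of its lattice of submodules. -/
def mlen (R : Type u) [CommRing R] (M : Type u) [AddCommGroup M] [Module R M] :
    WithBot ℕ∞ :=
  Order.krullDim (Submodule R M)

/-- An unramified regular local ring: equicharacteristic (contains a field), or of mixed
characteristic `(0, p)` with `p` not in the square of the maximal ideal. -/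
def IsUnramifiedRegLocal (Q : Type u) [CommRing Q] : Prop :=
  IsRegLocal Q ∧
    ((∃ (K : Type u) (_ : Field K), Nonempty (K →+* Q)) ∨
     (CharZero Q ∧ ∃ p : ℕ, p.Prime ∧ (p : Q) ∈ nonunits Q ∧
        (p : Q) ∉ (Ideal.span (nonunits Q)) ^ 2))

section

namespace HW

open TensorProduct Function

theorem snake_abs {R : Type*} [CommRing R] {M₁ M₂ M₃ N₁ N₂ N₃ C₁ C₂ : Type u}
    [AddCommGroup M₁] [Module R M₁] [AddCommGroup M₂] [Module R M₂] [AddCommGroup M₃] [Module R M₃]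
    [AddCommGroup N₁] [Module R N₁] [AddCommGroup N₂] [Module R N₂] [AddCommGroup N₃] [Module R N₃]
    [AddCommGroup C₁] [Module R C₁] [AddCommGroup C₂] [Module R C₂]
    {i₁ : M₁ →ₗ[R] N₁} {i₂ : M₂ →ₗ[R] N₂} {i₃ : M₃ →ₗ[R] N₃}
    {f₁ : M₁ →ₗ[R] M₂} {f₂ : M₂ →ₗ[R] M₃} {hf : Exact f₁ f₂}
    {g₁ : N₁ →ₗ[R] N₂} {g₂ : N₂ →ₗ[R] N₃} {hg : Exact g₁ g₂}
    (h₁ : g₁.comp i₁ = i₂.comp f₁) (h₂ : g₂.comp i₂ = i₃.comp f₂)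
    (hs : Surjective f₂) (hi : Injective g₁)
    {π₁ : N₁ →ₗ[R] C₁} {hπ₁ : Exact i₁ π₁} {π₂ : N₂ →ₗ[R] C₂} {hπ₂ : Exact i₂ π₂}
    (F : LinearMap.ker i₂ →ₗ[R] LinearMap.ker i₃)
    (hF : f₂.comp (LinearMap.ker i₂).subtype = (LinearMap.ker i₃).subtype.comp F)
    (G : C₁ →ₗ[R] C₂) (hG : G.comp π₁ = π₂.comp g₁) (hp : Surjective π₁) :
    ∃ δ : LinearMap.ker i₃ →ₗ[R] C₁, Exact F δ ∧ Exact δ G := by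
  have e : ∀ {A B : Type u} [AddCommGroup A] [Module R A] [AddCommGroup B] [Module R B]
      (i : A →ₗ[R] B), Exact (LinearMap.ker i).subtype i := by
    intro A B _ _ _ _ i
    rw [LinearMap.exact_iff]; simp
  exact ⟨SnakeLemma.δ' i₁ i₂ i₃ f₁ f₂ hf g₁ g₂ hg h₁ h₂ (LinearMap.ker i₃).subtype (e i₃) π₁ hπ₁
      hs hi,
    SnakeLemma.exact_δ'_right i₁ i₂ i₃ f₁ f₂ hf g₁ g₂ hg h₁ h₂ (LinearMap.ker i₂).subtype (e i₂)
      (LinearMap.ker i₃).subtype (e i₃) π₁ hπ₁ hs hi F hF Subtype.val_injective,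
    SnakeLemma.exact_δ'_left i₁ i₂ i₃ f₁ f₂ hf g₁ g₂ hg h₁ h₂
      (LinearMap.ker i₃).subtype (e i₃) π₁ hπ₁ π₂ hπ₂ hs hi G hG hp⟩

section gen

variable {S : Type u} [CommRing S] {K F M N₁ N₂ N₃ K' F' : Type u} [AddCommGroup K] [Module S K]
  [AddCommGroup F] [Module S F] [AddCommGroup M] [Module S M] [AddCommGroup N₁] [Module S N₁]
  [AddCommGroup N₂] [Module S N₂] [AddCommGroup N₃] [Module S N₃]
  [AddCommGroup K'] [Module S K'] [AddCommGroup F'] [Module S F']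

/-- functoriality of `ker (N ⊗ K → N ⊗ F)` -/
def kmap (i : K →ₗ[S] F) (f : N₁ →ₗ[S] N₂) :
    LinearMap.ker (LinearMap.lTensor N₁ i) →ₗ[S] LinearMap.ker (LinearMap.lTensor N₂ i) :=
  (LinearMap.rTensor K f).restrict (fun x hx => by
    rw [LinearMap.mem_ker] at hx ⊢
    rw [← LinearMap.comp_apply, LinearMap.lTensor_comp_rTensor, ← LinearMap.rTensor_comp_lTensor,
      LinearMap.comp_apply, hx, map_zero])

@[simp] theorem kmap_coe (i : K →ₗ[S] F) (f : N₁ →ₗ[S] N₂) (x) :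
    (kmap i f x : N₂ ⊗[S] K) = LinearMap.rTensor K f x := rfl

theorem lesg0 {i : K →ₗ[S] F} {p : F →ₗ[S] M} (hip : Exact i p) (hp : Surjective p)
    {f : N₁ →ₗ[S] N₂} {g : N₂ →ₗ[S] N₃}
    (hF : Injective (LinearMap.rTensor F f)) (hfg : Exact f g) (hg : Surjective g) :
    Exact (kmap i f) (kmap i g) ∧
    ∃ δ : LinearMap.ker (LinearMap.lTensor N₃ i) →ₗ[S] N₁ ⊗[S] M,
      Exact (kmap i g) δ ∧ Exact δ (LinearMap.rTensor M f) := by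
  have comm : ∀ {A B : Type u} [AddCommGroup A] [Module S A] [AddCommGroup B] [Module S B]
      (h : A →ₗ[S] B) , (LinearMap.rTensor F h).comp (LinearMap.lTensor A i)
        = (LinearMap.lTensor B i).comp (LinearMap.rTensor K h) := by
    intro A B _ _ _ _ h
    rw [LinearMap.lTensor_comp_rTensor, LinearMap.rTensor_comp_lTensor]
  refine ⟨?_, ?_⟩
  · intro x
    constructor
    · intro hx
      have hx' : LinearMap.rTensor K g x = 0 := by
        rw [← kmap_coe, hx]; rfl
      obtain ⟨y, hy⟩ := (rTensor_exact K hfg hg _).1 hx'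
      refine ⟨⟨y, ?_⟩, Subtype.ext hy⟩
      rw [LinearMap.mem_ker]
      apply hF
      rw [map_zero]
      have := LinearMap.congr_fun (comm f) y
      simp only [LinearMap.comp_apply] at this
      rw [this, hy]
      exact x.2
    · rintro ⟨y, rfl⟩
      apply Subtype.ext
      simp only [kmap_coe]
      rw [← LinearMap.comp_apply, ← LinearMap.rTensor_comp, hfg.linearMap_comp_eq_zero]
      simp
  · exact snake_abs (hf := rTensor_exact K hfg hg) (hg := rTensor_exact F hfg hg) (comm f) (comm g)
      (LinearMap.rTensor_surjective K hg) hF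
      (hπ₁ := lTensor_exact N₁ hip hp) (hπ₂ := lTensor_exact N₂ hip hp) (kmap i g) rfl
      (LinearMap.rTensor M f)
      (by rw [LinearMap.lTensor_comp_rTensor, LinearMap.rTensor_comp_lTensor])
      (LinearMap.lTensor_surjective _ hp)

theorem lesg1 {i : K →ₗ[S] F} {j : K' →ₗ[S] F'} {q : F' →ₗ[S] K}
    (hjq : Exact j q) (hq : Surjective q)
    {f : N₁ →ₗ[S] N₂} {g : N₂ →ₗ[S] N₃}
    (hF : Injective (LinearMap.rTensor F f))
    (hF' : Injective (LinearMap.rTensor F' f)) (hfg : Exact f g) (hg : Surjective g) :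
    ∃ δ : LinearMap.ker (LinearMap.lTensor N₃ j) →ₗ[S] LinearMap.ker (LinearMap.lTensor N₁ i),
      Exact (kmap j g) δ ∧ Exact δ (kmap i f) := by
  obtain ⟨-, δ, h1, h2⟩ := lesg0 hjq hq hF' hfg hg
  have key : ∀ y : N₁ ⊗[S] K, LinearMap.rTensor K f y = 0 →
      y ∈ LinearMap.ker (LinearMap.lTensor N₁ i) := by
    intro y hy
    rw [LinearMap.mem_ker]
    apply hF
    rw [← LinearMap.comp_apply, LinearMap.rTensor_comp_lTensor, ← LinearMap.lTensor_comp_rTensor,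
      LinearMap.comp_apply, hy, map_zero, map_zero]
  refine ⟨δ.codRestrict _ (fun x => key _ ((h2 _).2 ⟨x, rfl⟩)), ?_, ?_⟩
  · intro x
    rw [← h1 x]
    exact ⟨fun h => congrArg Subtype.val h, fun h => Subtype.ext h⟩
  · intro x
    constructor
    · intro hx
      obtain ⟨y, hy⟩ := (h2 x).1 (by rw [← kmap_coe, hx]; rfl)
      exact ⟨y, Subtype.ext hy⟩
    · rintro ⟨y, rfl⟩
      exact Subtype.ext ((h2 _).2 ⟨y, rfl⟩)

end gen

section TorDef

variable (S : Type u) [CommRing S]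

/-- canonical free cover -/
def FT (M : Type u) : Type u := M →₀ S

instance (M : Type u) : AddCommGroup (FT S M) := inferInstanceAs (AddCommGroup (M →₀ S))
instance (M : Type u) : Module S (FT S M) := inferInstanceAs (Module S (M →₀ S))
instance (M : Type u) : Module.Free S (FT S M) := inferInstanceAs (Module.Free S (M →₀ S))

/-- the augmentation -/
def eps (M : Type u) [AddCommGroup M] [Module S M] : FT S M →ₗ[S] M :=
  (Finsupp.linearCombination S (id : M → M) : (M →₀ S) →ₗ[S] M)

/-- canonical first syzygy -/
def KK (M : Type u) [AddCommGroup M] [Module S M] : Type u := LinearMap.ker (eps S M)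

instance (M : Type u) [AddCommGroup M] [Module S M] : AddCommGroup (KK S M) :=
  inferInstanceAs (AddCommGroup (LinearMap.ker (eps S M)))
instance (M : Type u) [AddCommGroup M] [Module S M] : Module S (KK S M) :=
  inferInstanceAs (Module S (LinearMap.ker (eps S M)))

/-- inclusion of the syzygy -/
def ki (M : Type u) [AddCommGroup M] [Module S M] : KK S M →ₗ[S] FT S M :=
  (LinearMap.ker (eps S M)).subtype

/-- iterated canonical syzygies -/
def Syz : ℕ → ModuleCat.{u} S → ModuleCat.{u} S
  | 0, M => M
  | n + 1, M => ModuleCat.of S (KK S (Syz n M))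

variable (N N₁ N₂ N₃ M : Type u) [AddCommGroup N] [Module S N] [AddCommGroup N₁] [Module S N₁]
  [AddCommGroup N₂] [Module S N₂] [AddCommGroup N₃] [Module S N₃] [AddCommGroup M] [Module S M]

/-- concrete `Tor_1` -/
abbrev T1 : Submodule S (N ⊗[S] (KK S M)) := LinearMap.ker (LinearMap.lTensor N (ki S M))

/-- concrete Tor -/
def TM (i : ℕ) : ModuleCat.{u} S :=
  match i with
  | 0 => ModuleCat.of S (N ⊗[S] M)
  | i + 1 => ModuleCat.of S (T1 S N (Syz S i (ModuleCat.of S M)))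

/-- concrete Tor, as a type -/
abbrev T (i : ℕ) : Type u := TM S N M i

variable {N N₁ N₂ N₃}

theorem eps_surj : Surjective (eps S M) := fun m =>
  ⟨(Finsupp.single m 1 : M →₀ S), by
    change Finsupp.linearCombination S (id : M → M) _ = _
    simp⟩

theorem ki_inj : Injective (ki S M) := Subtype.val_injective

theorem KK_exact : Exact (ki S M) (eps S M) := by
  intro x
  constructor
  · intro h; exact ⟨⟨x, h⟩, rfl⟩
  · rintro ⟨y, rfl⟩; exact y.2

/-- functoriality of `T` -/
def Tmap (i : ℕ) (f : N₁ →ₗ[S] N₂) : T S N₁ M i →ₗ[S] T S N₂ M i :=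
  match i with
  | 0 => (LinearMap.rTensor M f : N₁ ⊗[S] M →ₗ[S] N₂ ⊗[S] M)
  | i + 1 => (kmap (ki S (Syz S i (ModuleCat.of S M))) f)

theorem les0 {f : N₁ →ₗ[S] N₂} {g : N₂ →ₗ[S] N₃} (hf : Injective f) (hfg : Exact f g)
    (hg : Surjective g) :
    Exact (kmap (ki S M) f) (kmap (ki S M) g) ∧
    ∃ δ : T1 S N₃ M →ₗ[S] N₁ ⊗[S] M,
      Exact (kmap (ki S M) g) δ ∧ Exact δ (LinearMap.rTensor M f) :=
  lesg0 (KK_exact S M) (eps_surj S M)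
    (Module.Flat.rTensor_preserves_injective_linearMap f hf) hfg hg

theorem les1 {f : N₁ →ₗ[S] N₂} {g : N₂ →ₗ[S] N₃} (hf : Injective f) (hfg : Exact f g)
    (hg : Surjective g) : ∃ δ : T1 S N₃ (KK S M) →ₗ[S] T1 S N₁ M,
      Exact (kmap (ki S (KK S M)) g) δ ∧ Exact δ (kmap (ki S M) f) :=
  lesg1 (KK_exact S (KK S M)) (eps_surj S (KK S M))
    (Module.Flat.rTensor_preserves_injective_linearMap f hf)
    (Module.Flat.rTensor_preserves_injective_linearMap f hf) hfg hg

/-- The long exact sequence in the first variable. -/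
theorem les (i : ℕ) {f : N₁ →ₗ[S] N₂} {g : N₂ →ₗ[S] N₃} (hf : Injective f) (hfg : Exact f g)
    (hg : Surjective g) : ∃ δ : T S N₃ M (i + 1) →ₗ[S] T S N₁ M i,
      Exact (Tmap S M (i + 1) g) δ ∧ Exact δ (Tmap S M i f) := by
  match i with
  | 0 => exact (les0 S M hf hfg hg).2
  | i + 1 => exact les1 S _ hf hfg hg

theorem les_mid (i : ℕ) {f : N₁ →ₗ[S] N₂} {g : N₂ →ₗ[S] N₃} (hf : Injective f) (hfg : Exact f g)
    (hg : Surjective g) : Exact (Tmap S M i f) (Tmap S M i g) := by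
  match i with
  | 0 => exact rTensor_exact M hfg hg
  | i + 1 => exact (les0 S _ hf hfg hg).1

theorem Tmap0_surj {g : N₂ →ₗ[S] N₃} (hg : Surjective g) : Surjective (Tmap S M 0 g) :=
  LinearMap.rTensor_surjective M hg

theorem Tmap_smul (i : ℕ) (x : S) (f : N₁ →ₗ[S] N₂) : Tmap S M i (x • f) = x • Tmap S M i f := by
  match i with
  | 0 => exact LinearMap.rTensor_smul _ _ _
  | i + 1 =>
    apply LinearMap.ext; intro y
    apply Subtype.ext
    change LinearMap.rTensor _ (x • f) y.1 = x • LinearMap.rTensor _ f y.1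
    rw [LinearMap.rTensor_smul]; rfl

theorem Tmap_id (i : ℕ) : Tmap S M i (LinearMap.id : N →ₗ[S] N) = LinearMap.id := by
  match i with
  | 0 => exact LinearMap.rTensor_id _ _
  | i + 1 =>
    apply LinearMap.ext; intro y
    apply Subtype.ext
    change LinearMap.rTensor _ (LinearMap.id) y.1 = y.1
    rw [LinearMap.rTensor_id]; rfl

theorem Tmap_comp (i : ℕ) (f : N₁ →ₗ[S] N₂) (g : N₂ →ₗ[S] N₃) :
    Tmap S M i (g ∘ₗ f) = Tmap S M i g ∘ₗ Tmap S M i f := by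
  match i with
  | 0 => exact LinearMap.rTensor_comp _ _ _
  | i + 1 =>
    apply LinearMap.ext; intro y
    apply Subtype.ext
    change LinearMap.rTensor _ (g ∘ₗ f) y.1 = LinearMap.rTensor _ g (LinearMap.rTensor _ f y.1)
    rw [LinearMap.rTensor_comp]; rfl

/-- iso in the first variable -/
def TequivL (i : ℕ) (e : N₁ ≃ₗ[S] N₂) : T S N₁ M i ≃ₗ[S] T S N₂ M i :=
  LinearEquiv.ofLinearMap (Tmap S M i e) (Tmap S M i e.symm)
    (by rw [← Tmap_comp]; simp [Tmap_id]) (by rw [← Tmap_comp]; simp [Tmap_id])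

end TorDef

end HW

end

section

namespace HW

open TensorProduct Function

section TorBasic

variable (S : Type u) [CommRing S]
variable {N N₁ N₂ N₃ M M' : Type u} [AddCommGroup N] [Module S N] [AddCommGroup N₁] [Module S N₁]
  [AddCommGroup N₂] [Module S N₂] [AddCommGroup N₃] [Module S N₃] [AddCommGroup M] [Module S M]
  [AddCommGroup M'] [Module S M']

theorem exact_inj_of_subsingleton {A B C : Type*} [AddCommGroup A] [AddCommGroup B]
    [AddCommGroup C] [Module S A] [Module S B] [Module S C] {f : A →ₗ[S] B} {g : B →ₗ[S] C}
    (h : Exact f g) [Subsingleton A] : Injective g := by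
  rw [injective_iff_map_eq_zero]
  intro x hx
  obtain ⟨y, rfl⟩ := (h x).1 hx
  rw [Subsingleton.elim y 0, map_zero]

theorem exact_surj_of_subsingleton {A B C : Type*} [AddCommGroup A] [AddCommGroup B]
    [AddCommGroup C] [Module S A] [Module S B] [Module S C] {f : A →ₗ[S] B} {g : B →ₗ[S] C}
    (h : Exact f g) [Subsingleton C] : Surjective f := fun x =>
  (h x).1 (Subsingleton.elim _ _)

theorem exact_mid_zero {A B C : Type*} [AddCommGroup A] [AddCommGroup B]
    [AddCommGroup C] [Module S A] [Module S B] [Module S C] {f : A →ₗ[S] B} {g : B →ₗ[S] C}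
    (h : Exact f g) [Subsingleton A] [Subsingleton C] : Subsingleton B := by
  have := exact_inj_of_subsingleton S h
  exact this.subsingleton

theorem T_flat (i : ℕ) [Module.Flat S N] : Subsingleton (T S N M (i + 1)) := by
  have : Injective (LinearMap.lTensor N (ki S (Syz S i (ModuleCat.of S M)))) :=
    Module.Flat.lTensor_preserves_injective_linearMap _ (ki_inj S _)
  constructor
  intro a b
  exact Subtype.ext (this (a.2.trans b.2.symm))

/-- dimension shifting in the first variable -/
theorem shiftL (i : ℕ) {f : N₁ →ₗ[S] N₂} {g : N₂ →ₗ[S] N₃} (hf : Injective f) (hfg : Exact f g)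
    (hg : Surjective g) (h1 : Subsingleton (T S N₂ M (i + 2)))
    (h2 : Subsingleton (T S N₂ M (i + 1))) :
    Nonempty (T S N₃ M (i + 2) ≃ₗ[S] T S N₁ M (i + 1)) := by
  obtain ⟨δ, a, b⟩ := les S M (i + 1) hf hfg hg
  exact ⟨LinearEquiv.ofBijective δ ⟨exact_inj_of_subsingleton S a, exact_surj_of_subsingleton S b⟩⟩

theorem shiftL1 {f : N₁ →ₗ[S] N₂} {g : N₂ →ₗ[S] N₃} (hf : Injective f) (hfg : Exact f g)
    (hg : Surjective g) (h1 : Subsingleton (T S N₂ M 1)) :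
    Nonempty (T S N₃ M 1 ≃ₗ[S] LinearMap.ker (LinearMap.rTensor M f)) := by
  obtain ⟨δ, a, b⟩ := les S M 0 hf hfg hg
  have hinj := exact_inj_of_subsingleton S a
  have hr : LinearMap.ker (LinearMap.rTensor M f) = LinearMap.range δ :=
    LinearMap.exact_iff.1 b
  rw [hr]
  exact ⟨LinearEquiv.ofInjective δ hinj⟩

theorem Syz_succ (i : ℕ) (M : ModuleCat.{u} S) :
    Syz S (i + 1) M = Syz S i (ModuleCat.of S (KK S M)) := by
  induction i with
  | zero => rfl
  | succ n ih => change ModuleCat.of S (KK S (Syz S (n + 1) M)) = _; rw [ih]; rfl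

theorem shiftR (i : ℕ) : Nonempty (T S N M (i + 2) ≃ₗ[S] T S N (KK S M) (i + 1)) := by
  have h : TM S N M (i + 2) = TM S N (KK S M) (i + 1) := by
    change ModuleCat.of S (T1 S N (Syz S (i + 1) (ModuleCat.of S M))) = _
    rw [Syz_succ]; rfl
  change Nonempty ((TM S N M (i + 2) : Type u) ≃ₗ[S] T S N (KK S M) (i + 1))
  rw [h]
  exact ⟨LinearEquiv.refl S _⟩

/-- `ker (N ⊗ K → N ⊗ F) ≃ ker (K ⊗ N → F ⊗ N)` -/
theorem ker_comm {K F : Type u} [AddCommGroup K] [Module S K] [AddCommGroup F] [Module S F]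
    (f : K →ₗ[S] F) : Nonempty (LinearMap.ker (LinearMap.rTensor N f) ≃ₗ[S]
      LinearMap.ker (LinearMap.lTensor N f)) := by
  refine ⟨(TensorProduct.comm S K N).ofSubmodules _ _ ?_⟩
  ext y
  rw [Submodule.mem_map_equiv, LinearMap.mem_ker, LinearMap.mem_ker]
  have : LinearMap.rTensor N f ((TensorProduct.comm S K N).symm y) =
      (TensorProduct.comm S F N).symm (LinearMap.lTensor N f y) := by
    induction y with
    | zero => simp
    | tmul a b => simp
    | add a b ha hb => simp only [map_add, ha, hb]
  rw [this, LinearEquiv.map_eq_zero_iff]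

theorem Tsymm : ∀ (i : ℕ) (N M : Type u) [AddCommGroup N] [Module S N] [AddCommGroup M]
    [Module S M], Nonempty (T S N M i ≃ₗ[S] T S M N i)
  | 0, N, M, _, _, _, _ => ⟨(TensorProduct.comm S N M : N ⊗[S] M ≃ₗ[S] M ⊗[S] N)⟩
  | 1, N, M, _, _, _, _ => by
    obtain ⟨e⟩ := shiftL1 S (M := M) (ki_inj S N) (KK_exact S N) (eps_surj S N) (T_flat S 0)
    obtain ⟨e'⟩ := ker_comm S (N := M) (ki S N)
    exact ⟨e.trans e'⟩
  | i + 2, N, M, _, _, _, _ => by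
    obtain ⟨e⟩ := shiftL S (M := M) i (ki_inj S N) (KK_exact S N) (eps_surj S N) (T_flat S _)
      (T_flat S _)
    obtain ⟨e'⟩ := Tsymm (i + 1) (KK S N) M
    obtain ⟨e''⟩ := shiftR S (N := M) (M := N) i
    exact ⟨(e.trans e').trans e''.symm⟩

theorem T_flatR (i : ℕ) [Module.Flat S M] : Subsingleton (T S N M (i + 1)) := by
  obtain ⟨e⟩ := Tsymm S (i + 1) N M
  have := T_flat S (N := M) (M := N) i
  exact e.toEquiv.subsingleton

theorem TequivR (i : ℕ) (e : M ≃ₗ[S] M') : Nonempty (T S N M i ≃ₗ[S] T S N M' i) := by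
  obtain ⟨e1⟩ := Tsymm S i N M
  obtain ⟨e2⟩ := Tsymm S i M' N
  exact ⟨(e1.trans (TequivL S N i e)).trans e2⟩

theorem Tequiv (i : ℕ) (e : N ≃ₗ[S] N₁) (e' : M ≃ₗ[S] M') :
    Nonempty (T S N M i ≃ₗ[S] T S N₁ M' i) := by
  obtain ⟨e1⟩ := TequivR S (N := N₁) i e'
  exact ⟨(TequivL S M i e).trans e1⟩

theorem T_sub_of_sub (i : ℕ) [Subsingleton N] : Subsingleton (T S N M i) := by
  match i with
  | 0 => exact inferInstanceAs (Subsingleton (N ⊗[S] M))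
  | i + 1 => exact inferInstanceAs (Subsingleton (T1 S N (Syz S i (ModuleCat.of S M))))

theorem Tsymm_sub {i : ℕ} : Subsingleton (T S N M i) ↔ Subsingleton (T S M N i) := by
  obtain ⟨e⟩ := Tsymm S i N M
  exact e.toEquiv.subsingleton_congr

end TorBasic

end HW

end

section

namespace HW

open TensorProduct Function

section BC

variable (S : Type u) [CommRing S]
variable {N N₁ N₂ N₃ M M' M₁ M₂ M₃ : Type u} [AddCommGroup N] [Module S N] [AddCommGroup N₁]
  [Module S N₁] [AddCommGroup N₂] [Module S N₂] [AddCommGroup N₃] [Module S N₃]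
  [AddCommGroup M] [Module S M] [AddCommGroup M'] [Module S M']
  [AddCommGroup M₁] [Module S M₁] [AddCommGroup M₂] [Module S M₂] [AddCommGroup M₃] [Module S M₃]

theorem shiftR' (i : ℕ) {f : M₁ →ₗ[S] M₂} {g : M₂ →ₗ[S] M₃} (hf : Injective f) (hfg : Exact f g)
    (hg : Surjective g) (h1 : ∀ i, Subsingleton (T S M₂ N (i + 1))) :
    Nonempty (T S N M₃ (i + 2) ≃ₗ[S] T S N M₁ (i + 1)) := by
  obtain ⟨e⟩ := shiftL S (M := N) i hf hfg hg (h1 _) (h1 _)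
  obtain ⟨e1⟩ := Tsymm S (i + 2) N M₃
  obtain ⟨e2⟩ := Tsymm S (i + 1) M₁ N
  exact ⟨(e1.trans e).trans e2⟩

theorem shiftR1' {f : M₁ →ₗ[S] M₂} {g : M₂ →ₗ[S] M₃} (hf : Injective f) (hfg : Exact f g)
    (hg : Surjective g) (h1 : Subsingleton (T S M₂ N 1)) :
    Nonempty (T S N M₃ 1 ≃ₗ[S] LinearMap.ker (LinearMap.lTensor N f)) := by
  obtain ⟨e⟩ := shiftL1 S (M := N) hf hfg hg h1
  obtain ⟨e1⟩ := Tsymm S 1 N M₃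
  obtain ⟨e2⟩ := ker_comm S (N := N) f
  exact ⟨(e1.trans e).trans e2⟩

variable {S} (S' : Type u) [CommRing S'] [Algebra S S']

/-- additive equivalence compatible with a ring homomorphism `S → S'` -/
def SEquiv (S : Type u) [CommRing S] (S' : Type u) [CommRing S'] [Algebra S S']
    (A B : Type u) [AddCommGroup A] [Module S' A] [AddCommGroup B] [Module S B] : Prop :=
  ∃ e : A ≃+ B, ∀ (s : S) (x : A), e (algebraMap S S' s • x) = s • e x

theorem SEquiv.pre {A A' B : Type u} [AddCommGroup A] [Module S' A] [AddCommGroup B] [Module S B]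
    [AddCommGroup A'] [Module S' A'] (h : SEquiv S S' A B) (e : A' ≃ₗ[S'] A) :
    SEquiv S S' A' B := by
  obtain ⟨f, hf⟩ := h
  exact ⟨e.toAddEquiv.trans f, fun s x => by simp [hf]⟩

theorem SEquiv.post {A B B' : Type u} [AddCommGroup A] [Module S' A] [AddCommGroup B] [Module S B]
    [AddCommGroup B'] [Module S B'] (h : SEquiv S S' A B) (e : B ≃ₗ[S] B') :
    SEquiv S S' A B' := by
  obtain ⟨f, hf⟩ := h
  exact ⟨f.trans e.toAddEquiv, fun s x => by simp [hf]⟩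

theorem SEquiv.sub {A B : Type u} [AddCommGroup A] [Module S' A] [AddCommGroup B] [Module S B]
    (h : SEquiv S S' A B) : Subsingleton A ↔ Subsingleton B := by
  obtain ⟨f, hf⟩ := h
  exact f.toEquiv.subsingleton_congr

theorem ker_equiv_of_comm {A B C D : Type u} [AddCommMonoid A] [Module S A] [AddCommMonoid B]
    [Module S B] [AddCommMonoid C] [Module S C] [AddCommMonoid D] [Module S D]
    {f : A →ₗ[S] C} {g : B →ₗ[S] D} (e1 : A ≃ₗ[S] B) (e2 : C ≃ₗ[S] D)
    (h : ∀ x, g (e1 x) = e2 (f x)) : Nonempty (LinearMap.ker f ≃ₗ[S] LinearMap.ker g) := by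
  refine ⟨e1.ofSubmodules _ _ ?_⟩
  ext y
  rw [Submodule.mem_map_equiv, LinearMap.mem_ker, LinearMap.mem_ker]
  have := h (e1.symm y)
  rw [LinearEquiv.apply_symm_apply] at this
  rw [this, LinearEquiv.map_eq_zero_iff]

theorem baseChange_exact {f : M₁ →ₗ[S] M₂} {g : M₂ →ₗ[S] M₃} (hfg : Exact f g)
    (hg : Surjective g) : Exact (f.baseChange S') (g.baseChange S') :=
  lTensor_exact S' hfg hg

theorem baseChange_surj {g : M₂ →ₗ[S] M₃}
    (hg : Surjective g) : Surjective (g.baseChange S') :=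
  LinearMap.lTensor_surjective S' hg

theorem baseChange_inj_flat [Module.Flat S S'] {g : M₂ →ₗ[S] M₃}
    (hg : Injective g) : Injective (g.baseChange S') :=
  Module.Flat.lTensor_preserves_injective_linearMap (M := S') g hg

theorem baseChange_exact_flat [Module.Flat S S'] {f : M₁ →ₗ[S] M₂} {g : M₂ →ₗ[S] M₃}
    (hfg : Exact f g) : Exact (f.baseChange S') (g.baseChange S') :=
  Module.Flat.lTensor_exact S' hfg

theorem ker_bc {K F L : Type u} [AddCommGroup K] [Module S K] [AddCommGroup F] [Module S F]
    [AddCommGroup L] [Module S' L] [Module S L] [IsScalarTower S S' L] (f : K →ₗ[S] F) :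
    SEquiv S S' (LinearMap.ker (LinearMap.lTensor L (f.baseChange S')))
      (LinearMap.ker (LinearMap.lTensor L f)) := by
  let e1 := AlgebraTensorModule.cancelBaseChange S S' S' L K
  let e2 := AlgebraTensorModule.cancelBaseChange S S' S' L F
  have h : ∀ x, LinearMap.lTensor L f (e1 x) = e2 (LinearMap.lTensor L (f.baseChange S') x) := by
    intro x
    have := LinearMap.congr_fun
      (AlgebraTensorModule.lTensor_comp_cancelBaseChange S S' S' (M := L) f) x
    exact this
  refine ⟨⟨⟨fun x => ⟨e1 x.1, ?_⟩, fun y => ⟨e1.symm y.1, ?_⟩, ?_, ?_⟩, ?_⟩, ?_⟩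
  · rw [LinearMap.mem_ker, h, x.2, map_zero]
  · rw [LinearMap.mem_ker]
    apply e2.injective
    rw [← h, map_zero, LinearEquiv.apply_symm_apply]
    exact y.2
  · intro x; apply Subtype.ext; simp
  · intro x; apply Subtype.ext; simp
  · intro x y; apply Subtype.ext; simp
  · intro s x
    apply Subtype.ext
    change e1 (algebraMap S S' s • x.1) = s • e1 x.1
    rw [map_smul, algebraMap_smul]

theorem tensor_bc (L : Type u) [AddCommGroup L] [Module S' L] [Module S L] [IsScalarTower S S' L]
    (Z : Type u) [AddCommGroup Z] [Module S Z] :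
    SEquiv S S' (L ⊗[S'] (S' ⊗[S] Z)) (L ⊗[S] Z) := by
  refine ⟨(AlgebraTensorModule.cancelBaseChange S S' S' L Z).toAddEquiv, ?_⟩
  intro s x
  change (AlgebraTensorModule.cancelBaseChange S S' S' L Z) (algebraMap S S' s • x) = s •
    (AlgebraTensorModule.cancelBaseChange S S' S' L Z) x
  rw [map_smul, algebraMap_smul]

theorem distrib_comm (N K F : Type u) [AddCommGroup N] [Module S N] [AddCommGroup K] [Module S K]
    [AddCommGroup F] [Module S F] (f : K →ₗ[S] F) (x : S' ⊗[S] (N ⊗[S] K)) :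
    LinearMap.lTensor (S' ⊗[S] N) (f.baseChange S')
      (AlgebraTensorModule.distribBaseChange S S' N K x) =
    AlgebraTensorModule.distribBaseChange S S' N F
      (AlgebraTensorModule.lTensor S' S' (LinearMap.lTensor N f) x) := by
  induction x with
  | zero => simp only [map_zero]
  | add a b ha hb => simp only [map_add, ha, hb]
  | tmul s y =>
    induction y with
    | zero => simp only [map_zero, tmul_zero]
    | add a b ha hb => simp only [map_add, tmul_add, ha, hb]
    | tmul n k => simp

/-- base change for Tor when `Z` is Tor-independent of `S'` -/
theorem Tor_bc (L : Type u) [AddCommGroup L] [Module S' L] [Module S L] [IsScalarTower S S' L] :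
    ∀ (i : ℕ) (Z : Type u) [AddCommGroup Z] [Module S Z]
    (_ : ∀ i, Subsingleton (T S S' Z (i + 1))),
    SEquiv S S' (T S' L (S' ⊗[S] Z) i) (T S L Z i)
  | 0, Z, _, _, _ => by
    exact tensor_bc S' L Z
  | i + 1, Z, _, _, h => by
    have hinj : Injective ((ki S Z).baseChange S') := by
      rw [← LinearMap.ker_eq_bot]
      have h0 : Subsingleton (LinearMap.ker (LinearMap.lTensor S' (ki S Z))) := h 0
      rw [eq_bot_iff]
      intro x hx
      have : (⟨x, hx⟩ : LinearMap.ker (LinearMap.lTensor S' (ki S Z))) = 0 := Subsingleton.elim _ _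
      exact congrArg Subtype.val this
    have hex := baseChange_exact S' (KK_exact S Z) (eps_surj S Z)
    have hsurj := baseChange_surj S' (eps_surj S Z)
    match i with
    | 0 =>
      obtain ⟨e⟩ := shiftR1' S' (N := L) hinj hex hsurj (T_flat S' 0)
      exact (ker_bc S' (L := L) (ki S Z)).pre S' e
    | i + 1 =>
      obtain ⟨e⟩ := shiftR' S' (N := L) i hinj hex hsurj (fun _ => T_flat S' _)
      obtain ⟨e'⟩ := shiftR S (N := L) (M := Z) i
      refine ((Tor_bc L (i + 1) (KK S Z) ?_).pre S' e).post S' e'.symm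
      intro j
      obtain ⟨e''⟩ := shiftR S (N := S') (M := Z) j
      have := h (j + 1)
      exact e''.symm.toEquiv.subsingleton

/-- flat base change for Tor -/
theorem Tor_flat_bc [Module.Flat S S'] (N : Type u) [AddCommGroup N] [Module S N] :
    ∀ (i : ℕ) (Z : Type u) [AddCommGroup Z] [Module S Z],
    Nonempty (T S' (S' ⊗[S] N) (S' ⊗[S] Z) i ≃ₗ[S'] S' ⊗[S] (T S N Z i))
  | 0, Z, _, _ => ⟨(AlgebraTensorModule.distribBaseChange S S' N Z).symm⟩
  | i + 1, Z, _, _ => by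
    have hinj := baseChange_inj_flat S' (ki_inj S Z)
    have hex := baseChange_exact S' (KK_exact S Z) (eps_surj S Z)
    have hsurj := baseChange_surj S' (eps_surj S Z)
    match i with
    | 0 =>
      obtain ⟨e⟩ := shiftR1' S' (N := S' ⊗[S] N) hinj hex hsurj (T_flat S' 0)
      have e1 := LinearMap.tensorKerEquiv S' S' (LinearMap.lTensor N (ki S Z))
      have h := distrib_comm S' N _ _ (ki S Z)
      let d1 := AlgebraTensorModule.distribBaseChange S S' N (KK S Z)
      let d2 := AlgebraTensorModule.distribBaseChange S S' N (FT S Z)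
      obtain ⟨e2⟩ := ker_equiv_of_comm d1 d2 h
      exact ⟨(e.trans e2.symm).trans e1.symm⟩
    | i + 1 =>
      obtain ⟨e⟩ := shiftR' S' (N := S' ⊗[S] N) i hinj hex hsurj (fun _ => T_flat S' _)
      obtain ⟨e'⟩ := shiftR S (N := N) (M := Z) i
      obtain ⟨e''⟩ := Tor_flat_bc N (i + 1) (KK S Z)
      exact ⟨(e.trans e'').trans (e'.symm.baseChange S S' _ _)⟩

end BC

section fin

variable {S : Type u} [CommRing S] [IsNoetherianRing S]

theorem Tfinite (N : Type u) [AddCommGroup N] [Module S N] [Module.Finite S N] :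
    ∀ (i : ℕ) (Z : Type u) [AddCommGroup Z] [Module S Z] [Module.Finite S Z],
    Module.Finite S (T S N Z i)
  | 0, Z, _, _, _ => inferInstanceAs (Module.Finite S (N ⊗[S] Z))
  | i + 1, Z, _, _, _ => by
    obtain ⟨n, p, hp⟩ := Module.Finite.exists_fin' S Z
    have hex : Exact (LinearMap.ker p).subtype p := LinearMap.exact_subtype_ker_map p
    match i with
    | 0 =>
      obtain ⟨e⟩ := shiftR1' S (N := N) Subtype.val_injective hex hp (T_flat S 0)
      exact Module.Finite.equiv e.symm
    | i + 1 =>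
      obtain ⟨e⟩ := shiftR' S (N := N) i Subtype.val_injective hex hp (fun _ => T_flat S _)
      have := Tfinite N (i + 1) (LinearMap.ker p)
      exact Module.Finite.equiv e.symm

end fin

end HW

end

section

namespace HW

open TensorProduct Function

section CR

/-- `R = Q / f` with `f` a nonzerodivisor -/
structure Hyp (Q R : Type u) [CommRing Q] [CommRing R] [Algebra Q R] (f : Q) : Prop where
  surj : Surjective (algebraMap Q R)
  ker : ∀ x : Q, algebraMap Q R x = 0 ↔ f ∣ x
  nzd : ∀ x : Q, f * x = 0 → x = 0

variable {Q R : Type u} [CommRing Q] [CommRing R] [Algebra Q R] {f : Q} (H : Hyp Q R f)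
include H

theorem Hyp.mul_inj : Injective (LinearMap.mulLeft Q f) := by
  rw [injective_iff_map_eq_zero]
  intro x hx
  exact H.nzd x hx

theorem Hyp.mul_exact : Exact (LinearMap.mulLeft Q f) (Algebra.linearMap Q R) := by
  intro x
  rw [Algebra.linearMap_apply, H.ker]
  constructor
  · rintro ⟨y, rfl⟩; exact ⟨y, rfl⟩
  · rintro ⟨y, rfl⟩; exact ⟨y, rfl⟩

theorem Hyp.T_ge2 (W : Type u) [AddCommGroup W] [Module Q W] (i : ℕ) :
    Subsingleton (T Q R W (i + 2)) := by
  obtain ⟨e⟩ := shiftL Q (M := W) i H.mul_inj H.mul_exact H.surj (T_flat Q _) (T_flat Q _)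
  have := T_flat Q (N := Q) (M := W) i
  exact e.toEquiv.subsingleton

theorem Hyp.T_one (W : Type u) [AddCommGroup W] [Module Q W] :
    Nonempty (T Q R W 1 ≃ₗ[Q] LinearMap.ker (LinearMap.lsmul Q W f)) := by
  obtain ⟨e⟩ := shiftL1 Q (M := W) H.mul_inj H.mul_exact H.surj (T_flat Q _)
  obtain ⟨e'⟩ := ker_equiv_of_comm (S := Q) (f := LinearMap.rTensor W (LinearMap.mulLeft Q f))
    (g := LinearMap.lsmul Q W f) (TensorProduct.lid Q W) (TensorProduct.lid Q W) (by
      intro x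
      induction x with
      | zero => simp only [map_zero]
      | add a b ha hb => simp only [map_add, ha, hb]
      | tmul s y => simp [mul_smul, smul_comm s f y])
  exact ⟨e.trans e'⟩

theorem Hyp.T_pos (W : Type u) [AddCommGroup W] [Module Q W] (hW : ∀ w : W, f • w = 0 → w = 0)
    (i : ℕ) : Subsingleton (T Q R W (i + 1)) := by
  match i with
  | 0 =>
    obtain ⟨e⟩ := H.T_one W
    have : Subsingleton (LinearMap.ker (LinearMap.lsmul Q W f)) := by
      constructor
      intro a b
      rw [Subtype.ext_iff, hW a.1 a.2, hW b.1 b.2]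
    exact e.toEquiv.subsingleton
  | i + 1 => exact H.T_ge2 W i

theorem Hyp.smul_zero {X : Type u} [AddCommGroup X] [Module R X] [Module Q X]
    [IsScalarTower Q R X] (x : X) : f • x = 0 := by
  rw [← algebraMap_smul R f x, (H.ker f).2 dvd_rfl, zero_smul]

/-- The two short exact sequences over `R` attached to a `Q`-free cover of an `R`-module. -/
theorem Hyp.ses {X F : Type u} [AddCommGroup X] [Module R X] [Module Q X] [IsScalarTower Q R X]
    [AddCommGroup F] [Module Q F] [Module.Flat Q F] {K : Type u} [AddCommGroup K] [Module Q K]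
    (k : K →ₗ[Q] F) (hk : Injective k) (p : F →ₗ[Q] X) (hex : Exact k p) (hp : Surjective p) :
    ∃ (a : X →ₗ[R] R ⊗[Q] K) (d : R ⊗[Q] F →ₗ[R] X),
      Injective a ∧ Exact a (k.baseChange R) ∧
      Exact (k.baseChange R) d ∧ Surjective d := by
  obtain ⟨e1⟩ := shiftR1' Q (N := R) hk hex hp (T_flat Q 0)
  obtain ⟨e2⟩ := H.T_one X
  have htop : LinearMap.ker (LinearMap.lsmul Q X f) = ⊤ := by
    rw [eq_top_iff]; intro x _
    exact H.smul_zero x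
  let e3 : X ≃ₗ[Q] LinearMap.ker (LinearMap.lsmul Q X f) :=
    (LinearEquiv.ofTop _ htop).symm
  let e := (e3.trans e2.symm).trans e1
  let a0 : X →ₗ[Q] R ⊗[Q] K := (Submodule.subtype _).comp e.toLinearMap
  let d : R ⊗[Q] F →ₗ[R] X := LinearMap.liftBaseChange R p
  refine ⟨a0.extendScalarsOfSurjective H.surj, d, ?_, ?_, ?_, ?_⟩
  · exact Subtype.val_injective.comp e.injective
  · intro y
    constructor
    · intro hy
      exact ⟨e.symm ⟨y, hy⟩, by
        change ((e (e.symm ⟨y, hy⟩)) : R ⊗[Q] K) = y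
        rw [LinearEquiv.apply_symm_apply]⟩
    · rintro ⟨x, rfl⟩
      exact (e x).2
  · intro y
    rw [← (baseChange_exact R hex hp) y]
    let l : R ⊗[Q] X →ₗ[R] X := LinearMap.liftBaseChange R LinearMap.id
    have hl : Injective l := by
      let s : X →ₗ[Q] R ⊗[Q] X := TensorProduct.mk Q R X 1
      have : ∀ z, s (l z) = z := by
        intro z
        induction z with
        | zero => simp only [map_zero]
        | add a b ha hb => simp only [map_add, ha, hb]
        | tmul r x =>
          obtain ⟨q, rfl⟩ := H.surj r
          simp only [l, s, LinearMap.liftBaseChange_tmul, LinearMap.id_apply, mk_apply,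
            algebraMap_smul]
          rw [← smul_tmul, Algebra.smul_def, mul_one]
      exact Function.LeftInverse.injective this
    have : d y = l (p.baseChange R y) := by
      induction y with
      | zero => simp only [map_zero]
      | add a b ha hb => simp only [map_add, ha, hb]
      | tmul r x => simp [d, l]
    rw [this]
    exact map_eq_zero_iff _ hl
  · intro x
    obtain ⟨y, rfl⟩ := hp x
    exact ⟨1 ⊗ₜ y, by simp [d]⟩

omit H in
theorem CRcore (X Y B G : Type u) [AddCommGroup X] [Module R X] [Module Q X] [IsScalarTower Q R X]
    [AddCommGroup Y] [Module R Y] [Module Q Y] [IsScalarTower Q R Y]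
    [AddCommGroup B] [Module R B] [AddCommGroup G] [Module R G] [Module.Flat R G]
    (a : X →ₗ[R] B) (b : B →ₗ[R] G) (d : G →ₗ[R] X) (ha : Injective a) (hab : Exact a b)
    (hbd : Exact b d) (hd : Surjective d)
    (hEq : ∀ i, SEquiv Q R (T R B Y (i + 1)) (T Q X Y (i + 2)))
    (hE0' : SEquiv Q R (LinearMap.ker (LinearMap.lTensor Y b)) (T Q X Y 1)) :
    ∃ (E : ℕ → ModuleCat.{u} R) (α : ∀ i, T R X Y i →ₗ[R] E i)
      (β : ∀ i, E i →ₗ[R] T R X Y (i + 1)) (γ : ∀ i, T R X Y (i + 2) →ₗ[R] T R X Y i),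
      (∀ i, SEquiv Q R (E i) (T Q X Y (i + 1))) ∧ (∀ i, Exact (γ i) (α i)) ∧
      (∀ i, Exact (α i) (β i)) ∧ (∀ i, Exact (β (i + 1)) (γ i)) ∧ Surjective (β 0) := by
  obtain ⟨D, iD1, iD2, c, b', hcb, hc, hcd⟩ : ∃ (D : Type u) (_ : AddCommGroup D) (_ : Module R D)
      (c : D →ₗ[R] G) (b' : B →ₗ[R] D),
      c ∘ₗ b' = b ∧ Injective c ∧ Exact c d :=
    ⟨LinearMap.ker d, inferInstance, inferInstance, (LinearMap.ker d).subtype,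
      b.codRestrict _ (fun x => (hbd _).2 ⟨x, rfl⟩), rfl, Subtype.val_injective,
      LinearMap.exact_subtype_ker_map d⟩
  have hcb' : ∀ x, c (b' x) = b x := fun x => by rw [← hcb]; rfl
  have hab' : Exact a b' := by
    intro y
    rw [← hab y, ← hcb']
    exact ⟨fun h => by rw [h, map_zero], fun h => hc (by rw [h, map_zero])⟩
  have hb' : Surjective b' := by
    intro y
    obtain ⟨x, hx⟩ := (hbd (c y)).1 ((hcd _).2 ⟨y, rfl⟩)
    exact ⟨x, hc (by rw [hcb', ← hx])⟩
  have he : ∀ i, Nonempty (T R X Y (i + 2) ≃ₗ[R] T R D Y (i + 1)) := fun i =>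
    shiftL R i hc hcd hd (T_flat R _) (T_flat R _)
  choose e he using fun i => (exists_true_iff_nonempty.2 (he i))
  have hles : ∀ i, ∃ δ : T R D Y (i+1) →ₗ[R] T R X Y i,
      Exact (Tmap R Y (i+1) b') δ ∧ Exact δ (Tmap R Y i a) := fun i => les R Y i ha hab' hb'
  choose δ hδ1 hδ2 using hles
  have he0 : Nonempty (T R X Y 1 ≃ₗ[R] LinearMap.ker (LinearMap.rTensor Y c)) :=
    shiftL1 R (M := Y) hc hcd hd (T_flat R 0)
  obtain ⟨e0⟩ := he0
  have hE0 : SEquiv Q R (LinearMap.ker (LinearMap.rTensor Y b)) (T Q X Y 1) := by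
    obtain ⟨e1⟩ := ker_comm R (N := Y) b
    exact hE0'.pre R e1
  have hba : b ∘ₗ a = 0 := hab.linearMap_comp_eq_zero
  let α0 : X ⊗[R] Y →ₗ[R] LinearMap.ker (LinearMap.rTensor Y b) :=
    (LinearMap.rTensor Y a).codRestrict _ (fun x => by
      rw [LinearMap.mem_ker, ← LinearMap.comp_apply, ← LinearMap.rTensor_comp, hba]; simp)
  let β00 : LinearMap.ker (LinearMap.rTensor Y b) →ₗ[R] LinearMap.ker (LinearMap.rTensor Y c) :=
    (LinearMap.rTensor Y b').restrict (fun x hx => by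
      rw [LinearMap.mem_ker] at hx ⊢
      rw [← LinearMap.comp_apply, ← LinearMap.rTensor_comp, hcb, hx])
  have hrex := rTensor_exact Y hab' hb'
  refine ⟨fun i => match i with
      | 0 => ModuleCat.of R (LinearMap.ker (LinearMap.rTensor Y b))
      | i + 1 => ModuleCat.of R (T R (B) Y (i + 1)),
    fun i => match i with
      | 0 => α0
      | i + 1 => Tmap R Y (i + 1) a,
    fun i => match i with
      | 0 => e0.symm.toLinearMap ∘ₗ β00
      | i + 1 => (e i).symm.toLinearMap ∘ₗ Tmap R Y (i + 1) b',
    fun i => δ i ∘ₗ (e i).toLinearMap, ?_, ?_, ?_, ?_, ?_⟩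
  · intro i
    match i with
    | 0 => exact hE0
    | i + 1 => exact hEq i
  · intro i
    have hg : Exact (δ i ∘ₗ (e i).toLinearMap) (Tmap R Y i a) := by
      intro x
      rw [hδ2 i x]
      constructor
      · rintro ⟨y, rfl⟩; exact ⟨(e i).symm y, by simp⟩
      · rintro ⟨y, rfl⟩; exact ⟨e i y, by simp⟩
    match i with
    | 0 =>
      intro x
      rw [← hg x]
      exact ⟨fun h => congrArg Subtype.val h, fun h => Subtype.ext h⟩
    | i + 1 => exact hg
  · intro i
    match i with
    | 0 =>
      intro x
      change (e0.symm (β00 x) = 0) ↔ _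
      rw [LinearEquiv.map_eq_zero_iff]
      constructor
      · intro h
        obtain ⟨y, hy⟩ := (hrex x.1).1 (congrArg Subtype.val h)
        exact ⟨y, Subtype.ext hy⟩
      · rintro ⟨y, rfl⟩
        exact Subtype.ext ((hrex _).2 ⟨y, rfl⟩)
    | i + 1 =>
      intro x
      change ((e i).symm (Tmap R Y (i + 1) b' x) = 0) ↔ _
      rw [LinearEquiv.map_eq_zero_iff]
      exact les_mid R Y (i + 1) ha hab' hb' x
  · intro i x
    change δ i (e i x) = 0 ↔ _
    rw [hδ1 i (e i x)]
    constructor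
    · rintro ⟨y, hy⟩
      exact ⟨y, by
        change (e i).symm (Tmap R Y (i + 1) b' y) = x
        rw [hy, LinearEquiv.symm_apply_apply]⟩
    · rintro ⟨y, rfl⟩
      exact ⟨y, ((e i).apply_symm_apply _).symm⟩
  · intro x
    obtain ⟨y, hy⟩ := LinearMap.rTensor_surjective Y hb' (e0 x).1
    refine ⟨⟨y, ?_⟩, ?_⟩
    · rw [LinearMap.mem_ker, ← hcb, LinearMap.rTensor_comp, LinearMap.comp_apply, hy]
      exact (e0 x).2
    · change e0.symm (β00 ⟨y, _⟩) = x
      rw [LinearEquiv.symm_apply_eq]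
      exact Subtype.ext hy


/-- the change of rings long exact sequence -/
theorem Hyp.CR (X Y : Type u) [AddCommGroup X] [Module R X] [Module Q X] [IsScalarTower Q R X]
    [AddCommGroup Y] [Module R Y] [Module Q Y] [IsScalarTower Q R Y] :
    ∃ (E : ℕ → ModuleCat.{u} R) (α : ∀ i, T R X Y i →ₗ[R] E i)
      (β : ∀ i, E i →ₗ[R] T R X Y (i + 1)) (γ : ∀ i, T R X Y (i + 2) →ₗ[R] T R X Y i),
      (∀ i, SEquiv Q R (E i) (T Q X Y (i + 1))) ∧ (∀ i, Exact (γ i) (α i)) ∧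
      (∀ i, Exact (α i) (β i)) ∧ (∀ i, Exact (β (i + 1)) (γ i)) ∧ Surjective (β 0) := by
  let p := eps Q X
  let K := KK Q X
  let k : K →ₗ[Q] FT Q X := ki Q X
  have hk : Injective k := ki_inj Q X
  have hp : Surjective p := eps_surj Q X
  have hex : Exact k p := KK_exact Q X
  obtain ⟨a, d, ha, hab, hbd, hd⟩ := H.ses k hk p hex hp
  have ht : ∀ i, Subsingleton (T Q R K (i + 1)) := H.T_pos _ (by
    intro w hw
    apply hk
    rw [map_zero]
    have : f • (k w) = 0 := by rw [← map_smul, hw, map_zero]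
    apply Finsupp.ext
    intro x
    exact H.nzd _ (congrArg (fun z : X →₀ Q => z x) this))
  have hEq : ∀ i, SEquiv Q R (T R (R ⊗[Q] K) Y (i + 1)) (T Q X Y (i + 2)) := by
    intro i
    have h1 := Tor_bc R Y (i + 1) K ht
    obtain ⟨e1⟩ := Tsymm R (i + 1) (R ⊗[Q] K) Y
    obtain ⟨e2⟩ := Tsymm Q (i + 2) X Y
    obtain ⟨e3⟩ := shiftR' Q (N := Y) i hk hex hp (fun i => T_flat Q i)
    exact (h1.pre R e1).post R (e2.trans e3).symm
  have hE0 : SEquiv Q R (LinearMap.ker (LinearMap.lTensor Y (k.baseChange R))) (T Q X Y 1) := by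
    have h1 := ker_bc R (L := Y) k
    obtain ⟨e2⟩ := Tsymm Q 1 X Y
    obtain ⟨e3⟩ := shiftR1' Q (N := Y) hk hex hp (T_flat Q 0)
    exact h1.post R (e2.trans e3).symm
  exact CRcore X Y (R ⊗[Q] K) (R ⊗[Q] FT Q X) a (k.baseChange R) d ha hab hbd hd hEq hE0

end CR

end HW

end

section

namespace HW

open TensorProduct Function

section wrap

variable {B : Type u} [CommRing B] {H H' : Type u} [AddCommGroup H] [Module B H]
  [AddCommGroup H'] [Module B H']

/-- kernel as a wrapped module -/
def Ke (f : H →ₗ[B] H') : Type u := LinearMap.ker f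
instance (f : H →ₗ[B] H') : AddCommGroup (Ke f) := inferInstanceAs (AddCommGroup (LinearMap.ker f))
instance (f : H →ₗ[B] H') : Module B (Ke f) := inferInstanceAs (Module B (LinearMap.ker f))
/-- inclusion of the kernel -/
def Ke.i (f : H →ₗ[B] H') : Ke f →ₗ[B] H := (LinearMap.ker f).subtype
theorem Ke.inj (f : H →ₗ[B] H') : Injective (Ke.i f) := Subtype.val_injective
theorem Ke.exact (f : H →ₗ[B] H') : Exact (Ke.i f) f := LinearMap.exact_subtype_ker_map f
theorem Ke.apply (f : H →ₗ[B] H') (x : Ke f) : f (Ke.i f x) = 0 := x.2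
theorem Ke.ex (f : H →ₗ[B] H') (x : H) (hx : f x = 0) : ∃ y : Ke f, Ke.i f y = x :=
  ⟨⟨x, hx⟩, rfl⟩
/-- lift to the kernel -/
theorem Ke.lift (f : H →ₗ[B] H') {G : Type u} [AddCommGroup G] [Module B G] (g : G →ₗ[B] H)
    (h : ∀ x, f (g x) = 0) : ∃ k : G →ₗ[B] Ke f, ∀ x, Ke.i f (k x) = g x :=
  ⟨g.codRestrict (LinearMap.ker f) h, fun _ => rfl⟩

/-- image -/
def Rg (f : H →ₗ[B] H') : Type u := LinearMap.range f
instance (f : H →ₗ[B] H') : AddCommGroup (Rg f) := inferInstanceAs (AddCommGroup (LinearMap.range f))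
instance (f : H →ₗ[B] H') : Module B (Rg f) := inferInstanceAs (Module B (LinearMap.range f))
/-- inclusion of the image -/
def Rg.i (f : H →ₗ[B] H') : Rg f →ₗ[B] H' := (LinearMap.range f).subtype
/-- projection to the image -/
def Rg.p (f : H →ₗ[B] H') : H →ₗ[B] Rg f := f.rangeRestrict
theorem Rg.inj (f : H →ₗ[B] H') : Injective (Rg.i f) := Subtype.val_injective
theorem Rg.surj (f : H →ₗ[B] H') : Surjective (Rg.p f) := f.surjective_rangeRestrict
theorem Rg.ip (f : H →ₗ[B] H') (x : H) : Rg.i f (Rg.p f x) = f x := rfl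
theorem Rg.exact_i {H'' : Type u} [AddCommGroup H''] [Module B H''] {f : H →ₗ[B] H'}
    {g : H' →ₗ[B] H''} (h : Exact f g) : Exact (Rg.i f) (Rg.p g) := by
  intro y
  constructor
  · intro hy
    obtain ⟨x, rfl⟩ := (h y).1 (by rw [← Rg.ip, hy, map_zero])
    exact ⟨Rg.p f x, rfl⟩
  · rintro ⟨z, rfl⟩
    obtain ⟨x, rfl⟩ := Rg.surj f z
    apply Rg.inj g
    rw [Rg.ip, Rg.ip, map_zero]
    exact (h _).2 ⟨x, rfl⟩

/-- cokernel -/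
def Co (f : H →ₗ[B] H') : Type u := H' ⧸ LinearMap.range f
instance (f : H →ₗ[B] H') : AddCommGroup (Co f) := inferInstanceAs (AddCommGroup (H' ⧸ _))
instance (f : H →ₗ[B] H') : Module B (Co f) := inferInstanceAs (Module B (H' ⧸ LinearMap.range f))
/-- projection to the cokernel -/
def Co.p (f : H →ₗ[B] H') : H' →ₗ[B] Co f := (LinearMap.range f).mkQ
theorem Co.surj (f : H →ₗ[B] H') : Surjective (Co.p f) := Submodule.mkQ_surjective _
theorem Co.exact (f : H →ₗ[B] H') : Exact f (Co.p f) := LinearMap.exact_map_mkQ_range f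
theorem Co.lift (f : H →ₗ[B] H') {G : Type u} [AddCommGroup G] [Module B G] (g : H' →ₗ[B] G)
    (h : ∀ x, g (f x) = 0) : ∃ k : Co f →ₗ[B] G, ∀ x, k (Co.p f x) = g x :=
  ⟨(LinearMap.range f).liftQ g (by rintro _ ⟨x, rfl⟩; exact h x), fun _ => rfl⟩

instance [Module.Finite B H'] (f : H →ₗ[B] H') : Module.Finite B (Co f) :=
  Module.Finite.of_surjective _ (Co.surj f)
instance [Module.Finite B H] (f : H →ₗ[B] H') : Module.Finite B (Rg f) :=
  Module.Finite.of_surjective _ (Rg.surj f)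
theorem Ke.finite [IsNoetherianRing B] [Module.Finite B H] (f : H →ₗ[B] H') :
    Module.Finite B (Ke f) := Module.Finite.of_injective _ (Ke.inj f)
theorem fin_inj [IsNoetherianRing B] [Module.Finite B H'] {f : H →ₗ[B] H'} (hf : Injective f) :
    Module.Finite B H := Module.Finite.of_injective _ hf

/-- multiplication by `x` -/
abbrev mx (x : B) (H : Type u) [AddCommGroup H] [Module B H] : H →ₗ[B] H := LinearMap.lsmul B H x

theorem mx_apply (x : B) (h : H) : mx x H h = x • h := rfl

/-- six-term exact sequence of multiplication by `x` -/
theorem six (x : B) {H₁ H₂ H₃ : Type u} [AddCommGroup H₁] [Module B H₁] [AddCommGroup H₂]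
    [Module B H₂] [AddCommGroup H₃] [Module B H₃] {f : H₁ →ₗ[B] H₂} {g : H₂ →ₗ[B] H₃}
    (hf : Injective f) (hfg : Exact f g) (hg : Surjective g) :
    ∃ (a : Ke (mx x H₁) →ₗ[B] Ke (mx x H₂)) (b : Ke (mx x H₂) →ₗ[B] Ke (mx x H₃))
      (d : Ke (mx x H₃) →ₗ[B] Co (mx x H₁)) (a' : Co (mx x H₁) →ₗ[B] Co (mx x H₂))
      (b' : Co (mx x H₂) →ₗ[B] Co (mx x H₃)),
      Injective a ∧ Exact a b ∧ Exact b d ∧ Exact d a' ∧ Exact a' b' ∧ Surjective b' ∧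
      (∀ y, Ke.i _ (b y) = g (Ke.i _ y)) ∧ (∀ y, a' (Co.p _ y) = Co.p _ (f y)) := by
  obtain ⟨a, ha⟩ := Ke.lift (mx x H₂) (f ∘ₗ Ke.i (mx x H₁)) (fun y => by
    rw [LinearMap.comp_apply, mx_apply, ← map_smul, ← mx_apply, Ke.apply, map_zero])
  obtain ⟨b, hb⟩ := Ke.lift (mx x H₃) (g ∘ₗ Ke.i (mx x H₂)) (fun y => by
    rw [LinearMap.comp_apply, mx_apply, ← map_smul, ← mx_apply, Ke.apply, map_zero])
  obtain ⟨a', ha'⟩ := Co.lift (mx x H₁) (Co.p (mx x H₂) ∘ₗ f) (fun y => by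
    rw [LinearMap.comp_apply, mx_apply, map_smul]
    exact (Co.exact _ _).2 ⟨f y, rfl⟩)
  obtain ⟨b', hb'⟩ := Co.lift (mx x H₂) (Co.p (mx x H₃) ∘ₗ g) (fun y => by
    rw [LinearMap.comp_apply, mx_apply, map_smul]
    exact (Co.exact _ _).2 ⟨g y, rfl⟩)
  obtain ⟨d, hd1, hd2⟩ := snake_abs (i₁ := mx x H₁) (i₂ := mx x H₂) (i₃ := mx x H₃)
    (f₁ := f) (f₂ := g) (g₁ := f) (g₂ := g) (hf := hfg) (hg := hfg) (by ext; simp) (by ext; simp)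
    hg hf (π₁ := Co.p (mx x H₁)) (π₂ := Co.p (mx x H₂)) (hπ₁ := Co.exact _) (hπ₂ := Co.exact _)
    b (by ext y; exact (hb y).symm) a' (by ext y; exact ha' y) (Co.surj _)
  refine ⟨a, b, d, a', b', ?_, ?_, hd1, hd2, ?_, ?_, hb, ha'⟩
  · intro y z hyz
    apply Ke.inj
    apply hf
    rw [← LinearMap.comp_apply, ← ha, hyz, ha]; rfl
  · intro y
    constructor
    · intro hy
      have : g (Ke.i _ y) = 0 := by
        rw [← LinearMap.comp_apply, ← hb, hy, map_zero]
      obtain ⟨z, hz⟩ := (hfg _).1 this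
      obtain ⟨w, rfl⟩ := Ke.ex (mx x H₁) z (by
        apply hf; rw [mx_apply, map_smul, hz, ← mx_apply, Ke.apply, map_zero])
      exact ⟨w, Ke.inj _ (by rw [ha, ← hz]; rfl)⟩
    · rintro ⟨z, rfl⟩
      apply Ke.inj
      rw [hb, LinearMap.comp_apply, ha, map_zero]
      exact (hfg _).2 ⟨_, rfl⟩
  · intro y
    obtain ⟨y, rfl⟩ := Co.surj _ y
    constructor
    · intro hy
      rw [hb'] at hy
      obtain ⟨z, hz⟩ := (Co.exact _ _).1 hy
      obtain ⟨w, rfl⟩ := hg z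
      have : g (y - x • w) = 0 := by
        rw [map_sub, map_smul, sub_eq_zero, ← mx_apply, hz]
      obtain ⟨v, hv⟩ := (hfg _).1 this
      refine ⟨Co.p _ v, ?_⟩
      rw [ha', LinearMap.comp_apply, hv, map_sub, sub_eq_self]
      exact (Co.exact _ _).2 ⟨w, rfl⟩
    · rintro ⟨z, hz⟩
      obtain ⟨z, rfl⟩ := Co.surj _ z
      rw [← hz, ha', LinearMap.comp_apply, hb', LinearMap.comp_apply, (hfg _).2 ⟨z, rfl⟩, map_zero]
  · intro y
    obtain ⟨y, rfl⟩ := Co.surj _ y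
    obtain ⟨z, rfl⟩ := hg y
    exact ⟨Co.p _ z, hb' z⟩

/-- Artin-Rees consequence -/
theorem AR [IsNoetherianRing B] [Module.Finite B H'] (x : B) {f : H →ₗ[B] H'} (hf : Injective f) :
    ∃ n : ℕ, ∀ h : H, ∀ h' : H', f h = x ^ n • h' → ∃ k : H, h = x • k := by
  obtain ⟨k, hk⟩ := Ideal.exists_pow_inf_eq_pow_smul (Ideal.span {x}) (LinearMap.range f)
  refine ⟨k + 1, fun h h' hh => ?_⟩
  have h1 := hk (k + 1) (by omega)
  have : f h ∈ Ideal.span {x} ^ (k + 1) • (⊤ : Submodule B H') ⊓ LinearMap.range f := by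
    refine ⟨?_, ⟨h, rfl⟩⟩
    rw [hh, Ideal.span_singleton_pow]
    exact Submodule.smul_mem_smul (Ideal.mem_span_singleton_self _) trivial
  rw [h1, Nat.add_sub_cancel_left, pow_one, Submodule.ideal_span_singleton_smul] at this
  obtain ⟨z, ⟨_, ⟨w, rfl⟩⟩, hw⟩ := this
  exact ⟨w, hf (by rw [map_smul, ← hw]; rfl)⟩

end wrap

end HW

end

section

namespace HW

open TensorProduct Function

/-- length-like function with a Serre class, on finite modules -/
structure LF (B : Type u) [CommRing B] where
  C : ∀ (H : Type u) [AddCommGroup H] [Module B H], Prop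
  l : ∀ (H : Type u) [AddCommGroup H] [Module B H], ℤ
  ses : ∀ {H₁ H₂ H₃ : Type u} [AddCommGroup H₁] [Module B H₁] [AddCommGroup H₂]
    [Module B H₂] [AddCommGroup H₃] [Module B H₃] (f : H₁ →ₗ[B] H₂) (g : H₂ →ₗ[B] H₃),
    Module.Finite B H₂ → Injective f → Exact f g → Surjective g →
    (C H₂ ↔ C H₁ ∧ C H₃) ∧ (C H₂ → l H₂ = l H₁ + l H₃)
  nonneg : ∀ (H : Type u) [AddCommGroup H] [Module B H], Module.Finite B H → C H → 0 ≤ l H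
  zero : ∀ (H : Type u) [AddCommGroup H] [Module B H], Subsingleton H → C H

section

variable {B : Type u} [CommRing B] [IsNoetherianRing B] (L : LF B)
  {H H' H'' : Type u} [AddCommGroup H] [Module B H]
  [AddCommGroup H'] [Module B H'] [AddCommGroup H''] [Module B H'']

theorem exact_zero_right {f : H →ₗ[B] H'} (hf : Surjective f) :
    Exact f (0 : H' →ₗ[B] PUnit.{u+1}) := by
  intro x; exact ⟨fun _ => hf x, fun _ => rfl⟩

theorem surj_punit (f : H' →ₗ[B] PUnit.{u+1}) : Surjective f := fun x => ⟨0, rfl⟩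

theorem inj_punit (f : PUnit.{u+1} →ₗ[B] H) : Injective f := fun x y _ => rfl

theorem exact_zero_left {f : H →ₗ[B] H'} (hf : Injective f) :
    Exact (0 : PUnit.{u+1} →ₗ[B] H) f := by
  intro x
  exact ⟨fun h => ⟨0, (hf (by rw [h, LinearMap.zero_apply, map_zero])).symm⟩,
    by rintro ⟨y, rfl⟩; simp⟩

namespace LF

omit [IsNoetherianRing B] in
theorem l_zero (hH : Subsingleton H) : L.l H = 0 := by
  have hfin : Module.Finite B H := inferInstance
  have h := (L.ses (LinearMap.id : H →ₗ[B] H) (0 : H →ₗ[B] H) hfin injective_id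
    (fun x => ⟨fun _ => ⟨x, rfl⟩, fun _ => rfl⟩) (fun x => ⟨0, Subsingleton.elim _ _⟩)).2
      (L.zero H hH)
  linarith

theorem bij [Module.Finite B H] {f : H →ₗ[B] H'} (hi : Injective f) (hs : Surjective f) :
    (L.C H ↔ L.C H') ∧ (L.C H → L.l H = L.l H') := by
  have h := L.ses (0 : PUnit.{u+1} →ₗ[B] H) f ‹_› (inj_punit _) (exact_zero_left hi) hs
  have h0 : L.l PUnit.{u+1} = 0 := L.l_zero inferInstance
  have h1 : L.C PUnit.{u+1} := L.zero _ inferInstance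
  exact ⟨by rw [h.1]; simp [h1], fun hc => by rw [h.2 hc, h0, zero_add]⟩

theorem C_inj [Module.Finite B H'] {f : H →ₗ[B] H'} (hf : Injective f) (h : L.C H') : L.C H :=
  ((L.ses f (Co.p f) ‹_› hf (Co.exact f) (Co.surj f)).1.1 h).1

theorem l_inj [Module.Finite B H'] {f : H →ₗ[B] H'} (hf : Injective f) (h : L.C H') :
    L.l H ≤ L.l H' := by
  have h1 := (L.ses f (Co.p f) ‹_› hf (Co.exact f) (Co.surj f))
  have h2 := L.nonneg (Co f) inferInstance (h1.1.1 h).2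
  linarith [h1.2 h]

theorem C_surj [Module.Finite B H] {f : H →ₗ[B] H'} (hf : Surjective f) (h : L.C H) : L.C H' :=
  ((L.ses (Ke.i f) f ‹_› (Ke.inj f) (Ke.exact f) hf).1.1 h).2

theorem l_surj [Module.Finite B H] {f : H →ₗ[B] H'} (hf : Surjective f) (h : L.C H) :
    L.l H' ≤ L.l H := by
  have h1 := (L.ses (Ke.i f) f ‹_› (Ke.inj f) (Ke.exact f) hf)
  have h2 := L.nonneg (Ke f) (Ke.finite f) (h1.1.1 h).1
  linarith [h1.2 h]

theorem mid [Module.Finite B H'] {f : H →ₗ[B] H'} {g : H' →ₗ[B] H''} (hfg : Exact f g) :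
    (L.C H' ↔ L.C (Rg f) ∧ L.C (Rg g)) ∧ (L.C H' → L.l H' = L.l (Rg f) + L.l (Rg g)) :=
  L.ses (Rg.i f) (Rg.p g) ‹_› (Rg.inj f) (Rg.exact_i hfg) (Rg.surj g)

theorem C_mid [Module.Finite B H] [Module.Finite B H'] [Module.Finite B H''] {f : H →ₗ[B] H'}
    {g : H' →ₗ[B] H''} (hfg : Exact f g) (h1 : L.C H) (h2 : L.C H'') : L.C H' :=
  (L.mid hfg).1.2 ⟨L.C_surj (Rg.surj f) h1, L.C_inj (Rg.inj g) h2⟩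

theorem rg_surj [Module.Finite B H'] {f : H →ₗ[B] H'} (hf : Surjective f) :
    (L.C (Rg f) ↔ L.C H') ∧ (L.C (Rg f) → L.l (Rg f) = L.l H') := by
  have : Module.Finite B (Rg f) := fin_inj (Rg.inj f)
  exact L.bij (Rg.inj f) (fun y => by obtain ⟨x, rfl⟩ := hf y; exact ⟨Rg.p f x, rfl⟩)

theorem rg_inj [Module.Finite B H] {f : H →ₗ[B] H'} (hf : Injective f) :
    (L.C H ↔ L.C (Rg f)) ∧ (L.C H → L.l H = L.l (Rg f)) :=
  L.bij (f := Rg.p f) (fun x y h => hf (by rw [← Rg.ip, h, Rg.ip])) (Rg.surj f)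

theorem endo [Module.Finite B H] (h : L.C H) (x : B) :
    L.l (Ke (mx x H)) = L.l (Co (mx x H)) := by
  have e1 := (L.ses (Ke.i (mx x H)) (Rg.p (mx x H)) ‹_› (Ke.inj _) (by
    intro y
    rw [← (Ke.exact (mx x H) y), ← Rg.ip (mx x H)]
    exact ⟨fun h => by rw [h, map_zero], fun h => Rg.inj _ (by rw [h, map_zero])⟩) (Rg.surj _)).2 h
  have e2 := (L.ses (Rg.i (mx x H)) (Co.p (mx x H)) ‹_› (Rg.inj _) (by
    intro y
    rw [Co.exact (mx x H) y]
    constructor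
    · rintro ⟨z, rfl⟩; exact ⟨Rg.p _ z, rfl⟩
    · rintro ⟨z, rfl⟩; obtain ⟨w, rfl⟩ := Rg.surj _ z; exact ⟨w, rfl⟩) (Co.surj _)).2 h
  linarith

/-- powers -/
theorem C_pow [Module.Finite B H] (x : B) (h : L.C (Co (mx x H))) (n : ℕ) :
    L.C (Co (mx (x ^ n) H)) := by
  induction n with
  | zero =>
    apply L.zero
    constructor
    intro a b
    obtain ⟨a, rfl⟩ := Co.surj _ a
    obtain ⟨b, rfl⟩ := Co.surj _ b
    rw [← sub_eq_zero, ← map_sub]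
    exact (Co.exact _ _).2 ⟨a - b, by rw [mx_apply, pow_zero, one_smul]⟩
  | succ n ih =>
    obtain ⟨f, hf⟩ := Co.lift (mx x H) (Co.p (mx (x ^ (n + 1)) H) ∘ₗ mx (x ^ n) H) (fun y => by
      rw [LinearMap.comp_apply, mx_apply, mx_apply, smul_smul, ← pow_succ]
      exact (Co.exact _ _).2 ⟨y, rfl⟩)
    obtain ⟨g, hg⟩ := Co.lift (mx (x ^ (n + 1)) H) (Co.p (mx (x ^ n) H)) (fun y => by
      exact (Co.exact _ _).2 ⟨x • y, by rw [mx_apply, mx_apply, smul_smul, ← pow_succ]⟩)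
    refine L.C_mid (f := f) (g := g) ?_ h ih
    intro y
    obtain ⟨y, rfl⟩ := Co.surj _ y
    rw [hg]
    constructor
    · intro hy
      obtain ⟨z, rfl⟩ := (Co.exact _ _).1 hy
      exact ⟨Co.p _ z, hf z⟩
    · rintro ⟨z, hz⟩
      obtain ⟨z, rfl⟩ := Co.surj _ z
      rw [hf] at hz
      rw [← hg, ← hz, LinearMap.comp_apply, hg]
      exact (Co.exact _ _).2 ⟨z, rfl⟩

theorem C_sub [Module.Finite B H'] (x : B) {f : H →ₗ[B] H'} (hf : Injective f)
    (h : L.C (Co (mx x H'))) : L.C (Co (mx x H)) := by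
  have : Module.Finite B H := fin_inj hf
  obtain ⟨n, hn⟩ := AR x hf
  have h2 := L.C_pow x h n
  let r := Co.p (mx (x ^ n) H') ∘ₗ f
  have h3 : L.C (Rg r) := L.C_inj (Rg.inj r) h2
  -- `Rg r → Co (mx x H)`
  obtain ⟨g, hg⟩ := Co.lift (Ke.i r) (Co.p (mx x H)) (fun y => by
    have h0 : Co.p (mx (x ^ n) H') (f (Ke.i r y)) = 0 := Ke.apply r y
    obtain ⟨z, hz⟩ := (Co.exact _ _).1 h0
    obtain ⟨k, hk⟩ := hn _ z hz.symm
    exact (Co.exact _ _).2 ⟨k, hk.symm⟩)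
  obtain ⟨g', hg'⟩ := Co.lift (Ke.i r) (Rg.p r) (fun y => Rg.inj r (by
    rw [Rg.ip, Ke.apply, map_zero]))
  have hinj : Injective g' := by
    rw [injective_iff_map_eq_zero]
    intro y hy
    obtain ⟨y, rfl⟩ := Co.surj _ y
    rw [hg'] at hy
    exact (Co.exact _ _).2 ((Ke.exact r y).1 (by rw [← Rg.ip, hy, map_zero]))
  have h4 : L.C (Co (Ke.i r)) := L.C_inj hinj h3
  exact L.C_surj (f := g) (fun y => by
    obtain ⟨y, rfl⟩ := Co.surj _ y; exact ⟨Co.p _ y, hg y⟩) h4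

theorem Co_surj (x : B) {g : H →ₗ[B] H'} (hg : Surjective g) :
    ∃ g' : Co (mx x H) →ₗ[B] Co (mx x H'), Surjective g' := by
  obtain ⟨a, b, d, a', b', -, -, -, -, -, h, -⟩ := six x (Ke.inj g) (Ke.exact g) hg
  exact ⟨b', h⟩

theorem C_of_ann [Module.Finite B H] (x : B) (n : ℕ) (hx : ∀ h : H, x ^ n • h = 0)
    (h : L.C (Co (mx x H))) : L.C H := by
  have := L.C_pow x h n
  refine (L.bij (f := Co.p (mx (x ^ n) H)) ?_ (Co.surj _)).1.2 this
  rw [injective_iff_map_eq_zero]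
  intro y hy
  obtain ⟨z, hz⟩ := (Co.exact _ _).1 hy
  rw [← hz, mx_apply, hx]

theorem C_ker [Module.Finite B H] (x : B) (h : L.C (Co (mx x H))) : L.C (Ke (mx x H)) := by
  have := Ke.finite (mx x H)
  refine L.C_of_ann x 1 (fun y => Ke.inj _ ?_) (L.C_sub x (Ke.inj _) h)
  rw [pow_one, map_smul, ← mx_apply, Ke.apply, map_zero]

/-- next class without positivity: additivity -/
theorem next_ses (x : B) {H₁ H₂ H₃ : Type u} [AddCommGroup H₁] [Module B H₁] [AddCommGroup H₂]
    [Module B H₂] [AddCommGroup H₃] [Module B H₃] (f : H₁ →ₗ[B] H₂) (g : H₂ →ₗ[B] H₃)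
    (hfin : Module.Finite B H₂) (hf : Injective f) (hfg : Exact f g) (hg : Surjective g) :
    (L.C (Co (mx x H₂)) ↔ L.C (Co (mx x H₁)) ∧ L.C (Co (mx x H₃))) ∧
    (L.C (Co (mx x H₂)) → (L.l (Co (mx x H₂)) - L.l (Ke (mx x H₂)) =
      (L.l (Co (mx x H₁)) - L.l (Ke (mx x H₁))) + (L.l (Co (mx x H₃)) - L.l (Ke (mx x H₃))))) := by
  have : Module.Finite B H₁ := fin_inj hf
  have : Module.Finite B H₃ := Module.Finite.of_surjective g hg
  have f1 := Ke.finite (mx x H₁)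
  have f2 := Ke.finite (mx x H₂)
  have f3 := Ke.finite (mx x H₃)
  obtain ⟨a, b, d, a', b', h1, h2, h3, h4, h5, h6, -⟩ := six x hf hfg hg
  refine ⟨⟨fun h => ⟨L.C_sub x hf h, L.C_surj h6 h⟩, fun h => L.C_mid h5 h.1 h.2⟩, fun h => ?_⟩
  have c1 := L.C_sub x hf h
  have c3 := L.C_surj h6 h
  have e1 := (L.rg_inj h1).2 (L.C_ker x c1)
  have e2 := (L.mid h2).2 (L.C_ker x h)
  have e3 := (L.mid h3).2 (L.C_ker x c3)
  have e4 := (L.mid h4).2 c1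
  have e5 := (L.mid h5).2 h
  have e6 := (L.rg_surj h6).2 ((L.rg_surj h6).1.2 c3)
  linarith

/-- submodule of elements killed by a power of `x` -/
theorem exists_tors [Module.Finite B H] (x : B) : ∃ (n : ℕ), ∀ k (h : H), x ^ k • h = 0 → x ^ n • h = 0 := by
  let s : ℕ →o Submodule B H := ⟨fun n => LinearMap.ker (mx (x ^ n) H), by
    intro a b hab y hy
    rw [LinearMap.mem_ker, mx_apply] at hy ⊢
    obtain ⟨c, rfl⟩ := Nat.exists_eq_add_of_le hab
    rw [add_comm, pow_add, mul_smul, hy, smul_zero]⟩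
  obtain ⟨n, hn⟩ := monotone_stabilizes_iff_noetherian.2 (inferInstance : IsNoetherian B H) s
  refine ⟨n, fun k h hk => ?_⟩
  rcases le_total n k with h1 | h1
  · have : h ∈ s k := hk
    rw [← hn k h1] at this
    exact this
  · exact s.2 h1 hk

theorem next_nonneg [Module.Finite B H] (x : B) (h : L.C (Co (mx x H))) :
    0 ≤ L.l (Co (mx x H)) - L.l (Ke (mx x H)) := by
  obtain ⟨n, hn⟩ := exists_tors (H := H) x
  let G := Ke (mx (x ^ n) H)
  have hG : Module.Finite B G := Ke.finite _
  let D := Co (Ke.i (mx (x ^ n) H))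
  have e := L.next_ses x (Ke.i (mx (x ^ n) H)) (Co.p (Ke.i (mx (x ^ n) H))) ‹_› (Ke.inj _)
    (Co.exact _) (Co.surj _)
  have c := e.1.1 h
  have cG : L.C G := L.C_of_ann x n (fun y => Ke.inj _ (by
    rw [map_smul, ← mx_apply, Ke.apply, map_zero])) c.1
  have e2 := L.endo cG x
  have e3 : L.l (Ke (mx x D)) = 0 := by
    apply L.l_zero
    have : ∀ y : Ke (mx x D), y = 0 := by
      intro y
      apply Ke.inj
      rw [map_zero]
      have hy := Ke.apply (mx x D) y
      generalize Ke.i (mx x D) y = z at hy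
      obtain ⟨z, rfl⟩ := Co.surj _ z
      rw [mx_apply, ← map_smul] at hy
      obtain ⟨w, hw⟩ := (Co.exact _ _).1 hy
      apply (Co.exact _ _).2
      apply (Ke.exact _ _).1
      rw [mx_apply]
      apply hn (n + 1)
      rw [pow_succ, mul_smul, ← hw, ← mx_apply, Ke.apply]
    exact ⟨fun a b => by rw [this a, this b]⟩
  have e4 := L.nonneg (Co (mx x D)) inferInstance c.2
  have e5 := e.2 h
  change L.l (Ke (mx x G)) = L.l (Co (mx x G)) at e2
  change L.l _ - _ = (L.l (Co (mx x G)) - L.l (Ke (mx x G))) +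
    (L.l (Co (mx x D)) - L.l (Ke (mx x D))) at e5
  linarith

/-- the next length-like function -/
def next (x : B) : LF B where
  C H _ _ := L.C (Co (mx x H))
  l H _ _ := L.l (Co (mx x H)) - L.l (Ke (mx x H))
  ses f g h1 h2 h3 h4 := L.next_ses x f g h1 h2 h3 h4
  nonneg H _ _ _ h := L.next_nonneg x h
  zero H _ _ h := by
    apply L.zero
    have := Co.surj (mx x H)
    exact this.subsingleton

end LF
end

end HW

end

section

namespace HW

open TensorProduct Function

section

variable {B : Type u} [CommRing B]
  {H H' : Type u} [AddCommGroup H] [Module B H] [AddCommGroup H'] [Module B H']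

theorem Co_congr (x : B) (e : H ≃ₗ[B] H') : Nonempty (Co (mx x H) ≃ₗ[B] Co (mx x H')) := by
  obtain ⟨f, hf⟩ := Co.lift (mx x H) (Co.p (mx x H') ∘ₗ e.toLinearMap) (fun y => by
    rw [LinearMap.comp_apply, mx_apply]
    exact (Co.exact _ _).2 ⟨e y, by simp⟩)
  refine ⟨LinearEquiv.ofBijective f ⟨?_, ?_⟩⟩
  · rw [injective_iff_map_eq_zero]
    intro y hy
    obtain ⟨y, rfl⟩ := Co.surj _ y
    rw [hf] at hy
    obtain ⟨z, hz⟩ := (Co.exact _ _).1 hy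
    exact (Co.exact _ _).2 ⟨e.symm z, by
      apply e.injective; simpa using hz⟩
  · intro y
    obtain ⟨y, rfl⟩ := Co.surj _ y
    exact ⟨Co.p _ (e.symm y), by rw [hf]; simp⟩

theorem Ke_congr (x : B) (e : H ≃ₗ[B] H') : Nonempty (Ke (mx x H) ≃ₗ[B] Ke (mx x H')) := by
  obtain ⟨f, hf⟩ := Ke.lift (mx x H') (e.toLinearMap ∘ₗ Ke.i (mx x H)) (fun y => by
    have := Ke.apply (mx x H) y
    rw [mx_apply] at this
    rw [LinearMap.comp_apply, mx_apply, ← map_smul, this, map_zero])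
  refine ⟨LinearEquiv.ofBijective f ⟨?_, ?_⟩⟩
  · intro y z h
    apply Ke.inj
    apply e.injective
    have := congrArg (Ke.i (mx x H')) h
    rwa [hf, hf] at this
  · intro y
    obtain ⟨z, hz⟩ := Ke.ex (mx x H) (e.symm (Ke.i _ y)) (by
      have := Ke.apply (mx x H') y
      rw [mx_apply] at this
      rw [mx_apply, ← map_smul, this, map_zero])
    exact ⟨z, Ke.inj _ (by rw [hf, LinearMap.comp_apply, hz]; simp)⟩

theorem Ke_sub {f : H →ₗ[B] H'} : Subsingleton (Ke f) ↔ Injective f := by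
  constructor
  · intro h
    rw [injective_iff_map_eq_zero]
    intro y hy
    obtain ⟨z, rfl⟩ := Ke.ex f y hy
    rw [Subsingleton.elim z 0, map_zero]
  · intro h
    exact ⟨fun a b => Ke.inj _ (h (by rw [Ke.apply, Ke.apply]))⟩

theorem Co_sub {f : H →ₗ[B] H'} : Subsingleton (Co f) ↔ Surjective f := by
  constructor
  · intro h y
    exact (Co.exact f y).1 (Subsingleton.elim _ _)
  · intro h
    have : ∀ y : Co f, y = 0 := by
      intro y
      obtain ⟨y, rfl⟩ := Co.surj f y
      exact (Co.exact f y).2 (h y)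
    exact ⟨fun a b => by rw [this a, this b]⟩

theorem naka [IsLocalRing B] [Module.Finite B H] {x : B} (hx : x ∈ IsLocalRing.maximalIdeal B)
    (h : Subsingleton (Co (mx x H))) : Subsingleton H := by
  have hs := Co_sub.1 h
  have : (⊤ : Submodule B H) = ⊥ := by
    apply Submodule.eq_bot_of_le_smul_of_le_jacobson_bot (Ideal.span {x}) ⊤ Module.Finite.fg_top
    · intro y _
      obtain ⟨z, rfl⟩ := hs y
      exact Submodule.smul_mem_smul (Ideal.mem_span_singleton_self x) trivial
    · rw [Ideal.span_singleton_le_iff_mem, IsLocalRing.jacobson_eq_maximalIdeal _ bot_ne_top]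
      exact hx
  exact (Submodule.subsingleton_iff B).1 (subsingleton_of_bot_eq_top this.symm)

/-- weakly regular -/
def RegF : List B → ∀ (D : Type u) [AddCommGroup D] [Module B D], Prop
  | [], _, _, _ => True
  | x :: xs, D, _, _ => Injective (mx x D) ∧ RegF xs (Co (mx x D))

theorem RegF.congr (xs : List B) (e : H ≃ₗ[B] H') (h : RegF xs H) : RegF xs H' := by
  induction xs generalizing H H' with
  | nil => trivial
  | cons x xs ih =>
    obtain ⟨e'⟩ := Co_congr x e
    obtain ⟨e2⟩ := Ke_congr x e
    refine ⟨?_, ih e' h.2⟩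
    rw [← Ke_sub] at *
    have := Ke_sub.2 h.1
    exact e2.symm.toEquiv.subsingleton

/-- iterated quotient -/
def Wq : List B → ModuleCat.{u} B → ModuleCat.{u} B
  | [], W => W
  | x :: xs, W => Wq xs (ModuleCat.of B (Co (mx x W)))

theorem Wq_fin (xs : List B) (W : ModuleCat.{u} B) (h : Module.Finite B W) :
    Module.Finite B (Wq xs W) := by
  induction xs generalizing W with
  | nil => exact h
  | cons x xs ih => exact ih _ (inferInstanceAs (Module.Finite B (Co (mx x W))))

variable [IsNoetherianRing B] (L : LF B)

/-- iterated length functions -/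
def lst : List B → LF B
  | [] => L
  | x :: xs => (lst xs).next x

/-- vanishing of correction terms -/
def ZF : List B → ∀ (D : Type u) [AddCommGroup D] [Module B D], Prop
  | [], _, _, _ => True
  | x :: xs, D, _, _ =>
    ((lst L xs).C (Ke (mx x D)) ∧ (lst L xs).l (Ke (mx x D)) = 0) ∧ ZF xs (Co (mx x D))

theorem ZF.congr (xs : List B) [Module.Finite B H] (e : H ≃ₗ[B] H') (h : ZF L xs H) :
    ZF L xs H' := by
  induction xs generalizing H H' with
  | nil => trivial
  | cons x xs ih =>
    obtain ⟨e'⟩ := Co_congr x e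
    obtain ⟨e2⟩ := Ke_congr x e
    have := Ke.finite (mx x H)
    refine ⟨?_, ih e' h.2⟩
    have hb := (lst L xs).bij (f := e2.toLinearMap) e2.injective e2.surjective
    exact ⟨hb.1.1 h.1.1, by rw [← hb.2 h.1.1, h.1.2]⟩

/-- strictness -/
def LF.Strict : Prop := ∀ (H : Type u) [AddCommGroup H] [Module B H], Module.Finite B H →
  L.C H → L.l H = 0 → Subsingleton H

variable {L} [IsLocalRing B] (hL : L.Strict)
include hL

theorem van (xs : List B) (hxs : ∀ x ∈ xs, x ∈ IsLocalRing.maximalIdeal B) [Module.Finite B H']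
    (hreg : RegF xs H') {j : H →ₗ[B] H'} (hj : Injective j) (hC : (lst L xs).C H)
    (hl : (lst L xs).l H = 0) : Subsingleton H := by
  induction xs generalizing H H' with
  | nil => exact hL H (fin_inj hj) hC hl
  | cons y ys ih =>
    have hfin : Module.Finite B H := fin_inj hj
    obtain ⟨n, hn⟩ := LF.exists_tors (H := Co j) y
    let r : H' →ₗ[B] Co j := (mx (y ^ n) (Co j)) ∘ₗ Co.p j
    have hr : ∀ z : Ke r, ∃ h : H, j h = y ^ n • Ke.i r z := by
      intro z
      have := Ke.apply r z
      rw [LinearMap.comp_apply, mx_apply, ← map_smul] at this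
      exact (Co.exact j _).1 this
    have hfinr := Ke.finite r
    -- map Ke r → H by division
    have hyinj : ∀ n, ∀ d : H', y ^ n • d = 0 → d = 0 := by
      intro n
      induction n with
      | zero => intro d hd; simpa using hd
      | succ n ihn =>
        intro d hd
        apply ihn
        rw [pow_succ', mul_smul] at hd
        apply hreg.1
        rw [mx_apply, hd, map_zero]
    obtain ⟨k, hk⟩ := Ke.lift (Co.p j) (mx (y ^ n) H' ∘ₗ Ke.i r) (fun z => by
      obtain ⟨h, hh⟩ := hr z
      exact (Co.exact j _).2 ⟨h, hh⟩)
    have hkinj : Injective k := by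
      rw [injective_iff_map_eq_zero]
      intro z hz
      apply Ke.inj r
      rw [map_zero]
      apply hyinj n
      have := hk z
      rw [hz, map_zero] at this
      exact this.symm
    obtain ⟨j', hj'⟩ := Ke.lift (Co.p j) j (fun h => (Co.exact j _).2 ⟨h, rfl⟩)
    have hj'i : Injective j' := fun a b hab => hj (by rw [← hj', hab, hj'])
    have hj's : Surjective j' := fun z => by
      obtain ⟨h, hh⟩ := (Co.exact j _).1 (Ke.apply (Co.p j) z)
      exact ⟨h, Ke.inj _ (by rw [hj', hh])⟩
    have hb := (lst L (y :: ys)).bij hj'i hj's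
    have fK := Ke.finite (Co.p j)
    have c1 : (lst L (y :: ys)).C (Ke r) := LF.C_inj _ hkinj (hb.1.1 hC)
    have l1 : (lst L (y :: ys)).l (Ke r) ≤ 0 := by
      have := (lst L (y :: ys)).l_inj hkinj (hb.1.1 hC)
      rw [← hb.2 hC, hl] at this
      exact this
    have hKinj : Injective (mx y (Ke r)) := by
      rw [injective_iff_map_eq_zero]
      intro z hz
      apply Ke.inj r
      rw [map_zero]
      apply hyinj 1
      rw [pow_one, ← map_smul, ← mx_apply, hz, map_zero]
    have l2 : (lst L ys).l (Co (mx y (Ke r))) - (lst L ys).l (Ke (mx y (Ke r))) ≤ 0 := l1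
    rw [(lst L ys).l_zero (Ke_sub.2 hKinj), sub_zero] at l2
    have l3 : (lst L ys).l (Co (mx y (Ke r))) = 0 :=
      le_antisymm l2 ((lst L ys).nonneg _ inferInstance c1)
    obtain ⟨q, hq⟩ := Co.lift (mx y (Ke r)) (Co.p (mx y H') ∘ₗ Ke.i r) (fun z => by
      rw [LinearMap.comp_apply, mx_apply, map_smul]
      exact (Co.exact _ _).2 ⟨_, rfl⟩)
    have hqi : Injective q := by
      rw [injective_iff_map_eq_zero]
      intro z hz
      obtain ⟨z, rfl⟩ := Co.surj _ z
      rw [hq] at hz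
      obtain ⟨w, hw⟩ := (Co.exact _ _).1 hz
      obtain ⟨v, hv⟩ := Ke.ex r w (by
        rw [LinearMap.comp_apply, mx_apply]
        apply hn (n + 1)
        have h3 := Ke.apply r z
        rw [LinearMap.comp_apply, ← hw, mx_apply, mx_apply, map_smul, smul_smul, ← pow_succ] at h3
        exact h3)
      exact (Co.exact _ _).2 ⟨v, Ke.inj r (by rw [mx_apply, map_smul, hv, ← hw, mx_apply])⟩
    have hsub := ih (fun x hx => hxs x (List.mem_cons_of_mem _ hx)) hreg.2 hqi c1 l3
    have hsub2 := naka (hxs y List.mem_cons_self) hsub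
    obtain ⟨j2, hj2⟩ := Ke.lift r j (fun h => by
      rw [LinearMap.comp_apply, (Co.exact j _).2 ⟨h, rfl⟩, map_zero])
    have : Injective j2 := fun a b hab => hj (by rw [← hj2, hab, hj2])
    exact this.subsingleton

theorem reg_of_ZF (xs : List B) (hxs : ∀ x ∈ xs, x ∈ IsLocalRing.maximalIdeal B)
    [Module.Finite B H] (h : ZF L xs H) : RegF xs H := by
  induction xs generalizing H with
  | nil => trivial
  | cons x xs ih =>
    have hr := ih (fun x hx => hxs x (List.mem_cons_of_mem _ hx)) h.2
    refine ⟨?_, hr⟩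
    have hc : ∀ n, (lst L xs).C (Ke (mx (x ^ n) H)) ∧ (lst L xs).l (Ke (mx (x ^ n) H)) = 0 := by
      intro n
      have f1 := Ke.finite (mx x H)
      have f2 := Ke.finite (mx (x ^ n) H)
      induction n with
      | zero =>
        have : Subsingleton (Ke (mx (x ^ 0) H)) := Ke_sub.2 (fun a b hab => by
          simpa [mx_apply] using hab)
        exact ⟨LF.zero _ _ this, LF.l_zero _ this⟩
      | succ n ihn =>
        have f3 := Ke.finite (mx (x ^ n) H)
        have ihn := ihn f3
        obtain ⟨a, ha⟩ := Ke.lift (mx (x ^ (n + 1)) H) (Ke.i (mx (x ^ n) H)) (fun y => by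
          have := Ke.apply _ y
          rw [mx_apply] at this ⊢
          rw [pow_succ', mul_smul, this, smul_zero])
        obtain ⟨b, hb⟩ := Ke.lift (mx x H) (mx (x ^ n) H ∘ₗ Ke.i (mx (x ^ (n + 1)) H)) (fun y => by
          have := Ke.apply _ y
          rw [mx_apply] at this
          rw [LinearMap.comp_apply, mx_apply, mx_apply, smul_smul, ← pow_succ', this])
        have hab : Exact a b := by
          intro y
          constructor
          · intro hy
            obtain ⟨z, hz⟩ := Ke.ex (mx (x ^ n) H) (Ke.i _ y) (by
              rw [← LinearMap.comp_apply, ← hb, hy, map_zero])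
            exact ⟨z, Ke.inj _ (by rw [ha, hz])⟩
          · rintro ⟨z, rfl⟩
            apply Ke.inj
            rw [hb, LinearMap.comp_apply, ha, Ke.apply, map_zero]
        have hC := (lst L xs).C_mid hab ihn.1 h.1.1
        refine ⟨hC, ?_⟩
        have e := ((lst L xs).mid hab).2 hC
        have e1 := (lst L xs).l_surj (Rg.surj a) ihn.1
        have e2 := (lst L xs).l_inj (Rg.inj b) h.1.1
        have e3 := (lst L xs).nonneg _ f2 hC
        rw [h.1.2] at e2
        rw [ihn.2] at e1
        linarith
    obtain ⟨n, hn⟩ := LF.exists_tors (H := H) x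
    have fG := Ke.finite (mx (x ^ n) H)
    have hc := hc n
    obtain ⟨q, hq⟩ := Co.lift (mx x (Ke (mx (x ^ n) H))) (Co.p (mx x H) ∘ₗ Ke.i (mx (x ^ n) H))
      (fun z => by
        rw [LinearMap.comp_apply, mx_apply, map_smul]
        exact (Co.exact _ _).2 ⟨_, rfl⟩)
    have hqi : Injective q := by
      rw [injective_iff_map_eq_zero]
      intro z hz
      obtain ⟨z, rfl⟩ := Co.surj _ z
      rw [hq] at hz
      obtain ⟨w, hw⟩ := (Co.exact _ _).1 hz
      obtain ⟨v, hv⟩ := Ke.ex (mx (x ^ n) H) w (by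
        rw [mx_apply]
        apply hn (n + 1)
        have h3 := Ke.apply _ z
        rw [← hw, mx_apply, mx_apply, smul_smul, ← pow_succ] at h3
        exact h3)
      exact (Co.exact _ _).2 ⟨v, Ke.inj _ (by rw [mx_apply, map_smul, hv, ← hw, mx_apply])⟩
    have c1 := (lst L xs).C_surj (Co.surj (mx x (Ke (mx (x ^ n) H)))) hc.1
    have l1 : (lst L xs).l (Co (mx x (Ke (mx (x ^ n) H)))) = 0 := by
      have e1 := (lst L xs).l_surj (Co.surj (mx x (Ke (mx (x ^ n) H)))) hc.1
      rw [hc.2] at e1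
      exact le_antisymm e1 ((lst L xs).nonneg _ inferInstance c1)
    have hs := van hL xs (fun x hx => hxs x (List.mem_cons_of_mem _ hx)) hr hqi c1 l1
    have hs2 := naka (hxs x List.mem_cons_self) hs
    rw [injective_iff_map_eq_zero]
    intro y hy
    obtain ⟨z, rfl⟩ := Ke.ex (mx (x ^ n) H) y (hn 1 y (by rw [pow_one]; exact hy))
    rw [Subsingleton.elim z 0, map_zero]

end

end HW

end

section

namespace HW

open TensorProduct Function

section

variable {B : Type u} [CommRing B]
  {H H' H₁ H₂ H₃ H₄ : Type u} [AddCommGroup H] [Module B H] [AddCommGroup H'] [Module B H']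
  [AddCommGroup H₁] [Module B H₁] [AddCommGroup H₂] [Module B H₂] [AddCommGroup H₃] [Module B H₃]
  [AddCommGroup H₄] [Module B H₄]

/-- splitting a five-term exact sequence -/
theorem five_split {f : H →ₗ[B] H₁} {g : H₁ →ₗ[B] H₂} {h : H₂ →ₗ[B] H₃} {k : H₃ →ₗ[B] H₄}
    (e1 : Exact f g) (e2 : Exact g h) (e3 : Exact h k) :
    ∃ (a : Co f →ₗ[B] H₂) (b : H₂ →ₗ[B] Ke k), Injective a ∧ Exact a b ∧ Surjective b := by
  obtain ⟨a, ha⟩ := Co.lift f g (fun x => (e1 _).2 ⟨x, rfl⟩)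
  obtain ⟨b, hb⟩ := Ke.lift k h (fun x => (e3 _).2 ⟨x, rfl⟩)
  refine ⟨a, b, ?_, ?_, ?_⟩
  · rw [injective_iff_map_eq_zero]
    intro y hy
    obtain ⟨y, rfl⟩ := Co.surj _ y
    rw [ha] at hy
    exact (Co.exact _ _).2 ((e1 _).1 hy)
  · intro y
    constructor
    · intro hy
      obtain ⟨z, rfl⟩ := (e2 y).1 (by rw [← hb, hy, map_zero])
      exact ⟨Co.p _ z, ha z⟩
    · rintro ⟨z, rfl⟩
      obtain ⟨z, rfl⟩ := Co.surj _ z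
      apply Ke.inj
      rw [hb, ha, map_zero]
      exact (e2 _).2 ⟨z, rfl⟩
  · intro y
    obtain ⟨z, hz⟩ := (e3 _).1 (Ke.apply k y)
    exact ⟨z, Ke.inj _ (by rw [hb, hz])⟩

theorem co_equiv {f : H →ₗ[B] H₁} {g : H₁ →ₗ[B] H₂} (e1 : Exact f g) (hg : Surjective g) :
    Nonempty (Co f ≃ₗ[B] H₂) := by
  obtain ⟨a, ha⟩ := Co.lift f g (fun x => (e1 _).2 ⟨x, rfl⟩)
  refine ⟨LinearEquiv.ofBijective a ⟨?_, ?_⟩⟩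
  · rw [injective_iff_map_eq_zero]
    intro y hy
    obtain ⟨y, rfl⟩ := Co.surj _ y
    rw [ha] at hy
    exact (Co.exact _ _).2 ((e1 _).1 hy)
  · intro y
    obtain ⟨z, rfl⟩ := hg y
    exact ⟨Co.p _ z, ha z⟩

theorem Tmap_mx (W U : Type u) [AddCommGroup W] [Module B W] [AddCommGroup U] [Module B U]
    (i : ℕ) (x : B) : Tmap B U i (mx x W) = mx x (T B W U i) := by
  have : mx x W = x • (LinearMap.id : W →ₗ[B] W) := by
    apply LinearMap.ext; intro y; rfl
  rw [this, Tmap_smul, Tmap_id]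
  apply LinearMap.ext; intro y; rfl

theorem tstep (W U : Type u) [AddCommGroup W] [Module B W] [AddCommGroup U] [Module B U]
    (x : B) (hx : Injective (mx x W)) (i : ℕ) :
    ∃ (a : Co (mx x (T B W U (i+1))) →ₗ[B] T B (Co (mx x W)) U (i+1))
      (b : T B (Co (mx x W)) U (i+1) →ₗ[B] Ke (mx x (T B W U i))),
      Injective a ∧ Exact a b ∧ Surjective b := by
  have e1 := les_mid B U (i+1) hx (Co.exact (mx x W)) (Co.surj _)
  obtain ⟨δ, e2, e3⟩ := les B U i hx (Co.exact (mx x W)) (Co.surj _)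
  rw [Tmap_mx] at e1 e3
  exact five_split e1 e2 e3

theorem tstep0 (W U : Type u) [AddCommGroup W] [Module B W] [AddCommGroup U] [Module B U]
    (x : B) (hx : Injective (mx x W)) :
    Nonempty (Co (mx x (T B W U 0)) ≃ₗ[B] T B (Co (mx x W)) U 0) := by
  have e1 := les_mid B U 0 hx (Co.exact (mx x W)) (Co.surj _)
  rw [Tmap_mx] at e1
  exact co_equiv e1 (Tmap0_surj B U (Co.surj _))

variable [IsNoetherianRing B] (L : LF B)

/-- partial Euler characteristic -/
def chi1 (U : Type u) [AddCommGroup U] [Module B U] (d : ℕ) (L : LF B)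
    (W : Type u) [AddCommGroup W] [Module B W] : ℤ :=
  ∑ i ∈ Finset.range d, (-1) ^ i * L.l (T B W U (i + 1))

theorem tele (c k : ℕ → ℤ) (d : ℕ) (hk : k d = 0) :
    ∑ i ∈ Finset.range d, (-1) ^ i * (c i + k i) =
      ∑ i ∈ Finset.range d, (-1) ^ i * (c i - k (i + 1)) + k 0 := by
  have : ∀ d, ∑ i ∈ Finset.range d, (-1 : ℤ) ^ i * (c i + k i) =
      ∑ i ∈ Finset.range d, (-1) ^ i * (c i - k (i + 1)) + k 0 - (-1) ^ d * k d := by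
    intro d
    induction d with
    | zero => simp
    | succ d ih =>
      rw [Finset.sum_range_succ, Finset.sum_range_succ, ih, pow_succ]
      ring
  rw [this, hk]; ring

theorem chi_step (U : Type u) [AddCommGroup U] [Module B U] [Module.Finite B U] (d : ℕ)
    (W : Type u) [AddCommGroup W] [Module B W] [Module.Finite B W]
    (hd : Subsingleton (T B W U d)) (x : B) (hx : Injective (mx x W))
    (hC : ∀ i, L.C (T B (Co (mx x W)) U (i + 1))) :
    (∀ i, (L.next x).C (T B W U (i + 1))) ∧ L.C (Ke (mx x (T B W U 0))) ∧
    chi1 U d L (Co (mx x W)) = chi1 U d (L.next x) W + L.l (Ke (mx x (T B W U 0))) := by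
  have key : ∀ i, (L.C (Co (mx x (T B W U (i+1)))) ∧ L.C (Ke (mx x (T B W U i)))) ∧
      L.l (T B (Co (mx x W)) U (i + 1)) =
        L.l (Co (mx x (T B W U (i+1)))) + L.l (Ke (mx x (T B W U i))) := by
    intro i
    obtain ⟨a, b, h1, h2, h3⟩ := tstep W U x hx i
    have := Tfinite (S := B) (Co (mx x W)) (i+1) U
    have hs := L.ses a b this h1 h2 h3
    exact ⟨hs.1.1 (hC i), hs.2 (hC i)⟩
  refine ⟨fun i => (key i).1.1, (key 0).1.2, ?_⟩
  have := tele (fun i => L.l (Co (mx x (T B W U (i+1))))) (fun i => L.l (Ke (mx x (T B W U i)))) d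
    (L.l_zero (Ke_sub.2 (fun a b _ => Subsingleton.elim a b)))
  unfold chi1
  rw [Finset.sum_congr rfl (fun i _ => by rw [(key i).2])]
  exact this

theorem claimA (U : Type u) [AddCommGroup U] [Module B U] [Module.Finite B U] (d : ℕ)
    (hd : ∀ (W : Type u) [AddCommGroup W] [Module B W], Subsingleton (T B W U d))
    (xs : List B) : ∀ (W : ModuleCat.{u} B), Module.Finite B W → RegF xs W →
    (∀ i, L.C (T B (Wq xs W) U (i + 1))) →
    (∀ i, (lst L xs).C (T B W U (i + 1))) ∧
    ∃ s : ℤ, chi1 U d L (Wq xs W) = chi1 U d (lst L xs) W + s ∧ 0 ≤ s ∧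
      (s = 0 → ZF L xs (T B W U 0)) := by
  induction xs with
  | nil => exact fun W _ _ h => ⟨h, 0, by rw [add_zero]; rfl, le_rfl, fun _ => trivial⟩
  | cons x xs ih =>
    intro W hW hreg hC
    obtain ⟨h1, s, h2, h3, h4⟩ := ih (ModuleCat.of B (Co (mx x W)))
      (inferInstanceAs (Module.Finite B (Co (mx x W)))) hreg.2 hC
    obtain ⟨g1, g2, g3⟩ := chi_step (lst L xs) U d W (hd W) x hreg.1 h1
    have := Tfinite (S := B) W 0 U
    have hn := (lst L xs).nonneg _ (Ke.finite (mx x (T B W U 0))) g2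
    refine ⟨g1, s + (lst L xs).l (Ke (mx x (T B W U 0))), ?_, by linarith, ?_⟩
    · rw [show chi1 U d L (Wq (x :: xs) W) = chi1 U d L (Wq xs (ModuleCat.of B (Co (mx x W)))) from rfl,
        h2]
      rw [show chi1 U d (lst L (x :: xs)) W = chi1 U d ((lst L xs).next x) W from rfl]
      rw [show chi1 U d (lst L xs) (ModuleCat.of B (Co (mx x W))) = chi1 U d (lst L xs) (Co (mx x W)) from rfl, g3]
      ring
    · intro hs
      refine ⟨⟨g2, by linarith⟩, ?_⟩
      obtain ⟨e⟩ := tstep0 W U x hreg.1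
      have := Tfinite (S := B) (Co (mx x W)) 0 U
      exact ZF.congr L xs e.symm (h4 (by linarith))

theorem claimV (U : Type u) [AddCommGroup U] [Module B U] [Module.Finite B U]
    (xs : List B) : ∀ (W : ModuleCat.{u} B), Module.Finite B W → RegF xs W →
    RegF xs (T B W U 0) → (∀ i, Subsingleton (T B W U (i+1))) →
    ∀ i, Subsingleton (T B (Wq xs W) U (i+1)) := by
  induction xs with
  | nil => exact fun W _ _ _ h => h
  | cons x xs ih =>
    intro W hW hreg hregT hC
    apply ih (ModuleCat.of B (Co (mx x W)))
      (inferInstanceAs (Module.Finite B (Co (mx x W)))) hreg.2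
    · obtain ⟨e⟩ := tstep0 W U x hreg.1
      exact RegF.congr xs e hregT.2
    · intro i
      obtain ⟨a, b, h1, h2, h3⟩ := tstep W U x hreg.1 i
      have s1 : Subsingleton (Co (mx x (T B W U (i+1)))) :=
        (Co.surj _).subsingleton
      have s2 : Subsingleton (Ke (mx x (T B W U i))) := by
        match i with
        | 0 => exact Ke_sub.2 hregT.1
        | i + 1 => exact (Ke.inj _).subsingleton
      refine ⟨fun y z => ?_⟩
      have : ∀ y : T B (Co (mx x W)) U (i+1), y = 0 := fun y => by
        obtain ⟨w, rfl⟩ := (h2 y).1 (Subsingleton.elim _ _)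
        rw [Subsingleton.elim w 0, map_zero]
      exact (this y).trans (this z).symm

variable {L}
theorem PosL [IsLocalRing B] (hL : L.Strict)
    (U : Type u) [AddCommGroup U] [Module B U] [Module.Finite B U] (d : ℕ)
    (hd : ∀ (W : Type u) [AddCommGroup W] [Module B W], Subsingleton (T B W U d))
    (xs : List B) (hxs : ∀ x ∈ xs, x ∈ IsLocalRing.maximalIdeal B)
    (W : ModuleCat.{u} B) (hW : Module.Finite B W) (hreg : RegF xs W)
    (h0 : ∀ i, Subsingleton (T B W U (i+1)))
    (hC : ∀ i, L.C (T B (Wq xs W) U (i + 1)))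
    (hchi : chi1 U d L (Wq xs W) ≤ 0) : ∀ i, Subsingleton (T B (Wq xs W) U (i+1)) := by
  obtain ⟨h1, s, h2, h3, h4⟩ := claimA L U d hd xs W hW hreg hC
  have : chi1 U d (lst L xs) W = 0 := by
    unfold chi1
    apply Finset.sum_eq_zero
    intro i _
    rw [(lst L xs).l_zero (h0 i), mul_zero]
  have := Tfinite (S := B) W 0 U
  exact claimV U xs W hW hreg (reg_of_ZF hL xs hxs (h4 (by linarith))) h0

end

end HW

end

section

namespace HW

open TensorProduct Function

section Len

variable (B : Type u) [CommRing B]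

/-- finite length as a length function -/
def LFlen : LF B where
  C H _ _ := Module.length B H ≠ ⊤
  l H _ _ := ((Module.length B H).toNat : ℤ)
  ses := by
    intro H₁ H₂ H₃ _ _ _ _ _ _ f g hfin hf hfg hg
    have h := Module.length_eq_add_of_exact f g hf hg hfg
    rw [h]
    constructor
    · simp [not_or]
    · intro hne
      have : Module.length B H₁ ≠ ⊤ ∧ Module.length B H₃ ≠ ⊤ := by simpa [not_or] using hne
      rw [ENat.toNat_add this.1 this.2]
      push_cast; rfl
  nonneg H _ _ _ _ := by positivity
  zero H _ _ h := by rw [Module.length_eq_zero]; simp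

theorem LFlen_strict : (LFlen B).Strict := by
  intro H _ _ _ hC hl
  have hl : ((Module.length B H).toNat : ℤ) = 0 := hl
  have : (Module.length B H).toNat = 0 := by exact_mod_cast hl
  rw [ENat.toNat_eq_zero] at this
  exact Module.length_eq_zero_iff.1 (this.resolve_right hC)

end Len

section bc

variable {S : Type u} [CommRing S] {S' : Type u} [CommRing S'] [Algebra S S']

/-- base change of a length function along a flat map -/
def LF.bc [Module.Flat S S'] (L : LF S') : LF S where
  C H _ _ := L.C (S' ⊗[S] H)
  l H _ _ := L.l (S' ⊗[S] H)
  ses := by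
    intro H₁ H₂ H₃ _ _ _ _ _ _ f g hfin hf hfg hg
    exact L.ses (f.baseChange S') (g.baseChange S') inferInstance (baseChange_inj_flat S' hf)
      (baseChange_exact_flat S' hfg) (baseChange_surj S' hg)
  nonneg H _ _ _ h := L.nonneg _ inferInstance h
  zero H _ _ h := by
    apply L.zero
    infer_instance

/-- restriction of scalars -/
def RS (S S' : Type u) [CommRing S] [CommRing S'] [Algebra S S'] (H : Type u) [AddCommGroup H]
    [Module S' H] : Type u := H
section RS
variable (H : Type u) [AddCommGroup H] [Module S' H]
instance : AddCommGroup (RS S S' H) := inferInstanceAs (AddCommGroup H)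
instance RS.mod' : Module S' (RS S S' H) := inferInstanceAs (Module S' H)
instance RS.mod : Module S (RS S S' H) := Module.compHom H (algebraMap S S')
instance : IsScalarTower S S' (RS S S' H) := IsScalarTower.of_algebraMap_smul (fun _ _ => rfl)
end RS

/-- restriction of a length function along a surjection -/
def LF.res (hs : Surjective (algebraMap S S')) (L : LF S) : LF S' where
  C H _ _ := L.C (RS S S' H)
  l H _ _ := L.l (RS S S' H)
  ses := by
    intro H₁ H₂ H₃ _ _ _ _ _ _ f g hfin hf hfg hg
    have : Module.Finite S S' := Module.Finite.of_surjective (Algebra.linearMap S S') hs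
    have h2 : Module.Finite S' (RS S S' H₂) := hfin
    have h3 : Module.Finite S (RS S S' H₂) := Module.Finite.trans S' _
    exact L.ses (H₁ := RS S S' H₁) (H₂ := RS S S' H₂)
      (H₃ := RS S S' H₃)
      ⟨⟨f, fun x y => map_add f x y⟩, fun s x => map_smul f (algebraMap S S' s) x⟩
      ⟨⟨g, fun x y => map_add g x y⟩, fun s x => map_smul g (algebraMap S S' s) x⟩ h3 hf hfg hg
  nonneg H _ _ hfin h := by
    have : Module.Finite S S' := Module.Finite.of_surjective (Algebra.linearMap S S') hs
    have h2 : Module.Finite S' (RS S S' H) := hfin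
    have h3 : Module.Finite S (RS S S' H) := Module.Finite.trans S' _
    exact L.nonneg _ h3 h
  zero H _ _ h := L.zero _ h

theorem LF.res_iff [IsNoetherianRing S] (hs : Surjective (algebraMap S S')) (L : LF S) {A B : Type u}
    [AddCommGroup A]
    [Module S' A] [AddCommGroup B] [Module S B] [Module.Finite S' A] (h : SEquiv S S' A B) :
    ((L.res hs).C A ↔ L.C B) ∧ ((L.res hs).C A → (L.res hs).l A = L.l B) := by
  obtain ⟨e, he⟩ := h
  have : Module.Finite S S' := Module.Finite.of_surjective (Algebra.linearMap S S') hs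
  have h2 : Module.Finite S' (RS S S' A) := ‹Module.Finite S' A›
  have h3 : Module.Finite S (RS S S' A) := Module.Finite.trans S' _
  let f : RS S S' A →ₗ[S] B := ⟨⟨e, fun x y => map_add e x y⟩, fun s x => he s x⟩
  exact L.bij (f := f) e.injective e.surjective

/-- `H_p = 0` -/
def Zp (p : Ideal S) (H : Type u) [AddCommGroup H] [Module S H] : Prop :=
  ∀ m : H, ∃ r, r ∉ p ∧ r • m = 0

theorem Zp_iff (p : Ideal S) [p.IsPrime] (H : Type u) [AddCommGroup H] [Module S H] :
    Zp p H ↔ Subsingleton (Localization.AtPrime p ⊗[S] H) := by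
  have e : LocalizedModule p.primeCompl H ≃ₗ[Localization.AtPrime p] Localization.AtPrime p ⊗[S] H :=
    LocalizedModule.equivTensorProduct p.primeCompl H
  rw [← e.toEquiv.subsingleton_congr, LocalizedModule.subsingleton_iff]
  rfl

variable {H₁ H₂ H₃ : Type u} [AddCommGroup H₁] [Module S H₁] [AddCommGroup H₂] [Module S H₂]
  [AddCommGroup H₃] [Module S H₃]

theorem Zp.inj {p : Ideal S} {f : H₁ →ₗ[S] H₂} (hf : Injective f) (h : Zp p H₂) : Zp p H₁ := by
  intro m
  obtain ⟨r, hr, h⟩ := h (f m)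
  exact ⟨r, hr, hf (by rw [map_smul, h, map_zero])⟩

theorem Zp.surj {p : Ideal S} {f : H₁ →ₗ[S] H₂} (hf : Surjective f) (h : Zp p H₁) : Zp p H₂ := by
  intro m
  obtain ⟨m, rfl⟩ := hf m
  obtain ⟨r, hr, h⟩ := h m
  exact ⟨r, hr, (by rw [← map_smul, h, map_zero])⟩

theorem Zp.mid {p : Ideal S} [p.IsPrime] {f : H₁ →ₗ[S] H₂} {g : H₂ →ₗ[S] H₃} (hfg : Exact f g)
    (h1 : Zp p H₁) (h3 : Zp p H₃) : Zp p H₂ := by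
  intro m
  obtain ⟨r, hr, h⟩ := h3 (g m)
  obtain ⟨y, hy⟩ := (hfg (r • m)).1 (by rw [map_smul, h])
  obtain ⟨s, hs, h'⟩ := h1 y
  refine ⟨s * r, fun hh => (Ideal.IsPrime.mem_or_mem ‹_› hh).elim hs hr, ?_⟩
  rw [mul_smul, ← hy, ← map_smul, h', map_zero]

theorem Zp.of_sub {p : Ideal S} [p.IsPrime] (h : Subsingleton H₁) : Zp p H₁ := fun m =>
  ⟨1, fun h => (Ideal.IsPrime.ne_top ‹_›) ((Ideal.eq_top_iff_one _).2 h), Subsingleton.elim _ _⟩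

theorem Zp.mono {p q : Ideal S} (hpq : q ≤ p) (h : Zp p H₁) : Zp q H₁ := fun m => by
  obtain ⟨r, hr, h⟩ := h m
  exact ⟨r, fun hh => hr (hpq hh), h⟩

/-- the length function computes length at `p` -/
structure LF.At (L : LF S) (p : Ideal S) : Prop where
  fin : ∀ (H : Type u) [AddCommGroup H] [Module S H], Module.Finite S H →
    (∀ q : Ideal S, q.IsPrime → q ≤ p → ¬ Zp q H → q = p) → L.C H
  zero : ∀ (H : Type u) [AddCommGroup H] [Module S H], Module.Finite S H → L.C H → L.l H = 0 → Zp p H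
  zp : ∀ (H : Type u) [AddCommGroup H] [Module S H], Module.Finite S H → Zp p H → L.C H ∧ L.l H = 0

theorem LF.At.res {L : LF S} {p : Ideal S'} (hs : Surjective (algebraMap S S'))
    (h : L.At (p.comap (algebraMap S S'))) : (L.res hs).At p := by
  have : Module.Finite S S' := Module.Finite.of_surjective (Algebra.linearMap S S') hs
  refine ⟨?_, ?_, ?_⟩
  · intro H _ _ hfin hq
    have h2 : Module.Finite S' (RS S S' H) := hfin
    have h3 : Module.Finite S (RS S S' H) := Module.Finite.trans S' _
    apply h.fin (RS S S' H) h3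
    intro q hqp hle hz
    have hker : RingHom.ker (algebraMap S S') ≤ q := by
      intro x hx
      by_contra hxq
      apply hz
      intro m
      refine ⟨x, hxq, ?_⟩
      change algebraMap S S' x • (m : H) = 0
      rw [show algebraMap S S' x = 0 from hx, zero_smul]
    have hcm : (q.map (algebraMap S S')).comap (algebraMap S S') = q := by
      rw [Ideal.comap_map_of_surjective _ hs]
      apply sup_eq_left.2
      rwa [← RingHom.ker_eq_comap_bot]
    have hpr := Ideal.map_isPrime_of_surjective hs hker
    rw [← hcm, hq (q.map (algebraMap S S')) hpr (Ideal.map_le_iff_le_comap.2 hle) ?_]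
    intro hzz
    apply hz
    intro m
    obtain ⟨r, hr, hrm⟩ := hzz m
    obtain ⟨s, rfl⟩ := hs r
    exact ⟨s, fun hsq => hr (Ideal.mem_map_of_mem _ hsq), hrm⟩
  · intro H _ _ hfin hC hl
    have h2 : Module.Finite S' (RS S S' H) := hfin
    have h3 : Module.Finite S (RS S S' H) := Module.Finite.trans S' _
    have hz := h.zero (RS S S' H) h3 hC hl
    intro m
    obtain ⟨r, hr, hrm⟩ := hz m
    exact ⟨algebraMap S S' r, hr, hrm⟩
  · intro H _ _ hfin hz
    have h2 : Module.Finite S' (RS S S' H) := hfin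
    have h3 : Module.Finite S (RS S S' H) := Module.Finite.trans S' _
    apply h.zp (RS S S' H) h3
    intro m
    obtain ⟨r, hr, hrm⟩ := hz m
    obtain ⟨s, rfl⟩ := hs r
    exact ⟨s, hr, hrm⟩

theorem LFat_At [IsNoetherianRing S] (p : Ideal S) [p.IsPrime] :
    ((LFlen (Localization.AtPrime p)).bc : LF S).At p := by
  refine ⟨?_, ?_, ?_⟩
  · intro H _ _ hfin
    induction hfin using IsNoetherianRing.induction_on_isQuotientEquivQuotientPrime with
    | subsingleton N => exact fun _ => LF.zero _ _ inferInstance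
    | quotient N q e =>
      intro hq
      by_cases hqp : q.1 ≤ p
      · have := hq q.1 q.2 hqp (by
          intro hz
          obtain ⟨r, hr, hrm⟩ := hz (e.symm (Ideal.Quotient.mk _ 1))
          apply hr
          rw [← map_smul, e.symm.map_eq_zero_iff] at hrm
          rw [← Ideal.Quotient.eq_zero_iff_mem, ← hrm]
          change _ = Ideal.Quotient.mk q.1 (r * 1)
          rw [mul_one])
        let A := Localization.AtPrime p
        change Module.length A (A ⊗[S] N) ≠ ⊤
        let g : A →ₗ[A] A ⊗[S] N := LinearMap.toSpanSingleton A _ (1 ⊗ₜ e.symm (Ideal.Quotient.mk _ 1))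
        have hg : Surjective g := by
          rw [← LinearMap.range_eq_top, eq_top_iff]
          rintro x -
          induction x using TensorProduct.induction_on with
          | zero => exact zero_mem _
          | add x y hx hy => exact add_mem hx hy
          | tmul a n =>
            obtain ⟨n, rfl⟩ := e.symm.surjective n
            obtain ⟨n, rfl⟩ := Ideal.Quotient.mk_surjective n
            refine ⟨n • a, ?_⟩
            have : (Ideal.Quotient.mk q.1 n) = n • Ideal.Quotient.mk q.1 1 := by
              change _ = Ideal.Quotient.mk q.1 (n * 1); rw [mul_one]
            rw [this, LinearMap.toSpanSingleton_apply, TensorProduct.smul_tmul', smul_eq_mul,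
              mul_one, TensorProduct.smul_tmul, e.symm.map_smul]
        have hk : IsLocalRing.maximalIdeal A ≤ LinearMap.ker g := by
          rw [← Localization.AtPrime.map_eq_maximalIdeal, Ideal.map_le_iff_le_comap]
          intro x hx
          change g (algebraMap S A x) = 0
          rw [LinearMap.toSpanSingleton_apply, TensorProduct.smul_tmul', smul_eq_mul, mul_one,
            Algebra.algebraMap_eq_smul_one, TensorProduct.smul_tmul, ← map_smul]
          have : x • (Ideal.Quotient.mk q.1 1) = 0 := by
            change Ideal.Quotient.mk q.1 (x * 1) = 0
            rw [mul_one, Ideal.Quotient.eq_zero_iff_mem, this]; exact hx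
          rw [this, map_zero, TensorProduct.tmul_zero]
        let g' := (IsLocalRing.maximalIdeal A).liftQ g hk
        have hg' : Surjective g' := by
          intro x; obtain ⟨y, rfl⟩ := hg x; exact ⟨Submodule.Quotient.mk y, rfl⟩
        have hle := Module.length_le_of_surjective g' hg'
        have hsim : IsSimpleModule A (A ⧸ IsLocalRing.maximalIdeal A) :=
          isSimpleModule_iff_isCoatom.2 (Ideal.isMaximal_def.1 inferInstance)
        have h1 := Module.length_eq_one A (A ⧸ IsLocalRing.maximalIdeal A)
        rw [h1] at hle
        exact ne_top_of_le_ne_top (by simp) hle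
      · apply LF.zero (LFlen (Localization.AtPrime p)) (Localization.AtPrime p ⊗[S] N)
        rw [← Zp_iff]
        obtain ⟨x, hx, hxp⟩ := Set.not_subset.1 hqp
        intro m
        refine ⟨x, hxp, ?_⟩
        apply e.injective
        rw [map_smul, map_zero]
        obtain ⟨y, hy⟩ := Ideal.Quotient.mk_surjective (e m)
        rw [← hy]
        change Ideal.Quotient.mk q.1 (x * y) = 0
        rw [Ideal.Quotient.eq_zero_iff_mem]
        exact Ideal.mul_mem_right _ _ hx
    | exact N₁ N₂ N₃ f g hf hg hfg h1 h3 =>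
      intro hq
      exact (LF.ses _ f g inferInstance hf hfg hg).1.2
        ⟨h1 (fun q a b c => hq q a b (fun h => c (h.inj hf))),
          h3 (fun q a b c => hq q a b (fun h => c (h.surj hg)))⟩
  · intro H _ _ hfin hC hl
    rw [Zp_iff]
    exact LFlen_strict _ _ inferInstance hC hl
  · intro H _ _ hfin hz
    rw [Zp_iff] at hz
    exact ⟨LF.zero (LFlen (Localization.AtPrime p)) (Localization.AtPrime p ⊗[S] H) hz,
      LF.l_zero (LFlen (Localization.AtPrime p)) (H := Localization.AtPrime p ⊗[S] H) hz⟩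

end bc

section Pos
variable {B : Type u} [CommRing B] {B' : Type u} [CommRing B'] [Algebra B B'] [Module.Flat B B']

theorem Wq_congr (xs : List B) : ∀ (W W' : ModuleCat.{u} B) (_ : W ≃ₗ[B] W'),
    Nonempty (Wq xs W ≃ₗ[B] Wq xs W') := by
  induction xs with
  | nil => exact fun _ _ e => ⟨e⟩
  | cons x xs ih =>
    intro W W' e
    obtain ⟨e'⟩ := Co_congr x e
    exact ih _ _ e'

theorem mx_bc (x : B) (W : Type u) [AddCommGroup W] [Module B W] :
    (mx x W).baseChange B' = mx (algebraMap B B' x) (B' ⊗[B] W) := by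
  ext w
  simp [mx_apply, TensorProduct.smul_tmul', Algebra.algebraMap_eq_smul_one]

theorem Co_bc (x : B) (W : Type u) [AddCommGroup W] [Module B W] :
    Nonempty (Co (mx (algebraMap B B' x) (B' ⊗[B] W)) ≃ₗ[B'] B' ⊗[B] Co (mx x W)) := by
  rw [← mx_bc]
  exact co_equiv (baseChange_exact B' (Co.exact _) (Co.surj _)) (baseChange_surj B' (Co.surj _))

theorem Wq_bc (xs : List B) : ∀ (W : ModuleCat.{u} B),
    Nonempty (Wq (xs.map (algebraMap B B')) (ModuleCat.of B' (B' ⊗[B] W)) ≃ₗ[B'] B' ⊗[B] (Wq xs W)) := by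
  induction xs with
  | nil => exact fun _ => ⟨LinearEquiv.refl _ _⟩
  | cons x xs ih =>
    intro W
    obtain ⟨e⟩ := Co_bc (B' := B') x W
    obtain ⟨e1⟩ := ih (ModuleCat.of B (Co (mx x W)))
    obtain ⟨e2⟩ := Wq_congr (xs.map (algebraMap B B')) (ModuleCat.of B' (Co (mx (algebraMap B B' x) (B' ⊗[B] W))))
      (ModuleCat.of B' (B' ⊗[B] Co (mx x W))) e
    exact ⟨e2.trans e1⟩

theorem RegF_bc (xs : List B) : ∀ (W : Type u) [AddCommGroup W] [Module B W], RegF xs W →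
    RegF (xs.map (algebraMap B B')) (B' ⊗[B] W) := by
  induction xs with
  | nil => exact fun _ _ _ _ => trivial
  | cons x xs ih =>
    intro W _ _ h
    obtain ⟨e⟩ := Co_bc (B' := B') x W
    refine ⟨?_, RegF.congr _ e.symm (ih _ h.2)⟩
    rw [← mx_bc]
    exact baseChange_inj_flat B' h.1

theorem Pos [IsNoetherianRing B] [IsNoetherianRing B'] [IsLocalRing B'] {L : LF B'} (hL : L.Strict)
    (U : Type u) [AddCommGroup U] [Module B U] [Module.Finite B U] (d : ℕ)
    (hd : ∀ (W : Type u) [AddCommGroup W] [Module B W], Subsingleton (T B W U d))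
    (xs : List B) (hxs : ∀ x ∈ xs, algebraMap B B' x ∈ IsLocalRing.maximalIdeal B')
    (W : ModuleCat.{u} B) (hW : Module.Finite B W) (hreg : RegF xs W)
    (h0 : ∀ i, Subsingleton (T B W U (i+1)))
    (hC : ∀ i, (L.bc : LF B).C (T B (Wq xs W) U (i + 1)))
    (hchi : chi1 U d (L.bc : LF B) (Wq xs W) ≤ 0) :
    ∀ i, (L.bc : LF B).l (T B (Wq xs W) U (i+1)) = 0 := by
  obtain ⟨ew⟩ := Wq_bc (B' := B') xs W
  have key : ∀ i, Nonempty (T B' (Wq (xs.map (algebraMap B B')) (ModuleCat.of B' (B' ⊗[B] W)))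
      (B' ⊗[B] U) i ≃ₗ[B'] B' ⊗[B] (T B (Wq xs W) U i)) := by
    intro i
    obtain ⟨e⟩ := Tor_flat_bc (S := B) B' (Wq xs W) i U
    exact ⟨(TequivL B' (B' ⊗[B] U) i ew).trans e⟩
  have hfW := Wq_fin xs W hW
  have key2 : ∀ i, L.l (T B' (Wq (xs.map (algebraMap B B')) (ModuleCat.of B' (B' ⊗[B] W)))
      (B' ⊗[B] U) (i + 1)) = (L.bc : LF B).l (T B (Wq xs W) U (i+1)) ∧
      L.C (T B' (Wq (xs.map (algebraMap B B')) (ModuleCat.of B' (B' ⊗[B] W)))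
      (B' ⊗[B] U) (i + 1)) := by
    intro i
    obtain ⟨e⟩ := key (i + 1)
    have hf := Tfinite (S := B) (Wq xs W) (i + 1) U
    have hf' : Module.Finite B' (B' ⊗[B] (T B (Wq xs W) U (i+1))) := inferInstance
    have := L.bij (f := e.symm.toLinearMap) e.symm.injective e.symm.surjective
    exact ⟨(this.2 (hC i)).symm, this.1.1 (hC i)⟩
  have hsub := PosL hL (B' ⊗[B] U) d (fun V _ _ => by
      let _ : Module B V := Module.compHom V (algebraMap B B')
      have : IsScalarTower B B' V := IsScalarTower.of_algebraMap_smul (fun _ _ => rfl)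
      have h := Tor_bc (S := B) B' V d U (fun i => T_flat B i)
      exact h.sub.2 (hd V))
    (xs.map (algebraMap B B')) (by simpa using hxs) (ModuleCat.of B' (B' ⊗[B] W))
    (inferInstanceAs (Module.Finite B' (B' ⊗[B] W))) (RegF_bc xs W hreg)
    (fun i => by
      obtain ⟨e⟩ := Tor_flat_bc (S := B) B' W (i+1) U
      have := h0 i
      have h2 : Subsingleton (B' ⊗[B] (T B W U (i+1))) := inferInstance
      exact e.toEquiv.subsingleton) (fun i => (key2 i).2) (by
      unfold chi1 at hchi ⊢
      rwa [Finset.sum_congr rfl (fun i _ => by rw [(key2 i).1])])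
  intro i
  rw [← (key2 i).1]
  exact L.l_zero (hsub i)

end Pos

end HW

end

section

namespace HW

open TensorProduct Function

section

/-- rigidity with respect to a length function -/
def Rig (S : Type u) [CommRing S] (L : LF S) : Prop :=
  ∀ (X N : Type u) [AddCommGroup X] [Module S X] [AddCommGroup N] [Module S N],
    Module.Finite S X → Module.Finite S N → (∀ i, L.C (T S X N (i + 1))) → L.l (T S X N 1) = 0 →
    ∀ i, L.l (T S X N (i + 1)) = 0

/-- finite Tor dimension of finite modules -/
def FTD (S : Type u) [CommRing S] : Prop :=
  ∀ (X : Type u) [AddCommGroup X] [Module S X], Module.Finite S X → ∃ d : ℕ,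
    ∀ (N : Type u) [AddCommGroup N] [Module S N], ∀ j ≥ d, Subsingleton (T S N X j)

/-- positivity of the partial Euler characteristic -/
def PosA (S : Type u) [CommRing S] (L : LF S) : Prop :=
  ∀ (Y N : Type u) [AddCommGroup Y] [Module S Y] [AddCommGroup N] [Module S N] (m : ℕ)
    (j : Y →ₗ[S] (Fin m → S)), Injective j → 
    Module.Finite S Y → Module.Finite S N → (∀ i, L.C (T S Y N (i + 1))) →
    (∃ d₀, ∀ d ≥ d₀, chi1 N d L Y ≤ 0) → ∀ i, L.l (T S Y N (i + 1)) = 0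

variable {Q R : Type u} [CommRing Q] [CommRing R] [Algebra Q R] {f : Q} (H : Hyp Q R f)
  [IsNoetherianRing Q] [IsNoetherianRing R] {L : LF Q}

theorem CRnum (X Y : Type u) [AddCommGroup X] [Module R X] [Module Q X] [IsScalarTower Q R X]
    [AddCommGroup Y] [Module R Y] [Module Q Y] [IsScalarTower Q R Y]
    [Module.Finite R X] [Module.Finite R Y]
    (hC : ∀ i, (L.res H.surj).C (T R X Y (i + 1))) :
    ∃ g : ℕ → ℤ, ∀ i, L.C (T Q X Y (i + 2)) ∧ 0 ≤ L.l (T Q X Y (i + 2)) ∧ 0 ≤ g i ∧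
      g (i + 1) ≤ (L.res H.surj).l (T R X Y (i + 1)) ∧
      g i ≤ (L.res H.surj).l (T R X Y (i + 2)) ∧
      L.l (T Q X Y (i + 2)) + g (i + 1) + g i =
        (L.res H.surj).l (T R X Y (i + 1)) + (L.res H.surj).l (T R X Y (i + 2)) := by
  obtain ⟨E, α, β, γ, hE, h1, h2, h3, h4⟩ := H.CR X Y
  set M := L.res H.surj
  have fR : ∀ i, Module.Finite R (T R X Y i) := fun i => Tfinite (S := R) X i Y
  have hfinQ : Module.Finite Q R := Module.Finite.of_surjective (Algebra.linearMap Q R) H.surj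
  have hX : Module.Finite Q X := Module.Finite.trans R X
  have hY : Module.Finite Q Y := Module.Finite.trans R Y
  have fQ : ∀ i, Module.Finite Q (T Q X Y i) := fun i => Tfinite (S := Q) X i Y
  have fE : ∀ i, Module.Finite R (E i) := by
    intro i
    obtain ⟨e, he⟩ := hE i
    let _ : Module Q (E i) := Module.compHom (E i) (algebraMap Q R)
    have : IsScalarTower Q R (E i) := IsScalarTower.of_algebraMap_smul (fun _ _ => rfl)
    have := fQ (i + 1)
    have e' : T Q X Y (i + 1) ≃ₗ[Q] E i :=
      (({ e with map_smul' := fun s x => he s x } : E i ≃ₗ[Q] T Q X Y (i + 1))).symm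
    have h5 : Module.Finite Q (E i) := Module.Finite.equiv e'
    exact Module.Finite.of_restrictScalars_finite Q R _
  have CE : ∀ i, M.C (E (i + 1)) := fun i => M.C_mid (h2 (i + 1)) (hC i) (hC (i + 1))
  refine ⟨fun i => M.l (Rg (γ i)), fun i => ?_⟩
  have hq := L.res_iff H.surj (hE (i + 1))
  have mE := (M.mid (h2 (i + 1))).2 (CE i)
  have cE := (M.mid (h2 (i + 1))).1.1 (CE i)
  have m1 := (M.mid (h1 (i + 1))).2 (hC i)
  have c1 := (M.mid (h1 (i + 1))).1.1 (hC i)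
  have m2 := (M.mid (h3 i)).2 (hC (i + 1))
  have c2 := (M.mid (h3 i)).1.1 (hC (i + 1))
  have rh := M.rg_surj (f := β 0) h4
  have n1 := M.nonneg (Rg (α (i + 1))) inferInstance cE.1
  have n2 := M.nonneg (Rg (β (i + 1))) inferInstance cE.2
  have n3 := M.nonneg (Rg (γ i)) inferInstance c2.2
  have n4 := M.nonneg _ (fE (i + 1)) (CE i)
  have e1 := hq.2 (CE i)
  refine ⟨hq.1.1 (CE i), ?_, n3, ?_, ?_, ?_⟩
  · rw [← e1]; exact n4
  · linarith
  · linarith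
  · rw [← e1]; linarith

theorem tele2 (e g r : ℕ → ℤ) (h : ∀ i, e i + g (i + 1) + g i = r i + r (i + 1)) (d : ℕ) :
    ∑ i ∈ Finset.range d, (-1) ^ i * e i = r 0 - g 0 - (-1) ^ d * (r d - g d) := by
  induction d with
  | zero => simp
  | succ d ih =>
    rw [Finset.sum_range_succ, ih, pow_succ]
    have : e d = r d + r (d + 1) - g (d + 1) - g d := by linarith [h d]
    rw [this]; ring

theorem fin_cover (S : Type u) [CommRing S] [IsNoetherianRing S] (X : Type u) [AddCommGroup X]
    [Module S X] [Module.Finite S X] :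
    ∃ (m : ℕ) (Y : Type u) (_ : AddCommGroup Y) (_ : Module S Y) (j : Y →ₗ[S] (Fin m → S))
      (p : (Fin m → S) →ₗ[S] X), Module.Finite S Y ∧ Injective j ∧ Exact j p ∧ Surjective p := by
  obtain ⟨m, p, hp⟩ := Module.Finite.exists_fin' S X
  exact ⟨m, Ke p, inferInstance, inferInstance, Ke.i p, p, Ke.finite p, Ke.inj p, Ke.exact p, hp⟩

include H in
theorem Rig_of_PosA (hpos : PosA Q L) (hR : FTD R) : Rig R (L.res H.surj) := by
  intro X N _ _ _ _ hX hN hC h1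
  let _ : Module Q X := Module.compHom X (algebraMap Q R)
  have : IsScalarTower Q R X := IsScalarTower.of_algebraMap_smul (fun _ _ => rfl)
  let _ : Module Q N := Module.compHom N (algebraMap Q R)
  have : IsScalarTower Q R N := IsScalarTower.of_algebraMap_smul (fun _ _ => rfl)
  obtain ⟨g, hg⟩ := CRnum H (L := L) X N hC
  have hfinQ : Module.Finite Q R := Module.Finite.of_surjective (Algebra.linearMap Q R) H.surj
  have hXQ : Module.Finite Q X := Module.Finite.trans R X
  have hNQ : Module.Finite Q N := Module.Finite.trans R N
  obtain ⟨m, Y, _, _, j, p, fY, hj, hjp, hp⟩ := fin_cover Q X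
  have key : ∀ i, L.C (T Q Y N (i + 1)) ∧ L.l (T Q X N (i + 2)) = L.l (T Q Y N (i + 1)) := by
    intro i
    obtain ⟨e⟩ := shiftL Q (M := N) i hj hjp hp (T_flat Q _) (T_flat Q _)
    have := Tfinite (S := Q) X (i + 2) N
    have hb := L.bij (f := e.toLinearMap) e.injective e.surjective
    exact ⟨hb.1.1 (hg i).1, hb.2 (hg i).1⟩
  obtain ⟨D, hD⟩ := hR N hN
  have hD' : ∀ i ≥ D, (L.res H.surj).l (T R X N (i + 1)) = 0 := fun i hi =>
    (L.res H.surj).l_zero (hD X _ (by omega))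
  have tot := hpos Y N m j hj fY hNQ (fun i => (key i).1) ⟨D, fun d hd => by
    unfold chi1
    rw [Finset.sum_congr rfl (fun i _ => by rw [← (key i).2])]
    rw [tele2 _ g (fun i => (L.res H.surj).l (T R X N (i + 1))) (fun i => (hg i).2.2.2.2.2)]
    have h2 := hD' d hd
    have h3 := hD' (d + 1) (by omega)
    have h4 := (hg d).2.2.1
    have h5 := (hg d).2.2.2.2.1
    have h6 : g d = 0 := by
      rw [h3] at h5; linarith
    have h7 := (hg 0).2.2.1
    simp only [h2, h6, h1]
    simpa using h7⟩
  have per : ∀ i, (L.res H.surj).l (T R X N (i + 1)) = (L.res H.surj).l (T R X N (i + 3)) := by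
    intro i
    have e0 := (key i).2.trans (tot i)
    have e1 := (key (i + 1)).2.trans (tot (i + 1))
    have a0 := (hg i).2.2.2
    have a1 := (hg (i + 1)).2.2.2
    rw [e0] at a0; rw [e1] at a1
    linarith [a0.1, a0.2.1, a0.2.2, a1.1, a1.2.1, a1.2.2]
  have per2 : ∀ k i, (L.res H.surj).l (T R X N (i + 1)) =
      (L.res H.surj).l (T R X N (i + 2 * k + 1)) := by
    intro k
    induction k with
    | zero => intro i; rfl
    | succ k ih => intro i; rw [ih i, per (i + 2 * k)]; rfl
  intro i
  rw [per2 D i]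
  exact hD' _ (by omega)

include H in
theorem H1 (hrig : Rig Q L)
    (X N : Type u) [AddCommGroup X] [Module R X] [AddCommGroup N] [Module R N]
    (hX : Module.Finite R X) (hN : Module.Finite R N)
    (hC : ∀ i, (L.res H.surj).C (T R X N (i + 1))) (h1 : (L.res H.surj).l (T R X N 1) = 0)
    (h2 : (L.res H.surj).l (T R X N 2) = 0) : ∀ i, (L.res H.surj).l (T R X N (i + 1)) = 0 := by
  let _ : Module Q X := Module.compHom X (algebraMap Q R)
  have : IsScalarTower Q R X := IsScalarTower.of_algebraMap_smul (fun _ _ => rfl)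
  let _ : Module Q N := Module.compHom N (algebraMap Q R)
  have : IsScalarTower Q R N := IsScalarTower.of_algebraMap_smul (fun _ _ => rfl)
  obtain ⟨g, hg⟩ := CRnum H (L := L) X N hC
  have hfinQ : Module.Finite Q R := Module.Finite.of_surjective (Algebra.linearMap Q R) H.surj
  have hXQ : Module.Finite Q X := Module.Finite.trans R X
  have hNQ : Module.Finite Q N := Module.Finite.trans R N
  obtain ⟨m, Y, _, _, j, p, fY, hj, hjp, hp⟩ := fin_cover Q X
  have key : ∀ i, L.C (T Q Y N (i + 1)) ∧ L.l (T Q X N (i + 2)) = L.l (T Q Y N (i + 1)) := by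
    intro i
    obtain ⟨e⟩ := shiftL Q (M := N) i hj hjp hp (T_flat Q _) (T_flat Q _)
    have := Tfinite (S := Q) X (i + 2) N
    have hb := L.bij (f := e.toLinearMap) e.injective e.surjective
    exact ⟨hb.1.1 (hg i).1, hb.2 (hg i).1⟩
  have tot := hrig Y N fY hNQ (fun i => (key i).1) (by
    rw [← (key 0).2]
    have h0 := (hg 0).2
    have h3 := (hg 1).2.2.1
    rw [h1, h2] at h0
    linarith [h0.1, h0.2.1, h0.2.2.2.2, h3])
  have per : ∀ i, (L.res H.surj).l (T R X N (i + 1)) = (L.res H.surj).l (T R X N (i + 3)) := by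
    intro i
    have e0 := (key i).2.trans (tot i)
    have e1 := (key (i + 1)).2.trans (tot (i + 1))
    have a0 := (hg i).2.2.2
    have a1 := (hg (i + 1)).2.2.2
    rw [e0] at a0; rw [e1] at a1
    linarith [a0.1, a0.2.1, a0.2.2, a1.1, a1.2.1, a1.2.2]
  intro i
  induction i using Nat.strong_induction_on with
  | _ i ih =>
    match i with
    | 0 => exact h1
    | 1 => exact h2
    | i + 2 => rw [← per i]; exact ih i (by omega)

end

end HW

end

section

namespace HW

open TensorProduct Function

section

variable {Q : Type u} [CommRing Q] [IsLocalRing Q] [IsNoetherianRing Q]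

theorem free_of_T1 (X : Type u) [AddCommGroup X] [Module Q X] [Module.Finite Q X]
    (h : Subsingleton (T Q (IsLocalRing.ResidueField Q) X 1)) : Module.Free Q X := by
  obtain ⟨m, Y, _, _, j, p, hY, hj, hex, hp⟩ := fin_cover Q X
  obtain ⟨e⟩ := shiftR1' Q (N := IsLocalRing.ResidueField Q) hj hex hp (T_flat Q 0)
  have h1 := e.symm.toEquiv.subsingleton
  have h2 : Injective (j.lTensor (IsLocalRing.ResidueField Q)) := by
    rw [← LinearMap.ker_eq_bot]
    exact (Submodule.subsingleton_iff_eq_bot).1 h1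
  exact Module.free_of_lTensor_residueField_injective j p hp hex h2

theorem pdk (j : ℕ) : ∀ (X : Type u) [AddCommGroup X] [Module Q X] [Module.Finite Q X],
    Subsingleton (T Q (IsLocalRing.ResidueField Q) X (j + 1)) →
    ∀ (V : Type u) [AddCommGroup V] [Module Q V] (i : ℕ), Subsingleton (T Q V X (i + j + 1)) := by
  induction j with
  | zero =>
    intro X _ _ _ h V _ _ i
    have := free_of_T1 X h
    exact T_flatR Q _
  | succ j ih =>
    intro X _ _ _ h V _ _ i
    obtain ⟨m, Y, _, _, a, p, hY, hj, hex, hp⟩ := fin_cover Q X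
    obtain ⟨e⟩ := shiftR' Q (N := IsLocalRing.ResidueField Q) j hj hex hp (fun i => T_flat Q i)
    obtain ⟨e'⟩ := shiftR' Q (N := V) (i + j) hj hex hp (fun i => T_flat Q i)
    have h2 := ih Y e.symm.toEquiv.subsingleton V i
    exact e'.toEquiv.subsingleton

theorem T_ann {S : Type u} [CommRing S] {N : Type u} [AddCommGroup N] [Module S N] (M : Type u)
    [AddCommGroup M] [Module S M] (i : ℕ) {z : S} (hz : ∀ n : N, z • n = 0) (t : T S N M i) :
    z • t = 0 := by
  have h := Tmap_mx N M i z
  have h0 : mx z N = (0 : S) • (LinearMap.id : N →ₗ[S] N) := by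
    apply LinearMap.ext; intro x; rw [mx_apply, hz, zero_smul]; rfl
  rw [h0, Tmap_smul, zero_smul] at h
  rw [← mx_apply, ← h]; rfl

theorem T_annR {S : Type u} [CommRing S] {N : Type u} [AddCommGroup N] [Module S N] (M : Type u)
    [AddCommGroup M] [Module S M] (i : ℕ) {z : S} (hz : ∀ n : N, z • n = 0) (t : T S M N i) :
    z • t = 0 := by
  obtain ⟨e⟩ := Tsymm S i M N
  apply e.injective
  rw [map_smul, T_ann M i hz, map_zero]

theorem kk_ann {z : Q} (hz : z ∈ IsLocalRing.maximalIdeal Q) (x : IsLocalRing.ResidueField Q) :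
    z • x = 0 := by
  rw [Algebra.smul_def]
  have : algebraMap Q (IsLocalRing.ResidueField Q) z = 0 :=
    (IsLocalRing.residue_eq_zero_iff z).2 hz
  rw [this, zero_mul]

theorem drop (E : Type u) [AddCommGroup E] [Module Q E] {z : Q}
    (hz : z ∈ IsLocalRing.maximalIdeal Q) (hr : Injective (mx z E)) (j : ℕ)
    (h : Subsingleton (T Q (IsLocalRing.ResidueField Q) (Co (mx z E)) (j + 1))) :
    Subsingleton (T Q (IsLocalRing.ResidueField Q) E j) := by
  rw [Tsymm_sub] at h ⊢
  obtain ⟨δ, h1, h2⟩ := les Q (IsLocalRing.ResidueField Q) j hr (Co.exact _) (Co.surj _)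
  constructor
  intro a b
  have key : ∀ a : T Q E (IsLocalRing.ResidueField Q) j, a = 0 := by
    intro a
    obtain ⟨c, rfl⟩ := (h2 a).1 (by
      rw [Tmap_mx, mx_apply]; exact T_annR _ _ (kk_ann hz) a)
    rw [Subsingleton.elim c 0, map_zero]
  rw [key a, key b]

theorem pdmax (hF : FTD Q) {G : Type u} [AddCommGroup G] [Module Q G]
    (g : IsLocalRing.ResidueField Q →ₗ[Q] G) (hg : Injective g) (c : ℕ)
    (hG : ∀ (V : Type u) [AddCommGroup V] [Module Q V], ∀ j, Subsingleton (T Q G V (j + c + 1)))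
    (X : Type u) [AddCommGroup X] [Module Q X] [Module.Finite Q X] :
    ∀ (V : Type u) [AddCommGroup V] [Module Q V], ∀ j, Subsingleton (T Q V X (j + c + 1)) := by
  obtain ⟨d, hd⟩ := hF X inferInstance
  have key : ∀ e : ℕ, ∀ (V : Type u) [AddCommGroup V] [Module Q V], ∀ j,
      d ≤ j + c + 1 + e → Subsingleton (T Q V X (j + c + 1)) := by
    intro e
    induction e with
    | zero => intro V _ _ j h; exact hd V _ h
    | succ e ih =>
      intro V _ _ j h
      have h1 := ih (Co g) (j + 1) (by omega)
      obtain ⟨δ, h2, h3⟩ := les Q X (j + c + 1) hg (Co.exact _) (Co.surj _)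
      have h1' : Subsingleton (T Q (Co g) X (j + c + 1 + 1)) := by
        rw [show j + c + 1 + 1 = j + 1 + c + 1 by omega]; exact h1
      have h4 := hG X j
      have h5 := exact_mid_zero Q h3
      have := pdk (j + c) X h5 V 0
      rwa [Nat.zero_add] at this
  intro V _ _ j
  exact key d V j (by omega)

theorem kk_emb {G : Type u} [AddCommGroup G] [Module Q G] (x : G) (hx : x ≠ 0)
    (hm : ∀ z ∈ IsLocalRing.maximalIdeal Q, z • x = 0) :
    ∃ g : IsLocalRing.ResidueField Q →ₗ[Q] G, Injective g := by
  let g : (Q ⧸ IsLocalRing.maximalIdeal Q) →ₗ[Q] G :=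
    (IsLocalRing.maximalIdeal Q).liftQ (LinearMap.toSpanSingleton Q G x) (fun z hz => by
      rw [LinearMap.mem_ker, LinearMap.toSpanSingleton_apply]; exact hm z hz)
  suffices h : Injective g from ⟨g, h⟩
  rw [injective_iff_map_eq_zero]
  intro y hy
  obtain ⟨y, rfl⟩ := Submodule.Quotient.mk_surjective _ y
  have h1 : y • x = 0 := hy
  rw [Submodule.Quotient.mk_eq_zero]
  by_contra h2
  have h3 : IsUnit y := by
    by_contra h4; exact h2 ((IsLocalRing.mem_maximalIdeal y).2 h4)
  exact hx ((h3.smul_eq_zero).1 h1)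

/-- socle element -/
def Soc (S : Type u) [CommRing S] [IsLocalRing S] (X : Type u) [AddCommGroup X] [Module S X] : Prop :=
  ∃ x : X, x ≠ 0 ∧ ∀ z ∈ IsLocalRing.maximalIdeal S, z • x = 0

/-- depth one -/
def D1 (S : Type u) [CommRing S] [IsLocalRing S] : Prop :=
  ∃ y ∈ IsLocalRing.maximalIdeal S, (∀ x, y * x = 0 → x = 0) ∧
    ∃ x : S, ¬ y ∣ x ∧ ∀ z ∈ IsLocalRing.maximalIdeal S, y ∣ z * x

/-- depth at least two -/
def D2 (S : Type u) [CommRing S] [IsLocalRing S] : Prop :=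
  ∃ y ∈ IsLocalRing.maximalIdeal S, ∃ b ∈ IsLocalRing.maximalIdeal S, (∀ x, y * x = 0 → x = 0) ∧
    ∀ x : S, y ∣ b * x → y ∣ x

/-- projective dimension at most one over `Q` -/
def PD1 (Q : Type u) [CommRing Q] (E : Type u) [AddCommGroup E] [Module Q E] : Prop :=
  ∀ (V : Type u) [AddCommGroup V] [Module Q V] (j : ℕ), Subsingleton (T Q V E (j + 2))

/-- matrix factorization module -/
def MF (S : Type u) [CommRing S] (E : Type u) [AddCommGroup E] [Module S E] : Prop :=
  ∃ (m : ℕ) (a : E →ₗ[S] (Fin m → S)) (d : (Fin m → S) →ₗ[S] (Fin m → S))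
    (p : (Fin m → S) →ₗ[S] E), Injective a ∧ Exact a d ∧ Exact d p ∧ Surjective p

/-- local hypersurface interface -/
def LHyp (S : Type u) [CommRing S] : Prop :=
  ∃ (Q : Type u) (_ : CommRing Q) (_ : IsLocalRing Q) (_ : IsNoetherianRing Q) (_ : Algebra Q S)
    (f : Q), FTD Q ∧ Hyp Q S f

variable {S : Type u} [CommRing S] [IsLocalRing S] [Algebra Q S] {f : Q} (H : Hyp Q S f)
include H

theorem memQ (z : Q) : algebraMap Q S z ∈ IsLocalRing.maximalIdeal S ↔ z ∈ IsLocalRing.maximalIdeal Q := by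
  have := IsLocalHom.of_surjective _ H.surj
  rw [IsLocalRing.mem_maximalIdeal, IsLocalRing.mem_maximalIdeal, mem_nonunits_iff, mem_nonunits_iff,
    isUnit_map_iff]

section
variable {E : Type u} [AddCommGroup E] [Module S E] [Module Q E] [IsScalarTower Q S E]

theorem T1_ne [Module.Finite S E] [Nontrivial E] :
    ¬ Subsingleton (T Q (IsLocalRing.ResidueField Q) E 1) := by
  intro h
  have hfinQ : Module.Finite Q S := Module.Finite.of_surjective (Algebra.linearMap Q S) H.surj
  have hX : Module.Finite Q E := Module.Finite.trans S E
  have := free_of_T1 E h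
  obtain ⟨b⟩ := Module.Free.exists_basis (R := Q) (M := E)
  obtain ⟨i⟩ := b.2.index_nonempty
  have h1 : f • b.2 i = 0 := H.smul_zero _
  have h2 : f = 0 := by
    have := congrArg (fun x => b.2.repr x i) h1
    simpa using this
  have := H.nzd 1 (by rw [h2, zero_mul])
  exact one_ne_zero this

theorem PD1_of_reg {z : S} (hz : z ∈ IsLocalRing.maximalIdeal S) [Module.Finite S E]
    (hr : ∀ e : E, z • e = 0 → e = 0)
    (h3 : ∀ (X : Type u) [AddCommGroup X] [Module Q X] [Module.Finite Q X] (V : Type u)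
      [AddCommGroup V] [Module Q V] (j : ℕ), Subsingleton (T Q V X (j + 3))) : PD1 Q E := by
  obtain ⟨z, rfl⟩ := H.surj z
  have hfinQ : Module.Finite Q S := Module.Finite.of_surjective (Algebra.linearMap Q S) H.surj
  have hX : Module.Finite Q E := Module.Finite.trans S E
  have h1 : Injective (mx z E) := by
    rw [injective_iff_map_eq_zero]
    intro e he
    exact hr e (by rw [algebraMap_smul]; exact he)
  have h2 := drop E ((memQ H z).1 hz) h1 2 (h3 _ _ 0)
  intro V _ _ j
  exact pdk 1 E h2 V j

theorem PD1_MF [Module.Finite S E] (h : PD1 Q E) : MF S E := by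
  have hfinQ : Module.Finite Q S := Module.Finite.of_surjective (Algebra.linearMap Q S) H.surj
  have hX : Module.Finite Q E := Module.Finite.trans S E
  obtain ⟨m, Y, _, _, j, p, hY, hj, hex, hp⟩ := fin_cover Q E
  obtain ⟨e⟩ := shiftR' Q (N := IsLocalRing.ResidueField Q) 0 hj hex hp (fun i => T_flat Q i)
  have h0 := h (IsLocalRing.ResidueField Q) 0
  have hfree : Module.Free Q Y := free_of_T1 Y e.symm.toEquiv.subsingleton
  have hr1 : Module.finrank Q Y ≤ m := by
    have := LinearMap.finrank_le_finrank_of_injective hj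
    simpa using this
  have hr2 : m ≤ Module.finrank Q Y := by
    have hf : ∀ x : Fin m → Q, ∃ y, j y = f • x := fun x =>
      (hex _).1 (by rw [map_smul, H.smul_zero])
    choose g hg using hf
    let g' : (Fin m → Q) →ₗ[Q] Y := ⟨⟨g, fun x y => hj (by rw [map_add, hg, hg, hg, smul_add])⟩,
      fun c x => hj (by rw [RingHom.id_apply, map_smul, hg, hg, smul_comm])⟩
    have hgi : Injective g' := by
      rw [injective_iff_map_eq_zero]
      intro x hx
      have h1 : f • x = 0 := by rw [← hg]; exact (congrArg j hx).trans (map_zero j)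
      funext i
      exact H.nzd _ (congrFun h1 i)
    have := LinearMap.finrank_le_finrank_of_injective hgi
    simpa using this
  have hr : Module.finrank Q Y = m := le_antisymm hr1 hr2
  have eY : (Fin m → Q) ≃ₗ[Q] Y := LinearEquiv.ofFinrankEq _ _ (by simp [hr])
  obtain ⟨a, d, h1, h2, h3, h4⟩ := H.ses (j ∘ₗ eY.toLinearMap) (hj.comp eY.injective) p (by
    intro x
    rw [hex x]
    constructor
    · rintro ⟨y, rfl⟩; exact ⟨eY.symm y, by simp⟩
    · rintro ⟨y, rfl⟩; exact ⟨eY y, rfl⟩) hp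
  let e' : S ⊗[Q] (Fin m → Q) ≃ₗ[S] (Fin m → S) := TensorProduct.piScalarRight Q S S (Fin m)
  refine ⟨m, e'.toLinearMap ∘ₗ a, e'.toLinearMap ∘ₗ (j ∘ₗ eY.toLinearMap).baseChange S ∘ₗ
    e'.symm.toLinearMap, d ∘ₗ e'.symm.toLinearMap, e'.injective.comp h1, ?_, ?_,
    h4.comp e'.symm.surjective⟩
  · intro x
    have := h2 (e'.symm x)
    simp only [LinearMap.comp_apply, LinearEquiv.coe_coe, EmbeddingLike.map_eq_zero_iff]
    rw [this]
    constructor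
    · rintro ⟨y, hy⟩; exact ⟨y, by simp [hy]⟩
    · rintro ⟨y, hy⟩; exact ⟨y, by simp [← hy]⟩
  · intro x
    have := h3 (e'.symm x)
    simp only [LinearMap.comp_apply, LinearEquiv.coe_coe]
    rw [this]
    constructor
    · rintro ⟨y, hy⟩; exact ⟨e' y, by simp [hy]⟩
    · rintro ⟨y, hy⟩; exact ⟨e'.symm y, by simp [← hy]⟩

end

theorem PD1_free (m : ℕ) (V : Type u) [AddCommGroup V] [Module Q V] (j : ℕ) :
    Subsingleton (T Q V (Fin m → S) (j + 2)) := by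
  rw [Tsymm_sub]
  have h1 : Injective (mx f (Fin m → Q)) := by
    rw [injective_iff_map_eq_zero]
    intro x hx
    funext i
    exact H.nzd _ (congrFun hx i)
  have h2 : Exact (mx f (Fin m → Q)) ((Algebra.linearMap Q S).compLeft (Fin m)) := by
    intro x
    constructor
    · intro hx
      have : ∀ i, f ∣ x i := fun i => (H.ker _).1 (congrFun hx i)
      choose y hy using this
      exact ⟨y, by funext i; exact (hy i).symm⟩
    · rintro ⟨y, rfl⟩
      funext i
      exact (H.ker _).2 (dvd_mul_right f (y i))
  have h3 : Surjective ((Algebra.linearMap Q S).compLeft (Fin m)) := by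
    intro x
    choose y hy using fun i => H.surj (x i)
    exact ⟨y, by funext i; exact hy i⟩
  obtain ⟨e⟩ := shiftL Q (M := V) j h1 h2 h3 (T_flat Q _) (T_flat Q _)
  have := T_flat Q (N := (Fin m → Q)) (M := V) j
  exact e.toEquiv.subsingleton

section
variable {E : Type u} [AddCommGroup E] [Module S E] [Module Q E] [IsScalarTower Q S E]

/-- every functional extends -/
def _root_.HW.PF {S : Type u} [CommRing S] {M F : Type u} [AddCommGroup M] [Module S M]
    [AddCommGroup F] [Module S F] (i : M →ₗ[S] F) : Prop :=
  ∀ φ : M →ₗ[S] S, ∃ ψ : F →ₗ[S] S, ψ ∘ₗ i = φ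

omit H [IsLocalRing S] in
theorem PF.ext {M F : Type u} [AddCommGroup M] [Module S M]
    [AddCommGroup F] [Module S F] {i : M →ₗ[S] F} (hi : PF i) {m : ℕ} (a : M →ₗ[S] (Fin m → S)) :
    ∃ b : F →ₗ[S] (Fin m → S), b ∘ₗ i = a := by
  choose ψ hψ using fun j => hi (LinearMap.proj j ∘ₗ a)
  refine ⟨LinearMap.pi ψ, ?_⟩
  apply LinearMap.ext; intro x
  funext j
  exact LinearMap.congr_fun (hψ j) x

omit H [IsLocalRing S] in
theorem MF.inj {M F : Type u} [AddCommGroup M] [Module S M]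
    [AddCommGroup F] [Module S F] {i : M →ₗ[S] F} (hi : PF i) (h : MF S M) : Injective i := by
  obtain ⟨m, a, d, p, h1, -⟩ := h
  obtain ⟨b, rfl⟩ := hi.ext a
  exact Injective.of_comp h1

theorem PD1_coker [Module.Finite S E] (h : PD1 Q E) {n : ℕ} {G : Type u} [AddCommGroup G] [Module S G]
    [Module Q G] [IsScalarTower Q S G] (i : E →ₗ[S] (Fin n → S)) (hi : PF i) (g : (Fin n → S) →ₗ[S] G)
    (hig : Exact i g) (hg : Surjective g) : PD1 Q G := by
  obtain ⟨m, a, d, p, h1, h2, h3, h4⟩ := PD1_MF H h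
  obtain ⟨b, hb⟩ := hi.ext a
  have hinj : Injective i := by
    have : Injective (b ∘ₗ i) := by rw [hb]; exact h1
    exact Injective.of_comp this
  let Ω := RS Q S (Rg d)
  let di : Ω →ₗ[S] (Fin m → S) := Rg.i d
  let dp : (Fin m → S) →ₗ[S] Ω := Rg.p d
  have hΩ : ∀ (V : Type u) [AddCommGroup V] [Module Q V], Subsingleton (T Q Ω V 2) := by
    intro V _ _
    obtain ⟨δ, e1, e2⟩ := les Q V 2 (f := di.restrictScalars Q) (g := p.restrictScalars Q)
      (Rg.inj d) (by
        intro x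
        refine (h3 x).trans ?_
        constructor
        · rintro ⟨y, rfl⟩; exact ⟨Rg.p d y, rfl⟩
        · rintro ⟨y, rfl⟩
          obtain ⟨z, rfl⟩ := Rg.surj d y
          exact ⟨z, rfl⟩) h4
    have t1 := (Tsymm_sub Q).1 (h V 1)
    have t2 := (Tsymm_sub Q).1 (PD1_free H m V 0)
    exact exact_mid_zero Q e2
  have hA : ∀ (V : Type u) [AddCommGroup V] [Module Q V], Injective (Tmap Q V 1 (a.restrictScalars Q)) := by
    intro V _ _
    obtain ⟨δ, e1, e2⟩ := les Q V 1 (f := a.restrictScalars Q) (g := dp.restrictScalars Q) h1 (by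
      intro x
      refine Iff.trans ?_ (h2 x)
      constructor
      · intro hx
        exact (congrArg (Rg.i d) hx).trans (map_zero (Rg.i d))
      · intro hx
        exact Rg.inj d (hx.trans (map_zero (Rg.i d)).symm)) (Rg.surj d)
    have := hΩ V
    exact exact_inj_of_subsingleton Q e2
  intro V _ _ j
  rw [Tsymm_sub]
  obtain ⟨δ, e1, e2⟩ := les Q V (j + 1) (f := i.restrictScalars Q) (g := g.restrictScalars Q) hinj hig hg
  have t2 := (Tsymm_sub Q).1 (PD1_free H n V j)
  have hδ := exact_inj_of_subsingleton Q e1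
  match j with
  | j + 1 =>
    have t3 := (Tsymm_sub Q).1 (h V j)
    exact hδ.subsingleton
  | 0 =>
    have hI : Injective (Tmap Q V 1 (i.restrictScalars Q)) := by
      have h5 := hA V
      have : a.restrictScalars Q = b.restrictScalars Q ∘ₗ i.restrictScalars Q := by rw [← hb]; rfl
      rw [this, Tmap_comp, LinearMap.coe_comp] at h5
      exact Injective.of_comp h5
    constructor
    intro x y
    apply hδ
    apply hI
    rw [e2.apply_apply_eq_zero, e2.apply_apply_eq_zero]
end

end

end HW

end

section

namespace HW

open TensorProduct Function

section

variable {Q : Type u} [CommRing Q] [IsLocalRing Q] [IsNoetherianRing Q]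
variable {S : Type u} [CommRing S] [IsLocalRing S] [Algebra Q S] {f : Q} (H : Hyp Q S f)

include H
theorem d0_PD1 (hF : FTD Q) (h0 : Soc S S) (X : Type u) [AddCommGroup X] [Module Q X]
    [Module.Finite Q X] : PD1 Q X := by
  obtain ⟨x, hx, hm⟩ := h0
  obtain ⟨g, hg⟩ := kk_emb (Q := Q) x hx (fun z hz => by
    rw [← algebraMap_smul S z x]; exact hm _ ((memQ H z).2 hz))
  exact fun V _ _ j => pdmax hF g hg 1 (fun V _ _ j => H.T_ge2 V j) X V j

theorem d1_PD2 (hF : FTD Q) (h1 : D1 S) (X : Type u) [AddCommGroup X] [Module Q X]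
    [Module.Finite Q X] (V : Type u) [AddCommGroup V] [Module Q V] (j : ℕ) :
    Subsingleton (T Q V X (j + 3)) := by
  obtain ⟨y, hy, hyr, x, hx, hm⟩ := h1
  obtain ⟨y, rfl⟩ := H.surj y
  have hmx : ∀ w : S, mx y S w = algebraMap Q S y * w := fun w => Algebra.smul_def _ _
  obtain ⟨g, hg⟩ := kk_emb (Q := Q) (Co.p (mx y S) x) (fun h => hx (by
      obtain ⟨w, hw⟩ := (Co.exact (mx y S) x).1 h
      exact ⟨w, by rw [← hw, hmx]⟩)) (fun z hz => by
    rw [← map_smul]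
    obtain ⟨w, hw⟩ := hm _ ((memQ H z).2 hz)
    exact (Co.exact (mx y S) _).2 ⟨w, by rw [hmx, ← hw, Algebra.smul_def]⟩)
  have hinj : Injective (mx y S) := by
    rw [injective_iff_map_eq_zero]
    intro w hw
    exact hyr w (by rw [← hmx, hw])
  refine pdmax hF g hg 2 (fun V _ _ j => ?_) X V j
  obtain ⟨δ, e1, e2⟩ := les Q V (j + 2) hinj (Co.exact _) (Co.surj _)
  have := H.T_ge2 V j
  have := H.T_ge2 V (j + 1)
  exact exact_mid_zero Q e1

theorem d0_prime (hF : FTD Q) (h0 : Soc S S) (q : Ideal S) (hq : q.IsPrime) :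
    q = IsLocalRing.maximalIdeal S := by
  apply le_antisymm (IsLocalRing.le_maximalIdeal hq.ne_top)
  intro z hz
  by_contra hzq
  obtain ⟨z, rfl⟩ := H.surj z
  have hfinQ : Module.Finite Q S := Module.Finite.of_surjective (Algebra.linearMap Q S) H.surj
  have hfq : Module.Finite Q (S ⧸ q) := Module.Finite.trans S _
  have hr : Injective (mx z (S ⧸ q)) := by
    rw [injective_iff_map_eq_zero]
    intro e he
    obtain ⟨e, rfl⟩ := Ideal.Quotient.mk_surjective e
    have h1 : algebraMap Q S z * e ∈ q := by
      rw [← Ideal.Quotient.eq_zero_iff_mem, map_mul, ← he, mx_apply, Algebra.smul_def]; rfl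
    rw [Ideal.Quotient.eq_zero_iff_mem]
    exact (hq.mem_or_mem h1).resolve_left hzq
  have := Ideal.Quotient.nontrivial_iff.2 hq.ne_top
  exact T1_ne H (E := S ⧸ q) (drop _ ((memQ H z).1 hz) hr 1 (d0_PD1 H hF h0 _ _ 0))

theorem d1_prime (hF : FTD Q) (h1 : D1 S) (s : S) (hs : ∀ x, s * x = 0 → x = 0) (q : Ideal S)
    (hq : q.IsPrime) (hsq : s ∈ q) : q = IsLocalRing.maximalIdeal S := by
  apply le_antisymm (IsLocalRing.le_maximalIdeal hq.ne_top)
  intro z hz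
  by_contra hzq
  have hfinQ : Module.Finite Q S := Module.Finite.of_surjective (Algebra.linearMap Q S) H.surj
  have hfq : Module.Finite Q (S ⧸ q) := Module.Finite.trans S _
  have hPD : PD1 Q (S ⧸ q) := PD1_of_reg H hz (fun e he => by
    obtain ⟨e, rfl⟩ := Ideal.Quotient.mk_surjective e
    have h1 : z * e ∈ q := by
      rw [← Ideal.Quotient.eq_zero_iff_mem, map_mul, ← he, Algebra.smul_def]; rfl
    rw [Ideal.Quotient.eq_zero_iff_mem]
    exact (hq.mem_or_mem h1).resolve_left hzq) (d1_PD2 H hF h1)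
  obtain ⟨s, rfl⟩ := H.surj s
  have hmx : ∀ w : S, mx s S w = algebraMap Q S s * w := fun w => Algebra.smul_def _ _
  have hinj : Injective (mx s S) := by
    rw [injective_iff_map_eq_zero]
    intro w hw
    exact hs w (by rw [← hmx, hw])
  obtain ⟨δ, e1, e2⟩ := les Q (S ⧸ q) 1 hinj (Co.exact _) (Co.surj _)
  have t1 := hPD (Co (mx s S)) 0
  have t2 : Injective (Tmap Q (S ⧸ q) 1 (mx s S)) := exact_inj_of_subsingleton Q e2
  have hz0 : ∀ x : T Q S (S ⧸ q) 1, x = 0 := by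
    intro x
    apply t2
    rw [Tmap_mx, mx_apply, map_zero]
    apply T_annR
    intro n
    obtain ⟨e, rfl⟩ := Ideal.Quotient.mk_surjective n
    rw [Algebra.smul_def]
    change Ideal.Quotient.mk q (algebraMap Q S s) * _ = 0
    rw [← map_mul, Ideal.Quotient.eq_zero_iff_mem]
    exact q.mul_mem_right _ hsq
  obtain ⟨e⟩ := H.T_one (S ⧸ q)
  have h1 : (1 : S ⧸ q) = 0 := by
    have h2 : (1 : S ⧸ q) ∈ LinearMap.ker (LinearMap.lsmul Q (S ⧸ q) f) := H.smul_zero _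
    have h3 := hz0 (e.symm ⟨1, h2⟩)
    have h4 := congrArg e h3
    rw [LinearEquiv.apply_symm_apply, map_zero] at h4
    exact congrArg Subtype.val h4
  have := Ideal.Quotient.nontrivial_iff.2 hq.ne_top
  exact one_ne_zero h1

/-- no socle in a Tor-independent factor -/
theorem soc_tensor (hF : FTD Q) {X N : Type u} [AddCommGroup X] [Module S X] [Module Q X]
    [IsScalarTower Q S X] [AddCommGroup N] [Module S N] [Module Q N] [IsScalarTower Q S N]
    [Module.Finite S X] [Module.Finite S N] [Nontrivial N]
    (hT : ∀ i, Subsingleton (T S X N (i + 1))) (hs : ¬ Soc S (X ⊗[S] N)) : ¬ Soc S X := by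
  rintro ⟨x, hx, hm⟩
  have hfinQ : Module.Finite Q S := Module.Finite.of_surjective (Algebra.linearMap Q S) H.surj
  have hNQ : Module.Finite Q N := Module.Finite.trans S N
  obtain ⟨g, hg⟩ := kk_emb (Q := Q) x hx (fun z hz => by
    rw [← algebraMap_smul S z x]; exact hm _ ((memQ H z).2 hz))
  obtain ⟨d, hd⟩ := hF N inferInstance
  obtain ⟨E, α, β, γ, hE, h1, h2, h3, h4⟩ := H.CR X N
  have hE0 : ∀ i, Subsingleton (T Q X N (i + 2)) := by
    intro i
    obtain ⟨e, he⟩ := hE (i + 1)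
    have := hT i
    have := hT (i + 1)
    have : Subsingleton (E (i + 1)) := exact_mid_zero S (h2 (i + 1))
    exact e.symm.toEquiv.subsingleton
  have key : ∀ e : ℕ, ∀ j, d ≤ j + 1 + e → Subsingleton (T Q (IsLocalRing.ResidueField Q) N (j + 1)) := by
    intro e
    induction e with
    | zero => intro j h; exact hd _ _ h
    | succ e ih =>
      intro j h
      have t1 := pdk (j + 1) N (ih (j + 1) (by omega)) (Co g) 0
      rw [Nat.zero_add] at t1
      obtain ⟨δ, e1, e2⟩ := les Q N (j + 1) hg (Co.exact _) (Co.surj _)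
      have hi : Injective (Tmap Q N (j + 1) g) := exact_inj_of_subsingleton Q e2
      match j with
      | j + 1 =>
        have := hE0 j
        exact hi.subsingleton
      | 0 =>
        obtain ⟨ε, hε⟩ := hE 0
        have hT1 := hT 1
        have hT0 := hT 0
        have hα : Injective (α 0) := exact_inj_of_subsingleton S (h1 0)
        have hα' : Surjective (α 0) := exact_surj_of_subsingleton S (h2 0)
        constructor
        have hall : ∀ a : T Q (IsLocalRing.ResidueField Q) N 1, a = 0 := by
          intro a
          by_contra ha
          obtain ⟨b, hb⟩ := hα' (ε.symm (Tmap Q N 1 g a))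
          refine hs ⟨b, ?_, ?_⟩
          · intro hb0
            change b = (0 : T S X N 0) at hb0
            rw [hb0, map_zero] at hb
            have := congrArg ε hb
            rw [AddEquiv.apply_symm_apply, map_zero] at this
            exact ha (hi (by rw [← this, map_zero]))
          · intro z hz
            obtain ⟨z, rfl⟩ := H.surj z
            have : α 0 (algebraMap Q S z • (b : T S X N 0)) = 0 := by
              rw [map_smul, hb]
              apply ε.injective
              rw [hε, AddEquiv.apply_symm_apply, ← map_smul, map_zero,
                T_ann N 1 (kk_ann ((memQ H z).1 hz)), map_zero]
            exact hα (this.trans (map_zero _).symm)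
        intro a b
        rw [hall a, hall b]
  exact T1_ne H (E := N) (key d 0 (by omega))

end

end HW

end

section

namespace HW

open TensorProduct Function

section

variable {S : Type u} [CommRing S] [IsLocalRing S]

section I
variable (hS : LHyp S)
include hS
theorem I0 (h0 : Soc S S) (E : Type u) [AddCommGroup E] [Module S E] [Module.Finite S E] : MF S E := by
  obtain ⟨Q, _, _, _, _, f, hF, H⟩ := hS
  have hfinQ : Module.Finite Q S := Module.Finite.of_surjective (Algebra.linearMap Q S) H.surj
  let _ : Module Q E := Module.compHom E (algebraMap Q S)
  have : IsScalarTower Q S E := IsScalarTower.of_algebraMap_smul (fun _ _ => rfl)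
  have hE : Module.Finite Q E := Module.Finite.trans S E
  exact PD1_MF H (d0_PD1 H hF h0 E)

theorem I0p (h0 : Soc S S) (q : Ideal S) (hq : q.IsPrime) : q = IsLocalRing.maximalIdeal S := by
  obtain ⟨Q, _, _, _, _, f, hF, H⟩ := hS
  exact d0_prime H hF h0 q hq

theorem I1p (h1 : D1 S) (s : S) (hs : ∀ x, s * x = 0 → x = 0) (q : Ideal S)
    (hq : q.IsPrime) (hsq : s ∈ q) : q = IsLocalRing.maximalIdeal S := by
  obtain ⟨Q, _, _, _, _, f, hF, H⟩ := hS
  exact d1_prime H hF h1 s hs q hq hsq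

theorem I1 (h1 : D1 S) (E : Type u) [AddCommGroup E] [Module S E] [Module.Finite S E]
    {z : S} (hz : z ∈ IsLocalRing.maximalIdeal S) (hr : ∀ e : E, z • e = 0 → e = 0) :
    MF S E ∧ ∀ {n : ℕ} {G : Type u} [AddCommGroup G] [Module S G]
    (i : E →ₗ[S] (Fin n → S)) (_ : PF i) (g : (Fin n → S) →ₗ[S] G)
    (_ : Exact i g) (_ : Surjective g), MF S G := by
  obtain ⟨Q, _, _, _, _, f, hF, H⟩ := hS
  have hfinQ : Module.Finite Q S := Module.Finite.of_surjective (Algebra.linearMap Q S) H.surj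
  let _ : Module Q E := Module.compHom E (algebraMap Q S)
  have : IsScalarTower Q S E := IsScalarTower.of_algebraMap_smul (fun _ _ => rfl)
  have hE : Module.Finite Q E := Module.Finite.trans S E
  have hPD : PD1 Q E := PD1_of_reg H hz hr (d1_PD2 H hF h1)
  refine ⟨PD1_MF H hPD, ?_⟩
  intro n G _ _ i hi g hig hg
  let _ : Module Q G := Module.compHom G (algebraMap Q S)
  have : IsScalarTower Q S G := IsScalarTower.of_algebraMap_smul (fun _ _ => rfl)
  have : Module.Finite S G := Module.Finite.of_surjective g hg
  exact PD1_MF H (PD1_coker H hPD i hi g hig hg)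

theorem I2 {X N : Type u} [AddCommGroup X] [Module S X] [AddCommGroup N] [Module S N]
    [Module.Finite S X] [Module.Finite S N] [Nontrivial N]
    (hT : ∀ i, Subsingleton (T S X N (i + 1))) (hs : ¬ Soc S (X ⊗[S] N)) : ¬ Soc S X := by
  obtain ⟨Q, _, _, _, _, f, hF, H⟩ := hS
  let _ : Module Q X := Module.compHom X (algebraMap Q S)
  have : IsScalarTower Q S X := IsScalarTower.of_algebraMap_smul (fun _ _ => rfl)
  let _ : Module Q N := Module.compHom N (algebraMap Q S)
  have : IsScalarTower Q S N := IsScalarTower.of_algebraMap_smul (fun _ _ => rfl)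
  exact soc_tensor H hF hT hs
end I

theorem four {B : Type u} [CommRing B] [IsNoetherianRing B] (L : LF B) {A₁ A₂ A₃ A₄ : Type u} [AddCommGroup A₁]
    [Module B A₁] [AddCommGroup A₂] [Module B A₂] [AddCommGroup A₃] [Module B A₃] [AddCommGroup A₄]
    [Module B A₄] [Module.Finite B A₂] [Module.Finite B A₃] {f : A₁ →ₗ[B] A₂}
    {g : A₂ →ₗ[B] A₃} {h : A₃ →ₗ[B] A₄} (hf : Injective f) (h1 : Exact f g) (h2 : Exact g h)
    (h3 : Surjective h) (c2 : L.C A₂) (c3 : L.C A₃) : L.l A₁ - L.l A₂ + L.l A₃ - L.l A₄ = 0 := by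
  have : Module.Finite B A₁ := fin_inj hf
  have a2 := (L.mid h1).2 c2
  have a3 := (L.mid h2).2 c3
  have : Module.Finite B A₄ := Module.Finite.of_surjective h h3
  have a1 := (L.rg_inj hf).2 ((L.rg_inj hf).1.2 ((L.mid h1).1.1 c2).1)
  have a4 := (L.rg_surj h3).2 ((L.mid h2).1.1 c3).2
  omega

variable [IsNoetherianRing S]

theorem dim1 {X N C : Type u} [AddCommGroup X] [Module S X] [AddCommGroup N] [Module S N]
    [AddCommGroup C] [Module S C] [Module.Finite S X] [Module.Finite S N] {r : ℕ}
    {ι : (Fin r → S) →ₗ[S] N} {π : N →ₗ[S] C} (hι : Injective ι) (hιπ : Exact ι π) (hπ : Surjective π)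
    {s : S} (hs : ∀ c : C, s • c = 0)
    (hsp : ∀ q : Ideal S, q.IsPrime → s ∈ q → q = IsLocalRing.maximalIdeal S)
    (hX : MF S X) (hT : Subsingleton (T S X N 1)) : ∀ i, Subsingleton (T S X N (i + 1)) := by
  obtain ⟨m, a, d, p, h1, h2, h3, h4⟩ := hX
  have hC : Module.Finite S C := Module.Finite.of_surjective π hπ
  have e1 : Exact (Rg.i d) p := by
    intro x
    refine (h3 x).trans ?_
    constructor
    · rintro ⟨y, rfl⟩; exact ⟨Rg.p d y, rfl⟩
    · rintro ⟨y, rfl⟩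
      obtain ⟨z, rfl⟩ := Rg.surj d y
      exact ⟨z, rfl⟩
  have e2 : Exact a (Rg.p d) := by
    intro x
    refine Iff.trans ?_ (h2 x)
    constructor
    · intro hx
      exact (congrArg (Rg.i d) hx).trans (map_zero (Rg.i d))
    · intro hx
      exact Rg.inj d (hx.trans (map_zero (Rg.i d)).symm)
  have sh1 : ∀ (Z : Type u) [AddCommGroup Z] [Module S Z] (i : ℕ),
      Nonempty (T S X Z (i + 2) ≃ₗ[S] T S (Rg d) Z (i + 1)) := fun Z _ _ i =>
    shiftL S (M := Z) i (Rg.inj d) e1 h4 (T_flat S _) (T_flat S _)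
  have per : ∀ (Z : Type u) [AddCommGroup Z] [Module S Z] (i : ℕ),
      Nonempty (T S X Z (i + 3) ≃ₗ[S] T S X Z (i + 1)) := fun Z _ _ i => by
    obtain ⟨u⟩ := sh1 Z (i + 1)
    obtain ⟨v⟩ := shiftL S (M := Z) i h1 e2 (Rg.surj d) (T_flat S _) (T_flat S _)
    exact ⟨u.trans v⟩
  have nc : ∀ j, Nonempty (T S X N (j + 2) ≃ₗ[S] T S X C (j + 2)) := by
    intro j
    obtain ⟨δ, l1, l2⟩ := les S X (j + 1) hι hιπ hπ
    have l3 := les_mid S X (j + 2) hι hιπ hπ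
    have f1 := T_flat S (N := Fin r → S) (M := X) j
    have f2 := T_flat S (N := Fin r → S) (M := X) (j + 1)
    obtain ⟨u⟩ := Tsymm S (j + 2) X N
    obtain ⟨v⟩ := Tsymm S (j + 2) C X
    exact ⟨(u.trans (LinearEquiv.ofBijective (Tmap S X (j + 2) π)
      ⟨exact_inj_of_subsingleton S l3, exact_surj_of_subsingleton S l1⟩)).trans v⟩
  let L := ((LFlen (Localization.AtPrime (IsLocalRing.maximalIdeal S))).bc : LF S)
  have hL : L.At (IsLocalRing.maximalIdeal S) := LFat_At _
  have LC : ∀ (Z : Type u) [AddCommGroup Z] [Module S Z] [Module.Finite S Z], (∀ z : Z, s • z = 0) →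
      L.C Z := by
    intro Z _ _ _ hz
    apply hL.fin Z inferInstance
    intro q hq hqm hqz
    apply hsp q hq
    by_contra hsq
    exact hqz (fun m => ⟨s, hsq, hz m⟩)
  have fT : ∀ (Z : Type u) [AddCommGroup Z] [Module S Z] [Module.Finite S Z] (i : ℕ),
    Module.Finite S (T S Z C i) := fun Z _ _ _ i => Tfinite (S := S) Z i C
  have LCT : ∀ (Z : Type u) [AddCommGroup Z] [Module S Z] [Module.Finite S Z] (i : ℕ), L.C (T S Z C i) :=
    fun Z _ _ _ i => by
      have := fT Z i
      exact LC _ (fun t => T_annR Z i hs t)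
  have lz : ∀ i, L.l (T S X C i) = 0 → Subsingleton (T S X C i) := by
    intro i h
    have hz := hL.zero _ (fT X i) (LCT X i) h
    constructor
    have : ∀ t : T S X C i, t = 0 := by
      intro t
      obtain ⟨r, hr, hrt⟩ := hz t
      have : IsUnit r := by
        by_contra h4; exact hr ((IsLocalRing.mem_maximalIdeal r).2 h4)
      exact (this.smul_eq_zero).1 hrt
    intro x y
    rw [this x, this y]
  have hl : L.l (T S X C 2) = L.l (T S X C 1) := by
    obtain ⟨u⟩ := sh1 C 0
    have := fT X 2
    have := fT (Rg d) 0
    have := fT (Fin m → S) 0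
    rw [(L.bij (f := u.toLinearMap) u.injective u.surjective).2 (LCT X 2)]
    have f1 := T_flat S (N := Fin m → S) (M := C) 0
    obtain ⟨δ, l1, l2⟩ := les S C 0 (Rg.inj d) e1 h4
    have k1 := four L (exact_inj_of_subsingleton S l1) l2 (les_mid S C 0 (Rg.inj d) e1 h4)
      (Tmap0_surj S C h4) (LCT _ 0) (LCT _ 0)
    obtain ⟨δ', l1', l2'⟩ := les S C 0 h1 e2 (Rg.surj d)
    have := fT X 0
    have k2 := four L (exact_inj_of_subsingleton S l1') l2' (les_mid S C 0 h1 e2 (Rg.surj d))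
      (Tmap0_surj S C (Rg.surj d)) (LCT _ 0) (LCT _ 0)
    have k0 : L.l (T S (Rg d) C (0 + 1)) = L.l (T S X C (0 + 1)) := by linarith
    exact k0
  obtain ⟨u⟩ := per N 0
  obtain ⟨v⟩ := nc 1
  obtain ⟨w⟩ := per C 0
  have h3' : Subsingleton (T S X N 3) := u.toEquiv.subsingleton
  have h3'' : Subsingleton (T S X C 3) := v.symm.toEquiv.subsingleton
  have h1' : Subsingleton (T S X C 1) := w.symm.toEquiv.subsingleton
  have h2' := lz 2 (hl.trans (L.l_zero h1'))
  obtain ⟨v'⟩ := nc 0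
  have h2'' : Subsingleton (T S X N 2) := v'.toEquiv.subsingleton
  intro i
  induction i using Nat.strong_induction_on with
  | _ i ih =>
    match i with
    | 0 => exact hT
    | 1 => exact h2''
    | i + 2 =>
      obtain ⟨x⟩ := per N i
      have := ih i (by omega)
      exact x.toEquiv.subsingleton

omit [IsNoetherianRing S] in
/-- depth lemma -/
theorem soc_d2 (h2 : D2 S) {W D : Type u} [AddCommGroup W] [Module S W] [AddCommGroup D] [Module S D]
    {a b : ℕ} (α : W →ₗ[S] (Fin a → S)) (hα : Injective α) (β : (Fin a → S) →ₗ[S] (Fin b → S))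
    (hαβ : Exact α β) (g : W →ₗ[S] D) (hD : ∀ y : S, (∀ x, y * x = 0 → x = 0) → ∀ x : D, y • x = 0 → x = 0)
    {Z : Type u} [AddCommGroup Z] [Module S Z] (π : D →ₗ[S] Z) (hπ : Surjective π) (hgπ : Exact g π)
    (hg : Injective g) :
    ¬ Soc S Z := by
  obtain ⟨y, hy, b', hb, hyr, hbr⟩ := h2
  rintro ⟨z, hz, hm⟩
  obtain ⟨x, rfl⟩ := hπ z
  obtain ⟨wy, hwy⟩ := (hgπ (y • x)).1 (by rw [map_smul, hm y hy])
  obtain ⟨wb, hwb⟩ := (hgπ (b' • x)).1 (by rw [map_smul, hm b' hb])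
  have e1 : b' • wy = y • wb := hg (by rw [map_smul, map_smul, hwy, hwb, smul_comm])
  have e2 : ∀ i, y ∣ α wy i := fun i => hbr _ ⟨α wb i, by
    have := congrFun (congrArg α e1) i
    simpa using this⟩
  choose v hv using e2
  have hv' : α wy = y • v := by funext i; exact hv i
  obtain ⟨w, hw⟩ := (hαβ v).1 (by
    have h5 : β (α wy) = 0 := hαβ.apply_apply_eq_zero wy
    rw [hv', map_smul] at h5
    funext i
    exact hyr _ (congrFun h5 i))
  have e3 : wy = y • w := hα (by rw [hv', map_smul, hw])
  apply hz
  have e4 : y • (x - g w) = 0 := by rw [smul_sub, ← hwy, e3, map_smul, sub_self]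
  have e5 := hD y hyr _ e4
  rw [sub_eq_zero] at e5
  rw [e5]; exact hgπ.apply_apply_eq_zero w

end

end HW

end

section

namespace HW

open TensorProduct Function

section soc
variable {S : Type u} [CommRing S] [IsNoetherianRing S]

/-- associated prime, concretely -/
theorem exists_ass (X : Type u) [AddCommGroup X] [Module S X] [Nontrivial X] :
    ∃ (q : Ideal S) (_ : q.IsPrime) (x : X), ∀ r : S, r • x = 0 ↔ r ∈ q := by
  obtain ⟨q, hq⟩ := associatedPrimes.nonempty S X
  obtain ⟨h1, x, hx⟩ := (isAssociatedPrime_iff).1 hq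
  refine ⟨q, h1, x, fun r => ?_⟩
  rw [hx, Submodule.mem_colon_singleton, Submodule.mem_bot]

theorem exists_reg [IsLocalRing S] (X : Type u) [AddCommGroup X] [Module S X] [Module.Finite S X]
    (h : ¬ Soc S X) : ∃ y ∈ IsLocalRing.maximalIdeal S, ∀ x : X, y • x = 0 → x = 0 := by
  by_contra hy
  push Not at hy
  have hsub : ((IsLocalRing.maximalIdeal S : Ideal S) : Set S) ⊆ ⋃ p ∈ associatedPrimes S X, (p : Set S) := by
    intro y hym
    rw [biUnion_associatedPrimes_eq_compl_regular]
    obtain ⟨x, hx, hx0⟩ := hy y hym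
    intro hreg
    exact hx0 (hreg.right_eq_zero_of_smul hx)
  rw [Ideal.subset_union_prime_finite (f := fun p => p) (associatedPrimes.finite S X) ⊤ ⊤
    (fun i hi _ _ => IsAssociatedPrime.isPrime hi)] at hsub
  obtain ⟨p, hp, hle⟩ := hsub
  obtain ⟨h1, x, hx⟩ := (isAssociatedPrime_iff).1 hp
  apply h
  refine ⟨x, ?_, fun z hz => ?_⟩
  · rintro rfl
    apply h1.ne_top
    rw [hx, eq_top_iff]
    intro r _
    rw [Submodule.mem_colon_singleton, smul_zero]
    exact Submodule.zero_mem _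
  · have := hle hz
    rw [hx, Submodule.mem_colon_singleton, Submodule.mem_bot] at this
    exact this

theorem tri [IsLocalRing S] : Soc S S ∨ D1 S ∨ D2 S := by
  by_cases h0 : Soc S S
  · exact Or.inl h0
  right
  obtain ⟨y, hy, hyr⟩ := exists_reg S h0
  by_cases h1 : Soc S (S ⧸ Ideal.span {y})
  · left
    obtain ⟨x, hx, hz⟩ := h1
    obtain ⟨x, rfl⟩ := Ideal.Quotient.mk_surjective x
    refine ⟨y, hy, hyr, x, ?_, ?_⟩
    · rwa [Ne, Ideal.Quotient.eq_zero_iff_mem, Ideal.mem_span_singleton] at hx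
    · intro z hzm
      have := hz z hzm
      rw [Algebra.smul_def, Ideal.Quotient.algebraMap_eq, ← map_mul, Ideal.Quotient.eq_zero_iff_mem,
        Ideal.mem_span_singleton] at this
      exact this
  · right
    obtain ⟨b, hb, hbr⟩ := exists_reg (S ⧸ Ideal.span {y}) h1
    refine ⟨y, hy, b, hb, hyr, fun x hx => ?_⟩
    have := hbr (Ideal.Quotient.mk _ x) (by
      rw [Algebra.smul_def, Ideal.Quotient.algebraMap_eq, ← map_mul, Ideal.Quotient.eq_zero_iff_mem,
        Ideal.mem_span_singleton]
      exact hx)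
    rwa [Ideal.Quotient.eq_zero_iff_mem, Ideal.mem_span_singleton] at this

/-- elements dying in the localization -/
theorem mk_eq_zero (q : Ideal S) [q.IsPrime] {X : Type u} [AddCommGroup X] [Module S X] (x : X) :
    (1 : Localization.AtPrime q) ⊗ₜ[S] x = 0 ↔ ∃ r ∉ q, r • x = 0 := by
  have hl : IsLocalizedModule q.primeCompl (TensorProduct.mk S (Localization.AtPrime q) X 1) :=
    inferInstance
  have h := IsLocalizedModule.eq_zero_iff q.primeCompl (TensorProduct.mk S (Localization.AtPrime q) X 1) (m := x)
  refine Iff.trans h ?_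
  constructor
  · rintro ⟨c, hc⟩; exact ⟨c, c.2, hc⟩
  · rintro ⟨r, hr, hx⟩; exact ⟨⟨r, hr⟩, hx⟩

theorem exists_soc (X : Type u) [AddCommGroup X] [Module S X] [Nontrivial X] :
    ∃ (q : Ideal S) (_ : q.IsPrime), Soc (Localization.AtPrime q) (Localization.AtPrime q ⊗[S] X) := by
  obtain ⟨q, hq, x, hx⟩ := exists_ass (S := S) X
  refine ⟨q, hq, 1 ⊗ₜ x, ?_, ?_⟩
  · intro h
    obtain ⟨r, hr, hrx⟩ := (mk_eq_zero q x).1 h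
    exact hr ((hx r).1 hrx)
  · intro z hz
    rw [← Localization.AtPrime.map_eq_maximalIdeal] at hz
    have hle : q.map (algebraMap S (Localization.AtPrime q)) ≤
        (⊥ : Submodule (Localization.AtPrime q) (Localization.AtPrime q ⊗[S] X)).colon {(1 : Localization.AtPrime q) ⊗ₜ[S] x} := by
      rw [Ideal.map_le_iff_le_comap]
      intro r hr
      rw [Ideal.mem_comap, Submodule.mem_colon_singleton, Submodule.mem_bot, algebraMap_smul,
        ← TensorProduct.tmul_smul, (hx r).2 hr, TensorProduct.tmul_zero]
    have := hle hz
    rwa [Submodule.mem_colon_singleton, Submodule.mem_bot] at this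

/-- a finite module over the localization comes from below -/
theorem loc_descend (q : Ideal S) [q.IsPrime] (X : Type u) [AddCommGroup X]
    [Module (Localization.AtPrime q) X] [Module.Finite (Localization.AtPrime q) X] :
    ∃ (X₀ : Type u) (_ : AddCommGroup X₀) (_ : Module S X₀), Module.Finite S X₀ ∧
      Nonempty (Localization.AtPrime q ⊗[S] X₀ ≃ₗ[Localization.AtPrime q] X) := by
  let _ : Module S X := Module.compHom X (algebraMap S (Localization.AtPrime q))
  have : IsScalarTower S (Localization.AtPrime q) X := IsScalarTower.of_algebraMap_smul (fun _ _ => rfl)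
  obtain ⟨s, hs⟩ := Module.Finite.fg_top (R := Localization.AtPrime q) (M := X)
  let X₀ : Submodule S X := Submodule.span S (s : Set X)
  have hid : IsLocalizedModule q.primeCompl (LinearMap.id : X →ₗ[S] X) :=
    isLocalizedModule_id q.primeCompl X (Localization.AtPrime q)
  have hX₀ : IsLocalizedModule q.primeCompl X₀.subtype := by
    refine ⟨hid.map_units, ?_, ?_⟩
    · intro y
      have hy : y ∈ Submodule.localized' (Localization.AtPrime q) q.primeCompl (LinearMap.id : X →ₗ[S] X) X₀ := by
        rw [Submodule.localized'_span]
        simp [hs]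
      obtain ⟨m, hm, c, hc⟩ := hy
      refine ⟨(⟨m, hm⟩, c), ?_⟩
      have := (IsLocalizedModule.mk'_eq_iff (f := (LinearMap.id : X →ₗ[S] X))).1 hc
      exact this.symm
    · intro a b hab
      exact ⟨1, by rw [Subtype.ext hab]⟩
  refine ⟨X₀, inferInstance, inferInstance, Module.Finite.span_of_finite S s.finite_toSet, ?_⟩
  have hb := IsLocalizedModule.isBaseChange q.primeCompl (Localization.AtPrime q) X₀.subtype
  exact ⟨hb.equiv⟩

theorem FTD_loc (hF : FTD S) (q : Ideal S) [q.IsPrime] : FTD (Localization.AtPrime q) := by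
  intro X _ _ hX
  obtain ⟨X₀, _, _, hX₀, ⟨e⟩⟩ := loc_descend q X
  obtain ⟨d, hd⟩ := hF X₀ hX₀
  refine ⟨d, fun N _ _ j hj => ?_⟩
  let _ : Module S N := Module.compHom N (algebraMap S (Localization.AtPrime q))
  have : IsScalarTower S (Localization.AtPrime q) N := IsScalarTower.of_algebraMap_smul (fun _ _ => rfl)
  have h1 := Tor_bc (S := S) (Localization.AtPrime q) N j X₀ (fun i => T_flat S i)
  have h2 : Subsingleton (T (Localization.AtPrime q) N (Localization.AtPrime q ⊗[S] X₀) j) :=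
    h1.sub.2 (hd N j hj)
  obtain ⟨e2⟩ := TequivR (Localization.AtPrime q) (N := N) j e
  exact e2.symm.toEquiv.subsingleton

end soc
end HW

end

section

namespace HW

open TensorProduct Function

theorem PF.bc {S : Type u} [CommRing S] [IsNoetherianRing S] (S' : Type u) [CommRing S'] [Algebra S S']
    [Module.Flat S S'] {M F : Type u} [AddCommGroup M] [Module S M] [AddCommGroup F] [Module S F]
    [Module.Finite S M] {i : M →ₗ[S] F} (hi : PF i) : PF (i.baseChange S') := by
  intro φ
  have : Module.FinitePresentation S M := Module.finitePresentation_of_finite S M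
  let φ0 : M →ₗ[S] S' := (φ.restrictScalars S) ∘ₗ (TensorProduct.mk S S' M 1)
  obtain ⟨k, a, y, hay⟩ := Module.Flat.exists_factorization_of_finitePresentation φ0
  let e := Finsupp.linearEquivFunOnFinite S S (Fin k)
  obtain ⟨b, hb⟩ := hi.ext (e.toLinearMap ∘ₗ a)
  refine ⟨(y ∘ₗ e.symm.toLinearMap ∘ₗ b).liftBaseChange S', ?_⟩
  apply TensorProduct.AlgebraTensorModule.ext
  intro s m
  have h1 : b (i m) = e (a m) := LinearMap.congr_fun hb m
  have h2 : φ0 m = y (a m) := LinearMap.congr_fun hay m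
  have h3 : φ (s ⊗ₜ m) = s * φ0 m := by
    have : s ⊗ₜ[S] m = s • ((1 : S') ⊗ₜ[S] m) := by rw [TensorProduct.smul_tmul', smul_eq_mul, mul_one]
    rw [this, map_smul]; rfl
  rw [LinearMap.comp_apply, LinearMap.baseChange_tmul, LinearMap.liftBaseChange_tmul, h3, h2]
  simp [h1]

theorem PF.post {S : Type u} [CommRing S] {M F G : Type u} [AddCommGroup M] [Module S M] [AddCommGroup F] [Module S F]
    [AddCommGroup G] [Module S G] {i : M →ₗ[S] F} (hi : PF i) (e : F ≃ₗ[S] G) :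
    PF (e.toLinearMap ∘ₗ i) := by
  intro φ
  obtain ⟨ψ, hψ⟩ := hi φ
  refine ⟨ψ ∘ₗ e.symm.toLinearMap, ?_⟩
  rw [← hψ]
  ext x
  simp

/-- existence of a dualizing pushforward -/
theorem PF.exists {S : Type u} [CommRing S] [IsNoetherianRing S] (M : Type u) [AddCommGroup M] [Module S M]
    [Module.Finite S M] : ∃ (n : ℕ) (i : M →ₗ[S] (Fin n → S)), PF i := by
  obtain ⟨n, p, hp⟩ := Module.Finite.exists_fin' S (M →ₗ[S] S)
  refine ⟨n, LinearMap.pi (fun j => p (Pi.single j 1)), fun φ => ?_⟩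
  obtain ⟨c, rfl⟩ := hp φ
  refine ⟨∑ j, c j • LinearMap.proj j, ?_⟩
  have : p c = ∑ j, c j • p (Pi.single j 1) := by
    conv_lhs => rw [← LinearMap.sum_single_apply (fun _ => S) c]
    rw [map_sum]
    refine Finset.sum_congr rfl fun j _ => ?_
    rw [← map_smul]
    congr 1
    ext k
    simp [Pi.single_apply]
  rw [this]
  ext x
  simp [LinearMap.sum_apply]

theorem LHyp_loc {Q R : Type u} [CommRing Q] [CommRing R] [Algebra Q R] [IsNoetherianRing Q] {f : Q}
    (hF : FTD Q) (H : Hyp Q R f) (q : Ideal R) [q.IsPrime] : LHyp (Localization.AtPrime q) := by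
  let P : Ideal Q := q.comap (algebraMap Q R)
  let φ : Localization.AtPrime P →+* Localization.AtPrime q := Localization.localRingHom P q (algebraMap Q R) rfl
  let _ : Algebra (Localization.AtPrime P) (Localization.AtPrime q) := φ.toAlgebra
  refine ⟨Localization.AtPrime P, inferInstance, inferInstance,
    IsLocalization.isNoetherianRing P.primeCompl _ inferInstance, inferInstance, algebraMap _ _ f, FTD_loc hF P, ?_, ?_, ?_⟩
  · intro z
    obtain ⟨x, s, rfl⟩ := IsLocalization.exists_mk'_eq q.primeCompl z
    obtain ⟨x, rfl⟩ := H.surj x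
    obtain ⟨s, hs⟩ := s
    obtain ⟨s, rfl⟩ := H.surj s
    refine ⟨IsLocalization.mk' _ x (⟨s, hs⟩ : P.primeCompl), ?_⟩
    exact Localization.localRingHom_mk' P q (algebraMap Q R) rfl x ⟨s, hs⟩
  · intro z
    obtain ⟨x, s, rfl⟩ := IsLocalization.exists_mk'_eq P.primeCompl z
    have e : algebraMap (Localization.AtPrime P) (Localization.AtPrime q) (IsLocalization.mk' _ x s) = _ :=
      Localization.localRingHom_mk' P q (algebraMap Q R) rfl x s
    rw [e, IsLocalization.mk'_eq_zero_iff]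
    constructor
    · rintro ⟨⟨t, ht⟩, h⟩
      obtain ⟨t, rfl⟩ := H.surj t
      rw [← map_mul, H.ker] at h
      obtain ⟨c, hc⟩ := h
      refine ⟨IsLocalization.mk' _ c (⟨t, ht⟩ * s : P.primeCompl), ?_⟩
      rw [← IsLocalization.mk'_one (M := P.primeCompl), ← IsLocalization.mk'_mul, IsLocalization.mk'_eq_iff_eq]
      simp only [one_mul, ← hc, Submonoid.coe_mul]
      ring_nf
    · rintro ⟨c, hc⟩
      obtain ⟨c, t, rfl⟩ := IsLocalization.exists_mk'_eq P.primeCompl c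
      rw [← IsLocalization.mk'_one (M := P.primeCompl), ← IsLocalization.mk'_mul, IsLocalization.mk'_eq_iff_eq] at hc
      obtain ⟨w, hw⟩ := (IsLocalization.eq_iff_exists P.primeCompl _).1 hc
      refine ⟨⟨algebraMap Q R (w * t), (w * t).2⟩, ?_⟩
      simp only [← map_mul]
      rw [H.ker]
      refine ⟨w * s * c, ?_⟩
      simp only [Submonoid.coe_mul, Submonoid.coe_one, one_mul] at hw ⊢
      linear_combination hw
  · intro z hz
    obtain ⟨x, s, rfl⟩ := IsLocalization.exists_mk'_eq P.primeCompl z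
    rw [← IsLocalization.mk'_one (M := P.primeCompl), ← IsLocalization.mk'_mul, IsLocalization.mk'_eq_zero_iff] at hz
    rw [IsLocalization.mk'_eq_zero_iff]
    obtain ⟨w, hw⟩ := hz
    exact ⟨w, H.nzd _ (by linear_combination hw)⟩

end HW

end

section

namespace HW

open TensorProduct Function

section defs
variable (S : Type u) [CommRing S]

/-- pushforward sequence -/
def PFX (M M₁ : Type u) [AddCommGroup M] [Module S M] [AddCommGroup M₁] [Module S M₁] : Prop :=
  ∃ (a : ℕ) (i : M →ₗ[S] (Fin a → S)) (g : (Fin a → S) →ₗ[S] M₁),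
    PF i ∧ Injective i ∧ Exact i g ∧ Surjective g

/-- generic freeness of rank `r` -/
def RK (N : Type u) [AddCommGroup N] [Module S N] (r : ℕ) : Prop :=
  ∃ (ι : (Fin r → S) →ₗ[S] N) (s : S), Injective ι ∧ (∀ x, s * x = 0 → x = 0) ∧
    ∀ n, ∃ v, ι v = s • n

/-- second syzygy -/
def SSX (W : Type u) [AddCommGroup W] [Module S W] : Prop :=
  ∃ (c d : ℕ) (α : W →ₗ[S] (Fin c → S)) (β : (Fin c → S) →ₗ[S] (Fin d → S)),
    Injective α ∧ Exact α β

variable {S}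

theorem SSX.congr {W W' : Type u} [AddCommGroup W] [Module S W] [AddCommGroup W'] [Module S W']
    (e : W' ≃ₗ[S] W) (h : SSX S W) : SSX S W' := by
  obtain ⟨c, d, α, β, h1, h2⟩ := h
  refine ⟨c, d, α ∘ₗ e.toLinearMap, β, ?_, ?_⟩
  · exact h1.comp e.injective
  · intro x
    rw [h2 x]
    constructor
    · rintro ⟨w, rfl⟩; exact ⟨e.symm w, by simp⟩
    · rintro ⟨w, rfl⟩; exact ⟨e w, rfl⟩

variable (S' : Type u) [CommRing S'] [Algebra S S'] [Module.Flat S S']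

theorem exact_conj {A B C A' B' C' : Type u} [AddCommGroup A] [Module S A] [AddCommGroup B] [Module S B]
    [AddCommGroup C] [Module S C] [AddCommGroup B'] [Module S B']
    {f : A →ₗ[S] B} {g : B →ₗ[S] C} (h : Exact f g) (e : B ≃ₗ[S] B') :
    Exact (e.toLinearMap ∘ₗ f) (g ∘ₗ e.symm.toLinearMap) := by
  intro x
  have := h (e.symm x)
  refine this.trans ?_
  constructor
  · rintro ⟨y, hy⟩; exact ⟨y, by simp [hy]⟩
  · rintro ⟨y, rfl⟩; exact ⟨y, by simp⟩

/-- free modules base change -/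
abbrev bcE (n : ℕ) : S' ⊗[S] (Fin n → S) ≃ₗ[S'] (Fin n → S') := TensorProduct.piScalarRight S S' S' (Fin n)

theorem nzd_flat {s : S} (hs : ∀ x, s * x = 0 → x = 0) (x : S') (hx : algebraMap S S' s * x = 0) : x = 0 := by
  have h1 : Injective (LinearMap.mulLeft S s) := by
    rw [injective_iff_map_eq_zero]; exact hs
  have h2 := Module.Flat.lTensor_preserves_injective_linearMap (M := S') _ h1
  have h3 : LinearMap.lTensor S' (LinearMap.mulLeft S s) (x ⊗ₜ 1) = 0 := by
    rw [LinearMap.lTensor_tmul, LinearMap.mulLeft_apply, mul_one, ← mul_one s, ← smul_eq_mul,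
      ← TensorProduct.smul_tmul, Algebra.smul_def, hx, TensorProduct.zero_tmul]
  have h4 := h2 (h3.trans (map_zero _).symm)
  have := congrArg (TensorProduct.rid S S') h4
  simpa using this

theorem PFX.bc [IsNoetherianRing S] {M M₁ : Type u} [AddCommGroup M] [Module S M] [AddCommGroup M₁] [Module S M₁]
    [Module.Finite S M] (h : PFX S M M₁) : PFX S' (S' ⊗[S] M) (S' ⊗[S] M₁) := by
  obtain ⟨a, i, g, h1, h2, h3, h4⟩ := h
  refine ⟨a, (bcE S' a).toLinearMap ∘ₗ i.baseChange S', g.baseChange S' ∘ₗ (bcE S' a).symm.toLinearMap,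
    (h1.bc S').post _, ?_, exact_conj (A' := PUnit) (C' := PUnit) (baseChange_exact_flat S' h3) _, ?_⟩
  · exact (bcE S' a).injective.comp (baseChange_inj_flat S' h2)
  · exact (baseChange_surj S' h4).comp (bcE S' a).symm.surjective

theorem RK.bc {N : Type u} [AddCommGroup N] [Module S N] {r : ℕ} (h : RK S N r) : RK S' (S' ⊗[S] N) r := by
  obtain ⟨ι, s, h1, h2, h3⟩ := h
  refine ⟨ι.baseChange S' ∘ₗ (bcE S' r).symm.toLinearMap, algebraMap S S' s, ?_, nzd_flat S' h2, ?_⟩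
  · exact (baseChange_inj_flat S' h1).comp (bcE S' r).symm.injective
  · intro n
    suffices ∃ w, ι.baseChange S' w = algebraMap S S' s • n by
      obtain ⟨w, hw⟩ := this
      exact ⟨bcE S' r w, by rw [LinearMap.comp_apply, LinearEquiv.coe_coe, LinearEquiv.symm_apply_apply, hw]⟩
    induction n with
    | zero => exact ⟨0, by simp⟩
    | add x y hx hy =>
      obtain ⟨a, ha⟩ := hx
      obtain ⟨b, hb⟩ := hy
      exact ⟨a + b, by rw [map_add, ha, hb, smul_add]⟩
    | tmul t n =>
      obtain ⟨v, hv⟩ := h3 n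
      exact ⟨t ⊗ₜ v, by rw [LinearMap.baseChange_tmul, hv, algebraMap_smul, TensorProduct.tmul_smul]⟩

theorem SSX.bc {W : Type u} [AddCommGroup W] [Module S W] (h : SSX S W) : SSX S' (S' ⊗[S] W) := by
  obtain ⟨c, d, α, β, h1, h2⟩ := h
  refine ⟨c, d, (bcE S' c).toLinearMap ∘ₗ α.baseChange S',
    (bcE S' d).toLinearMap ∘ₗ β.baseChange S' ∘ₗ (bcE S' c).symm.toLinearMap, ?_, ?_⟩
  · exact (bcE S' c).injective.comp (baseChange_inj_flat S' h1)
  · have := exact_conj (A' := PUnit) (C' := PUnit) (baseChange_exact_flat S' h2) (bcE S' c)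
    intro x
    refine Iff.trans ?_ (this x)
    exact (bcE S' d).map_eq_zero_iff

end defs

section step1
variable {S : Type u} [CommRing S] {M M₁ N N₁ : Type u} [AddCommGroup M] [Module S M]
  [AddCommGroup M₁] [Module S M₁] [AddCommGroup N] [Module S N] [AddCommGroup N₁] [Module S N₁] {r : ℕ}

theorem nzd_pi {c : ℕ} {s : S} (hs : ∀ x, s * x = 0 → x = 0) (x : Fin c → S) (hx : s • x = 0) : x = 0 := by
  funext j
  exact hs _ (congrFun hx j)

theorem s1a (hM : PFX S M M₁) (hN : RK S N r) (hW : SSX S (M ⊗[S] N)) : Subsingleton (T S M₁ N 1) := by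
  obtain ⟨a, i, g, h1, h2, h3, h4⟩ := hM
  obtain ⟨ι, s, k1, k2, k3⟩ := hN
  obtain ⟨c, d, α, β, w1, w2⟩ := hW
  obtain ⟨e⟩ := shiftL1 S (M := N) h2 h3 h4 (T_flat S 0)
  have hann : ∀ t : T S N M₁ 1, s • t = 0 := by
    have l3 := les_mid S M₁ 1 k1 (Co.exact ι) (Co.surj ι)
    have f1 := T_flat S (N := Fin r → S) (M := M₁) 0
    have hi := exact_inj_of_subsingleton S l3
    intro t
    apply hi
    rw [map_smul, map_zero]
    apply T_ann
    intro x
    obtain ⟨n, rfl⟩ := Co.surj ι x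
    obtain ⟨v, hv⟩ := k3 n
    rw [← map_smul, ← hv]
    exact (Co.exact ι).apply_apply_eq_zero v
  obtain ⟨e'⟩ := Tsymm S 1 M₁ N
  have key : ∀ t : T S M₁ N 1, t = 0 := by
    intro t
    have ht : s • t = 0 := e'.injective (by rw [map_smul, hann, map_zero])
    apply e.injective
    rw [map_zero]
    apply Subtype.ext
    apply w1
    rw [Submodule.coe_zero, map_zero]
    apply nzd_pi k2
    rw [← map_smul, ← Submodule.coe_smul, ← map_smul, ht, map_zero, Submodule.coe_zero, map_zero]
  exact ⟨fun x y => by rw [key x, key y]⟩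

theorem rk_theta {N : Type u} [AddCommGroup N] [Module S N] {ι : (Fin r → S) →ₗ[S] N} {s : S} (k1 : Injective ι)
    (k3 : ∀ n, ∃ v, ι v = s • n) : ∃ θ : N →ₗ[S] (Fin r → S), ∀ n, ι (θ n) = s • n := by
  choose v hv using k3
  exact ⟨{ toFun := v
           map_add' := fun x y => k1 (by rw [map_add, hv, hv, hv, smul_add])
           map_smul' := fun c x => k1 (by rw [map_smul, hv, hv, RingHom.id_apply, smul_comm]) }, hv⟩

theorem s1b (hM : RK S N r) (hN : PFX S N N₁) (hW : SSX S (M ⊗[S] N)) : Subsingleton (T S M N₁ 1) := by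
  obtain ⟨a, i, g, h1, h2, h3, h4⟩ := hN
  obtain ⟨ι, s, k1, k2, k3⟩ := hM
  obtain ⟨c, d, α, β, w1, w2⟩ := hW
  obtain ⟨e⟩ := shiftR1' S (N := M) h2 h3 h4 (T_flat S 0)
  obtain ⟨θ, hθ⟩ := rk_theta k1 k3
  obtain ⟨Θ, hΘ⟩ := h1.ext θ
  have key : ∀ t : M ⊗[S] N, LinearMap.lTensor M i t = 0 → t = 0 := by
    intro t ht
    apply w1
    rw [map_zero]
    apply nzd_pi k2
    rw [← map_smul]
    have h5 : LinearMap.lTensor M (ι ∘ₗ Θ) (LinearMap.lTensor M i t) = s • t := by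
      rw [← LinearMap.comp_apply, ← LinearMap.lTensor_comp, LinearMap.comp_assoc, hΘ]
      have : ι ∘ₗ θ = s • LinearMap.id := LinearMap.ext hθ
      rw [this, LinearMap.lTensor_smul, LinearMap.lTensor_id]
      rfl
    rw [← h5, ht, map_zero, map_zero]
  have : Subsingleton (LinearMap.ker (LinearMap.lTensor M i)) :=
    ⟨fun x y => Subtype.ext ((key x x.2).trans (key y y.2).symm)⟩
  exact e.toEquiv.subsingleton

theorem s1c {s : S} {ι : (Fin r → S) →ₗ[S] N} (k1 : Injective ι)
    (k3 : ∀ n, ∃ v, ι v = s • n) (hN : PFX S N N₁) (j : ℕ) (t : T S M N₁ (j + 1)) : s • t = 0 := by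
  obtain ⟨a, i, g, h1, h2, h3, h4⟩ := hN
  obtain ⟨θ, hθ⟩ := rk_theta k1 k3
  obtain ⟨Θ, hΘ⟩ := h1.ext θ
  obtain ⟨e⟩ := Tsymm S (j + 1) M N₁
  let D : (Fin a → S) →ₗ[S] (Fin a → S) := s • LinearMap.id - i ∘ₗ ι ∘ₗ Θ
  have h0 : ∀ n, D (i n) = 0 := by
    intro n
    have : Θ (i n) = θ n := LinearMap.congr_fun hΘ n
    simp [D, this, hθ]
  -- lift to `N₁`
  have hker : LinearMap.ker g ≤ LinearMap.ker D := by
    intro x hx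
    obtain ⟨n, rfl⟩ := (h3 x).1 hx
    exact h0 n
  let hh : N₁ →ₗ[S] (Fin a → S) := (LinearMap.ker g).liftQ D hker ∘ₗ (g.quotKerEquivOfSurjective h4).symm.toLinearMap
  have hhg : ∀ x, hh (g x) = s • x - i (ι (Θ x)) := by
    intro x
    have : (g.quotKerEquivOfSurjective h4).symm (g x) = Submodule.Quotient.mk x := by
      rw [LinearEquiv.symm_apply_eq]; rfl
    simp only [hh, LinearMap.comp_apply, LinearEquiv.coe_coe, this]
    rfl
  have hgh : g ∘ₗ hh = s • LinearMap.id := by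
    apply LinearMap.ext
    intro y
    obtain ⟨x, rfl⟩ := h4 y
    rw [LinearMap.comp_apply, hhg, map_sub, map_smul, h3.apply_apply_eq_zero, sub_zero]
    rfl
  apply e.injective
  rw [map_smul, map_zero]
  have f1 := T_flat S (N := Fin a → S) (M := M) j
  have h5 : Tmap S M (j + 1) (g ∘ₗ hh) (e t) = s • e t := by
    rw [hgh, Tmap_smul, Tmap_id]; rfl
  rw [← h5, Tmap_comp, LinearMap.comp_apply, Subsingleton.elim (Tmap S M (j + 1) hh (e t)) 0, map_zero]

theorem MF.per {X : Type u} [AddCommGroup X] [Module S X] (hX : MF S X) (Z : Type u) [AddCommGroup Z] [Module S Z] (i : ℕ) :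
    Nonempty (T S X Z (i + 3) ≃ₗ[S] T S X Z (i + 1)) := by
  obtain ⟨m, a, d, p, h1, h2, h3, h4⟩ := hX
  have e1 : Exact (Rg.i d) p := by
    intro x
    refine (h3 x).trans ?_
    constructor
    · rintro ⟨y, rfl⟩; exact ⟨Rg.p d y, rfl⟩
    · rintro ⟨y, rfl⟩
      obtain ⟨z, rfl⟩ := Rg.surj d y
      exact ⟨z, rfl⟩
  have e2 : Exact a (Rg.p d) := by
    intro x
    refine Iff.trans ?_ (h2 x)
    constructor
    · intro hx
      exact (congrArg (Rg.i d) hx).trans (map_zero (Rg.i d))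
    · intro hx
      exact Rg.inj d (hx.trans (map_zero (Rg.i d)).symm)
  obtain ⟨u⟩ := shiftL S (M := Z) (i + 1) (Rg.inj d) e1 h4 (T_flat S _) (T_flat S _)
  obtain ⟨v⟩ := shiftL S (M := Z) i h1 e2 (Rg.surj d) (T_flat S _) (T_flat S _)
  exact ⟨u.trans v⟩

theorem Soc.map [IsLocalRing S] {f : M →ₗ[S] N} (hf : Injective f) (h : Soc S M) : Soc S N := by
  obtain ⟨x, hx, hz⟩ := h
  exact ⟨f x, fun h => hx (hf (h.trans (map_zero f).symm)), fun z hm => by rw [← map_smul, hz z hm, map_zero]⟩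

theorem Soc.pi [IsLocalRing S] {c : ℕ} (h : Soc S (Fin c → S)) : Soc S S := by
  obtain ⟨x, hx, hz⟩ := h
  obtain ⟨j, hj⟩ := Function.ne_iff.1 hx
  exact ⟨x j, hj, fun z hm => congrFun (hz z hm) j⟩

theorem nzd_free {F : Type u} [AddCommGroup F] [Module S F] [Module.Free S F] {s : S} (hs : ∀ x, s * x = 0 → x = 0)
    (x : F) (hx : s • x = 0) : x = 0 := by
  have b := Module.Free.chooseBasis S F
  apply b.repr.injective
  rw [map_zero]
  ext j
  apply hs
  have := congrArg (fun y => b.repr y j) hx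
  simpa using this

end step1

section loc
variable {S : Type u} [CommRing S] [IsLocalRing S] [IsNoetherianRing S] (hS : LHyp S) {M M₁ N N₁ : Type u} [AddCommGroup M] [Module S M]
  [AddCommGroup M₁] [Module S M₁] [AddCommGroup N] [Module S N] [AddCommGroup N₁] [Module S N₁] {r : ℕ}
  [Module.Finite S M] [Module.Finite S N]
include hS

theorem locMF (h1 : D1 S) (hM : PFX S M M₁) : MF S M₁ := by
  obtain ⟨a, i, g, m1, m2, m3, m4⟩ := hM
  have h1' := h1
  obtain ⟨y, hy, hyr, -⟩ := h1'
  refine (I1 hS h1 M hy ?_).2 i m1 g m3 m4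
  intro e he
  apply m2
  rw [map_zero]
  apply nzd_pi hyr
  rw [← map_smul, he, map_zero]

theorem locD1 (h1 : D1 S) (hM : PFX S M M₁) (hN : RK S N r) (hT : Subsingleton (T S M₁ N 1)) (j : ℕ) :
    Subsingleton (T S M₁ N (j + 1)) := by
  have hMF := locMF hS h1 hM
  have : Module.Finite S M₁ := by
    obtain ⟨a, i, g, m1, m2, m3, m4⟩ := hM
    exact Module.Finite.of_surjective g m4
  obtain ⟨ι, s, k1, k2, k3⟩ := hN
  refine dim1 k1 (Co.exact ι) (Co.surj ι) (s := s) ?_ (fun q hq hsq => I1p hS h1 s k2 q hq hsq) hMF hT j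
  intro x
  obtain ⟨n, rfl⟩ := Co.surj ι x
  obtain ⟨v, hv⟩ := k3 n
  rw [← map_smul, ← hv]
  exact (Co.exact ι).apply_apply_eq_zero v

theorem locX (hM : PFX S M M₁) (hN : RK S N r) (hN' : PFX S N N₁) (hW : SSX S (M ⊗[S] N)) :
    ¬ Soc S (T S M₁ N₁ 1) := by
  have a1 := s1a hM hN hW
  have a2 := s1b hN hN' hW
  intro hsoc
  rcases tri (S := S) with h | h | h
  · obtain ⟨ι, s, k1, k2, k3⟩ := hN
    obtain ⟨t, ht, -⟩ := hsoc
    have hst := s1c (M := M₁) k1 k3 hN' 0 t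
    have hsm : s ∈ IsLocalRing.maximalIdeal S := by
      rw [IsLocalRing.mem_maximalIdeal]
      intro hu
      exact ht (hu.smul_eq_zero.1 hst)
    obtain ⟨x, hx, hz⟩ := h
    exact hx (k2 x (hz s hsm))
  · obtain ⟨e⟩ := (locMF hS h hM).per N₁ 0
    have h3 : Subsingleton (T S M₁ N₁ 3) := by
      have := locD1 hS h hM hN a1 1
      obtain ⟨b, j, g', n1, n2, n3, n4⟩ := hN'
      obtain ⟨e⟩ := shiftR' S (N := M₁) 1 n2 n3 n4 (fun i => T_flat S i)
      exact e.toEquiv.subsingleton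
    have := e.symm.toEquiv.subsingleton
    obtain ⟨t, ht, -⟩ := hsoc
    exact ht (Subsingleton.elim _ _)
  · obtain ⟨b, j, g', n1, n2, n3, n4⟩ := hN'
    obtain ⟨a, i, g, m1, m2, m3, m4⟩ := hM
    obtain ⟨c, d, α, β, w1, w2⟩ := hW
    obtain ⟨e⟩ := shiftL1 S (M := N₁) m2 m3 m4 (T_flat S 0)
    have hs1 : Soc S (M ⊗[S] N₁) :=
      hsoc.map (f := (LinearMap.ker (LinearMap.rTensor N₁ i)).subtype ∘ₗ e.toLinearMap)
        ((Submodule.injective_subtype _).comp e.injective)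
    obtain ⟨e2⟩ := shiftR1' S (N := M) n2 n3 n4 (T_flat S 0)
    have : Subsingleton (LinearMap.ker (LinearMap.lTensor M j)) := e2.symm.toEquiv.subsingleton
    refine soc_d2 h α w1 β w2 (LinearMap.lTensor M j) ?_ (LinearMap.lTensor M g')
      (LinearMap.lTensor_surjective M n4) (lTensor_exact M n3 n4) ?_ hs1
    · intro y hy x hx
      have hinj : Injective (LinearMap.rTensor (Fin b → S) i) := Module.Flat.rTensor_preserves_injective_linearMap _ m2
      apply hinj
      rw [map_zero]
      apply nzd_free hy
      rw [← map_smul, hx, map_zero]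
    · rw [← LinearMap.ker_eq_bot]
      exact Submodule.eq_bot_of_subsingleton

theorem locR (hM : PFX S M M₁) (hN : RK S N r) (hN' : PFX S N N₁) (hW : SSX S (M ⊗[S] N)) [Nontrivial N]
    (hT : ∀ i, Subsingleton (T S M₁ N (i + 1))) {F : Type u} [AddCommGroup F] [Module S F] {i₁ : M₁ →ₗ[S] F}
    (hi : PF i₁) {K : Type u} [AddCommGroup K] [Module S K] {k : K →ₗ[S] M₁} (hk : Injective k) (hki : Exact k i₁) :
    ¬ Soc S K := by
  have hfin : Module.Finite S M₁ := by
    obtain ⟨a, i, g, m1, m2, m3, m4⟩ := hM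
    exact Module.Finite.of_surjective g m4
  intro hsoc
  have hMF : ¬ MF S M₁ := by
    intro h
    have hinj := h.inj hi
    obtain ⟨x, hx, -⟩ := hsoc
    apply hx
    apply hk
    apply hinj
    rw [hki.apply_apply_eq_zero, map_zero, map_zero]
  rcases tri (S := S) with h | h | h
  · exact hMF (I0 hS h M₁)
  · exact hMF (locMF hS h hM)
  · have hs1 : Soc S M₁ := hsoc.map hk
    refine I2 hS hT ?_ hs1
    obtain ⟨a, i, g, m1, m2, m3, m4⟩ := hM
    obtain ⟨b, j, g', n1, n2, n3, n4⟩ := hN'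
    obtain ⟨c, d, α, β, w1, w2⟩ := hW
    obtain ⟨e2⟩ := shiftL1 S (M := N) m2 m3 m4 (T_flat S 0)
    have := hT 0
    have : Subsingleton (LinearMap.ker (LinearMap.rTensor N i)) := e2.symm.toEquiv.subsingleton
    refine soc_d2 h α w1 β w2 (LinearMap.rTensor N i) ?_ (LinearMap.rTensor N g)
      (LinearMap.rTensor_surjective N m4) (rTensor_exact N m3 m4) ?_
    · intro y hy x hx
      have hinj : Injective (LinearMap.lTensor (Fin a → S) j) := Module.Flat.lTensor_preserves_injective_linearMap _ n2
      apply hinj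
      rw [map_zero]
      apply nzd_free hy
      rw [← map_smul, hx, map_zero]
    · rw [← LinearMap.ker_eq_bot]
      exact Submodule.eq_bot_of_subsingleton

end loc
end HW

end

section

namespace HW

open TensorProduct Function

theorem exists_min_prime {R : Type u} [CommRing R] [IsNoetherianRing R] (P : Ideal R → Prop)
    (h : ∃ p : Ideal R, p.IsPrime ∧ P p) :
    ∃ p : Ideal R, p.IsPrime ∧ P p ∧ ∀ q : Ideal R, q.IsPrime → q ≤ p → P q → q = p := by
  let s : Set (Ideal R) := {p | p.IsPrime ∧ P p}
  have hs : s.Nonempty := h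
  have hwf : WellFounded (fun a b : Ideal R => a.height < b.height) := InvImage.wf Ideal.height wellFounded_lt
  obtain ⟨p, hp, hmin⟩ := hwf.has_min s hs
  refine ⟨p, hp.1, hp.2, fun q hq hle hPq => ?_⟩
  by_contra hne
  have := hp.1
  have hlt := Ideal.height_strict_mono_of_isPrime_of_isPrime (lt_of_le_of_ne hle hne)
  exact hmin q ⟨hq, hPq⟩ hlt

theorem tensor_zero {R A B : Type u} [CommRing R] [IsLocalRing R] [AddCommGroup A] [Module R A]
    [AddCommGroup B] [Module R B] [Module.Finite R A] [Module.Finite R B] (h : Subsingleton (A ⊗[R] B)) :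
    Subsingleton A ∨ Subsingleton B := by
  by_cases hB : Subsingleton B
  · exact Or.inr hB
  left
  let k := IsLocalRing.ResidueField R
  have h1 : ¬ Subsingleton (k ⊗[R] B) := fun h => hB ((IsLocalRing.subsingleton_tensorProduct (M := B)).1 h)
  rw [not_subsingleton_iff_nontrivial] at h1
  obtain ⟨v, hv⟩ := exists_ne (0 : k ⊗[R] B)
  obtain ⟨φ, hφ⟩ := Module.Projective.exists_dual_eq_one k hv
  let ψ : B →ₗ[R] k := φ.restrictScalars R ∘ₗ TensorProduct.mk R k B 1
  have hψ : Surjective ψ := by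
    intro c
    obtain ⟨b, hb⟩ := TensorProduct.mk_surjective R B k IsLocalRing.residue_surjective (c • v)
    refine ⟨b, ?_⟩
    change φ (TensorProduct.mk R k B 1 b) = c
    rw [hb, map_smul, hφ, smul_eq_mul, mul_one]
  have h2 : Surjective ((TensorProduct.comm R A k).toLinearMap ∘ₗ LinearMap.lTensor A ψ) :=
    (TensorProduct.comm R A k).surjective.comp (LinearMap.lTensor_surjective A hψ)
  have h3 : Subsingleton (k ⊗[R] A) := h2.subsingleton
  exact IsLocalRing.subsingleton_tensorProduct.1 h3

section glob
variable {Q R : Type u} [CommRing Q] [CommRing R] [Algebra Q R] {f : Q} [IsNoetherianRing Q]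
  [IsNoetherianRing R] [IsLocalRing R] (H : Hyp Q R f) (hF : FTD Q)
  (hL : ∀ p : Ideal R, p.IsPrime → ∃ L : LF Q, Rig Q L ∧ (L.res H.surj).At p)
  {M M₁ N N₁ : Type u} [AddCommGroup M] [Module R M]
  [AddCommGroup M₁] [Module R M₁] [AddCommGroup N] [Module R N] [AddCommGroup N₁] [Module R N₁] {r : ℕ}
  [Module.Finite R M] [Module.Finite R N]

include H hF in
theorem gX (hM : PFX R M M₁) (hN : RK R N r) (hN' : PFX R N N₁) (hW : SSX R (M ⊗[R] N)) :
    Subsingleton (T R M₁ N₁ 1) := by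
  by_contra hne
  rw [not_subsingleton_iff_nontrivial] at hne
  obtain ⟨q, hq, hsoc⟩ := exists_soc (S := R) (T R M₁ N₁ 1)
  have : IsNoetherianRing (Localization.AtPrime q) := IsLocalization.isNoetherianRing q.primeCompl _ inferInstance
  obtain ⟨e⟩ := Tor_flat_bc (S := R) (Localization.AtPrime q) M₁ 1 N₁
  refine locX (LHyp_loc hF H q) (hM.bc (Localization.AtPrime q)) (hN.bc (Localization.AtPrime q))
    (hN'.bc (Localization.AtPrime q)) ((hW.bc (Localization.AtPrime q)).congr
      (AlgebraTensorModule.distribBaseChange R (Localization.AtPrime q) M N).symm)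
    (hsoc.map (f := e.symm.toLinearMap) e.symm.injective)

include hF hL in
theorem gT (hM : PFX R M M₁) (hN : RK R N r) (hN' : PFX R N N₁) (hW : SSX R (M ⊗[R] N)) (i : ℕ) :
    Subsingleton (T R M₁ N (i + 1)) ∧ Subsingleton (T R M N (i + 1)) := by
  have a1 := s1a hM hN hW
  have a2 := s1b hN hN' hW
  have a3 := gX H hF hM hN hN' hW
  obtain ⟨a, im, g, m1, m2, m3, m4⟩ := hM
  obtain ⟨b, j, g', n1, n2, n3, n4⟩ := hN'
  have fM : Module.Finite R M₁ := Module.Finite.of_surjective g m4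
  have fN : Module.Finite R N₁ := Module.Finite.of_surjective g' n4
  have a4 : Subsingleton (T R M₁ N₁ 2) := by
    obtain ⟨e⟩ := shiftL R (M := N₁) 0 m2 m3 m4 (T_flat R _) (T_flat R _)
    exact e.toEquiv.subsingleton
  have fT : ∀ i, Module.Finite R (T R M₁ N₁ i) := fun i => Tfinite (S := R) M₁ i N₁
  have all : ∀ i, Subsingleton (T R M₁ N₁ (i + 1)) := by
    by_contra hne
    push Not at hne
    obtain ⟨i₀, hi₀⟩ := hne
    obtain ⟨p, hp, ⟨i₁, hi₁⟩, hmin⟩ := exists_min_prime (fun p : Ideal R => ∃ i, ¬ Zp p (T R M₁ N₁ (i + 1)))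
      ⟨IsLocalRing.maximalIdeal R, inferInstance, i₀, fun hz => by
        have : ∀ t : T R M₁ N₁ (i₀ + 1), t = 0 := by
          intro t
          obtain ⟨r, hr, hrt⟩ := hz t
          have : IsUnit r := by
            by_contra h4; exact hr ((IsLocalRing.mem_maximalIdeal r).2 h4)
          exact (this.smul_eq_zero).1 hrt
        rw [← not_subsingleton_iff_nontrivial] at hi₀
        exact hi₀ ⟨fun x y => by rw [this x, this y]⟩⟩
    obtain ⟨L, hrig, hat⟩ := hL p hp
    have hC : ∀ i, (L.res H.surj).C (T R M₁ N₁ (i + 1)) := fun i =>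
      hat.fin _ (fT _) (fun q hq hle hz => hmin q hq hle ⟨i, hz⟩)
    have := H1 H hrig M₁ N₁ fM fN hC (LF.l_zero _ a3) (LF.l_zero _ a4) i₁
    exact hi₁ (hat.zero _ (fT _) (hC _) this)
  have b1 : ∀ i, Subsingleton (T R M₁ N (i + 1)) := by
    intro i
    obtain ⟨e⟩ := shiftR' R (N := M₁) i n2 n3 n4 (fun i => T_flat R i)
    have := all (i + 1)
    exact e.symm.toEquiv.subsingleton
  refine ⟨b1 i, ?_⟩
  obtain ⟨e⟩ := shiftL R (M := N) i m2 m3 m4 (T_flat R _) (T_flat R _)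
  have := b1 (i + 1)
  exact e.symm.toEquiv.subsingleton

include hF hL in
theorem gR (hM : PFX R M M₁) (hN : RK R N r) (hN' : PFX R N N₁) (hW : SSX R (M ⊗[R] N)) [hnt : Nontrivial N]
    {F : Type u} [AddCommGroup F] [Module R F] {i₁ : M₁ →ₗ[R] F} (hi : PF i₁) : Injective i₁ := by
  have hTT := gT H hF hL hM hN hN' hW
  have fM : Module.Finite R M₁ := by
    obtain ⟨a, i, g, m1, m2, m3, m4⟩ := hM
    exact Module.Finite.of_surjective g m4
  have hr : r ≠ 0 := by
    rintro rfl
    obtain ⟨ι, s, k1, k2, k3⟩ := hN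
    obtain ⟨b, j, g', n1, n2, n3, n4⟩ := hN'
    obtain ⟨n, hn⟩ := exists_ne (0 : N)
    apply hn
    apply n2
    rw [map_zero]
    apply nzd_pi k2
    obtain ⟨v, hv⟩ := k3 n
    rw [← map_smul, ← hv, Subsingleton.elim v 0, map_zero, map_zero]
  have key : Subsingleton (Ke i₁) := by
    by_contra hne
    rw [not_subsingleton_iff_nontrivial] at hne
    obtain ⟨q, hq, hsoc⟩ := exists_soc (S := R) (Ke i₁)
    have : IsNoetherianRing (Localization.AtPrime q) := IsLocalization.isNoetherianRing q.primeCompl _ inferInstance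
    have hrk := hN.bc (Localization.AtPrime q)
    have : Nontrivial (Localization.AtPrime q ⊗[R] N) := by
      obtain ⟨ι, s, k1, -⟩ := hrk
      have : Nonempty (Fin r) := ⟨⟨0, Nat.pos_of_ne_zero hr⟩⟩
      exact k1.nontrivial
    refine locR (LHyp_loc hF H q) (hM.bc (Localization.AtPrime q)) hrk
      (hN'.bc (Localization.AtPrime q)) ((hW.bc (Localization.AtPrime q)).congr
      (AlgebraTensorModule.distribBaseChange R (Localization.AtPrime q) M N).symm) ?_ (hi.bc (Localization.AtPrime q))
      (baseChange_inj_flat (Localization.AtPrime q) (Ke.inj i₁)) (baseChange_exact_flat _ (Ke.exact i₁)) hsoc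
    intro i
    obtain ⟨e⟩ := Tor_flat_bc (S := R) (Localization.AtPrime q) M₁ (i + 1) N
    have := (hTT i).1
    exact e.toEquiv.subsingleton
  rw [injective_iff_map_eq_zero]
  intro x hx
  obtain ⟨y, rfl⟩ := Ke.ex i₁ x hx
  rw [Subsingleton.elim y 0, map_zero]

include H hF in
theorem Zd0 {X : Type u} [AddCommGroup X] [Module R X] {c : ℕ} (α : X →ₗ[R] (Fin c → R)) (hα : Injective α)
    (h : ∀ (q : Ideal R) (_ : q.IsPrime), Soc (Localization.AtPrime q) (Localization.AtPrime q) → Zp q X) : Subsingleton X := by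
  by_contra hne
  rw [not_subsingleton_iff_nontrivial] at hne
  obtain ⟨q, hq, hsoc⟩ := exists_soc (S := R) X
  have h1 : Soc (Localization.AtPrime q) (Localization.AtPrime q) :=
    ((hsoc.map (baseChange_inj_flat (Localization.AtPrime q) hα)).map (bcE (Localization.AtPrime q) c).injective
      (f := (bcE (Localization.AtPrime q) c).toLinearMap)).pi
  have h2 := (Zp_iff q X).1 (h q hq h1)
  obtain ⟨x, hx, -⟩ := hsoc
  exact hx (Subsingleton.elim _ _)

include H hF in
/-- kernels of pushforwards vanish at depth zero primes -/
theorem Zker {n : ℕ} {i : M →ₗ[R] (Fin n → R)} (hi : PF i) (q : Ideal R) (hq : q.IsPrime)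
    (h0 : Soc (Localization.AtPrime q) (Localization.AtPrime q)) : Zp q (Ke i) := by
  have hMF := I0 (LHyp_loc hF H q) h0 (Localization.AtPrime q ⊗[R] M)
  have hinj := hMF.inj (hi.bc (Localization.AtPrime q))
  rw [Zp_iff]
  have h1 := baseChange_inj_flat (Localization.AtPrime q) (Ke.inj i)
  have h2 := baseChange_exact_flat (Localization.AtPrime q) (Ke.exact i)
  have : ∀ x : Localization.AtPrime q ⊗[R] (Ke i), x = 0 := by
    intro x
    apply h1
    apply hinj
    rw [h2.apply_apply_eq_zero, map_zero, map_zero]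
  exact ⟨fun x y => by rw [this x, this y]⟩

theorem Zp.tensor {q : Ideal R} (hq : q.IsPrime) (h : Zp q M) : Zp q (M ⊗[R] N) := by
  intro t
  induction t with
  | zero => exact ⟨1, fun h => hq.ne_top ((Ideal.eq_top_iff_one _).2 h), smul_zero _⟩
  | tmul m n =>
    obtain ⟨r, hr, h⟩ := h m
    exact ⟨r, hr, by rw [TensorProduct.smul_tmul', h, TensorProduct.zero_tmul]⟩
  | add x y hx hy =>
    obtain ⟨r, hr, h⟩ := hx
    obtain ⟨s, hs, h'⟩ := hy
    refine ⟨r * s, fun h => (hq.mem_or_mem h).elim hr hs, ?_⟩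
    rw [smul_add, mul_comm, mul_smul, h, smul_zero, mul_comm, mul_smul, h', smul_zero, add_zero]

theorem Rg_pf {n : ℕ} {i : M →ₗ[R] (Fin n → R)} (hi : PF i) : PFX R (Rg i) (Co (Rg.i i)) := by
  refine ⟨n, Rg.i i, Co.p _, ?_, Rg.inj i, Co.exact _, Co.surj _⟩
  intro φ
  obtain ⟨ψ, hψ⟩ := hi (φ ∘ₗ Rg.p i)
  refine ⟨ψ, ?_⟩
  apply LinearMap.ext
  intro x
  obtain ⟨y, rfl⟩ := Rg.surj i x
  exact LinearMap.congr_fun hψ y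

theorem Rg_ex {n : ℕ} (i : M →ₗ[R] (Fin n → R)) : Exact (Ke.i i) (Rg.p i) := by
  intro x
  refine Iff.trans ?_ (Ke.exact i x)
  constructor
  · intro hx
    exact (congrArg (Rg.i i) hx).trans (map_zero (Rg.i i))
  · intro hx
    exact Rg.inj i (hx.trans (map_zero (Rg.i i)).symm)

include H hF hL in
theorem gMain [Nontrivial M] [Nontrivial N] (hN : RK R N r) (hW : SSX R (M ⊗[R] N)) {a b : ℕ}
    {i : M →ₗ[R] (Fin a → R)} (hi : PF i) {j : N →ₗ[R] (Fin b → R)} (hj : PF j) :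
    Injective i ∧ Injective j := by
  obtain ⟨c, d, α, β, w1, w2⟩ := id hW
  have fM' : Module.Finite R (Rg i) := Module.Finite.of_surjective _ (Rg.surj i)
  have fN' : Module.Finite R (Rg j) := Module.Finite.of_surjective _ (Rg.surj j)
  have fKM : Module.Finite R (Ke i) := Ke.finite i
  have fKN : Module.Finite R (Ke j) := Ke.finite j
  -- first tensor
  have z1 : LinearMap.rTensor N (Ke.i i) = 0 := by
    have hs : Subsingleton (Rg (LinearMap.rTensor N (Ke.i i))) := by
      refine Zd0 H hF (α ∘ₗ Rg.i _) (w1.comp (Rg.inj _)) ?_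
      intro q hq h0
      exact (Zp.tensor hq (Zker H hF hi q hq h0)).surj (Rg.surj _)
    apply LinearMap.ext
    intro x
    rw [← Rg.ip, Subsingleton.elim (Rg.p _ x) 0, map_zero]; rfl
  have e1 : Bijective (LinearMap.rTensor N (Rg.p i)) := by
    refine ⟨?_, LinearMap.rTensor_surjective N (Rg.surj i)⟩
    rw [injective_iff_map_eq_zero]
    intro x hx
    obtain ⟨y, rfl⟩ := (rTensor_exact N (Rg_ex i) (Rg.surj i) x).1 hx
    rw [z1]; rfl
  let E1 : Rg i ⊗[R] N ≃ₗ[R] M ⊗[R] N := (LinearEquiv.ofBijective _ e1).symm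
  have z2 : LinearMap.lTensor (Rg i) (Ke.i j) = 0 := by
    have hs : Subsingleton (Rg (LinearMap.lTensor (Rg i) (Ke.i j))) := by
      refine Zd0 H hF (α ∘ₗ E1.toLinearMap ∘ₗ Rg.i _) (w1.comp (E1.injective.comp (Rg.inj _))) ?_
      intro q hq h0
      have : Zp q (Rg i ⊗[R] Ke j) := (Zp.tensor (N := Rg i) hq (Zker H hF hj q hq h0)).surj
        (f := (TensorProduct.comm R (Ke j) (Rg i)).toLinearMap) (TensorProduct.comm R (Ke j) (Rg i)).surjective
      exact this.surj (Rg.surj _)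
    apply LinearMap.ext
    intro x
    rw [← Rg.ip, Subsingleton.elim (Rg.p _ x) 0, map_zero]; rfl
  have e2 : Bijective (LinearMap.lTensor (Rg i) (Rg.p j)) := by
    refine ⟨?_, LinearMap.lTensor_surjective _ (Rg.surj j)⟩
    rw [injective_iff_map_eq_zero]
    intro x hx
    obtain ⟨y, rfl⟩ := (lTensor_exact (Rg i) (Rg_ex j) (Rg.surj j) x).1 hx
    rw [z2]; rfl
  let E2 : Rg i ⊗[R] Rg j ≃ₗ[R] Rg i ⊗[R] N := (LinearEquiv.ofBijective _ e2).symm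
  have hW' : SSX R (Rg i ⊗[R] Rg j) := hW.congr (E2.trans E1)
  have hN' : RK R (Rg j) r := by
    obtain ⟨ι, s, k1, k2, k3⟩ := hN
    refine ⟨Rg.p j ∘ₗ ι, s, ?_, k2, ?_⟩
    · have hs : Subsingleton (Ke (Rg.p j ∘ₗ ι)) := by
        refine Zd0 H hF (Ke.i (Rg.p j ∘ₗ ι)) (Ke.inj _) ?_
        intro q hq h0 x
        obtain ⟨y, hy⟩ := (Rg_ex j (ι (Ke.i _ x))).1 (Ke.apply _ x)
        obtain ⟨t, ht, hty⟩ := Zker H hF hj q hq h0 y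
        refine ⟨t, ht, Ke.inj _ (k1 ?_)⟩
        rw [map_smul, map_smul, ← hy, ← map_smul, hty, map_zero, map_zero, map_zero]
      rw [injective_iff_map_eq_zero]
      intro x hx
      obtain ⟨y, rfl⟩ := Ke.ex _ x hx
      rw [Subsingleton.elim y 0, map_zero]
    · intro n
      obtain ⟨n, rfl⟩ := Rg.surj j n
      obtain ⟨v, hv⟩ := k3 n
      exact ⟨v, by rw [LinearMap.comp_apply, hv, map_smul]⟩
  have hT := (gT H hF hL (Rg_pf hi) hN' (Rg_pf hj) hW' 0).2
  have ntM' : Nontrivial (Rg i) := by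
    by_contra hne
    rw [not_nontrivial_iff_subsingleton] at hne
    have : Subsingleton (M ⊗[R] N) := E1.symm.toEquiv.subsingleton
    replace this := tensor_zero this
    rcases this with h | h
    · exact not_subsingleton M h
    · exact not_subsingleton N h
  have KN : Subsingleton (Ke j) := by
    have hT' : Subsingleton (T R (Rg j) (Rg i) 1) := (Tsymm_sub R).1 hT
    obtain ⟨δ, l1, l2⟩ := les R (Rg i) 0 (Ke.inj j) (Rg_ex j) (Rg.surj j)
    have hinj : Injective (Tmap R (Rg i) 0 (Ke.i j)) := exact_inj_of_subsingleton R l2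
    have hz : ∀ x, Tmap R (Rg i) 0 (Ke.i j) x = 0 := by
      intro x
      have : ∀ y : Ke j ⊗[R] Rg i, LinearMap.rTensor (Rg i) (Ke.i j) y = 0 := by
        intro y
        have h1 := LinearMap.congr_fun z2 (TensorProduct.comm R _ _ y)
        rw [← LinearMap.comm_comp_rTensor_comp_comm_eq] at h1
        simpa using h1
      exact this x
    have : Subsingleton (Ke j ⊗[R] Rg i) :=
      ⟨fun x y => hinj ((hz x).trans (hz y).symm)⟩
    replace this := tensor_zero this
    exact this.resolve_right (not_subsingleton _)
  have jinj : Injective j := by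
    rw [injective_iff_map_eq_zero]
    intro x hx
    obtain ⟨y, rfl⟩ := Ke.ex _ x hx
    rw [Subsingleton.elim y 0, map_zero]
  have KM : Subsingleton (Ke i) := by
    have hb : Bijective (Rg.p j) := by
      refine ⟨?_, Rg.surj j⟩
      have : Injective (Rg.i j ∘ₗ Rg.p j) := jinj
      rw [LinearMap.coe_comp] at this
      exact Injective.of_comp this
    obtain ⟨e⟩ := TequivR R (N := Rg i) 1 (LinearEquiv.ofBijective _ hb)
    have hT' : Subsingleton (T R (Rg i) N 1) := e.toEquiv.subsingleton
    obtain ⟨δ, l1, l2⟩ := les R N 0 (Ke.inj i) (Rg_ex i) (Rg.surj i)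
    have hinj : Injective (Tmap R N 0 (Ke.i i)) := exact_inj_of_subsingleton R l2
    have hz : ∀ x, Tmap R N 0 (Ke.i i) x = 0 := fun x => LinearMap.congr_fun z1 x
    have : Subsingleton (Ke i ⊗[R] N) :=
      ⟨fun x y => hinj ((hz x).trans (hz y).symm)⟩
    replace this := tensor_zero this
    exact this.resolve_right (not_subsingleton _)
  refine ⟨?_, jinj⟩
  rw [injective_iff_map_eq_zero]
  intro x hx
  obtain ⟨y, rfl⟩ := Ke.ex _ x hx
  rw [Subsingleton.elim y 0, map_zero]

include H hF hL in
/-- the main theorem over a nice hypersurface -/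
theorem gFin [Nontrivial M] [Nontrivial N] (hN : RK R N r) (hW : SSX R (M ⊗[R] N)) {a b : ℕ}
    {i : M →ₗ[R] (Fin a → R)} (hi : PF i) {j : N →ₗ[R] (Fin b → R)} (hj : PF j) :
    Injective i ∧ Injective j ∧ (∀ n, Subsingleton (T R M N (n + 1))) ∧
      ∀ (G : Type u) [AddCommGroup G] [Module R G] (g : (Fin a → R) →ₗ[R] G), Exact i g → Surjective g →
        ∀ (F : Type u) [AddCommGroup F] [Module R F] (i₁ : G →ₗ[R] F), PF i₁ → Injective i₁ := by
  obtain ⟨h1, h2⟩ := gMain H hF hL hN hW hi hj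
  have pN : PFX R N (Co j) := ⟨b, j, Co.p j, hj, h2, Co.exact j, Co.surj j⟩
  have pM : PFX R M (Co i) := ⟨a, i, Co.p i, hi, h1, Co.exact i, Co.surj i⟩
  refine ⟨h1, h2, fun n => (gT H hF hL pM hN pN hW n).2, ?_⟩
  intro G _ _ g hg hgs F _ _ i₁ hi₁
  exact gR H hF hL ⟨a, i, g, hi, h1, hg, hgs⟩ hN pN hW hi₁

end glob
end HW

end

section

namespace HW

open TensorProduct Function
open scoped Pointwise

section regf
variable {B : Type u} [CommRing B]

theorem qst_equiv (x : B) (D : Type u) [AddCommGroup D] [Module B D] :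
    Nonempty (Co (mx x D) ≃ₗ[B] QuotSMulTop x D) := by
  refine co_equiv (g := Submodule.mkQ _) ?_ (Submodule.mkQ_surjective _)
  intro y
  rw [Submodule.mkQ_apply, Submodule.Quotient.mk_eq_zero, Submodule.mem_smul_pointwise_iff_exists]
  constructor
  · rintro ⟨b, -, rfl⟩; exact ⟨b, rfl⟩
  · rintro ⟨b, rfl⟩; exact ⟨b, trivial, rfl⟩

theorem RegF_iff (xs : List B) : ∀ (D : Type u) [AddCommGroup D] [Module B D],
    RegF xs D ↔ IsWeaklyRegular D xs := by
  induction xs with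
  | nil => intro D _ _; exact ⟨fun _ => IsWeaklyRegular.nil _ _, fun _ => trivial⟩
  | cons x xs ih =>
    intro D _ _
    obtain ⟨e⟩ := qst_equiv x D
    rw [isWeaklyRegular_cons_iff, ← e.isWeaklyRegular_congr, ← ih]
    exact Iff.rfl

theorem Wq_quot (xs : List B) : ∀ (W : ModuleCat.{u} B), ∃ p : W →ₗ[B] Wq xs W, Surjective p ∧
    ∀ w, p w = 0 ↔ w ∈ (Ideal.ofList xs • (⊤ : Submodule B W)) := by
  induction xs with
  | nil => 
    intro W
    refine ⟨LinearMap.id, surjective_id, fun w => ?_⟩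
    simp only [Ideal.ofList_nil, Submodule.bot_smul, Submodule.mem_bot]
    exact Iff.rfl
  | cons x xs ih =>
    intro W
    obtain ⟨p, hp, hk⟩ := ih (ModuleCat.of B (Co (mx x W)))
    refine ⟨p ∘ₗ Co.p (mx x W), hp.comp (Co.surj _), fun w => ?_⟩
    rw [Ideal.ofList_cons_smul]
    refine (hk (Co.p (mx x W) w)).trans ?_
    change Co.p (mx x W) w ∈ Ideal.ofList xs • (⊤ : Submodule B (Co (mx x W))) ↔ _
    have h1 : (⊤ : Submodule B (Co (mx x W))) = Submodule.map (Co.p (mx x W)) ⊤ := by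
      rw [Submodule.map_top, LinearMap.range_eq_top.2 (Co.surj _)]
    rw [h1, ← Submodule.map_smul'', ← Submodule.mem_comap, Submodule.comap_map_eq]
    have h2 : LinearMap.ker (Co.p (mx x W)) = x • (⊤ : Submodule B W) := by
      ext y
      rw [LinearMap.mem_ker, Co.exact, Submodule.mem_smul_pointwise_iff_exists]
      constructor
      · rintro ⟨b, rfl⟩; exact ⟨b, trivial, rfl⟩
      · rintro ⟨b, -, rfl⟩; exact ⟨b, rfl⟩
    rw [h2, sup_comm]

theorem Wq_self (xs : List B) (k : Type u) [CommRing k] [Algebra B k] (hs : Surjective (algebraMap B k))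
    (hk : ∀ b, algebraMap B k b = 0 ↔ b ∈ Ideal.ofList xs) :
    Nonempty (Wq xs (ModuleCat.of B B) ≃ₗ[B] k) := by
  obtain ⟨p, hp, hp'⟩ := Wq_quot xs (ModuleCat.of B B)
  have e1 : Exact (Ideal.ofList xs).subtype (Algebra.linearMap B k) := by
    intro y
    rw [Algebra.linearMap_apply, hk]; simp
  have e2 : Exact (Ideal.ofList xs).subtype p := by
    intro y
    refine (hp' y).trans ?_
    have : (Ideal.ofList xs • (⊤ : Submodule B B)) = Ideal.ofList xs := by
      rw [smul_eq_mul]; exact Ideal.mul_top _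
    rw [show (Ideal.ofList xs • (⊤ : Submodule B (ModuleCat.of B B))) = Ideal.ofList xs from this]
    simp
  obtain ⟨a⟩ := co_equiv e1 hs
  obtain ⟨b⟩ := co_equiv e2 hp
  exact ⟨b.symm.trans a⟩

theorem Wq_T (xs : List B) (U : Type u) [AddCommGroup U] [Module B U] : ∀ (d : ℕ) (W : ModuleCat.{u} B), RegF xs W →
    (∀ i > d, Subsingleton (T B W U i)) → ∀ i > d + xs.length, Subsingleton (T B (Wq xs W) U i) := by
  induction xs with
  | nil => intro d W _ h i hi; exact h i hi
  | cons x xs ih =>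
    intro d W hreg h i hi
    refine ih (d + 1) (ModuleCat.of B (Co (mx x W))) hreg.2 ?_ i (by rw [List.length_cons] at hi; omega)
    intro i hi
    obtain ⟨i, rfl⟩ : ∃ i', i = i' + 1 := ⟨i - 1, by omega⟩
    obtain ⟨a, b, h1, h2, h3⟩ := tstep W U x hreg.1 i
    have s1 := h (i + 1) (by omega)
    have s2 := h i (by omega)
    have t1 : Subsingleton (Co (mx x (T B W U (i+1)))) := (Co.surj _).subsingleton
    have t2 : Subsingleton (Ke (mx x (T B W U i))) := (Ke.inj _).subsingleton
    have : ∀ t : T B (Co (mx x W)) U (i+1), t = 0 := by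
      intro t
      obtain ⟨y, rfl⟩ := (h2 t).1 (Subsingleton.elim _ _)
      rw [Subsingleton.elim y 0, map_zero]
    exact ⟨fun x y => by rw [this x, this y]⟩

/-- a local ring with maximal ideal generated by a regular sequence -/
def RL (Q : Type u) [CommRing Q] [IsLocalRing Q] (xs : List Q) : Prop :=
  IsWeaklyRegular Q xs ∧ Ideal.ofList xs = IsLocalRing.maximalIdeal Q

theorem RL.FTD {Q : Type u} [CommRing Q] [IsLocalRing Q] [IsNoetherianRing Q] {xs : List Q} (h : RL Q xs) : FTD Q := by
  intro X _ _ hX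
  refine ⟨xs.length + 1, fun N _ _ j hj => ?_⟩
  obtain ⟨e⟩ := Wq_self xs (IsLocalRing.ResidueField Q) IsLocalRing.residue_surjective (fun b => by
    rw [h.2]; exact IsLocalRing.residue_eq_zero_iff b)
  have h1 := Wq_T xs X 0 (ModuleCat.of Q Q) ((RegF_iff xs Q).2 h.1) (fun i hi => by
    obtain ⟨i, rfl⟩ : ∃ i', i = i' + 1 := ⟨i - 1, by omega⟩
    exact T_flat Q i) (xs.length + 1) (by omega)
  have h2 : Subsingleton (T Q (IsLocalRing.ResidueField Q) X (xs.length + 1)) :=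
    (TequivL Q X _ e).symm.toEquiv.subsingleton
  have := pdk xs.length X h2 N (j - (xs.length + 1))
  rwa [show j - (xs.length + 1) + xs.length + 1 = j by omega] at this

end regf
end HW

end

section

namespace HW

open TensorProduct Function
open scoped Pointwise

section flatcrit

theorem Wq_T0 {B : Type u} [CommRing B] (xs : List B) (U : Type u) [AddCommGroup U] [Module B U] :
    ∀ (W : ModuleCat.{u} B), RegF xs W → RegF xs (T B W U 0) →
    (∀ i, Subsingleton (T B W U (i+1))) → ∀ i, Subsingleton (T B (Wq xs W) U (i+1)) := by
  induction xs with
  | nil => intro W _ _ h i; exact h i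
  | cons x xs ih =>
    intro W hreg h0 h i
    obtain ⟨e0⟩ := tstep0 W U x hreg.1
    refine ih (ModuleCat.of B (Co (mx x W))) hreg.2 (RegF.congr xs e0 h0.2) ?_ i
    intro i
    obtain ⟨a, b, h1, h2, h3⟩ := tstep W U x hreg.1 i
    have s1 := h i
    have t1 : Subsingleton (Co (mx x (T B W U (i+1)))) := (Co.surj _).subsingleton
    have t2 : Subsingleton (Ke (mx x (T B W U i))) := by
      cases i with
      | zero => exact Ke_sub.2 h0.1
      | succ i => have := h i; exact (Ke.inj _).subsingleton
    have : ∀ t : T B (Co (mx x W)) U (i+1), t = 0 := by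
      intro t
      obtain ⟨y, rfl⟩ := (h2 t).1 (Subsingleton.elim _ _)
      rw [Subsingleton.elim y 0, map_zero]
    exact ⟨fun x y => by rw [this x, this y]⟩

variable {A B : Type u} [CommRing A] [CommRing B] [Algebra A B]

theorem T1_ideal {M : Type u} [AddCommGroup M] [Module A M] (I : Ideal A) :
    Subsingleton (T A (A ⧸ I) M 1) ↔ Injective (LinearMap.lTensor M I.subtype) := by
  have ex : Exact I.subtype (Submodule.mkQ I) := LinearMap.exact_subtype_mkQ I
  obtain ⟨e⟩ := shiftR1' A (N := M) I.injective_subtype ex (Submodule.mkQ_surjective I) (T_flat A 0)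
  rw [Tsymm_sub, e.toEquiv.subsingleton_congr, ← LinearMap.ker_eq_bot, Submodule.subsingleton_iff_eq_bot]

theorem flat_crit [IsNoetherianRing A] [IsLocalRing A] [IsLocalRing B] [IsNoetherianRing B]
    [IsLocalHom (algebraMap A B)] {as : List A} (hA : RL A as)
    (M : Type u) [AddCommGroup M] [Module A M] [Module B M] [IsScalarTower A B M] [Module.Finite B M]
    (hM : IsWeaklyRegular M as) : Module.Flat A M := by
  have hk : Subsingleton (T A (A ⧸ IsLocalRing.maximalIdeal A) M 1) := by
    obtain ⟨e⟩ := Wq_self as (A ⧸ IsLocalRing.maximalIdeal A) Ideal.Quotient.mk_surjective (fun b => by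
      rw [hA.2]; exact Ideal.Quotient.eq_zero_iff_mem)
    have e0 : M ≃ₗ[A] T A A M 0 := (TensorProduct.lid A M).symm
    have := Wq_T0 as M (ModuleCat.of A A) ((RegF_iff _ _).2 hA.1) (RegF.congr as e0 ((RegF_iff _ _).2 hM))
      (fun i => T_flat A i) 0
    exact (TequivL A M 1 e).symm.toEquiv.subsingleton
  have key : ∀ I : Ideal A, Subsingleton (T A (A ⧸ I) M 1) := by
    intro I
    induction I using WellFoundedGT.induction with
    | ind I ih =>
    by_cases hI : IsLocalRing.maximalIdeal A ≤ I
    · by_cases hT : I = ⊤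
      · have : Subsingleton (A ⧸ I) := Ideal.Quotient.subsingleton_iff.2 hT
        have hf : Module.Flat A (A ⧸ I) := inferInstance
        exact T_flat A 0
      · rw [← (IsLocalRing.maximalIdeal.isMaximal A).eq_of_le hT hI]; exact hk
    obtain ⟨x, hxm, hxI⟩ := SetLike.not_le_iff_exists.1 hI
    -- I : x
    let J : Ideal A := Submodule.comap (LinearMap.mulLeft A x) I
    let K : Ideal A := I ⊔ Ideal.span {x}
    have hJ : ∀ y, y ∈ J ↔ x * y ∈ I := fun y => Iff.rfl
    have hIJ : I ≤ J := fun y hy => I.mul_mem_left _ hy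
    have hIK : I < K := by
      refine lt_of_le_of_ne le_sup_left fun h => hxI ?_
      rw [h]; exact Ideal.mem_sup_right (Ideal.mem_span_singleton_self x)
    let f : (A ⧸ J) →ₗ[A] (A ⧸ I) := Submodule.mapQ J I (LinearMap.mulLeft A x) le_rfl
    let g : (A ⧸ I) →ₗ[A] (A ⧸ K) := Submodule.mapQ I K LinearMap.id le_sup_left
    have hf : Injective f := by
      rw [injective_iff_map_eq_zero]
      intro y
      obtain ⟨y, rfl⟩ := Submodule.mkQ_surjective J y
      intro h
      exact (Submodule.Quotient.mk_eq_zero J).2 ((Submodule.Quotient.mk_eq_zero I).1 h)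
    have hg : Surjective g := by
      intro y
      obtain ⟨y, rfl⟩ := Submodule.mkQ_surjective K y
      exact ⟨Submodule.Quotient.mk y, rfl⟩
    have hfg : Exact f g := by
      intro y
      obtain ⟨y, rfl⟩ := Submodule.mkQ_surjective I y
      constructor
      · intro h
        have h' : y ∈ K := (Submodule.Quotient.mk_eq_zero K).1 h
        obtain ⟨i, hi, j, hj, rfl⟩ := Submodule.mem_sup.1 h'
        obtain ⟨c, rfl⟩ := Ideal.mem_span_singleton.1 hj
        refine ⟨Submodule.Quotient.mk c, ?_⟩
        change Submodule.Quotient.mk (x * c) = Submodule.Quotient.mk (i + x * c)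
        rw [Submodule.Quotient.eq]
        have : x * c - (i + x * c) = - i := by ring
        rw [this]; exact neg_mem hi
      · rintro ⟨z, hz⟩
        rw [← hz]
        obtain ⟨z, rfl⟩ := Submodule.mkQ_surjective J z
        exact (Submodule.Quotient.mk_eq_zero K).2 (Ideal.mem_sup_right (Ideal.mem_span_singleton.2 ⟨z, rfl⟩))
    have sK := ih K hIK
    have e1 := les_mid A M 1 hf hfg hg
    by_cases hlt : I < J
    · have sJ := ih J hlt
      have : ∀ t : T A (A ⧸ I) M 1, t = 0 := by
        intro t
        obtain ⟨y, rfl⟩ := (e1 t).1 (Subsingleton.elim _ _)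
        rw [Subsingleton.elim y 0, map_zero]
      exact ⟨fun x y => by rw [this x, this y]⟩
    -- x is surjective on T_1
    have hJI : J = I := by
      by_contra h
      exact hlt (lt_of_le_of_ne hIJ fun h' => h h'.symm)
    have hsurj : Surjective (mx x (T A (A ⧸ I) M 1)) := by
      let q : (A ⧸ I) →ₗ[A] (A ⧸ J) := Submodule.mapQ I J LinearMap.id hIJ
      have hq : f ∘ₗ q = mx x (A ⧸ I) := by
        apply LinearMap.ext; intro y
        obtain ⟨y, rfl⟩ := Submodule.mkQ_surjective I y
        rfl
      have hqs : ∃ q' : (A ⧸ J) →ₗ[A] (A ⧸ I), q ∘ₗ q' = LinearMap.id := by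
        refine ⟨Submodule.mapQ J I LinearMap.id hJI.le, ?_⟩
        apply LinearMap.ext; intro y
        obtain ⟨y, rfl⟩ := Submodule.mkQ_surjective J y
        rfl
      obtain ⟨q', hq'⟩ := hqs
      rw [← Tmap_mx, ← hq]
      intro t
      obtain ⟨y, rfl⟩ := (e1 t).1 (Subsingleton.elim _ _)
      refine ⟨Tmap A M 1 q' y, ?_⟩
      rw [← LinearMap.comp_apply, ← Tmap_comp, LinearMap.comp_assoc, hq', LinearMap.comp_id]
    have hsurj2 : Surjective (mx x (LinearMap.ker (LinearMap.lTensor M I.subtype))) := by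
      have ex : Exact I.subtype (Submodule.mkQ I) := LinearMap.exact_subtype_mkQ I
      obtain ⟨e⟩ := shiftR1' A (N := M) I.injective_subtype ex (Submodule.mkQ_surjective I) (T_flat A 0)
      obtain ⟨e'⟩ := Tsymm A 1 (A ⧸ I) M
      intro y
      obtain ⟨z, hz⟩ := hsurj ((e'.trans e).symm y)
      refine ⟨(e'.trans e) z, ?_⟩
      apply (e'.trans e).symm.injective
      rw [← hz, mx_apply, mx_apply, map_smul, LinearEquiv.symm_apply_apply]
    rw [T1_ideal]
    let F : M ⊗[A] I →ₗ[B] M ⊗[A] A := AlgebraTensorModule.lTensor B M I.subtype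
    have hF : ∀ t, F t = LinearMap.lTensor M I.subtype t := fun t => rfl
    have hfin : Module.Finite B (M ⊗[A] I) :=
      Module.Finite.equiv (AlgebraTensorModule.cancelBaseChange A B B M I)
    have hnoe : IsNoetherian B (M ⊗[A] I) := isNoetherian_of_isNoetherianRing_of_finite B _
    have hker : LinearMap.ker F = ⊥ := by
      apply Submodule.eq_bot_of_le_smul_of_le_jacobson_bot (Ideal.span {algebraMap A B x}) _
        (IsNoetherian.noetherian _)
      · intro y hy
        obtain ⟨z, hz⟩ := hsurj2 ⟨y, hy⟩
        have hz' : y = algebraMap A B x • (z : M ⊗[A] I) := by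
          rw [algebraMap_smul]
          exact (congrArg Subtype.val hz).symm
        rw [hz']
        exact Submodule.smul_mem_smul (Ideal.mem_span_singleton_self _) z.2
      · rw [IsLocalRing.jacobson_eq_maximalIdeal ⊥ bot_ne_top, Ideal.span_le, Set.singleton_subset_iff]
        rw [SetLike.mem_coe, IsLocalRing.mem_maximalIdeal]
        exact fun h => hxm (isUnit_of_map_unit (algebraMap A B) x h)
    have hinj : Injective F := LinearMap.ker_eq_bot.1 hker
    exact hinj
  rw [Module.Flat.iff_lTensor_injective]
  intro I _
  exact (T1_ideal I).1 (key I)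

end flatcrit
end HW

end

section

namespace HW

open TensorProduct Function
open scoped Pointwise

section flatstep

variable {A B : Type u} [CommRing A] [CommRing B] [Algebra A B]

/-- the flat step -/
theorem flat_step [IsNoetherianRing A] [IsLocalRing A] [IsLocalRing B] [IsNoetherianRing B]
    [IsLocalHom (algebraMap A B)] {as : List A} (hA : RL A as) (xs : List B)
    (hxs : ∀ x ∈ xs, x ∈ IsLocalRing.maximalIdeal B) :
    ∀ (M : Type u) [AddCommGroup M] [Module A M] [Module B M] [IsScalarTower A B M] [Module.Finite B M]
    (_ : IsWeaklyRegular M (xs ++ as.map (algebraMap A B))),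
    Module.Flat A M ∧ ∀ (Z : Type u) [AddCommGroup Z] [Module A Z], RegF xs (M ⊗[A] Z) := by
  have has : ∀ a ∈ as.map (algebraMap A B), a ∈ IsLocalRing.maximalIdeal B := by
    intro a ha
    obtain ⟨a, ha', rfl⟩ := List.mem_map.1 ha
    have : a ∈ IsLocalRing.maximalIdeal A := by
      rw [← hA.2]; exact Ideal.subset_span ha'
    rw [IsLocalRing.mem_maximalIdeal]
    exact fun h => this (isUnit_of_map_unit (algebraMap A B) a h)
  have hfl : ∀ (xs : List B) (M : Type u) [AddCommGroup M] [Module A M] [Module B M] [IsScalarTower A B M] [Module.Finite B M]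
    (_ : ∀ x ∈ xs, x ∈ IsLocalRing.maximalIdeal B)
    (_ : IsWeaklyRegular M (xs ++ as.map (algebraMap A B))), Module.Flat A M := by
    intro xs M _ _ _ _ _ hxs h
    have h' := IsLocalRing.isWeaklyRegular_of_perm_of_subset_maximalIdeal h (List.perm_append_comm)
      (fun r hr => (List.mem_append.1 hr).elim (hxs r) (has r))
    rw [isWeaklyRegular_append_iff] at h'
    exact flat_crit (B := B) hA M ((isWeaklyRegular_map_algebraMap_iff B M as).1 h'.1)
  induction xs with
  | nil => intro M _ _ _ _ _ h; exact ⟨hfl [] M hxs h, fun _ _ _ => trivial⟩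
  | cons x xs ih =>
    intro M _ _ _ _ _ h
    refine ⟨hfl (x :: xs) M hxs h, fun Z _ _ => ?_⟩
    have h0 : RegF (x :: (xs ++ as.map (algebraMap A B))) M := (RegF_iff _ _).2 h
    let M' := Co (mx x M)
    let _ : Module A M' := Module.compHom M' (algebraMap A B)
    have : IsScalarTower A B M' := IsScalarTower.of_algebraMap_smul (fun _ _ => rfl)
    have hx' : ∀ y ∈ xs, y ∈ IsLocalRing.maximalIdeal B := fun y hy => hxs y (List.mem_cons_of_mem _ hy)
    obtain ⟨f1, f2⟩ := ih hx' M' ((RegF_iff _ _).1 h0.2)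
    let q : M →ₗ[B] M' := Co.p (mx x M)
    have i1 : Injective ((mx x M).restrictScalars A) := h0.1
    have i2 : Exact ((mx x M).restrictScalars A) (q.restrictScalars A) := Co.exact (mx x M)
    have i3 : Surjective (q.restrictScalars A) := Co.surj (mx x M)
    have f0 := hfl (x :: xs) M hxs h
    obtain ⟨e⟩ := shiftL1 A (M := Z) i1 i2 i3 (T_flat A 0)
    have s1 : Subsingleton (T A M' Z 1) := T_flat A 0
    have s2 := e.symm.toEquiv.subsingleton
    have j1 : Injective (LinearMap.rTensor Z ((mx x M).restrictScalars A)) :=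
      LinearMap.ker_eq_bot.1 ((Submodule.subsingleton_iff_eq_bot).1 s2)
    have j2 := rTensor_exact Z i2 i3
    have j3 := LinearMap.rTensor_surjective Z i3
    have k1 : ∀ t, mx x (M ⊗[A] Z) t = LinearMap.rTensor Z ((mx x M).restrictScalars A) t := by
      intro t
      have : ((mx x (M ⊗[A] Z)).restrictScalars A) = LinearMap.rTensor Z ((mx x M).restrictScalars A) := by
        ext m z; rfl
      exact LinearMap.congr_fun this t
    let q' : M ⊗[A] Z →ₗ[B] M' ⊗[A] Z := AlgebraTensorModule.rTensor A Z q
    have hq' : ∀ t, q' t = LinearMap.rTensor Z (q.restrictScalars A) t := fun t => rfl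
    obtain ⟨e⟩ := co_equiv (f := mx x (M ⊗[A] Z)) (g := q') (by
      intro y
      rw [hq', j2 y]
      constructor
      · rintro ⟨z, rfl⟩; exact ⟨z, k1 z⟩
      · rintro ⟨z, rfl⟩; exact ⟨z, (k1 z).symm⟩) j3
    refine ⟨?_, RegF.congr xs e.symm (f2 Z)⟩
    intro y z hyz
    rw [k1, k1] at hyz
    exact j1 hyz

end flatstep

section diag
variable {A A₂ B : Type u} [CommRing A] [CommRing A₂] [CommRing B] [Algebra A B] [Algebra A₂ B]
  [Algebra B A] [IsNoetherianRing A] [IsNoetherianRing B] [SMulCommClass A A₂ B]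

theorem quot_equiv {S X Y Z : Type u} [CommRing S] [AddCommGroup X] [Module S X] [AddCommGroup Y] [Module S Y]
    [AddCommGroup Z] [Module S Z] (p : X →ₗ[S] Y) (g : X →ₗ[S] Z) (hp : Surjective p) (hg : Surjective g)
    (h : ∀ x, p x = 0 ↔ g x = 0) : Nonempty (Y ≃ₗ[S] Z) := by
  have e1 : Exact (Ke.i p) p := Ke.exact p
  have e2 : Exact (Ke.i p) g := fun x => (h x).symm.trans (e1 x)
  obtain ⟨a⟩ := co_equiv e1 hp
  obtain ⟨b⟩ := co_equiv e2 hg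
  exact ⟨a.symm.trans b⟩

theorem PosA_diag (h1 : ∀ a : A, algebraMap B A (algebraMap A B a) = a)
    (hs : Surjective (algebraMap B A))
    (h2 : Surjective fun a : A₂ => algebraMap B A (algebraMap A₂ B a))
    (δ : List B) (hker : ∀ b, algebraMap B A b = 0 ↔ b ∈ Ideal.ofList δ)
    [Module.Flat A B] [Module.Flat A₂ B]
    (hY : ∀ (Y : Type u) [AddCommGroup Y] [Module A Y] (m : ℕ) (j : Y →ₗ[A] (Fin m → A)),
      Injective j → Module.Finite A Y → Module.Flat A₂ (B ⊗[A] Y))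
    (hδ : ∀ (Z : Type u) [AddCommGroup Z] [Module A₂ Z], RegF δ (B ⊗[A₂] Z)) (hB : FTD B)
    (P : Ideal B) [P.IsPrime] (hP : ∀ x ∈ δ, x ∈ P) :
    PosA A (((LFlen (Localization.AtPrime P)).bc : LF B).res hs) := by
  intro Y N _ _ _ _ m j hj fY fN hC ⟨d₀, hchi⟩
  let N' := RS B A N
  let _ : Module A₂ N' := Module.compHom N' (algebraMap A₂ B)
  have t1 : IsScalarTower A₂ B N' := IsScalarTower.of_algebraMap_smul (fun _ _ => rfl)
  have hBN : ∀ (b : B) (n : N'), b • n = algebraMap B A b • n := fun _ _ => rfl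
  have t2 : IsScalarTower A B N' := IsScalarTower.of_algebraMap_smul (fun a n => by rw [hBN, h1])
  have fN' : Module.Finite A N' := fN
  have fBN : Module.Finite B N' := by
    have : Module.Finite B A := Module.Finite.of_surjective (Algebra.linearMap B A) hs
    exact Module.Finite.trans A N'
  have fA₂ : Module.Finite A₂ N' := by
    obtain ⟨s, hs'⟩ := fN'
    refine ⟨s, ?_⟩
    rw [eq_top_iff]
    intro n _
    have : n ∈ Submodule.span A (s : Set N') := by rw [hs']; trivial
    induction this using Submodule.span_induction with
    | mem x hx => exact Submodule.subset_span hx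
    | zero => exact zero_mem _
    | add x y _ _ h1 h2 => exact add_mem (h1 trivial) (h2 trivial)
    | smul a x _ h =>
      obtain ⟨a, rfl⟩ := h2 a
      exact Submodule.smul_mem _ a (h trivial)
  let U := B ⊗[A] Y
  let W : ModuleCat.{u} B := ModuleCat.of B (B ⊗[A₂] N')
  have fU : Module.Flat A₂ U := hY Y m j hj fY
  -- Tor vanishing
  have v : ∀ i, Subsingleton (T B W U (i + 1)) := by
    intro i
    rw [Tsymm_sub]
    have h := Tor_bc (S := A₂) B U (i + 1) N' (fun i => T_flat A₂ i)
    exact h.sub.2 (T_flat A₂ i)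
  -- the quotient
  have hW : Nonempty (Wq δ W ≃ₗ[B] N') := by
    obtain ⟨p, hp, hp'⟩ := Wq_quot δ W
    let g : B ⊗[A₂] N' →ₗ[B] N' := LinearMap.liftBaseChange B LinearMap.id
    have hg : ∀ b n, g (b ⊗ₜ n) = b • n := fun b n => by simp [g]
    have hrep : ∀ w : B ⊗[A₂] N', ∃ n : N', w - (1 : B) ⊗ₜ[A₂] n ∈ (Ideal.ofList δ • (⊤ : Submodule B (B ⊗[A₂] N'))) := by
      intro w
      induction w with
      | zero => exact ⟨0, by simp⟩
      | add x y hx hy =>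
        obtain ⟨n, hn⟩ := hx
        obtain ⟨n', hn'⟩ := hy
        refine ⟨n + n', ?_⟩
        have := add_mem hn hn'
        rwa [show x + y - (1 : B) ⊗ₜ[A₂] (n + n') = x - 1 ⊗ₜ n + (y - 1 ⊗ₜ n') by rw [tmul_add]; abel]
      | tmul b n =>
        obtain ⟨a, ha⟩ := h2 (algebraMap B A b)
        refine ⟨a • n, ?_⟩
        rw [← smul_tmul, ← sub_tmul]
        have : (b - a • 1) ∈ Ideal.ofList δ := by
          rw [← hker, map_sub, ← Algebra.algebraMap_eq_smul_one, sub_eq_zero]; exact ha.symm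
        have h := Submodule.smul_mem_smul this (Submodule.mem_top : ((1:B) ⊗ₜ[A₂] n) ∈ (⊤ : Submodule B (B ⊗[A₂] N')))
        rwa [smul_tmul', smul_eq_mul, mul_one] at h
    have hzero : ∀ w ∈ (Ideal.ofList δ • (⊤ : Submodule B (B ⊗[A₂] N'))), g w = 0 := by
      intro w hw
      refine Submodule.smul_induction_on hw ?_ ?_
      · intro b hb w _
        rw [map_smul, hBN, (hker b).2 hb, zero_smul]
      · intro x y hx hy; rw [map_add, hx, hy, add_zero]
    have hgs : Surjective g := fun n => ⟨1 ⊗ₜ n, by rw [hg, one_smul]⟩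
    refine quot_equiv p g hp hgs fun w => ?_
    refine (hp' w).trans ⟨hzero w, fun hw => ?_⟩
    obtain ⟨n, hn⟩ := hrep w
    have := hzero _ hn
    rw [map_sub, hw, hg, one_smul, zero_sub, neg_eq_zero] at this
    rw [this, tmul_zero, sub_zero] at hn
    exact hn
  obtain ⟨eW⟩ := hW
  -- comparison
  have hcmp : ∀ i, SEquiv B A (T A N' Y i) (T B (Wq δ W) U i) := by
    intro i
    have h : SEquiv A B (T B N' U i) (T A N' Y i) := Tor_bc (S := A) B N' i Y (fun i => T_flat A i)
    have h' : SEquiv B A (T A N' Y i) (T B N' U i) := by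
      obtain ⟨e, he⟩ := h
      refine ⟨e.symm, fun b x => ?_⟩
      obtain ⟨y, rfl⟩ := e.surjective x
      rw [← he, AddEquiv.symm_apply_apply, AddEquiv.symm_apply_apply, ← sub_eq_zero, ← sub_smul]
      refine T_ann U i (fun n => ?_) y
      rw [hBN, map_sub, h1, sub_self, zero_smul]
    exact h'.post A (TequivL B U i eW.symm)
  set L : LF B := (LFlen (Localization.AtPrime P)).bc with hLdef
  have eN : N' ≃ₗ[A] N := LinearEquiv.refl A N
  have hall : ∀ i, L.C (T B (Wq δ W) U (i + 1)) ∧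
      (L.res hs).l (T A Y N (i + 1)) = L.l (T B (Wq δ W) U (i + 1)) := by
    intro i
    obtain ⟨e1⟩ := Tsymm A (i + 1) Y N
    have e2 := TequivL A Y (i + 1) eN.symm
    have e3 := e1.trans e2
    have f1 : Module.Finite A (T A Y N (i + 1)) := Tfinite (S := A) _ _ _
    have f2 : Module.Finite A (T A N' Y (i + 1)) := Tfinite (S := A) _ _ _
    obtain ⟨a1, a2⟩ := LF.res_iff hs L ((hcmp (i + 1)).pre A e3)
    exact ⟨a1.1 (hC i), a2 (hC i)⟩
  obtain ⟨d₁, hd₁⟩ := hB U inferInstance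
  have hpos := Pos (B' := Localization.AtPrime P) (LFlen_strict _) U (max d₀ d₁) (fun W _ _ => hd₁ W _ (le_max_right _ _)) δ (fun x hx => by
    rw [IsLocalization.AtPrime.to_map_mem_maximal_iff (Localization.AtPrime P) P]; exact hP x hx) W
    (inferInstanceAs (Module.Finite B (B ⊗[A₂] N'))) (hδ N') v (fun i => (hall i).1) (by
      have := hchi (max d₀ d₁) (le_max_left _ _)
      unfold chi1 at this ⊢
      convert this using 3 with i
      exact (hall i).2.symm)
  intro i
  rw [(hall i).2]
  exact hpos i

end diag
end HW

end

section

namespace HW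

open TensorProduct Function
open scoped Pointwise

theorem reg_quot_ring {B V : Type u} [CommRing B] [CommRing V] (g : B →+* V) (hg : Surjective g) (xs : List B)
    (hk : ∀ b, b ∈ Ideal.ofList xs ↔ g b = 0) (bs : List B) :
    IsWeaklyRegular B (xs ++ bs) ↔ IsWeaklyRegular B xs ∧ IsWeaklyRegular V (bs.map g) := by
  rw [isWeaklyRegular_append_iff]
  letI := g.toAlgebra
  obtain ⟨e⟩ := quot_equiv (S := B) (Submodule.mkQ (Ideal.ofList xs • (⊤ : Submodule B B))) (Algebra.linearMap B V) (Submodule.mkQ_surjective _) hg (fun w => by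
      rw [Submodule.mkQ_apply, Submodule.Quotient.mk_eq_zero, smul_eq_mul, Ideal.mul_top, hk]
      rfl)
  rw [e.isWeaklyRegular_congr, ← isWeaklyRegular_map_algebraMap_iff (R := B) (S := V) (M := V)]
  rfl

section mv
variable {V : Type u} [CommRing V] {τ : Type}

open MvPowerSeries

theorem mv_mem (l : List τ) (f : MvPowerSeries τ V) :
    f ∈ Ideal.ofList (l.map (X : τ → MvPowerSeries τ V)) ↔ ∀ m : τ →₀ ℕ, (∀ i ∈ l, m i = 0) → coeff m f = 0 := by
  classical
  induction l generalizing f with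
  | nil => 
    rw [List.map_nil, Ideal.ofList_nil, Ideal.mem_bot]
    constructor
    · rintro rfl m -; simp
    · intro h; ext m; rw [h m (by simp)]; simp
  | cons i l ih =>
    rw [List.map_cons, Ideal.ofList_cons]
    constructor
    · intro h m hm
      obtain ⟨a, ha, b, hb, rfl⟩ := Submodule.mem_sup.1 h
      rw [map_add, (ih b).1 hb m (fun j hj => hm j (List.mem_cons_of_mem _ hj)), add_zero]
      exact X_dvd_iff.1 (Ideal.mem_span_singleton.1 ha) m (hm i List.mem_cons_self)
    · intro h
      let g : MvPowerSeries τ V := fun m => if m i = 0 then coeff m f else 0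
      have hg : ∀ m, coeff m g = if m i = 0 then coeff m f else 0 := fun m => rfl
      refine Submodule.mem_sup.2 ⟨f - g, ?_, g, ?_, sub_add_cancel _ _⟩
      · refine Ideal.mem_span_singleton.2 (X_dvd_iff.2 fun m hm => ?_)
        rw [map_sub, hg, if_pos hm, sub_self]
      · refine (ih g).2 fun m hm => ?_
        rw [hg]
        split_ifs with h0
        · refine h m fun j hj => ?_
          rcases List.mem_cons.1 hj with rfl | hj
          · exact h0
          · exact hm j hj
        · rfl

theorem mv_reg (l : List τ) (hl : l.Nodup) : IsWeaklyRegular (MvPowerSeries τ V) (l.map (X : τ → MvPowerSeries τ V)) := by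
  classical
  refine ⟨fun k hk => ?_⟩
  rw [isSMulRegular_quotient_iff_mem_of_smul_mem]
  intro f hf
  rw [smul_eq_mul, Ideal.mul_top, ← List.map_take, mv_mem] at hf ⊢
  intro m hm
  rw [List.length_map] at hk
  have h := hf (Finsupp.single l[k] 1 + m) fun i hi => by
    rw [Finsupp.add_apply, hm i hi, add_zero, Finsupp.single_apply, if_neg]
    rintro rfl
    obtain ⟨j, hj, hj'⟩ := List.mem_iff_getElem.1 hi
    rw [List.getElem_take] at hj'
    rw [List.length_take] at hj
    have := (List.Nodup.getElem_inj_iff hl).1 hj'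
    omega
  rw [List.getElem_map, smul_eq_mul, X_def, coeff_add_monomial_mul, one_mul] at h
  exact h

theorem mv_const (l : List τ) (hl : ∀ i, i ∈ l) (f : MvPowerSeries τ V) :
    f ∈ Ideal.ofList (l.map (X : τ → MvPowerSeries τ V)) ↔ constantCoeff f = 0 := by
  rw [mv_mem, ← coeff_zero_eq_constantCoeff_apply]
  constructor
  · intro h; exact h 0 (fun _ _ => rfl)
  · intro h m hm
    have : m = 0 := Finsupp.ext fun i => hm i (hl i)
    rw [this, h]

theorem RL_mv [IsLocalRing V] (l : List τ) (hl : l.Nodup) (hl' : ∀ i, i ∈ l) (vs : List V) (h : RL V vs) :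
    RL (MvPowerSeries τ V) (l.map X ++ vs.map (algebraMap V (MvPowerSeries τ V))) := by
  constructor
  · refine (reg_quot_ring (constantCoeff (σ := τ) (R := V)) (fun v => ⟨C v, constantCoeff_C v⟩) (l.map X) (fun f => mv_const l hl' f) _).2 ?_
    refine ⟨mv_reg l hl, ?_⟩
    have : (vs.map (algebraMap V (MvPowerSeries τ V))).map (constantCoeff (σ := τ) (R := V)) = vs := by
      rw [List.map_map]
      convert List.map_id vs
      ext v; simp [MvPowerSeries.algebraMap_apply]
    rw [this]
    exact h.1
  · ext f
    rw [Ideal.ofList_append, IsLocalRing.mem_maximalIdeal, mem_nonunits_iff, isUnit_iff_constantCoeff, ← mem_nonunits_iff,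
      ← IsLocalRing.mem_maximalIdeal, ← h.2, ← Ideal.map_ofList]
    constructor
    · intro hf
      obtain ⟨a, ha, b, hb, rfl⟩ := Submodule.mem_sup.1 hf
      rw [map_add, (mv_const l hl' a).1 ha, zero_add]
      have := Ideal.mem_map_of_mem (constantCoeff (σ := τ) (R := V)) hb
      rw [Ideal.map_map] at this
      convert this
      have : (constantCoeff (σ := τ) (R := V)).comp (algebraMap V (MvPowerSeries τ V)) = RingHom.id V := by
        ext v; simp [MvPowerSeries.algebraMap_apply]
      rw [this, Ideal.map_id]
    · intro hf
      refine Submodule.mem_sup.2 ⟨f - algebraMap V _ (constantCoeff f), ?_, _, Ideal.mem_map_of_mem _ hf, sub_add_cancel _ _⟩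
      rw [mv_const l hl', map_sub, MvPowerSeries.algebraMap_apply]
      simp

end mv
end HW

end

section

namespace HW

open TensorProduct Function
open scoped Pointwise

section dg
variable {A A₂ B : Type u} [CommRing A] [CommRing A₂] [CommRing B] [Algebra A B] [Algebra A₂ B]
  [Algebra B A] [IsNoetherianRing A] [IsNoetherianRing B] [SMulCommClass A A₂ B]
  [IsNoetherianRing A₂] [IsLocalRing A] [IsLocalRing A₂] [IsLocalRing B]
  [IsLocalHom (algebraMap A B)] [IsLocalHom (algebraMap A₂ B)]

theorem reg_replace (ys xs δ bs : List B) (h : List.Forall₂ (fun d x => d - x ∈ Ideal.ofList ys) δ xs)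
    (hr : IsWeaklyRegular B (ys ++ (xs ++ bs))) : IsWeaklyRegular B (ys ++ (δ ++ bs)) := by
  rw [isWeaklyRegular_append_iff] at hr ⊢
  refine ⟨hr.1, ?_⟩
  refine ((AddEquiv.refl _).isWeaklyRegular_congr ?_).1 hr.2
  refine List.rel_append ?_ ?_
  · have h' := h.flip
    refine h'.imp ?_
    intro x d hd z
    obtain ⟨z, rfl⟩ := Submodule.mkQ_surjective _ z
    have hd : d - x ∈ Ideal.ofList ys := hd
    rw [AddEquiv.refl_apply, AddEquiv.refl_apply, ← map_smul, ← map_smul, eq_comm, ← sub_eq_zero, ← map_sub, ← sub_smul,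
      Submodule.mkQ_apply, Submodule.Quotient.mk_eq_zero]
    exact Submodule.smul_mem_smul hd trivial
  · exact List.forall₂_same.2 fun r _ x => rfl

theorem diag_PosA (h1 : ∀ a : A, algebraMap B A (algebraMap A B a) = a)
    (h2 : Surjective fun a : A₂ => algebraMap B A (algebraMap A₂ B a))
    {as : List A} {π : A} (hA : RL A (as ++ [π])) (hπ : ∀ a, π * a = 0 → a = 0)
    {as₂ : List A₂} {π₂ : A₂} (hA₂ : RL A₂ (as₂ ++ [π₂])) (hpp : algebraMap A₂ B π₂ = algebraMap A B π)
    (hreg : IsWeaklyRegular B (as₂.map (algebraMap A₂ B) ++ (as.map (algebraMap A B) ++ [algebraMap A B π])))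
    (δ : List B) (hker : ∀ b, algebraMap B A b = 0 ↔ b ∈ Ideal.ofList δ)
    (hδm : ∀ d ∈ δ, d ∈ IsLocalRing.maximalIdeal B)
    (hδ : List.Forall₂ (fun d x => d - x ∈ Ideal.ofList (as₂.map (algebraMap A₂ B))) δ (as.map (algebraMap A B)))
    (hB : FTD B) (p : Ideal A) [p.IsPrime] : ∃ L : LF A, PosA A L ∧ L.At p := by
  have hs : Surjective (algebraMap B A) := fun a => ⟨_, h1 a⟩
  have mA : ∀ a ∈ as ++ [π], algebraMap A B a ∈ IsLocalRing.maximalIdeal B := by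
    intro a ha
    have : a ∈ IsLocalRing.maximalIdeal A := hA.2 ▸ Ideal.subset_span ha
    exact map_nonunit _ _ this
  have mA2 : ∀ a ∈ as₂ ++ [π₂], algebraMap A₂ B a ∈ IsLocalRing.maximalIdeal B := by
    intro a ha
    have : a ∈ IsLocalRing.maximalIdeal A₂ := hA₂.2 ▸ Ideal.subset_span ha
    exact map_nonunit _ _ this
  have my : ∀ b ∈ as₂.map (algebraMap A₂ B), b ∈ IsLocalRing.maximalIdeal B := by
    intro b hb
    obtain ⟨a, ha, rfl⟩ := List.mem_map.1 hb
    exact mA2 a (List.mem_append_left _ ha)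
  have mπ : algebraMap A B π ∈ IsLocalRing.maximalIdeal B := mA π (by simp)
  obtain ⟨fA, sA⟩ := flat_step hA (as₂.map (algebraMap A₂ B)) my B (by
    rw [List.map_append]; exact hreg)
  obtain ⟨fA2, sA2⟩ := flat_step hA₂ δ hδm B (by
    have h := reg_replace _ _ _ _ hδ hreg
    rw [List.map_append, List.map_singleton, hpp]
    refine IsLocalRing.isWeaklyRegular_of_perm_of_subset_maximalIdeal h ?_ ?_
    · rw [← List.append_assoc, ← List.append_assoc]
      exact List.Perm.append_right _ List.perm_append_comm
    · intro r hr
      rcases List.mem_append.1 hr with hr | hr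
      · exact my r hr
      · rcases List.mem_append.1 hr with hr | hr
        · exact hδm r hr
        · rw [List.mem_singleton.1 hr]; exact mπ)
  have hY : ∀ (Y : Type u) [AddCommGroup Y] [Module A Y] (m : ℕ) (j : Y →ₗ[A] (Fin m → A)),
      Injective j → Module.Finite A Y → Module.Flat A₂ (B ⊗[A] Y) := by
    intro Y _ _ m j hj hfin
    have hinj : Injective (mx π Y) := by
      rw [injective_iff_map_eq_zero]
      intro y hy
      refine (injective_iff_map_eq_zero j).1 hj y ?_
      rw [mx_apply] at hy
      have := congrArg j hy
      rw [map_smul, map_zero] at this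
      ext k
      exact hπ _ (congrFun this k)
    have hb1 := baseChange_inj_flat B hinj
    have hmx : (mx π Y).baseChange B = mx (algebraMap A B π) (B ⊗[A] Y) := by
      ext y
      simp [mx_apply, TensorProduct.smul_tmul']
    obtain ⟨e⟩ := co_equiv (baseChange_exact B (Co.exact (mx π Y)) (Co.surj _)) (baseChange_surj B (Co.surj _))
    have hreg2 : RegF (algebraMap A B π :: as₂.map (algebraMap A₂ B)) (B ⊗[A] Y) := by
      rw [hmx] at e hb1
      exact ⟨hb1, RegF.congr _ e.symm (sA _)⟩
    refine flat_crit (B := B) hA₂ (B ⊗[A] Y) ?_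
    rw [← isWeaklyRegular_map_algebraMap_iff (S := B), List.map_append, List.map_singleton, hpp]
    refine IsLocalRing.isWeaklyRegular_of_perm_of_subset_maximalIdeal ((RegF_iff _ _).1 hreg2) ?_ ?_
    · exact (List.perm_append_singleton _ _).symm
    · intro r hr
      rcases List.mem_cons.1 hr with rfl | hr
      · exact mπ
      · exact my r hr
  let P := p.comap (algebraMap B A)
  have hP : ∀ x ∈ δ, x ∈ P := by
    intro x hx
    have := (hker x).2 (Ideal.subset_span hx)
    rw [Ideal.mem_comap, this]; exact zero_mem _
  exact ⟨_, PosA_diag h1 hs h2 δ hker hY sA2 hB P hP, LF.At.res hs (LFat_At P)⟩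

end dg
end HW

end

section

namespace HW

open TensorProduct Function
open scoped Pointwise

theorem surj_lem {A S : Type u} [CommRing A] [CommRing S] [IsNoetherianRing S] [IsLocalRing S] (I : Ideal A) [IsPrecomplete I A]
    (f : A →+* S) (hI : ∀ a ∈ I, f a ∈ IsLocalRing.maximalIdeal S) (h : ∀ s, ∃ a, s - f a ∈ I.map f) : Surjective f := by
  have : IsHausdorff (I.map f) S := IsHausdorff.of_le_jacobson _ _ (by
    rw [Ideal.map_le_iff_le_comap]
    intro a ha
    exact IsLocalRing.maximalIdeal_le_jacobson _ (hI a ha))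
  refine surjective_of_mk_map_comp_surjective (I := I) f fun s => ?_
  obtain ⟨s, rfl⟩ := Ideal.Quotient.mk_surjective s
  obtain ⟨a, ha⟩ := h s
  exact ⟨a, ((Ideal.Quotient.mk_eq_mk_iff_sub_mem _ _).2 ha).symm⟩

section
variable {A B : Type u} [CommRing A] [CommRing B] [IsNoetherianRing A] [IsNoetherianRing B]
  [IsLocalRing A] [IsLocalRing B] (φ ψ : A →+* B) (μ : B →+* A) [IsLocalHom φ] [IsLocalHom ψ]

theorem ker_lem (h1 : ∀ a : A, μ (φ a) = a) {I : Ideal A} [IsPrecomplete I A] (hI : ∀ a ∈ I, a ∈ IsLocalRing.maximalIdeal A)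
    (δ : List B) (hδm : ∀ d ∈ δ, d ∈ IsLocalRing.maximalIdeal B) (hδ0 : ∀ d ∈ δ, μ d = 0)
    (h : ∀ b, ∃ a, b - φ a ∈ Ideal.ofList δ ⊔ I.map φ) (b : B) :
    μ b = 0 ↔ b ∈ Ideal.ofList δ := by
  have hle : Ideal.ofList δ ≤ IsLocalRing.maximalIdeal B := Ideal.span_le.2 hδm
  have hle2 : Ideal.ofList δ ≤ RingHom.ker μ := Ideal.span_le.2 hδ0
  have : Nontrivial (B ⧸ Ideal.ofList δ) := Ideal.Quotient.nontrivial_iff.2 (fun h => by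
    rw [h] at hle; exact (IsLocalRing.maximalIdeal.isMaximal B).ne_top (top_le_iff.1 hle))
  have : IsLocalRing (B ⧸ Ideal.ofList δ) := IsLocalRing.of_surjective' _ Ideal.Quotient.mk_surjective
  have : IsLocalHom (Ideal.Quotient.mk (Ideal.ofList δ)) := IsLocalHom.of_surjective _ Ideal.Quotient.mk_surjective
  have hs : Surjective ((Ideal.Quotient.mk (Ideal.ofList δ)).comp φ) := by
    refine surj_lem I _ (fun a ha => ?_) ?_
    · exact map_nonunit (Ideal.Quotient.mk (Ideal.ofList δ)) _ (map_nonunit φ _ (hI a ha))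
    · intro s
      obtain ⟨b, rfl⟩ := Ideal.Quotient.mk_surjective s
      obtain ⟨a, ha⟩ := h b
      refine ⟨a, ?_⟩
      obtain ⟨c, hc, d, hd, hcd⟩ := Submodule.mem_sup.1 ha
      rw [RingHom.comp_apply, ← map_sub, ← hcd, map_add, Ideal.Quotient.eq_zero_iff_mem.2 hc, zero_add, ← Ideal.map_map]
      exact Ideal.mem_map_of_mem _ hd
  constructor
  · intro hb
    obtain ⟨a, ha⟩ := hs (Ideal.Quotient.mk _ b)
    have h3 : φ a - b ∈ Ideal.ofList δ := (Ideal.Quotient.mk_eq_mk_iff_sub_mem _ _).1 ha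
    have h4 : μ (φ a - b) = 0 := hle2 h3
    rw [map_sub, h1, hb, sub_zero] at h4
    rw [h4, map_zero, zero_sub, neg_mem_iff] at h3
    exact h3
  · intro hb; exact hle2 hb

theorem diag_PosA' (h1 : ∀ a : A, μ (φ a) = a) (h2 : ∀ a : A, μ (ψ a) = a)
    {as : List A} [IsPrecomplete (Ideal.ofList as) A] {π : A} (hA : RL A (as ++ [π])) (hπ : ∀ a, π * a = 0 → a = 0)
    (hpp : ψ π = φ π)
    (hreg : IsWeaklyRegular B (as.map ψ ++ (as.map φ ++ [φ π])))
    (h : ∀ b, ∃ a, b - φ a ∈ Ideal.ofList (as.map ψ) ⊔ Ideal.ofList (as.map φ))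
    (hB : FTD B) (p : Ideal A) [p.IsPrime] : ∃ L : LF A, PosA A L ∧ L.At p := by
  let δ := as.map fun a => φ a - ψ a
  have mA : ∀ a ∈ as ++ [π], a ∈ IsLocalRing.maximalIdeal A := fun a ha => hA.2 ▸ Ideal.subset_span ha
  have hδm : ∀ d ∈ δ, d ∈ IsLocalRing.maximalIdeal B := by
    intro d hd
    obtain ⟨a, ha, rfl⟩ := List.mem_map.1 hd
    have := mA a (List.mem_append_left _ ha)
    exact sub_mem (map_nonunit φ _ this) (map_nonunit ψ _ this)
  refine @diag_PosA A A B _ _ _ φ.toAlgebra ψ.toAlgebra μ.toAlgebra _ _ 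
    (@SMulCommClass.mk A A B φ.toAlgebra.toSMul ψ.toAlgebra.toSMul fun a b c => mul_left_comm (φ a) (ψ b) c) _ _ _ _ 
    (show IsLocalHom φ from inferInstance) (show IsLocalHom ψ from inferInstance)
    h1 (fun a => ⟨a, h2 a⟩) as π hA hπ as π hA hpp hreg δ ?_ hδm ?_ hB p _
  · refine ker_lem φ μ h1 (I := Ideal.ofList as) ?_ δ hδm ?_ ?_
    · intro a ha
      rw [← hA.2, Ideal.ofList_append]
      exact Ideal.mem_sup_left ha
    · intro d hd
      obtain ⟨a, ha, rfl⟩ := List.mem_map.1 hd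
      rw [map_sub, h1, h2, sub_self]
    · intro b
      obtain ⟨a, ha⟩ := h b
      refine ⟨a, ?_⟩
      rw [Ideal.map_ofList]
      refine (sup_le (Ideal.span_le.2 ?_) le_sup_right : Ideal.ofList (as.map ψ) ⊔ Ideal.ofList (as.map φ) ≤ _) ha
      intro y hy
      obtain ⟨a, ha, rfl⟩ := List.mem_map.1 hy
      have : ψ a = -(φ a - ψ a) + φ a := by ring
      rw [this]
      exact add_mem (Ideal.mem_sup_left (neg_mem (Ideal.subset_span (List.mem_map.2 ⟨a, ha, rfl⟩))))
        (Ideal.mem_sup_right (Ideal.subset_span (List.mem_map.2 ⟨a, ha, rfl⟩)))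
  · refine List.forall₂_map_left_iff.2 (List.forall₂_map_right_iff.2 (List.forall₂_same.2 fun a ha => ?_))
    change φ a - ψ a - φ a ∈ Ideal.ofList (as.map ψ)
    rw [sub_sub_cancel_left, neg_mem_iff]
    exact Ideal.subset_span (List.mem_map.2 ⟨a, ha, rfl⟩)

end

open MvPowerSeries in
theorem PosA_mv {V : Type u} [CommRing V] [IsNoetherianRing V] [IsLocalRing V] {π : V} (hV : RL V [π]) (n : ℕ)
    (p : Ideal (MvPowerSeries (Fin n) V)) [p.IsPrime] :
    ∃ L : LF (MvPowerSeries (Fin n) V), PosA (MvPowerSeries (Fin n) V) L ∧ L.At p := by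
  let φ : MvPowerSeries (Fin n) V →+* MvPowerSeries (Fin n ⊕ Fin n) V := (rename Sum.inl).toRingHom
  let ψ : MvPowerSeries (Fin n) V →+* MvPowerSeries (Fin n ⊕ Fin n) V := (rename Sum.inr).toRingHom
  let μ : MvPowerSeries (Fin n ⊕ Fin n) V →+* MvPowerSeries (Fin n) V := (rename (Sum.elim id id)).toRingHom
  have hl1 : IsLocalHom φ := ⟨fun a ha => by
    rw [isUnit_iff_constantCoeff] at ha ⊢
    exact (constantCoeff_rename (R := V) Sum.inl a) ▸ ha⟩
  have hl2 : IsLocalHom ψ := ⟨fun a ha => by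
    rw [isUnit_iff_constantCoeff] at ha ⊢
    exact (constantCoeff_rename (R := V) Sum.inr a) ▸ ha⟩
  let as : List (MvPowerSeries (Fin n) V) := (List.finRange n).map X
  have has : Ideal.ofList as = Ideal.span (Set.range X) := by
    unfold Ideal.ofList
    congr 1
    ext f
    simp [as]
  have hpre : IsPrecomplete (Ideal.ofList as) (MvPowerSeries (Fin n) V) := by
    rw [has]; infer_instance
  have hφX : as.map φ = ((List.finRange n).map Sum.inl).map X := by
    rw [List.map_map, List.map_map]
    exact List.map_congr_left fun i _ => rename_X Sum.inl i
  have hψX : as.map ψ = ((List.finRange n).map Sum.inr).map X := by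
    rw [List.map_map, List.map_map]
    exact List.map_congr_left fun i _ => rename_X Sum.inr i
  have hφC : ∀ v, φ (algebraMap V _ v) = algebraMap V _ v := fun v => AlgHom.commutes (rename Sum.inl) v
  have hψC : ∀ v, ψ (algebraMap V _ v) = algebraMap V _ v := fun v => AlgHom.commutes (rename Sum.inr) v
  let l : List (Fin n ⊕ Fin n) := (List.finRange n).map Sum.inr ++ (List.finRange n).map Sum.inl
  have hl : l.Nodup := by
    refine List.Nodup.append ((List.nodup_finRange n).map Sum.inr_injective) ((List.nodup_finRange n).map Sum.inl_injective) ?_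
    intro a ha hb
    obtain ⟨i, -, rfl⟩ := List.mem_map.1 ha
    obtain ⟨j, -, h⟩ := List.mem_map.1 hb
    cases h
  have hl' : ∀ i, i ∈ l := by
    rintro (i | i) <;> simp [l]
  have hRB := RL_mv l hl hl' [π] hV
  have hA := RL_mv (List.finRange n) (List.nodup_finRange n) (fun i => by simp) [π] hV
  have hmap : l.map X = as.map ψ ++ as.map φ := by
    rw [hφX, hψX, ← List.map_append]
  refine diag_PosA' (as := as) (π := algebraMap V _ π) φ ψ μ ?_ ?_ hA ?_ ?_ ?_ ?_ hRB.FTD p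
  · intro a
    change rename (Sum.elim id id) (rename Sum.inl a) = a
    rw [rename_rename]
    exact rename_id_apply a
  · intro a
    change rename (Sum.elim id id) (rename Sum.inr a) = a
    rw [rename_rename]
    exact rename_id_apply a
  · intro a ha
    have hπ : ∀ v, π * v = 0 → v = 0 := by
      have := ((RegF_iff _ _).2 hV.1).1
      intro v hv
      exact (injective_iff_map_eq_zero _).1 this v hv
    ext m
    have := congrArg (coeff m) ha
    rw [MvPowerSeries.algebraMap_apply, Algebra.algebraMap_self_apply, coeff_C_mul, map_zero] at this
    rw [hπ _ this, map_zero]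
  · rw [hφC, hψC]
  · have := hRB.1
    rw [hmap, List.append_assoc] at this
    rw [hφC]
    exact this
  · intro b
    refine ⟨algebraMap V _ (constantCoeff b), ?_⟩
    rw [← Ideal.ofList_append, ← hmap, mv_const l hl', map_sub, hφC, MvPowerSeries.algebraMap_apply]
    simp

end HW

end

section

namespace HW

open TensorProduct Function
open scoped Pointwise

open MvPowerSeries in
theorem eval_hom {V Q : Type*} [CommRing V] [CommRing Q] (I : Ideal Q) [IsAdicComplete I Q] (h : V →+* Q) {n : ℕ} (x : Fin n → Q)
    (hx : ∀ i, x i ∈ I) : ∃ F : MvPowerSeries (Fin n) V →+* Q, (∀ v, F (C v) = h v) ∧ ∀ i, F (X i) = x i := by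
  let ev : MvPolynomial (Fin n) V →+* Q := MvPolynomial.eval₂Hom h x
  have hev : (MvPolynomial.idealOfVars (Fin n) V).map ev ≤ I := by
    rw [Ideal.map_span, Ideal.span_le]
    rintro _ ⟨_, ⟨i, rfl⟩, rfl⟩
    have : ev (MvPolynomial.X i) = x i := MvPolynomial.eval₂_X _ _ _
    rw [SetLike.mem_coe, this]
    exact hx i
  have hev2 : ∀ k, (MvPolynomial.idealOfVars (Fin n) V) ^ k ≤ (I ^ k).comap ev := by
    intro k
    rw [← Ideal.map_le_iff_le_comap, Ideal.map_pow]
    exact Ideal.pow_right_mono hev k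
  let f : (k : ℕ) → MvPowerSeries (Fin n) V →+* Q ⧸ I ^ k := fun k =>
    (Ideal.quotientMap (I ^ k) ev (hev2 k)).comp (truncTotalAlgHom (Fin n) V k).toRingHom
  have hf : ∀ k p, f k p = Ideal.Quotient.mk (I ^ k) (ev (truncTotal k p)) := fun k p => rfl
  have hf2 : ∀ k (p : MvPolynomial (Fin n) V), f k (p : MvPowerSeries (Fin n) V) = Ideal.Quotient.mk (I ^ k) (ev p) := by
    intro k p
    have := (truncTotalAlgHom (Fin n) V k).commutes p
    rw [MvPowerSeries.algebraMap_apply', Algebra.algebraMap_self, MvPowerSeries.map_id] at this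
    change Ideal.quotientMap (I ^ k) ev (hev2 k) ((truncTotalAlgHom (Fin n) V k) _) = _
    erw [this]
    rfl
  have hc : ∀ {m k : ℕ} (hle : m ≤ k), (Ideal.Quotient.factorPow I hle).comp (f k) = f m := by
    intro m k hle
    ext p
    change Ideal.Quotient.mk (I ^ m) (ev (truncTotal k p)) = Ideal.Quotient.mk (I ^ m) (ev (truncTotal m p))
    rw [Ideal.Quotient.mk_eq_mk_iff_sub_mem, ← map_sub]
    exact hev2 m (truncTotal_sub_truncTotal_mem_pow_idealOfVars hle le_rfl p)
  let F := IsAdicComplete.liftRingHom I f hc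
  have hF : ∀ p : MvPolynomial (Fin n) V, F p = ev p := by
    intro p
    refine (IsHausdorff.eq_iff_smodEq (I := I)).2 fun k => ?_
    rw [SModEq.sub_mem, smul_eq_mul, Ideal.mul_top, ← Ideal.Quotient.mk_eq_mk_iff_sub_mem]
    rw [← hf2 k]
    exact IsAdicComplete.mk_liftRingHom I f hc k _
  refine ⟨F, fun v => ?_, fun i => ?_⟩
  · have := hF (MvPolynomial.C v)
    rw [MvPolynomial.coe_C] at this
    rw [this]
    exact MvPolynomial.eval₂_C _ _ _
  · have := hF (MvPolynomial.X i)
    rw [MvPolynomial.coe_X] at this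
    rw [this]
    exact MvPolynomial.eval₂_X _ _ _

section
variable {A Q : Type u} [CommRing A] [CommRing Q]

theorem ker_reg (F : A →+* Q) (hF : Surjective F) (Xs : List A) (h : IsWeaklyRegular Q (Xs.map F)) (a : A)
    (ha : a ∈ Ideal.ofList Xs) (ha' : F a = 0) : a ∈ Ideal.ofList Xs * RingHom.ker F := by
  induction Xs using List.reverseRecOn generalizing a with
  | nil => 
    rw [Ideal.ofList_nil, Ideal.mem_bot] at ha
    rw [ha]; exact zero_mem _
  | append_singleton Xs X ih =>
    rw [List.map_append, isWeaklyRegular_append_iff, List.map_singleton, isWeaklyRegular_singleton_iff,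
      isSMulRegular_quotient_iff_mem_of_smul_mem] at h
    rw [Ideal.ofList_append, Ideal.ofList_singleton] at ha
    obtain ⟨b, hb, y, hy, rfl⟩ := Submodule.mem_sup.1 ha
    obtain ⟨c, rfl⟩ := Ideal.mem_span_singleton.1 hy
    have h1 : F c ∈ Ideal.ofList (Xs.map F) := by
      have := h.2 (F c) (by
        rw [smul_eq_mul, smul_eq_mul, Ideal.mul_top, ← map_mul]
        have : F (X * c) = - F b := by rw [map_add] at ha'; linear_combination ha'
        rw [this, neg_mem_iff, ← Ideal.map_ofList]
        exact Ideal.mem_map_of_mem _ hb)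
      rwa [smul_eq_mul, Ideal.mul_top] at this
    rw [← Ideal.map_ofList, Ideal.mem_map_iff_of_surjective F hF] at h1
    obtain ⟨c', hc', hcc⟩ := h1
    have h2 := ih h.1 (b + X * c') (add_mem hb (Ideal.mul_mem_left _ _ hc')) (by
      rw [map_add, map_mul] at ha' ⊢; rw [hcc, ha'])
    have : b + X * c = (b + X * c') + X * (c - c') := by ring
    rw [this, Ideal.ofList_append, Ideal.sup_mul]
    refine add_mem (Ideal.mem_sup_left h2) (Ideal.mem_sup_right (Ideal.mul_mem_mul (Ideal.subset_span (by simp)) ?_))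
    rw [RingHom.mem_ker, map_sub, hcc, sub_self]

theorem ker_gen [IsNoetherianRing A] [IsLocalRing A] (F : A →+* Q) (hF : Surjective F) (Xs : List A) (h : IsWeaklyRegular Q (Xs.map F))
    (hK : RingHom.ker F ≤ IsLocalRing.maximalIdeal A) 
    (g : A) (hg : F g = 0) (hm : Ideal.ofList (Xs ++ [g]) = IsLocalRing.maximalIdeal A) (a : A) : F a = 0 ↔ g ∣ a := by
  constructor
  · suffices h : RingHom.ker F ≤ Ideal.span {g} from fun ha => Ideal.mem_span_singleton.1 (h ha)
    refine Submodule.le_of_le_smul_of_le_jacobson_bot (I := Ideal.ofList Xs) (IsNoetherian.noetherian _) ?_ ?_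
    · refine le_trans ?_ (IsLocalRing.maximalIdeal_le_jacobson _)
      rw [← hm, Ideal.ofList_append]; exact le_sup_left
    · intro a ha
      have h1 := hK ha
      rw [← hm, Ideal.ofList_append, Ideal.ofList_singleton] at h1
      obtain ⟨b, hb, y, hy, rfl⟩ := Submodule.mem_sup.1 h1
      refine add_mem (Submodule.mem_sup_right ?_) (Submodule.mem_sup_left hy)
      refine ker_reg F hF Xs h b hb ?_
      obtain ⟨c, rfl⟩ := Ideal.mem_span_singleton.1 hy
      rw [RingHom.mem_ker, map_add, map_mul, hg, zero_mul, add_zero] at ha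
      exact ha
  · rintro ⟨c, rfl⟩
    rw [map_mul, hg, zero_mul]

end

open MvPowerSeries in
theorem cohen_hyp {V Q : Type u} [CommRing V] [IsNoetherianRing V] [IsLocalRing V] {π : V} (hV : RL V [π])
    [CommRing Q] [IsNoetherianRing Q] [IsLocalRing Q] [IsAdicComplete (IsLocalRing.maximalIdeal Q) Q] {xs : List Q} (hQ : RL Q xs)
    (h : V →+* Q) (hπ : h π ∈ IsLocalRing.maximalIdeal Q) (hs : ∀ q, ∃ v, q - h v ∈ IsLocalRing.maximalIdeal Q) :
    ∃ (n : ℕ) (F : MvPowerSeries (Fin n) V →+* Q) (g : MvPowerSeries (Fin n) V), 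
      @Hyp (MvPowerSeries (Fin n) V) Q _ _ F.toAlgebra g := by
  let n := xs.length
  obtain ⟨F, hFC, hFX⟩ := eval_hom (IsLocalRing.maximalIdeal Q) h (fun i : Fin n => xs.get i) (fun i => by
    rw [← hQ.2]; exact Ideal.subset_span (List.get_mem _ _))
  let as : List (MvPowerSeries (Fin n) V) := (List.finRange n).map X
  have has : Ideal.ofList as = Ideal.span (Set.range X) := by
    unfold Ideal.ofList
    congr 1
    ext f
    simp [as]
  have hpre : IsPrecomplete (Ideal.ofList as) (MvPowerSeries (Fin n) V) := by
    rw [has]; infer_instance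
  have hF : as.map F = xs := by
    rw [List.map_map]
    conv_rhs => rw [← List.map_get_finRange xs]
    exact List.map_congr_left fun i _ => hFX i
  have hA := RL_mv (List.finRange n) (List.nodup_finRange n) (fun i => by simp) [π] hV
  have hmap : (Ideal.ofList as).map F = IsLocalRing.maximalIdeal Q := by
    rw [Ideal.map_ofList, hF, hQ.2]
  have hsur : Surjective F := by
    refine surj_lem (Ideal.ofList as) F ?_ ?_
    · intro a ha; rw [← hmap]; exact Ideal.mem_map_of_mem _ ha
    · intro q
      obtain ⟨v, hv⟩ := hs q
      exact ⟨C v, by rw [hmap, hFC]; exact hv⟩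
  rw [← hmap, Ideal.mem_map_iff_of_surjective F hsur] at hπ
  obtain ⟨a, ha, haπ⟩ := hπ
  refine ⟨n, F, C π - a, ?_⟩
  have hCm : ∀ r ∈ as ++ [C π], r ∈ IsLocalRing.maximalIdeal (MvPowerSeries (Fin n) V) := by
    intro r hr; rw [← hA.2]; exact Ideal.subset_span hr
  have ham : ∀ r ∈ Ideal.ofList as, r ∈ IsLocalRing.maximalIdeal (MvPowerSeries (Fin n) V) := by
    intro r hr; rw [← hA.2, Ideal.ofList_append]; exact Ideal.mem_sup_left hr
  have hm : Ideal.ofList (as ++ [C π - a]) = IsLocalRing.maximalIdeal (MvPowerSeries (Fin n) V) := by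
    refine le_antisymm (Ideal.span_le.2 ?_) ?_
    · intro r hr
      rcases List.mem_append.1 hr with hr | hr
      · exact hCm r (List.mem_append_left _ hr)
      · rw [List.mem_singleton.1 hr]
        exact sub_mem (hCm _ (by simp)) (ham a ha)
    · rw [← hA.2]
      refine Ideal.span_le.2 ?_
      intro r hr
      rcases List.mem_append.1 hr with hr | hr
      · exact Ideal.subset_span (List.mem_append_left _ hr)
      · rw [List.mem_singleton.1 hr]
        have : algebraMap V (MvPowerSeries (Fin n) V) π = (C π - a) + a := by
          rw [sub_add_cancel]; rfl
        rw [this, Ideal.ofList_append]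
        exact add_mem (Ideal.mem_sup_right (Ideal.subset_span (by simp))) (Ideal.mem_sup_left ha)
  have hg : F (C π - a) = 0 := by rw [map_sub, hFC, haπ, sub_self]
  have hreg : IsWeaklyRegular (MvPowerSeries (Fin n) V) ((C π - a) :: as) := by
    have h1 := reg_replace as [C π] [C π - a] [] (List.Forall₂.cons (by rw [sub_sub_cancel_left, neg_mem_iff]; exact ha) List.Forall₂.nil) hA.1
    refine IsLocalRing.isWeaklyRegular_of_perm_of_subset_maximalIdeal h1 ?_ ?_
    · exact (List.perm_append_singleton _ _)
    · intro r hr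
      rw [← hm]; exact Ideal.subset_span hr
  refine @Hyp.mk _ _ _ _ F.toAlgebra _ hsur ?_ ?_
  · refine ker_gen F hsur as (hF ▸ hQ.1) ?_ _ hg hm
    exact IsLocalRing.le_maximalIdeal (RingHom.ker_ne_top F)
  · exact (injective_iff_map_eq_zero _).1 ((RegF_iff _ _).2 hreg).1

theorem Rig_complete {V Q : Type u} [CommRing V] [IsNoetherianRing V] [IsLocalRing V] {π : V} (hV : RL V [π])
    [CommRing Q] [IsNoetherianRing Q] [IsLocalRing Q] [IsAdicComplete (IsLocalRing.maximalIdeal Q) Q] {xs : List Q} (hQ : RL Q xs)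
    (h : V →+* Q) (hπ : h π ∈ IsLocalRing.maximalIdeal Q) (hs : ∀ q, ∃ v, q - h v ∈ IsLocalRing.maximalIdeal Q)
    (p : Ideal Q) [p.IsPrime] : ∃ L : LF Q, Rig Q L ∧ L.At p := by
  obtain ⟨n, F, g, H⟩ := cohen_hyp hV hQ h hπ hs
  letI := F.toAlgebra
  obtain ⟨L, hL, hp⟩ := PosA_mv hV n (p.comap F)
  exact ⟨L.res H.surj, Rig_of_PosA H hL hQ.FTD, LF.At.res H.surj hp⟩

end HW

end

section

namespace HW

open TensorProduct Function
open scoped Pointwise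

/-- existence of a discrete valuation ring mapping onto the residue field -/
def HasCoeff (Q : Type u) [CommRing Q] [IsLocalRing Q] : Prop :=
  ∃ (V : Type u) (_ : CommRing V) (_ : IsNoetherianRing V) (_ : IsLocalRing V) (π : V) (h : V →+* Q),
    RL V [π] ∧ h π ∈ IsLocalRing.maximalIdeal Q ∧ ∀ q, ∃ v, q - h v ∈ IsLocalRing.maximalIdeal Q

theorem RL_of_domain {V : Type u} [CommRing V] [IsDomain V] [IsLocalRing V] {π : V} (h0 : π ≠ 0)
    (h : IsLocalRing.maximalIdeal V = Ideal.span {π}) : RL V [π] := by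
  refine ⟨?_, by rw [h, Ideal.ofList_singleton]⟩
  rw [isWeaklyRegular_singleton_iff]
  exact fun a b hab => mul_left_cancel₀ h0 hab

theorem HasCoeff_of_field {Q : Type u} [CommRing Q] [IsLocalRing Q] {K : Type u} [Field K] (h : K →+* Q) 
    (hs : ∀ q, ∃ v, q - h v ∈ IsLocalRing.maximalIdeal Q) : HasCoeff Q := by
  refine ⟨PowerSeries K, inferInstance, inferInstance, inferInstance, PowerSeries.X, 
    h.comp (PowerSeries.constantCoeff), RL_of_domain PowerSeries.X_ne_zero PowerSeries.maximalIdeal_eq_span_X, ?_, ?_⟩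
  · rw [RingHom.comp_apply, PowerSeries.constantCoeff_X, map_zero]; exact zero_mem _
  · intro q
    obtain ⟨v, hv⟩ := hs q
    exact ⟨PowerSeries.C v, by rwa [RingHom.comp_apply, PowerSeries.constantCoeff_C]⟩

theorem smooth_char0 (K : Type u) [Field K] [Algebra ℚ K] : Algebra.FormallySmooth ℚ K := by
  obtain ⟨s, hs⟩ := exists_isTranscendenceBasis ℚ K
  have : Algebra.IsAlgebraic (IntermediateField.adjoin ℚ (Set.range ((↑) : s → K))) K := hs.isAlgebraic_field
  have : Algebra.IsSeparable (IntermediateField.adjoin ℚ (Set.range ((↑) : s → K))) K := inferInstance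
  exact .of_algebraicIndependent_of_isSeparable hs.1

theorem HasCoeff_char0 {Q : Type u} [CommRing Q] [IsLocalRing Q] [IsAdicComplete (IsLocalRing.maximalIdeal Q) Q]
    [Algebra ℚ Q] : HasCoeff Q := by
  letI : Field (Q ⧸ IsLocalRing.maximalIdeal Q) := Ideal.Quotient.field _
  have := smooth_char0 (Q ⧸ IsLocalRing.maximalIdeal Q)
  obtain ⟨g, hg⟩ := Algebra.FormallySmooth.exists_mkₐ_comp_eq_of_isAdicComplete (I := IsLocalRing.maximalIdeal Q) (AlgHom.id ℚ (Q ⧸ IsLocalRing.maximalIdeal Q))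
  refine HasCoeff_of_field g.toRingHom fun q => ?_
  refine ⟨Ideal.Quotient.mk _ q, ?_⟩
  rw [← Ideal.Quotient.mk_eq_mk_iff_sub_mem]
  exact (congrArg (fun φ => φ (Ideal.Quotient.mk _ q)) hg).symm

end HW

end

section

namespace HW

open TensorProduct Function
open scoped Pointwise

section pb
variable {k : Type u} [Field k] (p : ℕ) [hp : Fact p.Prime] [CharP k p] {ι : Type u} (b : ι → k)

/-- twisted evaluation -/
def ev (n : ℕ) : MvPolynomial ι k →+* k := MvPolynomial.eval₂Hom (iterateFrobenius k p n) b

theorem ev_C (n : ℕ) (c : k) : ev p b n (MvPolynomial.C c) = c ^ p ^ n := by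
  rw [ev, MvPolynomial.coe_eval₂Hom, MvPolynomial.eval₂_C, iterateFrobenius_def]
theorem ev_X (n : ℕ) (i : ι) : ev p b n (MvPolynomial.X i) = b i := by
  rw [ev, MvPolynomial.coe_eval₂Hom, MvPolynomial.eval₂_X]

/-- the ideal of obvious relations -/
def Ib (n : ℕ) : Ideal (MvPolynomial ι k) := Ideal.span (Set.range fun i => MvPolynomial.X i ^ p ^ n - MvPolynomial.C (b i))

theorem Ib_le (n : ℕ) (f) (hf : f ∈ Ib p b n) : ev p b n f = 0 := by
  have : Ib p b n ≤ RingHom.ker (ev p b n) := by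
    refine Ideal.span_le.2 ?_
    rintro _ ⟨i, rfl⟩
    change ev p b n _ = 0
    rw [map_sub, map_pow, ev_C, ev_X, sub_self]
  exact this hf

theorem ev_succ (h1 : Surjective (ev p b 1)) (hk : ∀ f, ev p b 1 f = 0 → f ∈ Ib p b 1) (n : ℕ) :
    Surjective (ev p b (n + 1)) ∧ ∀ f, ev p b (n + 1) f = 0 → f ∈ Ib p b (n + 1) := by
  induction n with
  | zero => exact ⟨h1, hk⟩
  | succ n ih =>
    obtain ⟨ih1, ih2⟩ := ih
    have hexp : ∀ g, ev p b (n + 2) (MvPolynomial.expand p g) = (ev p b (n + 1) g) ^ p := by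
      intro g
      have : (ev p b (n + 2)).comp (MvPolynomial.expand (R := k) (σ := ι) p).toRingHom = (frobenius k p).comp (ev p b (n + 1)) := by
        ext c
        · simp [ev_C]
          rw [pow_succ p (n + 1), pow_mul, frobenius_def, ← pow_mul, ← pow_mul, mul_comm]
        · simp [ev_X, frobenius_def]
      exact congrArg (fun φ => φ g) this
    constructor
    · intro c
      obtain ⟨f, rfl⟩ := h1 c
      induction f using MvPolynomial.induction_on with
      | C c => 
        obtain ⟨g, rfl⟩ := ih1 c
        exact ⟨_, (hexp g).trans (by rw [ev_C, pow_one])⟩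
      | add f g hf hg => 
        obtain ⟨f', hf⟩ := hf
        obtain ⟨g', hg⟩ := hg
        exact ⟨f' + g', by rw [map_add, map_add, hf, hg]⟩
      | mul_X f i hf =>
        obtain ⟨f', hf⟩ := hf
        exact ⟨f' * MvPolynomial.X i, by rw [map_mul, map_mul, hf, ev_X, ev_X]⟩
    · let mk := Ideal.Quotient.mk (Ib p b (n + 2))
      let σ₀ : MvPolynomial ι k →+* MvPolynomial ι k ⧸ Ib p b (n + 2) := mk.comp (MvPolynomial.expand (R := k) (σ := ι) p).toRingHom
      have hσ₀ : ∀ g, ev p b (n + 1) g = 0 → σ₀ g = 0 := by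
        intro g hg
        have hle : Ib p b (n + 1) ≤ RingHom.ker σ₀ := by
          refine Ideal.span_le.2 ?_
          rintro _ ⟨i, rfl⟩
          change mk (MvPolynomial.expand p _) = 0
          refine Ideal.Quotient.eq_zero_iff_mem.2 (Ideal.subset_span ⟨i, ?_⟩)
          simp [MvPolynomial.expand_X]
          rw [pow_succ p (n + 1), mul_comm, pow_mul]
        exact hle (ih2 g hg)
      let σ : k →+* MvPolynomial ι k ⧸ Ib p b (n + 2) := RingHom.liftOfSurjective (ev p b (n + 1)) ih1 ⟨σ₀, fun g hg => hσ₀ g hg⟩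
      have hσ : ∀ g, σ (ev p b (n + 1) g) = mk (MvPolynomial.expand p g) := fun g => 
        RingHom.liftOfRightInverse_comp_apply _ _ _ ⟨σ₀, fun g hg => hσ₀ g hg⟩ g
      let ρ : MvPolynomial ι k →+* MvPolynomial ι k ⧸ Ib p b (n + 2) := MvPolynomial.eval₂Hom σ (fun i => mk (MvPolynomial.X i))
      have hρC : ∀ c, ρ (MvPolynomial.C c) = σ c := fun c => MvPolynomial.eval₂_C _ _ _
      have hρX : ∀ i, ρ (MvPolynomial.X i) = mk (MvPolynomial.X i) := fun c => MvPolynomial.eval₂_X _ _ _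
      have hρ : ∀ g, ev p b 1 g = 0 → ρ g = 0 := by
        intro g hg
        have hle : Ib p b 1 ≤ RingHom.ker ρ := by
          refine Ideal.span_le.2 ?_
          rintro _ ⟨i, rfl⟩
          change ρ _ = 0
          rw [map_sub, map_pow, hρC, hρX, pow_one]
          have := hσ (MvPolynomial.X i)
          rw [ev_X, MvPolynomial.expand_X, map_pow] at this
          rw [this, sub_self]
        exact hle (hk g hg)
      let τ : k →+* MvPolynomial ι k ⧸ Ib p b (n + 2) := RingHom.liftOfSurjective (ev p b 1) h1 ⟨ρ, fun g hg => hρ g hg⟩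
      have hτ : ∀ g, τ (ev p b 1 g) = ρ g := fun g => 
        RingHom.liftOfRightInverse_comp_apply _ _ _ ⟨ρ, fun g hg => hρ g hg⟩ g
      have hfin : τ.comp (ev p b (n + 2)) = mk := by
        refine MvPolynomial.ringHom_ext (fun c => ?_) (fun i => ?_)
        · have h3 := hτ (MvPolynomial.C (c ^ p ^ (n + 1)))
          rw [ev_C, hρC, pow_one, ← pow_mul, ← pow_succ, ← ev_C p b (n + 1), hσ, MvPolynomial.expand_C] at h3
          rw [RingHom.comp_apply, ev_C]
          exact h3
        · rw [RingHom.comp_apply, ev_X, ← ev_X p b 1 i, hτ, hρX]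
      intro f hf
      have := congrArg (fun φ => φ f) hfin
      simp only [RingHom.comp_apply, hf, map_zero] at this
      exact Ideal.Quotient.eq_zero_iff_mem.1 this.symm

end pb
section pb2
variable {k : Type u} [Field k] (p : ℕ) [hp : Fact p.Prime] [CharP k p]

/-- p-independence inside the universal polynomial ring -/
def Ind (B : Set k) : Prop := ∀ f ∈ MvPolynomial.supported k B, ev p (id : k → k) 1 f = 0 →
  f ∈ Ideal.span (Set.image (fun a : k => (MvPolynomial.X a ^ p - MvPolynomial.C a : MvPolynomial k k)) B)

/-- the field generated -/
def KB (B : Set k) : Subfield k :=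
  { (MvPolynomial.supported k B).toSubring.map (ev p (id : k → k) 1) with
    inv_mem' := by
      rintro x ⟨f, hf, rfl⟩
      have hf : f ∈ MvPolynomial.supported k B := hf
      set x := ev p (id : k → k) 1 f with hx
      refine ⟨f ^ (p - 1) * MvPolynomial.C x⁻¹, ?_, ?_⟩
      · refine mul_mem (pow_mem hf _) ?_
        exact (MvPolynomial.supported k B).algebraMap_mem x⁻¹
      · rw [map_mul, map_pow, ev_C, ← hx, pow_one]
        by_cases h0 : x = 0
        · rw [h0, inv_zero, zero_pow hp.out.ne_zero, mul_zero]
        · have : p = (p - 1) + 1 := (Nat.succ_pred_prime hp.out).symm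
          conv_lhs => enter [2]; rw [this]
          rw [pow_succ, ← mul_assoc, ← mul_pow, mul_inv_cancel₀ h0, one_pow, one_mul] }

theorem mem_KB (B : Set k) (x : k) : x ∈ KB p B ↔ ∃ f ∈ MvPolynomial.supported k B, ev p (id : k → k) 1 f = x := Iff.rfl

theorem Ind_insert {B : Set k} (hB : Ind p B) {a : k} (ha : a ∉ KB p B) : Ind p (insert a B) := by
  intro f hf h0
  set A := MvPolynomial.supported k B with hA
  set J := Ideal.span (Set.image (fun a : k => (MvPolynomial.X a ^ p - MvPolynomial.C a : MvPolynomial k k)) (insert a B)) with hJ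
  have hBJ : Ideal.span (Set.image (fun a : k => (MvPolynomial.X a ^ p - MvPolynomial.C a : MvPolynomial k k)) B) ≤ J :=
    Ideal.span_mono (Set.image_mono (Set.subset_insert _ _))
  let sub : A →+* MvPolynomial k k := A.val.toRingHom
  have hq : ∃ q : Polynomial A, q.eval₂ sub (MvPolynomial.X a) = f := by
    rw [MvPolynomial.supported] at hf
    clear h0
    induction hf using Algebra.adjoin_induction with
    | mem x hx =>
      obtain ⟨c, hc, rfl⟩ := hx
      rcases hc with rfl | hc
      · exact ⟨Polynomial.X, Polynomial.eval₂_X _ _⟩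
      · exact ⟨Polynomial.C ⟨MvPolynomial.X c, Algebra.subset_adjoin ⟨c, hc, rfl⟩⟩, Polynomial.eval₂_C _ _⟩
    | algebraMap r => exact ⟨Polynomial.C (algebraMap k A r), Polynomial.eval₂_C _ _⟩
    | add x y _ _ hx hy =>
      obtain ⟨q, rfl⟩ := hx
      obtain ⟨q', rfl⟩ := hy
      exact ⟨q + q', Polynomial.eval₂_add _ _⟩
    | mul x y _ _ hx hy =>
      obtain ⟨q, rfl⟩ := hx
      obtain ⟨q', rfl⟩ := hy
      exact ⟨q * q', Polynomial.eval₂_mul _ _⟩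
  obtain ⟨q, rfl⟩ := hq
  let D : Polynomial A := Polynomial.X ^ p - Polynomial.C (algebraMap k A a)
  have hD : D.Monic := Polynomial.monic_X_pow_sub_C _ hp.out.ne_zero
  have hDd : D.natDegree = p := Polynomial.natDegree_X_pow_sub_C
  have hDe : D.eval₂ sub (MvPolynomial.X a) ∈ J := by
    refine Ideal.subset_span ⟨a, Set.mem_insert _ _, ?_⟩
    simp only [D, Polynomial.eval₂_sub, Polynomial.eval₂_pow, Polynomial.eval₂_X, Polynomial.eval₂_C]
    rfl
  set r := q %ₘ D with hr
  have hdiv : q.eval₂ sub (MvPolynomial.X a) = r.eval₂ sub (MvPolynomial.X a) + D.eval₂ sub (MvPolynomial.X a) * (q /ₘ D).eval₂ sub (MvPolynomial.X a) := by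
    rw [← Polynomial.eval₂_mul, ← Polynomial.eval₂_add, hr, Polynomial.modByMonic_add_div]
  have hJ0 : ∀ g ∈ J, ev p (id : k → k) 1 g = 0 := by
    intro g hg
    refine Ib_le p id 1 g ?_
    refine Ideal.span_mono ?_ hg
    rintro _ ⟨c, _, rfl⟩
    exact ⟨c, by rw [pow_one]; rfl⟩
  have hJm := J.mul_mem_right ((q /ₘ D).eval₂ sub (MvPolynomial.X a)) hDe
  rw [hdiv]
  refine add_mem ?_ hJm
  have hr0 : ev p (id : k → k) 1 (r.eval₂ sub (MvPolynomial.X a)) = 0 := by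
    rw [hdiv, map_add, hJ0 _ hJm, add_zero] at h0
    exact h0
  -- map to KB
  let φ : A →+* KB p B := ((ev p (id : k → k) 1).comp sub).codRestrict (KB p B) (fun x => ⟨x, x.2, rfl⟩)
  have hφ : ∀ x, ((φ x : KB p B) : k) = ev p (id : k → k) 1 x := fun x => rfl
  let s : Polynomial (KB p B) := r.map φ
  have hs0 : s.eval₂ (KB p B).subtype a = 0 := by
    rw [Polynomial.eval₂_map, ← hr0, Polynomial.hom_eval₂, ev_X]
    rfl
  have hap : a ^ p ∈ KB p B := ⟨MvPolynomial.C a, A.algebraMap_mem a, by change ev p _ 1 _ = _; rw [ev_C, pow_one]⟩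
  let P : Polynomial (KB p B) := Polynomial.X ^ p - Polynomial.C ⟨a ^ p, hap⟩
  have hP : Irreducible P := by
    refine X_pow_sub_C_irreducible_of_prime hp.out fun c hc => ha ?_
    have : (c : k) ^ p = a ^ p := congrArg Subtype.val hc
    rw [← frobenius_inj k p this]
    exact c.2
  have hPa : Polynomial.aeval a P = 0 := by
    simp [P, Subfield.algebraMap_ofSubfield]
  have hPd : P.natDegree = p := Polynomial.natDegree_X_pow_sub_C
  have hs : s = 0 := by
    by_contra hs
    have hdvd : P ∣ s := by
      rw [minpoly.eq_of_irreducible_of_monic hP hPa (Polynomial.monic_X_pow_sub_C _ hp.out.ne_zero)]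
      exact minpoly.dvd _ _ hs0
    have h1 := Polynomial.natDegree_le_of_dvd hdvd hs
    have h2 : r.natDegree < p := by
      rw [← hDd]
      refine Polynomial.natDegree_modByMonic_lt _ hD fun h => ?_
      rw [h, Polynomial.natDegree_one] at hDd
      exact hp.out.ne_zero hDd.symm
    have h3 : s.natDegree ≤ r.natDegree := Polynomial.natDegree_map_le
    omega
  rw [Polynomial.eval₂_eq_sum, Polynomial.sum]
  refine sum_mem fun i _ => J.mul_mem_right _ (hBJ (hB _ (r.coeff i).2 ?_))
  have := congrArg (fun t => ((t.coeff i : KB p B) : k)) hs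
  simp only [s, Polynomial.coeff_map] at this
  exact this

theorem Ind_max : ∃ B : Set k, Ind p B ∧ ∀ a, a ∈ KB p B := by
  obtain ⟨B, hB⟩ := zorn_subset {B : Set k | Ind p B} (by
    intro c hc hchain
    rcases c.eq_empty_or_nonempty with rfl | hne
    · refine ⟨∅, ?_, fun s hs => absurd hs (Set.notMem_empty _)⟩
      intro f hf h0
      rw [MvPolynomial.supported_empty, Algebra.mem_bot] at hf
      obtain ⟨r, rfl⟩ := hf
      rw [MvPolynomial.algebraMap_eq, ev_C] at h0
      rw [eq_zero_of_pow_eq_zero h0, map_zero]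
      exact zero_mem _
    · refine ⟨⋃₀ c, ?_, fun s hs => Set.subset_sUnion_of_mem hs⟩
      intro f hf h0
      rw [MvPolynomial.mem_supported] at hf
      obtain ⟨B, hBc, hfB⟩ := DirectedOn.exists_mem_subset_of_finset_subset_biUnion (f := id) hne (s := f.vars) (hchain.directedOn) (by rwa [Set.sUnion_eq_biUnion] at hf)
      exact Ideal.span_mono (Set.image_mono (Set.subset_sUnion_of_mem hBc)) (hc hBc f (MvPolynomial.mem_supported.2 hfB) h0))
  refine ⟨B, hB.prop, fun a => ?_⟩
  by_contra ha
  have := hB.le_of_ge (Ind_insert p hB.prop ha) (Set.subset_insert _ _)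
  have haB : a ∈ B := this (Set.mem_insert _ _)
  exact ha ⟨MvPolynomial.X a, (MvPolynomial.X_mem_supported).2 haB, ev_X p _ 1 a⟩

theorem pbasis (k : Type u) [Field k] (p : ℕ) [hp : Fact p.Prime] [CharP k p] : ∃ (ι : Type u) (b : ι → k), Surjective (ev p b 1) ∧ ∀ f, ev p b 1 f = 0 → f ∈ Ib p b 1 := by
  obtain ⟨B, hB, hs⟩ := Ind_max (k := k) p
  have hev : ∀ g : MvPolynomial B k, ev p (id : k → k) 1 (MvPolynomial.rename Subtype.val g) = ev p (Subtype.val : B → k) 1 g := by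
    intro g
    simp only [ev, MvPolynomial.coe_eval₂Hom, MvPolynomial.eval₂_rename]
    rfl
  refine ⟨B, Subtype.val, fun c => ?_, fun f hf => ?_⟩
  · obtain ⟨f, hf, rfl⟩ := hs c
    have hf : f ∈ MvPolynomial.supported k B := hf
    rw [MvPolynomial.supported_eq_range_rename] at hf
    obtain ⟨g, rfl⟩ := hf
    exact ⟨g, (hev g).symm⟩
  · have h1 := hB (MvPolynomial.rename Subtype.val f) (by rw [MvPolynomial.supported_eq_range_rename]; exact ⟨f, rfl⟩) (by rw [hev, hf])
    have h2 := Ideal.mem_map_of_mem (MvPolynomial.killCompl (R := k) (Subtype.val_injective (p := (· ∈ B)))).toRingHom h1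
    have h3 : (MvPolynomial.killCompl (R := k) (Subtype.val_injective (p := (· ∈ B)))).toRingHom (MvPolynomial.rename Subtype.val f) = f :=
      MvPolynomial.killCompl_rename_app _ f
    rw [h3] at h2
    refine Ideal.map_le_iff_le_comap.2 (Ideal.span_le.2 ?_) h2
    rintro _ ⟨a, ha, rfl⟩
    change MvPolynomial.killCompl (R := k) (Subtype.val_injective (p := (· ∈ B))) _ ∈ Ib p _ 1
    refine Ideal.subset_span ⟨⟨a, ha⟩, ?_⟩
    have := MvPolynomial.killCompl_rename_app (R := k) (Subtype.val_injective (p := (· ∈ B))) (MvPolynomial.X ⟨a, ha⟩ ^ p - MvPolynomial.C a)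
    simp only [map_sub, map_pow, MvPolynomial.rename_X, MvPolynomial.rename_C] at this
    rw [map_sub, map_pow, this, pow_one]
end pb2

end HW

end

section

namespace HW

open TensorProduct Function
open scoped Pointwise

section wt
variable {Q : Type u} [CommRing Q] (p : ℕ) [hp : Fact p.Prime]

/-- ghost sums -/
def gh (n : ℕ) (x : ℕ → Q) : Q := ∑ i ∈ Finset.range (n + 1), (p : Q) ^ i * x i ^ p ^ (n - i)

variable (Q) in
/-- the subring of ghost sums -/
def SG (n : ℕ) : Subring Q := (WittVector.ghostComponent (p := p) (R := Q) n).range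

theorem mem_SG (n : ℕ) (z : Q) : z ∈ SG Q p n ↔ ∃ x, z = gh p n x := by
  have hg : ∀ x : WittVector p Q, WittVector.ghostComponent n x = gh p n x.coeff := by
    intro x
    rw [WittVector.ghostComponent_apply, wittPolynomial_eq_sum_C_mul_X_pow, map_sum, gh]
    refine Finset.sum_congr rfl fun i _ => ?_
    simp
  constructor
  · rintro ⟨x, rfl⟩
    exact ⟨_, hg x⟩
  · rintro ⟨x, rfl⟩
    exact ⟨WittVector.mk p x, hg _⟩

theorem SG_pow (n : ℕ) (a : Q) : a ^ p ^ n ∈ SG Q p n := by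
  refine (mem_SG p n _).2 ⟨fun i => if i = 0 then a else 0, ?_⟩
  rw [gh, Finset.sum_range_succ', Finset.sum_eq_zero]
  · simp
  · intro i _
    simp [hp.out.ne_zero]

theorem gh_zero (n : ℕ) (x : ℕ → Q) : gh p (n + 1) x = x 0 ^ p ^ (n + 1) + p * gh p n (fun i => x (i + 1)) := by
  rw [gh, Finset.sum_range_succ', gh, Finset.mul_sum, add_comm]
  congr 1
  · simp
  · refine Finset.sum_congr rfl fun i _ => ?_
    rw [Nat.add_sub_add_right, pow_succ]; ring

theorem SG_p (n : ℕ) (a : Q) (h : a ∈ SG Q p n) : p * a ∈ SG Q p (n + 1) := by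
  obtain ⟨x, rfl⟩ := (mem_SG p n a).1 h
  refine (mem_SG p _ _).2 ⟨fun i => if i = 0 then 0 else x (i - 1), ?_⟩
  rw [gh_zero]
  simp [hp.out.ne_zero]

theorem SG_down (n : ℕ) (a : Q) (h : a ∈ SG Q p (n + 1)) : ∃ s ∈ SG Q p n, ∃ y, a - s = p ^ (n + 1) * y := by
  obtain ⟨x, rfl⟩ := (mem_SG p _ a).1 h
  refine ⟨_, (mem_SG p n _).2 ⟨fun i => x i ^ p, rfl⟩, x (n + 1), ?_⟩
  rw [gh, Finset.sum_range_succ, gh, add_sub_right_comm, Nat.sub_self, pow_zero, pow_one]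
  convert zero_add _
  rw [sub_eq_zero]
  refine Finset.sum_congr rfl fun i hi => ?_
  rw [← pow_mul, ← pow_succ']
  congr 3
  have := Finset.mem_range.1 hi
  omega

variable [IsLocalRing Q] (hpm : (p : Q) ∈ IsLocalRing.maximalIdeal Q)
include hpm

theorem SG_res (n : ℕ) (a : Q) (h : a ∈ SG Q p n) : ∃ c, IsLocalRing.residue Q a = c ^ p ^ n := by
  obtain ⟨x, rfl⟩ := (mem_SG p n a).1 h
  refine ⟨IsLocalRing.residue Q (x 0), ?_⟩
  cases n with
  | zero => simp [gh]
  | succ n =>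
    rw [gh_zero, map_add, map_mul, (IsLocalRing.residue_eq_zero_iff (p : Q)).2 hpm, zero_mul, add_zero, map_pow]

theorem SG_m (n : ℕ) (a : Q) (h : a ∈ SG Q p (n + 1)) (ha : a ∈ IsLocalRing.maximalIdeal Q) : 
    ∃ s ∈ SG Q p n, a - p * s ∈ IsLocalRing.maximalIdeal Q ^ (n + 2) := by
  obtain ⟨x, rfl⟩ := (mem_SG p _ a).1 h
  refine ⟨_, (mem_SG p n _).2 ⟨fun i => x (i + 1), rfl⟩, ?_⟩
  rw [gh_zero, Ideal.add_mem_iff_left _ (Ideal.mul_mem_right _ _ hpm)] at ha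
  rw [gh_zero, add_sub_cancel_right]
  have := Ideal.IsPrime.mem_of_pow_mem inferInstance _ ha
  exact Ideal.pow_le_pow_right (Nat.lt_pow_self hp.out.one_lt) (Ideal.pow_mem_pow this _)

end wt

section cr
variable {Q : Type u} [CommRing Q] [IsLocalRing Q] (p : ℕ) [hp : Fact p.Prime] {ι : Type u} (β : ι → Q)

/-- evaluation with ghost coefficients -/
def EG (n : ℕ) : MvPolynomial ι (SG Q p n) →+* Q := MvPolynomial.eval₂Hom (SG Q p n).subtype β

/-- the subrings -/
def TG (n : ℕ) : Subring Q := (EG p β n).range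

theorem EG_C (n : ℕ) (s) : EG p β n (MvPolynomial.C s) = s := MvPolynomial.eval₂_C _ _ _
theorem EG_X (n : ℕ) (s) : EG p β n (MvPolynomial.X s) = β s := MvPolynomial.eval₂_X _ _ _

theorem SG_le_TG (n : ℕ) (s) (hs : s ∈ SG Q p n) : s ∈ TG p β n := ⟨MvPolynomial.C ⟨s, hs⟩, EG_C p β n _⟩
theorem b_mem_TG (n : ℕ) (i) : β i ∈ TG p β n := ⟨MvPolynomial.X i, EG_X p β n _⟩

theorem TG_le (n : ℕ) (U : Subring Q) (h1 : SG Q p n ≤ U) (h2 : ∀ i, β i ∈ U) : TG p β n ≤ U := by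
  rintro _ ⟨f, rfl⟩
  induction f using MvPolynomial.induction_on with
  | C c => rw [EG_C]; exact h1 c.2
  | add f g hf hg => rw [map_add]; exact add_mem hf hg
  | mul_X f i hf => rw [map_mul, EG_X]; exact mul_mem hf (h2 i)

/-- fattened subring -/
def UG (n : ℕ) : Subring Q := ((TG p β n).map (Ideal.Quotient.mk (IsLocalRing.maximalIdeal Q ^ (n + 1)))).comap (Ideal.Quotient.mk (IsLocalRing.maximalIdeal Q ^ (n + 1)))

theorem mem_UG (n : ℕ) (z : Q) : z ∈ UG p β n ↔ ∃ t ∈ TG p β n, z - t ∈ IsLocalRing.maximalIdeal Q ^ (n + 1) := by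
  rw [UG, Subring.mem_comap, Subring.mem_map]
  refine exists_congr fun t => and_congr_right fun _ => ?_
  rw [eq_comm, Ideal.Quotient.mk_eq_mk_iff_sub_mem]

theorem TG_le_UG (n : ℕ) : TG p β n ≤ UG p β n := fun t ht => (mem_UG p β n t).2 ⟨t, ht, by rw [sub_self]; exact zero_mem _⟩

theorem pow_le_UG (n : ℕ) (z) (hz : z ∈ IsLocalRing.maximalIdeal Q ^ (n + 1)) : z ∈ UG p β n := 
  (mem_UG p β n z).2 ⟨0, zero_mem _, by rwa [sub_zero]⟩

theorem UG_closed (n : ℕ) (z u) (hu : u ∈ UG p β n) (hz : z - u ∈ IsLocalRing.maximalIdeal Q ^ (n + 1)) : z ∈ UG p β n := by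
  have := add_mem (pow_le_UG p β n _ hz) hu
  rwa [sub_add_cancel] at this

theorem TG_p (n : ℕ) (z) (hz : z ∈ TG p β n) : p * z ∈ TG p β (n + 1) := by
  obtain ⟨f, rfl⟩ := hz
  induction f using MvPolynomial.induction_on with
  | C c => rw [EG_C]; exact SG_le_TG p β _ _ (SG_p p n _ c.2)
  | add f g hf hg => rw [map_add, mul_add]; exact add_mem hf hg
  | mul_X f i hf => rw [map_mul, EG_X, ← mul_assoc]; exact mul_mem hf (b_mem_TG p β _ i)

variable (hpm : (p : Q) ∈ IsLocalRing.maximalIdeal Q)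
include hpm

theorem TG_succ_le (n : ℕ) : TG p β (n + 1) ≤ UG p β n := by
  refine TG_le p β _ _ (fun s hs => ?_) (fun i => TG_le_UG p β n (b_mem_TG p β n i))
  obtain ⟨s', hs', y, hy⟩ := SG_down p n s hs
  refine (mem_UG p β n _).2 ⟨s', SG_le_TG p β n _ hs', ?_⟩
  rw [hy]
  exact Ideal.mul_mem_right _ _ (Ideal.pow_mem_pow hpm _)

theorem UG_anti (n : ℕ) : UG p β (n + 1) ≤ UG p β n := by
  intro z hz
  obtain ⟨t, ht, hz⟩ := (mem_UG p β _ z).1 hz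
  exact UG_closed p β n z t (TG_succ_le p β hpm n ht) (Ideal.pow_le_pow_right (Nat.le_succ _) hz)

variable [CharP (IsLocalRing.ResidueField Q) p] (h1 : Surjective (ev p (fun i => IsLocalRing.residue Q (β i)) 1))

omit hpm in
include h1 in
theorem ev_surj (n : ℕ) (hk : ∀ f, ev p (fun i => IsLocalRing.residue Q (β i)) 1 f = 0 → f ∈ Ib p (fun i => IsLocalRing.residue Q (β i)) 1) :
    Surjective (ev p (fun i => IsLocalRing.residue Q (β i)) n) := by
  cases n with
  | zero => exact fun c => ⟨MvPolynomial.C c, by rw [ev_C, pow_zero, pow_one]⟩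
  | succ n => exact (ev_succ p _ h1 hk n).1

omit hpm in
theorem TG_surj (n : ℕ) (hs : Surjective (ev p (fun i => IsLocalRing.residue Q (β i)) n)) (c) :
    ∃ t ∈ TG p β n, IsLocalRing.residue Q t = c := by
  obtain ⟨f, rfl⟩ := hs c
  induction f using MvPolynomial.induction_on with
  | C c => 
    obtain ⟨a, rfl⟩ := IsLocalRing.residue_surjective c
    exact ⟨_, SG_le_TG p β _ _ (SG_pow p n a), by rw [ev_C, map_pow]⟩
  | add f g hf hg => 
    obtain ⟨a, ha, ha'⟩ := hf
    obtain ⟨b, hb, hb'⟩ := hg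
    exact ⟨a + b, add_mem ha hb, by rw [map_add, map_add, ha', hb']⟩
  | mul_X f i hf =>
    obtain ⟨a, ha, ha'⟩ := hf
    exact ⟨a * β i, mul_mem ha (b_mem_TG p β n i), by rw [map_mul, map_mul, ev_X, ha']⟩

/-- coefficientwise residue -/
def mres (n : ℕ) : MvPolynomial ι (SG Q p n) →+* MvPolynomial ι (IsLocalRing.ResidueField Q) :=
  MvPolynomial.map ((IsLocalRing.residue Q).comp (SG Q p n).subtype)

omit hpm in
theorem lift1 (n : ℕ) (g : MvPolynomial ι (IsLocalRing.ResidueField Q)) : ∃ G, mres p n G = MvPolynomial.map (iterateFrobenius _ p n) g := by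
  induction g using MvPolynomial.induction_on with
  | C c => 
    obtain ⟨a, rfl⟩ := IsLocalRing.residue_surjective c
    exact ⟨MvPolynomial.C ⟨_, SG_pow p n a⟩, by rw [mres, MvPolynomial.map_C, MvPolynomial.map_C, iterateFrobenius_def, ← map_pow]; rfl⟩
  | add f g hf hg => 
    obtain ⟨a, ha⟩ := hf
    obtain ⟨b, hb⟩ := hg
    exact ⟨a + b, by rw [map_add, map_add, ha, hb]⟩
  | mul_X f i hf =>
    obtain ⟨a, ha⟩ := hf
    exact ⟨a * MvPolynomial.X i, by rw [map_mul, map_mul, ha, mres, MvPolynomial.map_X, MvPolynomial.map_X]⟩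

theorem lift2 (n : ℕ) (F : MvPolynomial ι (SG Q p n)) : ∃ g, mres p n F = MvPolynomial.map (iterateFrobenius _ p n) g := by
  induction F using MvPolynomial.induction_on with
  | C c => 
    obtain ⟨a, ha⟩ := SG_res p hpm n c c.2
    exact ⟨MvPolynomial.C a, by rw [mres, MvPolynomial.map_C, MvPolynomial.map_C, iterateFrobenius_def, ← ha]; rfl⟩
  | add f g hf hg => 
    obtain ⟨a, ha⟩ := hf
    obtain ⟨b, hb⟩ := hg
    exact ⟨a + b, by rw [map_add, map_add, ha, hb]⟩
  | mul_X f i hf =>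
    obtain ⟨a, ha⟩ := hf
    exact ⟨a * MvPolynomial.X i, by rw [map_mul, map_mul, ha, mres, MvPolynomial.map_X, MvPolynomial.map_X]⟩

omit hpm in
theorem lift3 (n : ℕ) (g) (hg : g ∈ Ib p (fun i => IsLocalRing.residue Q (β i)) n) : 
    ∃ G, mres p n G = MvPolynomial.map (iterateFrobenius _ p n) g ∧ EG p β n G = 0 := by
  induction hg using Submodule.span_induction with
  | mem x hx =>
    obtain ⟨i, rfl⟩ := hx
    refine ⟨MvPolynomial.X i ^ p ^ n - MvPolynomial.C ⟨_, SG_pow p n (β i)⟩, ?_, ?_⟩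
    · simp only [map_sub, map_pow, mres, MvPolynomial.map_X, MvPolynomial.map_C, iterateFrobenius_def]
      rw [← map_pow MvPolynomial.C, ← map_pow]; rfl
    · rw [map_sub, map_pow, EG_X, EG_C, sub_self]
  | zero => exact ⟨0, by rw [map_zero, map_zero], map_zero _⟩
  | add x y _ _ hx hy =>
    obtain ⟨a, ha, ha'⟩ := hx
    obtain ⟨b, hb, hb'⟩ := hy
    exact ⟨a + b, by rw [map_add, map_add, ha, hb], by rw [map_add, ha', hb', add_zero]⟩
  | smul c x _ hx =>
    obtain ⟨a, ha, ha'⟩ := hx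
    obtain ⟨b, hb⟩ := lift1 p n c
    exact ⟨b * a, by rw [map_mul, smul_eq_mul, map_mul, ha, hb], by rw [map_mul, ha', mul_zero]⟩

theorem TG_m (n : ℕ) (hk : ∀ f, ev p (fun i => IsLocalRing.residue Q (β i)) (n + 1) f = 0 → f ∈ Ib p (fun i => IsLocalRing.residue Q (β i)) (n + 1))
    (z : Q) (hz : z ∈ TG p β (n + 1)) (hzm : z ∈ IsLocalRing.maximalIdeal Q) :
    ∃ t ∈ TG p β n, z - p * t ∈ IsLocalRing.maximalIdeal Q ^ (n + 2) := by
  obtain ⟨F, rfl⟩ := hz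
  obtain ⟨g, hg⟩ := lift2 p hpm (n + 1) F
  have hg0 : ev p (fun i => IsLocalRing.residue Q (β i)) (n + 1) g = 0 := by
    have h1 : ev p (fun i => IsLocalRing.residue Q (β i)) (n + 1) g = MvPolynomial.eval (fun i => IsLocalRing.residue Q (β i)) (MvPolynomial.map (iterateFrobenius _ p (n + 1)) g) := by
      rw [MvPolynomial.eval_map]; rfl
    rw [h1, ← hg, mres, MvPolynomial.eval_map, ← (IsLocalRing.residue_eq_zero_iff _).2 hzm, EG, MvPolynomial.coe_eval₂Hom, MvPolynomial.hom_eval₂]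
  obtain ⟨F', hF', hF0⟩ := lift3 p β (n + 1) g (hk g hg0)
  have hd : mres p (n + 1) (F - F') = 0 := by rw [map_sub, hg, hF', sub_self]
  have he : EG p β (n + 1) F = EG p β (n + 1) (F - F') := by rw [map_sub, hF0, sub_zero]
  rw [he]
  generalize F - F' = G at hd
  have hc : ∀ d, ∃ s ∈ SG Q p n, ((G.coeff d : SG Q p (n + 1)) : Q) - p * s ∈ IsLocalRing.maximalIdeal Q ^ (n + 2) := by
    intro d
    refine SG_m p hpm n _ (G.coeff d).2 ((IsLocalRing.residue_eq_zero_iff _).1 ?_)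
    have := congrArg (MvPolynomial.coeff d) hd
    rwa [mres, MvPolynomial.coeff_map, MvPolynomial.coeff_zero] at this
  choose s hs hs' using hc
  refine ⟨∑ d ∈ G.support, s d * ∏ i ∈ d.support, β i ^ d i, ?_, ?_⟩
  · exact sum_mem fun d _ => mul_mem (SG_le_TG p β n _ (hs d)) (prod_mem fun i _ => pow_mem (b_mem_TG p β n i) _)
  · rw [EG, MvPolynomial.coe_eval₂Hom, MvPolynomial.eval₂_eq, Finset.mul_sum, ← Finset.sum_sub_distrib]
    refine sum_mem fun d _ => ?_
    rw [← mul_assoc, ← sub_mul]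
    exact Ideal.mul_mem_right _ _ (hs' d)

variable (hk : ∀ f, ev p (fun i => IsLocalRing.residue Q (β i)) 1 f = 0 → f ∈ Ib p (fun i => IsLocalRing.residue Q (β i)) 1)
include h1 hk

theorem TG_up (n : ℕ) (z : Q) (hz : z ∈ TG p β n) : ∃ t ∈ TG p β (n + 1), z - t ∈ IsLocalRing.maximalIdeal Q ^ (n + 1) := by
  induction n generalizing z with
  | zero =>
    obtain ⟨t, ht, h⟩ := TG_surj p β 1 h1 (IsLocalRing.residue Q z)
    refine ⟨t, ht, ?_⟩
    rw [zero_add, pow_one, ← IsLocalRing.residue_eq_zero_iff, map_sub, h, sub_self]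
  | succ n ih =>
    obtain ⟨t, ht, h⟩ := TG_surj p β (n + 2) (ev_surj p β h1 _ hk) (IsLocalRing.residue Q z)
    obtain ⟨t', ht', he⟩ := (mem_UG p β _ _).1 (TG_succ_le p β hpm _ ht)
    obtain ⟨s, hs, hs'⟩ := TG_m p β hpm n (ev_succ p _ h1 hk n).2 (z - t') (sub_mem hz ht') (by
      rw [← IsLocalRing.residue_eq_zero_iff, map_sub, ← h, ← map_sub, IsLocalRing.residue_eq_zero_iff]
      exact Ideal.pow_le_self (Nat.succ_ne_zero _) he)
    obtain ⟨s', hs2, hs3⟩ := ih s hs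
    refine ⟨t + p * s', add_mem ht (TG_p p β _ _ hs2), ?_⟩
    have h5 : (p : Q) * (s - s') ∈ IsLocalRing.maximalIdeal Q ^ (n + 1 + 1) := by
      rw [pow_succ']
      exact Ideal.mul_mem_mul hpm hs3
    have : z - (t + p * s') = (z - t' - p * s) - (t - t') + p * (s - s') := by ring
    rw [this]
    exact add_mem (sub_mem hs' he) h5

theorem UG_up (n : ℕ) (z : Q) (hz : z ∈ UG p β n) : ∃ t ∈ UG p β (n + 1), z - t ∈ IsLocalRing.maximalIdeal Q ^ (n + 1) := by
  obtain ⟨t, ht, h⟩ := (mem_UG p β n z).1 hz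
  obtain ⟨t', ht', h'⟩ := TG_up p β hpm h1 hk n t ht
  refine ⟨t', TG_le_UG p β _ ht', ?_⟩
  rw [← sub_add_sub_cancel z t t']
  exact add_mem h h'

end cr

end HW

end

section

namespace HW

open TensorProduct Function
open scoped Pointwise

theorem adic_limit {Q : Type u} [CommRing Q] (I : Ideal Q) [IsAdicComplete I Q] (x : ℕ → Q) (hx : ∀ n, x n - x (n + 1) ∈ I ^ n) :
    ∃ L, ∀ n, x n - L ∈ I ^ n := by
  have hd : ∀ m d, x m - x (m + d) ∈ I ^ m := by
    intro m d
    induction d with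
    | zero => rw [add_zero, sub_self]; exact zero_mem _
    | succ d ih =>
      rw [← sub_add_sub_cancel _ (x (m + d))]
      exact add_mem ih (Ideal.pow_le_pow_right (Nat.le_add_right _ _) (hx (m + d)))
  obtain ⟨L, hL⟩ := IsPrecomplete.prec (I := I) (M := Q) inferInstance (f := x) (by
    intro m n hmn
    obtain ⟨d, rfl⟩ := Nat.exists_eq_add_of_le hmn
    rw [SModEq.sub_mem, smul_eq_mul, Ideal.mul_top]
    exact hd m d)
  refine ⟨L, fun n => ?_⟩
  have := hL n
  rwa [SModEq.sub_mem, smul_eq_mul, Ideal.mul_top] at this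

theorem adic_zero {Q : Type u} [CommRing Q] (I : Ideal Q) [IsAdicComplete I Q] (x : Q) (hx : ∀ n, x ∈ I ^ n) : x = 0 := by
  refine IsHausdorff.haus (I := I) inferInstance x fun n => ?_
  rw [SModEq.sub_mem, smul_eq_mul, Ideal.mul_top, sub_zero]
  exact hx n

section cr
variable {Q : Type u} [CommRing Q] [IsLocalRing Q] [IsAdicComplete (IsLocalRing.maximalIdeal Q) Q] (p : ℕ) [hp : Fact p.Prime] {ι : Type u} (β : ι → Q)
  (hpm : (p : Q) ∈ IsLocalRing.maximalIdeal Q) [CharP (IsLocalRing.ResidueField Q) p] 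
  (h1 : Surjective (ev p (fun i => IsLocalRing.residue Q (β i)) 1))
  (hk : ∀ f, ev p (fun i => IsLocalRing.residue Q (β i)) 1 f = 0 → f ∈ Ib p (fun i => IsLocalRing.residue Q (β i)) 1)

/-- the coefficient ring -/
def VG : Subring Q := ⨅ n, UG p β n

theorem mem_VG (z : Q) : z ∈ VG p β ↔ ∀ n, z ∈ UG p β n := Subring.mem_iInf

include hpm h1 hk

theorem VG_approx (n : ℕ) (u : Q) (hu : u ∈ UG p β n) : ∃ v ∈ VG p β, v - u ∈ IsLocalRing.maximalIdeal Q ^ (n + 1) := by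
  choose! F hF hF' using fun n z => UG_up p β hpm h1 hk n z
  let x : ℕ → Q := fun j => Nat.rec u (fun j y => F (n + j) y) j
  have hx : ∀ j, x j ∈ UG p β (n + j) := by
    intro j
    induction j with
    | zero => exact hu
    | succ j ih => exact hF (n + j) _ ih
  have hx' : ∀ j, x j - x (j + 1) ∈ IsLocalRing.maximalIdeal Q ^ (n + j + 1) := fun j => hF' (n + j) _ (hx j)
  -- shift so that precision matches
  let y : ℕ → Q := fun i => x (i - (n + 1))
  obtain ⟨L, hL⟩ := adic_limit (IsLocalRing.maximalIdeal Q) y (by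
    intro i
    by_cases h : i < n + 1
    · have e1 : i - (n + 1) = 0 := by omega
      have e2 : i + 1 - (n + 1) = 0 := by omega
      simp only [y, e1, e2, sub_self]
      exact zero_mem _
    · have e2 : i + 1 - (n + 1) = (i - (n + 1)) + 1 := by omega
      simp only [y, e2]
      exact Ideal.pow_le_pow_right (by omega) (hx' _))
  have hL' : ∀ j, L - x j ∈ IsLocalRing.maximalIdeal Q ^ (n + j + 1) := by
    intro j
    have := neg_mem (hL (n + j + 1))
    rw [neg_sub] at this
    have e : n + j + 1 - (n + 1) = j := by omega
    simp only [y, e] at this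
    exact this
  refine ⟨L, (mem_VG p β L).2 fun j => ?_, hL' 0⟩
  have : UG p β (n + j) ≤ UG p β j := by
    have : Antitone (UG p β) := antitone_nat_of_succ_le (UG_anti p β hpm)
    exact this (Nat.le_add_left _ _)
  exact this (UG_closed p β _ L (x j) (hx j) (hL' j))

theorem VG_surj (q : Q) : ∃ v ∈ VG p β, q - v ∈ IsLocalRing.maximalIdeal Q := by
  obtain ⟨v, hv, h⟩ := VG_approx p β hpm h1 hk 0 q ((mem_UG p β 0 q).2 ⟨q, ⟨MvPolynomial.C ⟨q, by
    have := SG_pow p 0 q; rwa [pow_zero, pow_one] at this⟩, EG_C p β 0 _⟩, by rw [sub_self]; exact zero_mem _⟩)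
  refine ⟨v, hv, ?_⟩
  rw [zero_add, pow_one] at h
  have := neg_mem h
  rwa [neg_sub] at this

theorem VG_unit (v : Q) (hv : v ∈ VG p β) (u : Q) (hu : v * u = 1) : u ∈ VG p β := by
  obtain ⟨w, hw, hw'⟩ := VG_surj p β hpm h1 hk u
  have ht : 1 - v * w ∈ IsLocalRing.maximalIdeal Q := by
    rw [← hu, ← mul_sub]; exact Ideal.mul_mem_left _ _ hw'
  have htV : 1 - v * w ∈ VG p β := sub_mem (one_mem _) (mul_mem hv hw)
  refine (mem_VG p β u).2 fun n => ?_
  refine UG_closed p β n u (w * ∑ i ∈ Finset.range (n + 1), (1 - v * w) ^ i) ?_ ?_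
  · exact (mem_VG p β _).1 (mul_mem hw (sum_mem fun i _ => pow_mem htV i)) n
  · have h2 := geom_sum_mul (1 - v * w) (n + 1)
    have : u - w * ∑ i ∈ Finset.range (n + 1), (1 - v * w) ^ i = u * (1 - v * w) ^ (n + 1) := by
      rw [← sub_add_cancel ((1 - v * w) ^ (n + 1)) 1, ← h2]
      linear_combination (w * (∑ i ∈ Finset.range (n + 1), (1 - v * w) ^ i)) * hu
    rw [this]
    exact Ideal.mul_mem_left _ _ (Ideal.pow_mem_pow ht _)

theorem VG_m (z : Q) (hz : z ∈ VG p β) (hzm : z ∈ IsLocalRing.maximalIdeal Q) (n : ℕ) : ∃ v ∈ VG p β, z - p * v ∈ IsLocalRing.maximalIdeal Q ^ (n + 2) := by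
  obtain ⟨t, ht, h⟩ := (mem_UG p β (n + 1) z).1 ((mem_VG p β z).1 hz (n + 1))
  obtain ⟨s, hs, h'⟩ := TG_m p β hpm n (ev_succ p _ h1 hk n).2 t ht (by
    have := sub_mem hzm (Ideal.pow_le_self (Nat.succ_ne_zero _) h)
    rwa [sub_sub_cancel] at this)
  obtain ⟨v, hv, h''⟩ := VG_approx p β hpm h1 hk n s (TG_le_UG p β n hs)
  refine ⟨v, hv, ?_⟩
  have h5 : (p : Q) * (v - s) ∈ IsLocalRing.maximalIdeal Q ^ (n + 1 + 1) := by
    rw [pow_succ']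
    exact Ideal.mul_mem_mul hpm h''
  have : z - p * v = (z - t) + (t - p * s) - p * (v - s) := by ring
  rw [this]
  exact sub_mem (add_mem h h') h5

theorem VG_m' [IsNoetherianRing Q] [IsDomain Q] (hp0 : (p : Q) ≠ 0) (z : Q) (hz : z ∈ VG p β) (hzm : z ∈ IsLocalRing.maximalIdeal Q) : ∃ v ∈ VG p β, z = p * v := by
  choose v hv hv' using VG_m p β hpm h1 hk z hz hzm
  obtain ⟨c, hc⟩ := Ideal.exists_pow_inf_eq_pow_smul (IsLocalRing.maximalIdeal Q) (M := Q) (Ideal.span {(p : Q)})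
  have key : ∀ n x, (p : Q) * x ∈ IsLocalRing.maximalIdeal Q ^ (n + c) → x ∈ IsLocalRing.maximalIdeal Q ^ n := by
    intro n x hx
    have h2 := hc (n + c) (Nat.le_add_left _ _)
    have hmem : (p : Q) * x ∈ (IsLocalRing.maximalIdeal Q) ^ (n + c) • (⊤ : Submodule Q Q) ⊓ Ideal.span {(p : Q)} := by
      refine ⟨by rwa [smul_eq_mul, Ideal.mul_top], Ideal.mem_span_singleton.2 ⟨x, rfl⟩⟩
    rw [h2, Nat.add_sub_cancel] at hmem
    have := Submodule.smul_mono (le_refl (IsLocalRing.maximalIdeal Q ^ n)) (inf_le_right : (IsLocalRing.maximalIdeal Q) ^ c • (⊤ : Submodule Q Q) ⊓ Ideal.span {(p : Q)} ≤ _) hmem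
    rw [smul_eq_mul, mul_comm, Ideal.mem_span_singleton_mul] at this
    obtain ⟨y, hy, h⟩ := this
    rw [← mul_left_cancel₀ hp0 h]
    exact hy
  let w : ℕ → Q := fun n => v (n + c)
  obtain ⟨L, hL⟩ := adic_limit (IsLocalRing.maximalIdeal Q) w (by
    intro n
    refine key n _ ?_
    have e : (p : Q) * (w n - w (n + 1)) = (z - p * v (n + 1 + c)) - (z - p * v (n + c)) := by simp only [w]; ring
    rw [e]
    exact sub_mem (Ideal.pow_le_pow_right (by omega) (hv' _)) (Ideal.pow_le_pow_right (by omega) (hv' _)))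
  refine ⟨L, (mem_VG p β L).2 fun n => ?_, ?_⟩
  · refine UG_closed p β n L (w (n + 1)) ((mem_VG p β _).1 (hv _) n) ?_
    have := neg_mem (hL (n + 1))
    rwa [neg_sub] at this
  · rw [← sub_eq_zero]
    refine adic_zero (IsLocalRing.maximalIdeal Q) _ fun n => ?_
    have e : z - p * L = (z - p * w n) + p * (w n - L) := by ring
    rw [e]
    exact add_mem (Ideal.pow_le_pow_right (by omega) (hv' _)) (Ideal.mul_mem_left _ _ (hL n))

theorem VG_HasCoeff0 (hp0 : (p : Q) = 0) : HasCoeff Q := by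
  have hf : IsField (VG p β) := by
    refine ⟨⟨0, 1, zero_ne_one⟩, mul_comm, fun {a} ha => ?_⟩
    have hu : IsUnit (a : Q) := by
      by_contra hu
      have hm : (a : Q) ∈ IsLocalRing.maximalIdeal Q := (IsLocalRing.mem_maximalIdeal _).2 hu
      refine ha (Subtype.ext (adic_zero (IsLocalRing.maximalIdeal Q) _ fun n => ?_))
      obtain ⟨v, _, h⟩ := VG_m p β hpm h1 hk a a.2 hm n
      rw [hp0, zero_mul, sub_zero] at h
      exact Ideal.pow_le_pow_right (by omega) h
    obtain ⟨b, hb⟩ := hu.exists_right_inv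
    exact ⟨⟨b, VG_unit p β hpm h1 hk a a.2 b hb⟩, Subtype.ext hb⟩
  letI : Field (VG p β) := hf.toField
  refine HasCoeff_of_field (K := VG p β) (VG p β).subtype fun q => ?_
  obtain ⟨v, hv, h⟩ := VG_surj p β hpm h1 hk q
  exact ⟨⟨v, hv⟩, h⟩

theorem VG_HasCoeff1 [IsNoetherianRing Q] [IsDomain Q] (hp0 : (p : Q) ≠ 0) : HasCoeff Q := by
  have hlh : IsLocalHom (VG p β).subtype := by
    refine ⟨fun a ha => ?_⟩
    obtain ⟨b, hb⟩ := ha.exists_right_inv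
    exact IsUnit.of_mul_eq_one ⟨b, VG_unit p β hpm h1 hk a a.2 b hb⟩ (Subtype.ext hb)
  have hloc : IsLocalRing (VG p β) := RingHom.domain_isLocalRing (VG p β).subtype
  have hmm : ∀ a : VG p β, a ∈ IsLocalRing.maximalIdeal (VG p β) → (a : Q) ∈ IsLocalRing.maximalIdeal Q := 
    fun a ha => map_nonunit (VG p β).subtype a ha
  have hpV : ((p : VG p β)) ≠ 0 := fun h => hp0 (by simpa using congrArg Subtype.val h)
  have hpm' : ((p : VG p β)) ∈ IsLocalRing.maximalIdeal (VG p β) := by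
    refine (IsLocalRing.mem_maximalIdeal _).2 fun h => ?_
    have := h.map (VG p β).subtype
    rw [map_natCast] at this
    exact (IsLocalRing.mem_maximalIdeal _).1 hpm this
  have hmax : IsLocalRing.maximalIdeal (VG p β) = Ideal.span {((p : VG p β))} := by
    refine le_antisymm (fun a ha => ?_) ((Ideal.span_singleton_le_iff_mem _).2 hpm')
    obtain ⟨v, hv, h⟩ := VG_m' p β hpm h1 hk hp0 a a.2 (hmm a ha)
    exact Ideal.mem_span_singleton.2 ⟨⟨v, hv⟩, Subtype.ext (by simpa using h)⟩
  have hprime : Prime ((p : VG p β)) := by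
    rw [← Ideal.span_singleton_prime hpV, ← hmax]; infer_instance
  have hdvr : IsDiscreteValuationRing (VG p β) := by
    refine IsDiscreteValuationRing.ofHasUnitMulPowIrreducibleFactorization ⟨_, hprime.irreducible, fun {x} hx => ?_⟩
    by_contra hne
    push Not at hne
    refine hx (Subtype.ext (adic_zero (IsLocalRing.maximalIdeal Q) _ fun n => ?_))
    have hdiv : ∀ n, ((p : VG p β)) ^ n ∣ x := by
      intro n
      induction n with
      | zero => rw [pow_zero]; exact one_dvd _
      | succ n ih =>
        obtain ⟨y, rfl⟩ := ih
        have hy : y ∈ IsLocalRing.maximalIdeal (VG p β) := by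
          refine (IsLocalRing.mem_maximalIdeal _).2 fun hu => hne n ?_
          exact associated_mul_unit_right _ y hu
        rw [hmax, Ideal.mem_span_singleton] at hy
        rw [pow_succ]
        exact mul_dvd_mul_left _ hy
    obtain ⟨y, hy⟩ := hdiv n
    rw [hy]
    push_cast
    exact Ideal.mul_mem_right _ _ (Ideal.pow_mem_pow hpm n)
  refine ⟨VG p β, inferInstance, inferInstance, hloc, (p : VG p β), (VG p β).subtype, RL_of_domain hpV hmax, by rwa [map_natCast], fun q => ?_⟩
  obtain ⟨v, hv, h⟩ := VG_surj p β hpm h1 hk q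
  exact ⟨⟨v, hv⟩, h⟩

end cr

theorem HasCoeff_all {Q : Type u} [CommRing Q] [IsLocalRing Q] [IsNoetherianRing Q] [IsDomain Q] [IsAdicComplete (IsLocalRing.maximalIdeal Q) Q] :
    HasCoeff Q := by
  by_cases h : ∃ p : ℕ, p.Prime ∧ (p : Q) ∈ IsLocalRing.maximalIdeal Q
  · obtain ⟨p, hp, hpm⟩ := h
    have : Fact p.Prime := ⟨hp⟩
    have hc : CharP (IsLocalRing.ResidueField Q) p := by
      have h0 : ((p : ℕ) : IsLocalRing.ResidueField Q) = 0 := by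
        rw [← map_natCast (IsLocalRing.residue Q)]; exact (IsLocalRing.residue_eq_zero_iff _).2 hpm
      exact (CharP.ringChar_of_prime_eq_zero hp h0) ▸ ringChar.charP _
    obtain ⟨ι, b, h1, hk⟩ := pbasis (IsLocalRing.ResidueField Q) p
    choose β hβ using fun i => IsLocalRing.residue_surjective (b i)
    obtain rfl : (fun i => IsLocalRing.residue Q (β i)) = b := funext hβ
    by_cases hp0 : (p : Q) = 0
    · exact VG_HasCoeff0 p β hpm h1 hk hp0
    · exact VG_HasCoeff1 p β hpm h1 hk hp0
  · push Not at h
    have hu : ∀ n : ℕ, n ≠ 0 → IsUnit (n : Q) := by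
      intro n hn
      by_contra hu
      have hm : (n : Q) ∈ IsLocalRing.maximalIdeal Q := (IsLocalRing.mem_maximalIdeal _).2 hu
      have key : ∀ n : ℕ, n ≠ 0 → (n : Q) ∈ IsLocalRing.maximalIdeal Q → False := by
        intro n hn hm
        induction n using Nat.recOnMul with
        | zero => exact hn rfl
        | one => rw [Nat.cast_one] at hm; exact (Ideal.ne_top_iff_one _).1 (IsLocalRing.maximalIdeal.isMaximal Q).ne_top hm
        | prime p hp => exact h p hp hm
        | mul a b iha ihb =>
          rw [Nat.cast_mul] at hm
          rcases Ideal.IsPrime.mem_or_mem inferInstance hm with h | h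
          · exact iha (by rintro rfl; simp at hn) h
          · exact ihb (by rintro rfl; simp at hn) h
      exact key n hn hm
    have hu' : ∀ n : nonZeroDivisors ℤ, IsUnit (Int.castRingHom Q n) := by
      rintro ⟨n, hn⟩
      have hn : n ≠ 0 := nonZeroDivisors.ne_zero hn
      have := hu n.natAbs (by simpa using hn)
      rcases Int.natAbs_eq n with h | h
      · change IsUnit ((n : ℤ) : Q); rw [h]; simpa using this
      · change IsUnit ((n : ℤ) : Q); rw [h]; simpa using this
    letI : Algebra ℚ Q := (IsLocalization.lift (M := nonZeroDivisors ℤ) (S := ℚ) hu').toAlgebra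
    exact HasCoeff_char0

end HW

end

section

namespace HW

open TensorProduct Function
open scoped Pointwise

theorem dom_lift {Q : Type u} [CommRing Q] [IsNoetherianRing Q] [IsLocalRing Q] (x : Q) (hx : ∀ a, x * a = 0 → a = 0)
    (hxm : x ∈ IsLocalRing.maximalIdeal Q) (hd : (Ideal.span {x}).IsPrime) : IsDomain Q := by
  have kr : ∀ a : Q, a ≠ 0 → ∃ n a', a = x ^ n * a' ∧ a' ∉ Ideal.span {x} := by
    intro a ha
    by_contra hne
    push Not at hne
    apply ha
    have hdiv : ∀ n, ∃ a', a = x ^ n * a' := by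
      intro n
      induction n with
      | zero => exact ⟨a, by rw [pow_zero, one_mul]⟩
      | succ n ih =>
        obtain ⟨a', h⟩ := ih
        obtain ⟨c, hc⟩ := Ideal.mem_span_singleton.1 (hne n a' h)
        exact ⟨c, by rw [h, hc, pow_succ, mul_assoc]⟩
    refine IsHausdorff.haus (I := IsLocalRing.maximalIdeal Q) inferInstance a fun n => ?_
    rw [SModEq.sub_mem, smul_eq_mul, Ideal.mul_top, sub_zero]
    obtain ⟨a', h⟩ := hdiv n
    rw [h]
    exact Ideal.mul_mem_right _ _ (Ideal.pow_mem_pow hxm n)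
  have hpow : ∀ n a, x ^ n * a = 0 → a = 0 := by
    intro n
    induction n with
    | zero => intro a h; rwa [pow_zero, one_mul] at h
    | succ n ih => intro a h; rw [pow_succ, mul_assoc] at h; exact hx _ (ih _ h)
  have : NoZeroDivisors Q := by
    refine ⟨fun {a b} hab => ?_⟩
    by_contra hne
    push Not at hne
    obtain ⟨n, a', ha, ha'⟩ := kr a hne.1
    obtain ⟨m, b', hb, hb'⟩ := kr b hne.2
    have h0 : a' * b' = 0 := hpow (n + m) _ (by rw [← hab, ha, hb]; ring)
    rcases hd.mem_or_mem (h0 ▸ zero_mem (Ideal.span {x}) : a' * b' ∈ Ideal.span {x}) with h | h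
    · exact ha' h
    · exact hb' h
  exact NoZeroDivisors.to_isDomain Q

theorem RL_domain (xs : List ℕ) : ∀ {Q : Type u} [CommRing Q] [IsNoetherianRing Q] [IsLocalRing Q] (ys : List Q), 
    ys.length = xs.length → RL Q ys → IsDomain Q := by
  induction xs with
  | nil =>
    intro Q _ _ _ ys hl h
    obtain rfl := List.length_eq_zero_iff.1 hl
    have h2 := h.2
    rw [Ideal.ofList_nil] at h2
    exact (IsLocalRing.isField_iff_maximalIdeal_eq.2 h2.symm).isDomain
  | cons n xs ih =>
    intro Q _ _ _ ys hl h
    obtain _ | ⟨x, ys⟩ := ys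
    · simp at hl
    have hxm : x ∈ IsLocalRing.maximalIdeal Q := by
      rw [← h.2]; exact Ideal.subset_span List.mem_cons_self
    have hne : Ideal.span {x} ≠ ⊤ := fun ht => by
      have : Ideal.span {x} ≤ IsLocalRing.maximalIdeal Q := (Ideal.span_singleton_le_iff_mem _).2 hxm
      rw [ht, top_le_iff] at this
      exact (IsLocalRing.maximalIdeal.isMaximal Q).ne_top this
    have : Nontrivial (Q ⧸ Ideal.span {x}) := Ideal.Quotient.nontrivial_iff.2 hne
    have hloc : IsLocalRing (Q ⧸ Ideal.span {x}) := IsLocalRing.of_surjective' _ Ideal.Quotient.mk_surjective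
    have hreg := (reg_quot_ring (Ideal.Quotient.mk (Ideal.span {x})) Ideal.Quotient.mk_surjective [x] (fun b => by
      rw [Ideal.ofList_singleton, Ideal.Quotient.eq_zero_iff_mem]) ys).1 h.1
    have hd : IsDomain (Q ⧸ Ideal.span {x}) := by
      refine ih (ys.map (Ideal.Quotient.mk (Ideal.span {x}))) (by simpa using hl) ⟨hreg.2, ?_⟩
      have h2 := congrArg (Ideal.map (Ideal.Quotient.mk (Ideal.span {x}))) h.2
      rw [Ideal.map_ofList, List.map_cons, Ideal.ofList_cons, Ideal.Quotient.eq_zero_iff_mem.2 (Ideal.mem_span_singleton_self x)] at h2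
      rw [Ideal.span_singleton_eq_bot.2 rfl, bot_sup_eq] at h2
      rw [h2]
      exact IsLocalRing.map_maximalIdeal_of_surjective _ Ideal.Quotient.mk_surjective
    refine dom_lift x ?_ hxm ((Ideal.Quotient.isDomain_iff_prime _).1 hd)
    intro a ha
    have := (isWeaklyRegular_singleton_iff _ _).1 hreg.1
    exact this (by simpa using ha)

theorem compl_noeth (Q : Type u) [CommRing Q] [IsNoetherianRing Q] [IsLocalRing Q] :
    IsNoetherianRing (AdicCompletion (IsLocalRing.maximalIdeal Q) Q) := by
  obtain ⟨n, g, hg⟩ := Submodule.fg_iff_exists_fin_generating_family.1 (IsNoetherian.noetherian (IsLocalRing.maximalIdeal Q))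
  set B := AdicCompletion (IsLocalRing.maximalIdeal Q) Q with hB
  obtain ⟨F, hF1, hF2⟩ := eval_hom (IsLocalRing.maximalIdeal B) (algebraMap Q B) (fun i => algebraMap Q B (g i)) (fun i => by
    rw [AdicCompletion.maximalIdeal_eq_map]
    refine Ideal.mem_map_of_mem _ ?_
    rw [← hg]; exact Submodule.subset_span ⟨i, rfl⟩)
  have hmap : (Ideal.span (Set.range MvPowerSeries.X) : Ideal (MvPowerSeries (Fin n) Q)).map F = IsLocalRing.maximalIdeal B := by
    rw [AdicCompletion.maximalIdeal_eq_map]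
    refine Eq.trans ?_ (congrArg (Ideal.map (algebraMap Q B)) hg)
    rw [Ideal.map_span]
    change _ = Ideal.map _ (Ideal.span _)
    rw [Ideal.map_span, ← Set.range_comp, ← Set.range_comp]
    congr 1
    ext z
    simp [hF2, Set.mem_range]
  have hha : IsHausdorff ((Ideal.span (Set.range MvPowerSeries.X) : Ideal (MvPowerSeries (Fin n) Q)).map F) B := by
    rw [hmap]; infer_instance
  have hs : Surjective F := by
    refine surjective_of_mk_map_comp_surjective (I := Ideal.span (Set.range MvPowerSeries.X)) F ?_
    intro z
    obtain ⟨b, rfl⟩ := Ideal.Quotient.mk_surjective z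
    obtain ⟨c, hc⟩ := (AdicCompletion.residueField_map_bijective Q).2 (IsLocalRing.residue B b)
    obtain ⟨q, rfl⟩ := IsLocalRing.residue_surjective c
    refine ⟨MvPowerSeries.C q, ?_⟩
    rw [RingHom.comp_apply, hF1, Ideal.Quotient.mk_eq_mk_iff_sub_mem, hmap, ← IsLocalRing.residue_eq_zero_iff, map_sub, ← hc,
      IsLocalRing.ResidueField.map_residue, sub_self]
  exact isNoetherianRing_of_surjective _ _ F hs

theorem compl_RL {Q : Type u} [CommRing Q] [IsNoetherianRing Q] [IsLocalRing Q] {xs : List Q} (h : RL Q xs) :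
    RL (AdicCompletion (IsLocalRing.maximalIdeal Q) Q) (xs.map (algebraMap Q _)) := by
  refine ⟨IsWeaklyRegular.of_flat h.1, ?_⟩
  rw [AdicCompletion.maximalIdeal_eq_map, ← h.2, Ideal.map_ofList]

/-- passage to a complete regular presentation -/
theorem setup {R : Type u} [CommRing R] [IsNoetherianRing R] [IsLocalRing R] {Q₀ : Type u} [CommRing Q₀] [IsNoetherianRing Q₀]
    [IsLocalRing Q₀] {xs : List Q₀} (h : RL Q₀ xs) {f : Q₀} (hf : f ∈ nonunits Q₀) (hf' : f ∈ nonZeroDivisors Q₀)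
    (e : (Q₀ ⧸ Ideal.span {f}) ≃+* AdicCompletion (IsLocalRing.maximalIdeal R) R) :
    ∃ (Q R' : Type u) (_ : CommRing Q) (_ : CommRing R') (_ : IsNoetherianRing Q) (_ : IsLocalRing Q) 
      (_ : IsAdicComplete (IsLocalRing.maximalIdeal Q) Q) (ys : List Q) (_ : RL Q ys) (_ : Algebra Q R') (f' : Q) (_ : Hyp Q R' f')
      (_ : IsLocalRing R') (_ : Algebra R R') (_ : Module.Flat R R'), IsLocalHom (algebraMap R R') := by
  let Q := AdicCompletion (IsLocalRing.maximalIdeal Q₀) Q₀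
  let I : Ideal Q₀ := Ideal.span {f}
  let R' := Q ⧸ I.map (algebraMap Q₀ Q)
  have hI : I.map (algebraMap Q₀ Q) = Ideal.span {algebraMap Q₀ Q f} := by
    rw [Ideal.map_span, Set.image_singleton]
  have hm : algebraMap Q₀ Q f ∈ IsLocalRing.maximalIdeal Q := by
    rw [AdicCompletion.maximalIdeal_eq_map]; exact Ideal.mem_map_of_mem _ hf
  have hnt : Nontrivial R' := Ideal.Quotient.nontrivial_iff.2 (by
    rw [hI]
    intro ht
    have : Ideal.span {algebraMap Q₀ Q f} ≤ IsLocalRing.maximalIdeal Q := (Ideal.span_singleton_le_iff_mem _).2 hm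
    rw [ht, top_le_iff] at this
    exact (IsLocalRing.maximalIdeal.isMaximal Q).ne_top this)
  have hloc : IsLocalRing R' := IsLocalRing.of_surjective' (Ideal.Quotient.mk (I.map (algebraMap Q₀ Q))) Ideal.Quotient.mk_surjective
  have hyp : Hyp Q R' (algebraMap Q₀ Q f) := by
    refine ⟨Ideal.Quotient.mk_surjective, fun x => ?_, fun x hx => ?_⟩
    · change Ideal.Quotient.mk (I.map (algebraMap Q₀ Q)) x = 0 ↔ _
      rw [Ideal.Quotient.eq_zero_iff_mem, hI, Ideal.mem_span_singleton]
    · refine nzd_flat (S := Q₀) Q (s := f) (fun x hx => ?_) x hx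
      exact (mem_nonZeroDivisors_iff.1 hf').1 x hx
  have hfl : Module.Flat (Q₀ ⧸ I) R' := 
    Module.Flat.of_linearEquiv (Algebra.TensorProduct.quotIdealMapEquivQuotTensor Q I).toLinearEquiv
  let ψ : Q₀ ⧸ I →+* R' := algebraMap (Q₀ ⧸ I) R'
  have hψ : ψ.Flat := RingHom.flat_algebraMap_iff.2 hfl
  let φ : R →+* R' := (ψ.comp e.symm.toRingHom).comp (algebraMap R (AdicCompletion (IsLocalRing.maximalIdeal R) R))
  have hφ : φ.Flat := by
    refine RingHom.Flat.comp ?_ (RingHom.Flat.comp (RingHom.Flat.of_bijective e.symm.bijective) hψ)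
    exact RingHom.flat_algebraMap_iff.2 inferInstance
  letI := φ.toAlgebra
  have hψl : IsLocalHom ψ := by
    refine ⟨fun a ha => ?_⟩
    obtain ⟨q, rfl⟩ := Ideal.Quotient.mk_surjective a
    refine IsUnit.map (Ideal.Quotient.mk I) ?_
    by_contra hq
    have hqm : algebraMap Q₀ Q q ∈ IsLocalRing.maximalIdeal Q := by
      rw [AdicCompletion.maximalIdeal_eq_map]; exact Ideal.mem_map_of_mem _ hq
    have : IsLocalHom (Ideal.Quotient.mk (I.map (algebraMap Q₀ Q))) := IsLocalHom.of_surjective _ Ideal.Quotient.mk_surjective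
    exact (IsLocalRing.mem_maximalIdeal _).1 hqm (isUnit_of_map_unit (Ideal.Quotient.mk (I.map (algebraMap Q₀ Q))) _ ha)
  have hel : IsLocalHom e.symm.toRingHom := ⟨fun a ha => by
    have := ha.map e
    simpa using this⟩
  refine ⟨Q, R', inferInstance, inferInstance, compl_noeth Q₀, inferInstance, inferInstance, _, compl_RL h, inferInstance, _, hyp, hloc, inferInstance, hφ, ?_⟩
  change IsLocalHom φ
  have h3 : IsLocalHom (ψ.comp e.symm.toRingHom) := RingHom.isLocalHom_comp _ _
  exact RingHom.isLocalHom_comp _ _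

end HW

end

section

namespace HW

open TensorProduct Function
open scoped Pointwise

theorem hL_complete {Q R : Type u} [CommRing Q] [CommRing R] [IsNoetherianRing Q] [IsLocalRing Q]
    [IsAdicComplete (IsLocalRing.maximalIdeal Q) Q] {ys : List Q} (hy : RL Q ys) [Algebra Q R] {f : Q} (H : Hyp Q R f)
    (p : Ideal R) [p.IsPrime] : ∃ L : LF Q, Rig Q L ∧ (L.res H.surj).At p := by
  have : IsDomain Q := RL_domain (ys.map fun _ => 0) ys (by simp) hy
  obtain ⟨V, _, _, _, π, h, h1, h2, h3⟩ := HasCoeff_all (Q := Q)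
  obtain ⟨L, hL, hp⟩ := Rig_complete h1 hy h h2 h3 (p.comap (algebraMap Q R))
  exact ⟨L, hL, LF.At.res H.surj hp⟩

theorem ass_min {Q R : Type u} [CommRing Q] [CommRing R] [Algebra Q R] [IsNoetherianRing Q] {f : Q}
    (hF : FTD Q) (H : Hyp Q R f) (q : Ideal R) (hq : q.IsPrime) {x : R} (hx : ∀ y, y * x = 0 ↔ y ∈ q)
    (q' : Ideal R) (hq' : q'.IsPrime) (hle : q' ≤ q) : q' = q := by
  have h0 : Soc (Localization.AtPrime q) (Localization.AtPrime q) := by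
    refine ⟨algebraMap _ _ x, fun h => ?_, fun z hz => ?_⟩
    · rw [IsLocalization.map_eq_zero_iff q.primeCompl] at h
      obtain ⟨m, hm⟩ := h
      exact m.2 ((hx _).1 hm)
    · obtain ⟨a, s, rfl⟩ := IsLocalization.exists_mk'_eq q.primeCompl z
      rw [IsLocalization.AtPrime.mk'_mem_maximal_iff _ q] at hz
      rw [smul_eq_mul, mul_comm, IsLocalization.mul_mk'_eq_mk'_of_mul, mul_comm, (hx a).2 hz, IsLocalization.mk'_zero]
  have hd : Disjoint (q.primeCompl : Set R) (q' : Set R) := by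
    rw [Set.disjoint_left]
    intro a ha hb
    exact ha (hle hb)
  have h1 := I0p (LHyp_loc hF H q) h0 (q'.map (algebraMap R (Localization.AtPrime q)))
    (IsLocalization.isPrime_of_isPrime_disjoint q.primeCompl _ _ hq' hd)
  have h2 := congrArg (Ideal.comap (algebraMap R (Localization.AtPrime q))) h1
  have h3 := IsLocalization.comap_map_of_isPrime_disjoint q.primeCompl (Localization.AtPrime q) hq' hd
  have h4 : Ideal.comap (algebraMap R (Localization.AtPrime q)) (IsLocalRing.maximalIdeal (Localization.AtPrime q)) = q :=
    Localization.AtPrime.comap_maximalIdeal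
  exact h3.symm.trans (h2.trans h4)

section rk
variable {S : Type u} [CommRing S] [IsNoetherianRing S] {N : Type u} [AddCommGroup N] [Module S N] [Module.Finite S N]

/-- lifting a local basis -/
theorem loc_gens {r : ℕ} (q : Ideal S) [q.IsPrime]
    (e : (Localization.AtPrime q) ⊗[S] N ≃ₗ[Localization.AtPrime q] (Fin r → Localization.AtPrime q)) :
    ∃ n : Fin r → N, Submodule.span (Localization.AtPrime q) (Set.range fun j => (1 : Localization.AtPrime q) ⊗ₜ[S] n j) = ⊤ := by
  have key : ∀ w : (Localization.AtPrime q) ⊗[S] N, ∃ s : q.primeCompl, ∃ n : N,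
      algebraMap S (Localization.AtPrime q) s • w = 1 ⊗ₜ n := by
    intro w
    obtain ⟨⟨n, s⟩, h⟩ := IsLocalizedModule.surj q.primeCompl (TensorProduct.mk S (Localization.AtPrime q) N 1) w
    refine ⟨s, n, ?_⟩
    rw [algebraMap_smul]
    exact h
  choose s n hn using fun j => key (e.symm (Pi.single j 1))
  refine ⟨n, ?_⟩
  rw [eq_top_iff]
  intro w _
  have hw : w = ∑ j, e w j • e.symm (Pi.single j 1) := by
    apply e.injective
    simp only [map_sum, map_smul, LinearEquiv.apply_symm_apply]
    ext k
    simp [Finset.sum_apply, Pi.single_apply]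
  rw [hw]
  refine Submodule.sum_mem _ fun j _ => Submodule.smul_mem _ _ ?_
  have hu : IsUnit (algebraMap S (Localization.AtPrime q) (s j)) := IsLocalization.map_units _ (s j)
  obtain ⟨u, hu⟩ := hu
  have : e.symm (Pi.single j 1) = (↑u⁻¹ : Localization.AtPrime q) • ((1 : Localization.AtPrime q) ⊗ₜ[S] n j) := by
    rw [← hn j, ← hu, smul_smul, Units.inv_mul, one_smul]
  rw [this]
  exact Submodule.smul_mem _ _ (Submodule.subset_span ⟨j, rfl⟩)

theorem RK_of_loc {r : ℕ}
    (h : ∀ (q : Ideal S) [q.IsPrime], (∃ x : S, ∀ y, y * x = 0 ↔ y ∈ q) →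
      Nonempty ((Localization.AtPrime q) ⊗[S] N ≃ₗ[Localization.AtPrime q] (Fin r → Localization.AtPrime q)))
    (hmin : ∀ (q : Ideal S), q.IsPrime → (∃ x : S, ∀ y, y * x = 0 ↔ y ∈ q) → ∀ q' : Ideal S, q'.IsPrime → q' ≤ q → q' = q) :
    RK S N r := by
  classical
  have hass : ∀ q ∈ associatedPrimes S S, q.IsPrime ∧ ∃ x : S, ∀ y, y * x = 0 ↔ y ∈ q := by
    intro q hq
    obtain ⟨h1, x, hx⟩ := (isAssociatedPrime_iff).1 hq
    refine ⟨h1, x, fun y => ?_⟩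
    rw [hx, Submodule.mem_colon_singleton, Submodule.mem_bot, smul_eq_mul]
  have hass' : ∀ q : Ideal S, q.IsPrime → (∃ x : S, ∀ y, y * x = 0 ↔ y ∈ q) → q ∈ associatedPrimes S S := by
    rintro q hq ⟨x, hx⟩
    refine (isAssociatedPrime_iff).2 ⟨hq, x, ?_⟩
    ext y
    rw [Submodule.mem_colon_singleton, Submodule.mem_bot, smul_eq_mul, hx]
  have hfin := associatedPrimes.finite S S
  let A := hfin.toFinset
  have hA : ∀ q, q ∈ A ↔ q ∈ associatedPrimes S S := fun q => hfin.mem_toFinset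
  have ht : ∀ q ∈ A, ∃ t : S, t ∉ q ∧ ∀ q' ∈ A, q' ≠ q → t ∈ q' := by
    intro q hq
    have hqp := hass q ((hA q).1 hq)
    have := hqp.1
    have h1 : ∀ q' ∈ A.erase q, ∃ t, t ∈ q' ∧ t ∉ q := by
      intro q' hq'
      rw [Finset.mem_erase] at hq'
      by_contra hc
      push Not at hc
      exact hq'.1 (hmin q hqp.1 hqp.2 q' (hass q' ((hA q').1 hq'.2)).1 hc)
    choose! t h2 h3 using h1
    refine ⟨∏ q' ∈ A.erase q, t q', ?_, ?_⟩
    · intro hc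
      rw [Ideal.IsPrime.prod_mem_iff] at hc
      obtain ⟨q', hq', hc⟩ := hc
      exact h3 q' hq' hc
    · intro q' hq' hne
      have hm : q' ∈ A.erase q := Finset.mem_erase.2 ⟨hne, hq'⟩
      exact Ideal.mem_of_dvd _ (Finset.dvd_prod_of_mem t hm) (h2 q' hm)
  choose! t ht1 ht2 using ht
  have hn : ∀ q ∈ A, ∃ n : Fin r → N, ∀ _ : q.IsPrime,
      Submodule.span (Localization.AtPrime q) (Set.range fun j => (1 : Localization.AtPrime q) ⊗ₜ[S] n j) = ⊤ := by
    intro q hq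
    obtain ⟨h1, h2⟩ := hass q ((hA q).1 hq)
    obtain ⟨e⟩ := h q h2
    obtain ⟨n, hn⟩ := loc_gens q e
    exact ⟨n, fun _ => hn⟩
  choose! n hn using hn
  let w : Fin r → N := fun j => ∑ q ∈ A, t q • n q j
  have hw : ∀ q ∈ A, ∀ _ : q.IsPrime,
      Submodule.span (Localization.AtPrime q) (Set.range fun j => (1 : Localization.AtPrime q) ⊗ₜ[S] w j) = ⊤ := by
    intro q hq hqp
    let B := Localization.AtPrime q
    have h2 : (⊤ : Submodule B (B ⊗[S] N)) ≤ Submodule.span B (Set.range fun j => (1 : B) ⊗ₜ[S] w j) ⊔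
        (IsLocalRing.maximalIdeal B) • ⊤ := by
      rw [← hn q hq hqp, Submodule.span_le]
      rintro _ ⟨j, rfl⟩
      obtain ⟨u, hu⟩ : IsUnit (algebraMap S B (t q)) := IsLocalization.map_units B (⟨t q, ht1 q hq⟩ : q.primeCompl)
      have e1 : algebraMap S B (t q) • ((1 : B) ⊗ₜ[S] n q j) = 
          1 ⊗ₜ w j - ∑ q' ∈ A.erase q, algebraMap S B (t q') • ((1 : B) ⊗ₜ[S] n q' j) := by
        rw [eq_sub_iff_add_eq, Finset.add_sum_erase A (fun q' => algebraMap S B (t q') • ((1 : B) ⊗ₜ[S] n q' j)) hq,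
          TensorProduct.tmul_sum]
        refine Finset.sum_congr rfl fun q' _ => ?_
        rw [algebraMap_smul, TensorProduct.tmul_smul]
      have e2 : (1 : B) ⊗ₜ[S] n q j = (↑u⁻¹ : B) • (1 ⊗ₜ w j - ∑ q' ∈ A.erase q, algebraMap S B (t q') • ((1 : B) ⊗ₜ[S] n q' j)) := by
        rw [← e1, ← hu, smul_smul, Units.inv_mul, one_smul]
      change (1 : B) ⊗ₜ[S] n q j ∈ _
      rw [e2]
      refine Submodule.smul_mem _ _ (Submodule.sub_mem _ (Submodule.mem_sup_left (Submodule.subset_span ⟨j, rfl⟩))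
        (Submodule.mem_sup_right (Submodule.sum_mem _ fun q' hq' => Submodule.smul_mem_smul ?_ (by rw [hn q hq hqp]; trivial))))
      rw [Finset.mem_erase] at hq'
      exact (IsLocalization.AtPrime.to_map_mem_maximal_iff B q _).2 (ht2 q' hq'.2 q hq (Ne.symm hq'.1))
    exact top_le_iff.1 (Submodule.le_of_le_smul_of_le_jacobson_bot Module.Finite.fg_top
      (IsLocalRing.maximalIdeal_le_jacobson _) h2)
  let ι : (Fin r → S) →ₗ[S] N := Fintype.linearCombination S w
  have hbs : ∀ q ∈ A, ∀ _ : q.IsPrime, Surjective (ι.baseChange (Localization.AtPrime q)) := by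
    intro q hq hqp
    rw [← LinearMap.range_eq_top, ← top_le_iff, ← hw q hq hqp, Submodule.span_le]
    rintro _ ⟨j, rfl⟩
    refine ⟨1 ⊗ₜ (Pi.single j 1), ?_⟩
    rw [LinearMap.baseChange_tmul]
    simp [ι, Fintype.linearCombination_apply_single]
  have hbi : ∀ q ∈ A, ∀ _ : q.IsPrime, Injective (ι.baseChange (Localization.AtPrime q)) := by
    intro q hq hqp
    obtain ⟨e⟩ := h q (hass q ((hA q).1 hq)).2
    let φ := e.toLinearMap ∘ₗ ι.baseChange (Localization.AtPrime q) ∘ₗ (bcE (Localization.AtPrime q) r).symm.toLinearMap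
    have h1 : Surjective φ := e.surjective.comp ((hbs q hq hqp).comp (bcE (Localization.AtPrime q) r).symm.surjective)
    have h2 := OrzechProperty.injective_of_surjective_endomorphism φ h1
    intro x y hxy
    have h3 : φ (bcE (Localization.AtPrime q) r x) = φ (bcE (Localization.AtPrime q) r y) := by
      simp only [φ, LinearMap.comp_apply, LinearEquiv.coe_coe, LinearEquiv.symm_apply_apply, hxy]
    exact (bcE (Localization.AtPrime q) r).injective (h2 h3)
  -- a regular element killing the cokernel
  have hs : ∃ s ∈ Module.annihilator S (N ⧸ LinearMap.range ι), ∀ x, s * x = 0 → x = 0 := by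
    have : Module.Finite S (N ⧸ LinearMap.range ι) := inferInstance
    by_contra hc
    push Not at hc
    have hsub : ((Module.annihilator S (N ⧸ LinearMap.range ι) : Ideal S) : Set S) ⊆ ⋃ p ∈ associatedPrimes S S, (p : Set S) := by
      intro y hym
      rw [biUnion_associatedPrimes_eq_compl_regular]
      obtain ⟨x, hx, hx0⟩ := hc y hym
      intro hreg
      exact hx0 (hreg.right_eq_zero_of_smul hx)
    rw [Ideal.subset_union_prime_finite (f := fun p => p) hfin ⊤ ⊤
      (fun i hi _ _ => IsAssociatedPrime.isPrime hi)] at hsub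
    obtain ⟨q, hq, hle⟩ := hsub
    have hqA := (hA q).2 hq
    have hqp := (hass q hq).1
    have hs1 : ∀ x : N, ∃ s : S, s ∉ q ∧ s • x ∈ LinearMap.range ι := by
      intro x
      obtain ⟨y, hy⟩ := hbs q hqA hqp ((1 : Localization.AtPrime q) ⊗ₜ x)
      obtain ⟨⟨v, s⟩, hv⟩ := IsLocalizedModule.surj q.primeCompl (TensorProduct.mk S (Localization.AtPrime q) (Fin r → S) 1) y
      have e1 : (TensorProduct.mk S (Localization.AtPrime q) N 1) ((s : S) • x) = 
          (TensorProduct.mk S (Localization.AtPrime q) N 1) (ι v) := by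
        have e2 := congrArg (ι.baseChange (Localization.AtPrime q)) hv
        rw [TensorProduct.mk_apply, LinearMap.baseChange_tmul] at e2
        rw [TensorProduct.mk_apply, TensorProduct.mk_apply, ← e2, TensorProduct.tmul_smul, ← hy, Submonoid.smul_def,
          LinearMap.map_smul_of_tower]
      rw [IsLocalizedModule.eq_iff_exists q.primeCompl] at e1
      obtain ⟨c, hc⟩ := e1
      refine ⟨c * s, ?_, (c : S) • v, ?_⟩
      · exact (c * s).2
      · rw [map_smul, mul_smul]; exact hc.symm
    obtain ⟨k, gen, hgen⟩ := Module.Finite.exists_fin (R := S) (M := N)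
    choose s hs2 hs3 using fun j => hs1 (gen j)
    have hprod : (∏ j, s j) ∈ Module.annihilator S (N ⧸ LinearMap.range ι) := by
      rw [Module.mem_annihilator]
      intro m
      obtain ⟨m, rfl⟩ := Submodule.mkQ_surjective _ m
      have : m ∈ Submodule.span S (Set.range gen) := by rw [hgen]; trivial
      induction this using Submodule.span_induction with
      | mem x hx =>
        obtain ⟨j, rfl⟩ := hx
        rw [← map_smul, Submodule.mkQ_apply, Submodule.Quotient.mk_eq_zero, ← Finset.prod_erase_mul _ _ (Finset.mem_univ j),
          mul_smul]
        exact Submodule.smul_mem _ _ (hs3 j)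
      | zero => simp
      | add x y _ _ hx hy => rw [map_add, smul_add, hx, hy, add_zero]
      | smul c x _ hx => rw [map_smul, smul_comm, hx, smul_zero]
    have := hle hprod
    rw [Ideal.IsPrime.prod_mem_iff] at this
    obtain ⟨j, -, hj⟩ := this
    exact hs2 j hj
  obtain ⟨s, hs1, hs2⟩ := hs
  refine ⟨ι, s, ?_, hs2, ?_⟩
  · -- injectivity
    have hsubs : Subsingleton (Ke ι) := by
      by_contra hc
      rw [not_subsingleton_iff_nontrivial] at hc
      obtain ⟨q, hqp, x, hx⟩ := exists_ass (S := S) (Ke ι)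
      have hx1 : ∀ y : S, y • (Ke.i ι x) = 0 ↔ y ∈ q := by
        intro y
        rw [← map_smul, ← hx]
        exact ⟨fun h => Ke.inj ι (h.trans (map_zero _).symm), fun h => by rw [h, map_zero]⟩
      have hqa : q ∈ associatedPrimes S S := by
        have h1 : (Finset.univ : Finset (Fin r)).inf (fun j => LinearMap.ker (LinearMap.toSpanSingleton S S (Ke.i ι x j))) ≤ q := by
          intro y hy
          rw [Submodule.mem_finsetInf] at hy
          rw [← hx1]
          funext j
          exact hy j (Finset.mem_univ j)
        rw [Ideal.IsPrime.inf_le' hqp] at h1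
        obtain ⟨j, -, hj⟩ := h1
        refine hass' q hqp ⟨Ke.i ι x j, fun y => ⟨fun hy => hj hy, fun hy => congrFun ((hx1 y).2 hy) j⟩⟩
      have h1 := hbi q ((hA q).2 hqa) hqp
      have h2 : ι.baseChange (Localization.AtPrime q) (1 ⊗ₜ (Ke.i ι x)) = 0 := by
        rw [LinearMap.baseChange_tmul, (Ke.exact ι).apply_apply_eq_zero, TensorProduct.tmul_zero]
      have h3 := h1 (h2.trans (map_zero _).symm)
      have h4 : (TensorProduct.mk S (Localization.AtPrime q) (Fin r → S) 1) (Ke.i ι x) = 0 := h3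
      rw [IsLocalizedModule.eq_zero_iff q.primeCompl] at h4
      obtain ⟨c, hc⟩ := h4
      exact c.2 ((hx1 c).1 hc)
    rw [injective_iff_map_eq_zero]
    intro v hv
    obtain ⟨y, rfl⟩ := ((Ke.exact ι) v).1 hv
    rw [Subsingleton.elim y 0, map_zero]
  · intro m
    have h1 := (Module.mem_annihilator.1 hs1) (Submodule.mkQ _ m)
    rw [← map_smul, Submodule.mkQ_apply, Submodule.Quotient.mk_eq_zero] at h1
    exact h1

end rk

end HW

end

section

namespace HW

open TensorProduct Function
open scoped Pointwise

theorem RK_desc {Q R R' : Type u} [CommRing Q] [CommRing R] [CommRing R'] [Algebra Q R'] [IsNoetherianRing Q] [IsNoetherianRing R']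
    {f : Q} (hF : FTD Q) (H : Hyp Q R' f) [Algebra R R'] [Module.Flat R R'] (N : Type u) [AddCommGroup N] [Module R N]
    [Module.Finite R N] {r : ℕ}
    (hr : ∀ (p : Ideal R) (_ : p.IsPrime), p ∈ minimalPrimes R → Nonempty (LocalizedModule p.primeCompl N ≃ₗ[Localization p.primeCompl]
      (Fin r → Localization p.primeCompl))) : RK R' (R' ⊗[R] N) r := by
  refine RK_of_loc ?_ ?_
  · rintro q hq ⟨x, hx⟩
    let p := q.under R
    have hp : p ∈ minimalPrimes R := by
      refine ⟨⟨inferInstance, bot_le⟩, ?_⟩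
      rintro p0 ⟨hp0, -⟩ hle
      obtain ⟨q0, h1, h2, h3⟩ := Ideal.exists_ideal_le_liesOver_of_le (p := p0) (q := p) q hle
      have h4 := ass_min hF H q hq hx q0 h2 h1
      rw [h3.over, h4]
    obtain ⟨e⟩ := hr p inferInstance hp
    let A := Localization.AtPrime p
    let B := Localization.AtPrime q
    let _ : Algebra A B := (Localization.localRingHom p q (algebraMap R R') rfl).toAlgebra
    have : IsScalarTower R A B := by
      refine IsScalarTower.of_algebraMap_eq fun z => ?_
      rw [RingHom.algebraMap_toAlgebra, Localization.localRingHom_to_map, ← IsScalarTower.algebraMap_apply]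
    let e1 : A ⊗[R] N ≃ₗ[A] (Fin r → A) := (LocalizedModule.equivTensorProduct p.primeCompl N).symm ≪≫ₗ e
    let e2 : B ⊗[R'] (R' ⊗[R] N) ≃ₗ[B] B ⊗[R] N := AlgebraTensorModule.cancelBaseChange R R' B B N
    let e3 : B ⊗[A] (A ⊗[R] N) ≃ₗ[B] B ⊗[R] N := AlgebraTensorModule.cancelBaseChange R A B B N
    exact ⟨e2 ≪≫ₗ e3.symm ≪≫ₗ (e1.baseChange A B _ _) ≪≫ₗ bcE B r⟩
  · rintro q hq ⟨x, hx⟩ q' hq' hle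
    exact ass_min hF H q hq hx q' hq' hle

section refl
variable {R : Type u} [CommRing R]

theorem SSX_of_reflexive [IsNoetherianRing R] (W : Type u) [AddCommGroup W] [Module R W] [Module.Finite R W]
    [Module.IsReflexive R W] : SSX R W := by
  classical
  obtain ⟨c, p, hp⟩ := Module.Finite.exists_fin' R (W →ₗ[R] R)
  obtain ⟨d, g, hg⟩ := Module.Finite.exists_fin' R (LinearMap.ker p)
  let lam : (Fin c → R) → ((Fin c → R) →ₗ[R] R) := fun v => Fintype.linearCombination R v
  have hpsum : ∀ x : Fin c → R, p x = ∑ j, x j • p (Pi.single j 1) := by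
    intro x
    conv_lhs => rw [← LinearMap.sum_single_apply (fun _ => R) x]
    rw [map_sum]
    refine Finset.sum_congr rfl fun j _ => ?_
    rw [← map_smul]
    congr 1
    ext k
    simp [Pi.single_apply]
  have hgsum : ∀ x : Fin d → R, g x = ∑ j, x j • g (Pi.single j 1) := by
    intro x
    conv_lhs => rw [← LinearMap.sum_single_apply (fun _ => R) x]
    rw [map_sum]
    refine Finset.sum_congr rfl fun j _ => ?_
    rw [← map_smul]
    congr 1
    ext k
    simp [Pi.single_apply]
  refine ⟨c, d, LinearMap.pi (fun j => p (Pi.single j 1)),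
    LinearMap.pi (fun k => Fintype.linearCombination R (g (Pi.single k 1)).1), ?_, ?_⟩
  · rw [injective_iff_map_eq_zero]
    intro w hw
    apply (Module.bijective_dual_eval R W).1
    rw [map_zero]
    refine LinearMap.ext fun φ => ?_
    obtain ⟨x, rfl⟩ := hp φ
    rw [Module.Dual.eval_apply, hpsum, LinearMap.sum_apply]
    refine Finset.sum_eq_zero fun j _ => ?_
    rw [LinearMap.smul_apply, show p (Pi.single j 1) w = 0 from congrFun hw j, smul_zero]
  · intro v
    constructor
    · intro hv
      have hk : LinearMap.ker p ≤ LinearMap.ker (Fintype.linearCombination R v) := by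
        intro x hx
        obtain ⟨y, hy⟩ := hg ⟨x, hx⟩
        have hx' : x = ∑ k, y k • (g (Pi.single k 1)).1 := by
          have := congrArg Subtype.val (hy.symm.trans (hgsum y))
          simpa using this
        rw [LinearMap.mem_ker, hx', map_sum]
        refine Finset.sum_eq_zero fun k _ => ?_
        have h0 : Fintype.linearCombination R (g (Pi.single k 1)).1 v = 0 := congrFun hv k
        rw [map_smul]
        rw [Fintype.linearCombination_apply] at h0 ⊢
        have : ∑ i, (g (Pi.single k 1)).1 i • v i = 0 := by
          rw [← h0]; exact Finset.sum_congr rfl fun i _ => by rw [smul_eq_mul, smul_eq_mul, mul_comm]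
        rw [this, smul_zero]
      let Φ : (W →ₗ[R] R) →ₗ[R] R := (LinearMap.ker p).liftQ _ hk ∘ₗ (p.quotKerEquivOfSurjective hp).symm.toLinearMap
      have hΦ : ∀ x, Φ (p x) = Fintype.linearCombination R v x := by
        intro x
        have : (p.quotKerEquivOfSurjective hp).symm (p x) = (LinearMap.ker p).mkQ x := by
          rw [LinearEquiv.symm_apply_eq]; rfl
        simp only [Φ, LinearMap.comp_apply, LinearEquiv.coe_coe, this]
        exact Submodule.liftQ_apply _ _ _
      obtain ⟨w, hw⟩ := (Module.bijective_dual_eval R W).2 Φ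
      refine ⟨w, ?_⟩
      funext j
      have := hΦ (Pi.single j 1)
      rw [← hw] at this
      rw [Fintype.linearCombination_apply_single, one_smul] at this
      exact this
    · rintro ⟨w, rfl⟩
      funext k
      have h0 : p (g (Pi.single k 1)).1 = 0 := (g (Pi.single k 1)).2
      have h1 := LinearMap.congr_fun ((hpsum _).symm.trans h0) w
      rw [LinearMap.sum_apply] at h1
      change Fintype.linearCombination R (g (Pi.single k 1)).1 _ = 0
      rw [Fintype.linearCombination_apply]
      refine Eq.trans (Finset.sum_congr rfl fun i _ => ?_) h1
      rw [LinearMap.smul_apply, smul_eq_mul, smul_eq_mul, mul_comm]; rfl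

theorem reflexive_of_PF {M G : Type u} [AddCommGroup M] [Module R M] [AddCommGroup G] [Module R G] {a b : ℕ}
    {i : M →ₗ[R] (Fin a → R)} (hi : PF i) (hinj : Injective i) {g : (Fin a → R) →ₗ[R] G} (hg : Exact i g)
    {i₁ : G →ₗ[R] (Fin b → R)} (hinj₁ : Injective i₁) : Module.IsReflexive R M := by
  classical
  have key : ∀ ψ : (Fin a → R) →ₗ[R] R, ψ ∘ₗ i = ∑ j, ψ (Pi.single j 1) • (LinearMap.proj j ∘ₗ i) := by
    intro ψ
    ext m
    have : i m = ∑ j, i m j • Pi.single j 1 := by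
      ext k; simp [Finset.sum_apply, Pi.single_apply]
    rw [LinearMap.comp_apply, this, map_sum, LinearMap.sum_apply]
    refine Finset.sum_congr rfl fun j _ => ?_
    rw [map_smul, smul_eq_mul, mul_comm]; rfl
  have key2 : ∀ (Φ : Module.Dual R (Module.Dual R M)) (ψ : (Fin a → R) →ₗ[R] R),
      Φ (ψ ∘ₗ i) = ψ (fun j => Φ (LinearMap.proj j ∘ₗ i)) := by
    intro Φ ψ
    rw [key, map_sum]
    have : (fun j => Φ (LinearMap.proj j ∘ₗ i)) = ∑ j, Φ (LinearMap.proj j ∘ₗ i) • (Pi.single j 1 : Fin a → R) := by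
      ext k; simp [Finset.sum_apply, Pi.single_apply]
    rw [this, map_sum]
    refine Finset.sum_congr rfl fun j _ => ?_
    rw [map_smul, map_smul, smul_eq_mul, smul_eq_mul, mul_comm]
  refine ⟨?_, ?_⟩
  · rw [injective_iff_map_eq_zero]
    intro m hm
    apply hinj
    rw [map_zero]
    funext j
    exact LinearMap.congr_fun hm (LinearMap.proj j ∘ₗ i)
  · intro Φ
    have h1 : g (fun j => Φ (LinearMap.proj j ∘ₗ i)) = 0 := by
      apply hinj₁
      rw [map_zero]
      funext k
      have := key2 Φ (LinearMap.proj k ∘ₗ i₁ ∘ₗ g)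
      have h0 : (LinearMap.proj k ∘ₗ i₁ ∘ₗ g) ∘ₗ i = 0 := by
        ext m
        simp [hg.apply_apply_eq_zero]
      rw [h0, map_zero] at this
      exact this.symm
    obtain ⟨m, hm⟩ := (hg _).1 h1
    refine ⟨m, LinearMap.ext fun φ => ?_⟩
    obtain ⟨ψ, rfl⟩ := hi φ
    rw [key2 Φ, ← hm]
    rfl

theorem torsion_of_inj {N : Type u} [AddCommGroup N] [Module R N] {b : ℕ} {j : N →ₗ[R] (Fin b → R)} (hj : Injective j) :
    Submodule.torsion R N = ⊥ := by
  rw [eq_bot_iff]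
  rintro x hx
  rw [Submodule.mem_torsion_iff] at hx
  obtain ⟨a, ha⟩ := hx
  apply hj
  rw [map_zero]
  funext k
  have h1 : (a : R) * j x k = 0 := by
    have : j ((a : R) • x) = 0 := by rw [show (a : R) • x = 0 from ha, map_zero]
    rw [map_smul] at this
    exact congrFun this k
  exact (mul_left_mem_nonZeroDivisors_eq_zero_iff a.2).1 h1

end refl

/-- the main theorem, in terms of the concrete Tor -/
theorem main0 {R : Type u} [CommRing R] [IsNoetherianRing R] [IsLocalRing R] {Q₀ : Type u} [CommRing Q₀] [IsNoetherianRing Q₀]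
    [IsLocalRing Q₀] {xs : List Q₀} (h : RL Q₀ xs) {f : Q₀} (hf : f ∈ nonunits Q₀) (hf' : f ∈ nonZeroDivisors Q₀)
    (e : (Q₀ ⧸ Ideal.span {f}) ≃+* AdicCompletion (IsLocalRing.maximalIdeal R) R)
    (M N : Type u) [AddCommGroup M] [Module R M] [Module.Finite R M] [Nontrivial M]
    [AddCommGroup N] [Module R N] [Module.Finite R N] [Nontrivial N] {r : ℕ}
    (hr : ∀ (p : Ideal R) (_ : p.IsPrime), p ∈ minimalPrimes R → Nonempty (LocalizedModule p.primeCompl N ≃ₗ[Localization p.primeCompl]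
      (Fin r → Localization p.primeCompl))) (hW : Module.IsReflexive R (M ⊗[R] N)) :
    (∀ n, Subsingleton (T R M N (n + 1))) ∧ Module.IsReflexive R M ∧ Submodule.torsion R N = ⊥ := by
  obtain ⟨Q, R', _, _, _, _, _, ys, hy, _, f', H, _, _, _, hloc⟩ := setup h hf hf' e
  have hff : Module.FaithfullyFlat R R' := Module.FaithfullyFlat.of_flat_of_isLocalHom
  have : IsNoetherianRing R' := isNoetherianRing_of_surjective Q R' (algebraMap Q R') H.surj
  obtain ⟨a, i, hi⟩ := PF.exists (S := R) M
  obtain ⟨b, j, hj⟩ := PF.exists (S := R) N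
  have hfin : Module.Finite R (Co i) := Module.Finite.of_surjective (Co.p i) (Co.surj i)
  obtain ⟨c, i₁, hi₁⟩ := PF.exists (S := R) (Co i)
  have : Nontrivial (R' ⊗[R] M) := (Module.FaithfullyFlat.nontrivial_tensorProduct_iff_right R R').2 inferInstance
  have : Nontrivial (R' ⊗[R] N) := (Module.FaithfullyFlat.nontrivial_tensorProduct_iff_right R R').2 inferInstance
  obtain ⟨g1, g2, g3, g4⟩ := gFin H hy.FTD (fun p hp => hL_complete hy H p) (RK_desc hy.FTD H N hr)
    (((SSX_of_reflexive (M ⊗[R] N)).bc R').congr (AlgebraTensorModule.distribBaseChange R R' M N).symm)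
    ((hi.bc R').post (bcE R' a)) ((hj.bc R').post (bcE R' b))
  have i1 : Injective i := by
    rw [← Module.FaithfullyFlat.lTensor_injective_iff_injective R R']
    rw [LinearMap.coe_comp] at g1
    exact Injective.of_comp g1
  have j1 : Injective j := by
    rw [← Module.FaithfullyFlat.lTensor_injective_iff_injective R R']
    rw [LinearMap.coe_comp] at g2
    exact Injective.of_comp g2
  have g5 := g4 (R' ⊗[R] Co i) ((Co.p i).baseChange R' ∘ₗ (bcE R' a).symm.toLinearMap)
    (exact_conj (A' := PUnit) (C' := PUnit) (baseChange_exact_flat R' (Co.exact i)) _)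
    ((baseChange_surj R' (Co.surj i)).comp (bcE R' a).symm.surjective) _ (i₁.baseChange R') (hi₁.bc R')
  have i2 : Injective i₁ := by
    rw [← Module.FaithfullyFlat.lTensor_injective_iff_injective R R']
    exact g5
  refine ⟨fun n => ?_, reflexive_of_PF hi i1 (Co.exact i) i2, torsion_of_inj j1⟩
  obtain ⟨e⟩ := Tor_flat_bc (S := R) R' M (n + 1) N
  have := g3 n
  exact (Module.FaithfullyFlat.subsingleton_tensorProduct_iff_right R R').1 e.symm.toEquiv.subsingleton

end HW

end

section

namespace HW

open TensorProduct Function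
open scoped Pointwise

section res
variable {S : Type u} [CommRing S] {M N : Type u} [AddCommGroup M] [Module S M] [AddCommGroup N] [Module S N]
  {P : ℕ → Type u} [∀ n, AddCommGroup (P n)] [∀ n, Module S (P n)] [∀ n, Module.Flat S (P n)]
  (d : ∀ n, P (n + 1) →ₗ[S] P n) (ε : P 0 →ₗ[S] N)

theorem res_aux (h : ∀ n, Subsingleton (T S M N (n + 1))) (hd : ∀ n, Exact (d (n + 1)) (d n)) (hε : Exact (d 0) ε)
    (hs : Surjective ε) (n : ℕ) : (∀ i, Subsingleton (T S M (Rg (d n)) (i + 1))) ∧ Injective ((Rg.i (d n)).lTensor M) := by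
  have step : ∀ {A B C : Type u} [AddCommGroup A] [Module S A] [AddCommGroup B] [Module S B] [AddCommGroup C] [Module S C]
      [Module.Flat S B] {f : A →ₗ[S] B} {g : B →ₗ[S] C}, Injective f → Exact f g → Surjective g → 
      (∀ n, Subsingleton (T S M C (n + 1))) → (∀ n, Subsingleton (T S M A (n + 1))) ∧ Injective (f.lTensor M) := by
    intro A B C _ _ _ _ _ _ _ f g h1 h2 h3 h4
    have hB : ∀ i, Subsingleton (T S B M (i + 1)) := fun i => T_flat S i
    constructor
    · intro n
      obtain ⟨e⟩ := shiftR' S (N := M) n h1 h2 h3 hB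
      have := h4 (n + 1)
      exact e.symm.toEquiv.subsingleton
    · obtain ⟨e⟩ := shiftR1' S (N := M) h1 h2 h3 (hB 0)
      have := h4 0
      have : Subsingleton (LinearMap.ker (LinearMap.lTensor M f)) := e.symm.toEquiv.subsingleton
      rw [← LinearMap.ker_eq_bot]
      exact Submodule.subsingleton_iff_eq_bot.1 this
  induction n with
  | zero =>
    refine step (g := ε) (Rg.inj _) ?_ hs h
    intro x
    rw [hε x]
    constructor
    · rintro ⟨y, rfl⟩; exact ⟨Rg.p _ y, rfl⟩
    · rintro ⟨y, rfl⟩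
      obtain ⟨z, rfl⟩ := Rg.surj _ y
      exact ⟨z, rfl⟩
  | succ n ih => exact step (Rg.inj _) (Rg.exact_i (hd n)) (Rg.surj _) ih.1

theorem res_exact (h : ∀ n, Subsingleton (T S M N (n + 1))) (hd : ∀ n, Exact (d (n + 1)) (d n)) (hε : Exact (d 0) ε)
    (hs : Surjective ε) (n : ℕ) : Exact ((d (n + 1)).lTensor M) ((d n).lTensor M) := by
  have h1 := (res_aux d ε h hd hε hs n).2
  have h2 : Exact (d (n + 1)) (Rg.p (d n)) := by
    intro x
    rw [← hd n x]
    constructor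
    · intro hx; rw [← Rg.ip, hx, map_zero]
    · intro hx; exact Rg.inj _ ((Rg.ip _ _).trans (hx.trans (map_zero _).symm))
  have h3 := lTensor_exact M h2 (Rg.surj (d n))
  have h4 : (d n).lTensor M = (Rg.i (d n)).lTensor M ∘ₗ (Rg.p (d n)).lTensor M := by
    rw [← LinearMap.lTensor_comp]; rfl
  intro x
  rw [← h3 x, h4]
  constructor
  · intro hx; exact h1 (hx.trans (map_zero _).symm)
  · intro hx; rw [LinearMap.comp_apply, hx, map_zero]

end res

theorem Tor_zero {S : Type u} [CommRing S] (M N : Type u) [AddCommGroup M] [Module S M] [AddCommGroup N] [Module S N]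
    (h : ∀ n, Subsingleton (T S M N (n + 1))) (n : ℕ) :
    Subsingleton (((Tor (ModuleCat.{u} S) (n + 1)).obj (ModuleCat.of S M)).obj (ModuleCat.of S N)) := by
  let R := ProjectiveResolution.of (ModuleCat.of S N)
  have hp : ∀ n, Module.Flat S (R.complex.X n) := fun n => by
    have := (IsProjective.iff_projective (R.complex.X n)).2 (R.projective n)
    exact Module.Flat.of_projective
  have hd : ∀ n, Exact (R.complex.d (n + 2) (n + 1)).hom (R.complex.d (n + 1) n).hom := fun n =>
    (ShortComplex.ShortExact.moduleCat_exact_iff_function_exact _).1 (R.exact_succ n)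
  have hε : Exact (R.complex.d 1 0).hom (R.π.f 0).hom :=
    (ShortComplex.ShortExact.moduleCat_exact_iff_function_exact _).1 R.exact₀
  have hs : Surjective (R.π.f 0).hom := (ModuleCat.epi_iff_surjective _).1 inferInstance
  have key := res_exact (M := M) (P := fun n => R.complex.X n) (fun n => (R.complex.d (n + 1) n).hom) (R.π.f 0).hom
    h hd hε hs n
  have hz : Limits.IsZero (((Tor (ModuleCat.{u} S) (n + 1)).obj (ModuleCat.of S M)).obj (ModuleCat.of S N)) := by
    refine Limits.IsZero.of_iso ?_ (R.isoLeftDerivedObj ((MonoidalCategory.tensoringLeft (ModuleCat.{u} S)).obj (ModuleCat.of S M)) (n + 1))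
    refine (HomologicalComplex.exactAt_iff_isZero_homology _ _).1 ?_
    rw [HomologicalComplex.exactAt_iff' _ (n + 2) (n + 1) n (by simp) (by simp)]
    exact (ShortComplex.ShortExact.moduleCat_exact_iff_function_exact _).2 key
  exact ModuleCat.subsingleton_of_isZero hz

end HW

end

/-- Huneke–Wiegand: over a hypersurface, if `N` has rank and `M ⊗ N` is
reflexive, then all `Tor_i(M,N)` vanish, `M` is reflexive and `N` is torsion-free. -/
theorem stmt18 (R : Type u) [CommRing R] (hR : IsHypersurfaceRing R)
    (M N : Type u) [AddCommGroup M] [Module R M] [Module.Finite R M] [Nontrivial M]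
    [AddCommGroup N] [Module R N] [Module.Finite R N] [Nontrivial N]
    (hrk : HasRank R N)
    (hrefl : Module.IsReflexive R (TensorProduct R M N)) :
    (∀ i ≥ 1, Subsingleton (TorM R i M N)) ∧
      Module.IsReflexive R M ∧ Submodule.torsion R N = ⊥ := by
  obtain ⟨hN, hL, Q, _, ⟨hQN, hQL, rs, h1, h2, h3⟩, f, hf, hf', ⟨e⟩⟩ := hR
  have hspan : ∀ (A : Type u) [CommRing A] [IsLocalRing A], Ideal.span (nonunits A) = IsLocalRing.maximalIdeal A := fun A _ _ =>
    Ideal.span_eq (IsLocalRing.maximalIdeal A)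
  rw [hspan R] at e
  obtain ⟨r, hr⟩ := hrk
  obtain ⟨g1, g2, g3⟩ := HW.main0 (xs := rs) ⟨h1, h3.trans (hspan Q)⟩ hf hf' e M N hr hrefl
  refine ⟨fun i hi => ?_, g2, g3⟩
  obtain ⟨n, rfl⟩ : ∃ n, i = n + 1 := ⟨i - 1, by omega⟩
  exact HW.Tor_zero M N g1 n

end
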